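/- If G is a finite group in which every abelian subgroup is cyclic, then there exist n > 0, a finite CW complex X homotopy equivalent to the sphere S^n, and a free continuous action of G on X. -/

import Mathlib

open Metric

/-- `Sph n` is the unit sphere `S^n`, i.e. the set of unit vectors in `ℝ^{n+1}`. -/
abbrev Sph (n : ℕ) : Type := Metric.sphere (0 : EuclideanSpace ℝ (Fin (n + 1))) 1

/-- The self-homeomorphisms of a topological space form a group under composition.
A continuous action of a group `G` on `X` (every element acting by a homeomorphism)
is then precisely a group homomorphism `G →* (X ≃ₜ X)`. -/
instance homeoGroup (X : Type*) [TopologicalSpace X] : Group (X ≃ₜ X) where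
  mul e f := f.trans e
  one := Homeomorph.refl X
  inv := Homeomorph.symm
  mul_assoc _ _ _ := Homeomorph.ext fun _ => rfl
  one_mul _ := Homeomorph.ext fun _ => rfl
  mul_one _ := Homeomorph.ext fun _ => rfl
  inv_mul_cancel e := Homeomorph.ext fun x => e.symm_apply_apply x

/-- The boundary sphere `S^{n-1}` of an `n`-cell: the unit sphere in `ℝ^n`. -/
abbrev CellBoundary (n : ℕ) : Type := Metric.sphere (0 : EuclideanSpace ℝ (Fin n)) 1

/-- A closed `n`-cell: the closed unit ball `D^n` in `ℝ^n`. -/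
abbrev Cell (n : ℕ) : Type := Metric.closedBall (0 : EuclideanSpace ℝ (Fin n)) 1

/-- The space obtained from `X` by attaching `k` cells of dimension `n` along the attaching
maps `f i : S^{n-1} → X`: the quotient of the disjoint union `X ⊔ (Fin k × D^n)` obtained by
identifying each boundary point of each disk with its image under the corresponding
attaching map, endowed with the quotient topology. -/
abbrev AttachCells (n k : ℕ) (X : Type) [TopologicalSpace X]
    (f : Fin k → C(CellBoundary n, X)) : Type :=
  Quot (fun a b : X ⊕ (Σ _ : Fin k, Cell n) =>
    ∃ (i : Fin k) (s : CellBoundary n),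
      a = Sum.inl (f i s) ∧ b = Sum.inr ⟨i, ⟨s.1, Metric.sphere_subset_closedBall s.2⟩⟩)

/-- `IsFiniteCWAtMost n X` : the space `X` is a finite CW complex of dimension at most `n`,
i.e. it is built from the empty space by attaching, for each dimension `0, 1, …, n` in
increasing order, finitely many cells of that dimension (and it is allowed to skip
dimensions, and to replace the space by a homeomorphic copy). -/
inductive IsFiniteCWAtMost : (n : ℕ) → (X : Type) → [TopologicalSpace X] → Prop
  | base (k : ℕ) (f : Fin k → C(CellBoundary 0, Empty)) :
      IsFiniteCWAtMost 0 (AttachCells 0 k Empty f)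
  | up {n : ℕ} {X : Type} [TopologicalSpace X] :
      IsFiniteCWAtMost n X → IsFiniteCWAtMost (n + 1) X
  | attach {n : ℕ} {X : Type} [TopologicalSpace X] (hX : IsFiniteCWAtMost n X)
      (k : ℕ) (f : Fin k → C(CellBoundary (n + 1), X)) :
      IsFiniteCWAtMost (n + 1) (AttachCells (n + 1) k X f)
  | homeo {n : ℕ} {X Y : Type} [TopologicalSpace X] [TopologicalSpace Y]
      (hX : IsFiniteCWAtMost n X) (e : X ≃ₜ Y) : IsFiniteCWAtMost n Y

/-- `X` is a finite CW complex: it can be built from finitely many cells, attached in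
order of increasing dimension. -/
def IsFiniteCW (X : Type) [TopologicalSpace X] : Prop :=
  ∃ n, IsFiniteCWAtMost n X

/-- A bundled abelian group with an additive action of `G`. -/
structure GMod (G : Type) [Group G] where
  V : Type
  [ab : AddCommGroup V]
  [act : DistribMulAction G V]

namespace GMod

instance (G : Type) [Group G] : CoeSort (GMod G) Type := ⟨GMod.V⟩

attribute [instance] GMod.ab GMod.act

variable {G : Type} [Group G]

/-- Equivariance of an additive map. -/
def Eqv {A B : GMod G} (f : A →+ B) : Prop := ∀ (g : G) (a : A), f (g • a) = g • f a

/-- Two modules are isomorphic. -/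
def Iso (A B : GMod G) : Prop := ∃ e : A ≃+ B, ∀ (g : G) (a : A), e (g • a) = g • e a

theorem Iso.refl (A : GMod G) : Iso A A := ⟨AddEquiv.refl _, fun _ _ => rfl⟩

theorem Iso.symm {A B : GMod G} : Iso A B → Iso B A := by
  rintro ⟨e, he⟩
  refine ⟨e.symm, fun g b => e.injective ?_⟩
  rw [he]; simp

theorem Iso.trans {A B C : GMod G} : Iso A B → Iso B C → Iso A C := by
  rintro ⟨e, he⟩ ⟨f, hf⟩
  exact ⟨e.trans f, fun g a => by simp [he, hf]⟩

theorem Eqv.id (A : GMod G) : Eqv (AddMonoidHom.id A) := fun _ _ => rfl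

theorem Eqv.comp {A B C : GMod G} {f : B →+ C} {h : A →+ B} (hf : Eqv f) (hh : Eqv h) :
    Eqv (f.comp h) := fun g a => by simp [hf g, hh g]

theorem Eqv.add {A B : GMod G} {f h : A →+ B} (hf : Eqv f) (hh : Eqv h) : Eqv (f + h) :=
  fun g a => by simp [hf g, hh g]

theorem Eqv.sub {A B : GMod G} {f h : A →+ B} (hf : Eqv f) (hh : Eqv h) : Eqv (f - h) :=
  fun g a => by simp [hf g, hh g, smul_sub]

theorem Eqv.zsmul {A B : GMod G} {f : A →+ B} (hf : Eqv f) (n : ℤ) : Eqv (n • f) :=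
  fun g a => by
  simpa [hf g] using (map_zsmul (DistribSMul.toAddMonoidHom B g) n (f a)).symm

theorem Eqv.zero (A B : GMod G) : Eqv (0 : A →+ B) := fun g a => by simp

/-- The action of `g` as an additive map. -/
def sm (A : GMod G) (g : G) : A →+ A := DistribSMul.toAddMonoidHom A g

@[simp] theorem sm_apply (A : GMod G) (g : G) (a : A) : A.sm g a = g • a := rfl

/-- Sum of all conjugates of an additive map. -/
noncomputable def tr [Finite G] {A B : GMod G} (φ : A →+ B) : A →+ B :=
  letI := Fintype.ofFinite G
  ∑ g : G, (B.sm g).comp (φ.comp (A.sm g⁻¹))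

theorem tr_apply [Fintype G] {A B : GMod G} (φ : A →+ B) (a : A) :
    tr φ a = ∑ g : G, g • φ (g⁻¹ • a) := by
  have : Fintype.ofFinite G = ‹Fintype G› := Subsingleton.elim _ _
  unfold tr
  rw [this]
  simp [AddMonoidHom.finsetSum_apply]

/-- Additive maps that are sums of conjugates of a single additive map. -/
def IsTr [Finite G] {A B : GMod G} (f : A →+ B) : Prop := ∃ φ : A →+ B, tr φ = f

section
variable [Finite G] {A B C : GMod G}

theorem tr_eqv (φ : A →+ B) : Eqv (tr φ) := by
  intro g a
  cases nonempty_fintype G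
  rw [tr_apply, tr_apply, Finset.smul_sum]
  refine Fintype.sum_equiv (Equiv.mulLeft g⁻¹) _ _ fun h => ?_
  simp [← mul_smul]

theorem comp_tr {f : B →+ C} (hf : Eqv f) (φ : A →+ B) : f.comp (tr φ) = tr (f.comp φ) := by
  cases nonempty_fintype G
  ext a
  simp [tr_apply, hf _]

theorem tr_comp {f : A →+ B} (hf : Eqv f) (φ : B →+ C) : (tr φ).comp f = tr (φ.comp f) := by
  cases nonempty_fintype G
  ext a
  simp [tr_apply, hf _]

theorem tr_add (φ ψ : A →+ B) : tr (φ + ψ) = tr φ + tr ψ := by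
  cases nonempty_fintype G
  ext a
  simp [tr_apply, Finset.sum_add_distrib]

theorem tr_neg (φ : A →+ B) : tr (-φ) = - tr φ := by
  cases nonempty_fintype G
  ext a
  simp [tr_apply]

theorem tr_zero : tr (0 : A →+ B) = 0 := by
  cases nonempty_fintype G
  ext a
  simp [tr_apply]

theorem IsTr.add {f h : A →+ B} : IsTr f → IsTr h → IsTr (f + h) := by
  rintro ⟨φ, rfl⟩ ⟨ψ, rfl⟩; exact ⟨φ + ψ, tr_add φ ψ⟩

theorem IsTr.neg {f : A →+ B} : IsTr f → IsTr (-f) := by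
  rintro ⟨φ, rfl⟩; exact ⟨-φ, tr_neg φ⟩

theorem IsTr.sub {f h : A →+ B} (hf : IsTr f) (hh : IsTr h) : IsTr (f - h) := by
  rw [sub_eq_add_neg]; exact hf.add hh.neg

theorem IsTr.zero : IsTr (0 : A →+ B) := ⟨0, tr_zero⟩

theorem IsTr.comp_left {f : B →+ C} (hf : Eqv f) {t : A →+ B} : IsTr t → IsTr (f.comp t) := by
  rintro ⟨φ, rfl⟩; exact ⟨_, (comp_tr hf φ).symm⟩

theorem IsTr.comp_right {f : A →+ B} (hf : Eqv f) {t : B →+ C} : IsTr t → IsTr (t.comp f) := by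
  rintro ⟨φ, rfl⟩; exact ⟨_, (tr_comp hf φ).symm⟩

theorem tr_of_eqv {f : A →+ B} (hf : Eqv f) : tr f = (Nat.card G : ℤ) • f := by
  cases nonempty_fintype G
  ext a
  simp [tr_apply, ← hf _]

theorem IsTr.of_dvd {f : A →+ B} (hf : Eqv f) {n : ℤ} (hn : (Nat.card G : ℤ) ∣ n) :
    IsTr (n • f) := by
  obtain ⟨k, rfl⟩ := hn
  refine ⟨k • f, ?_⟩
  rw [tr_of_eqv (hf.zsmul k), mul_smul]

/-- Relatively projective modules: the identity is a sum of conjugates. -/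
def IsProj (A : GMod G) : Prop := IsTr (AddMonoidHom.id A)

theorem IsProj.isTr_of_left (hA : IsProj A) {f : A →+ B} (hf : Eqv f) : IsTr f := by
  simpa using IsTr.comp_left hf hA

theorem IsProj.isTr_of_right (hB : IsProj B) {f : A →+ B} (hf : Eqv f) : IsTr f := by
  simpa using IsTr.comp_right hf hB

theorem IsProj.of_retract (hB : IsProj B) {i : A →+ B} {r : B →+ A} (hi : Eqv i) (hr : Eqv r)
    (h : r.comp i = AddMonoidHom.id A) : IsProj A := by
  have := (hB.isTr_of_right hi).comp_left hr
  rwa [h] at this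

theorem IsProj.of_iso (hB : IsProj B) (h : Iso A B) : IsProj A := by
  obtain ⟨e, he⟩ := h
  refine hB.of_retract (i := e.toAddMonoidHom) (r := e.symm.toAddMonoidHom) he ?_ ?_
  · intro g b
    apply e.injective
    simp [he]
  · ext; simp

end

/-- Finitely generated free underlying abelian group. -/
def Lat (A : GMod G) : Prop := Module.Free ℤ A ∧ Module.Finite ℤ A

theorem Lat.of_inj {A B : GMod G} (hB : Lat B) (f : A →+ B) (hf : Function.Injective f) :
    Lat A := by
  have h1 := hB.1
  have h2 := hB.2
  have : IsNoetherian ℤ B := isNoetherian_of_isNoetherianRing_of_finite ℤ B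
  have hfin : Module.Finite ℤ A := Module.Finite.of_injective f.toIntLinearMap hf
  have : Module.IsTorsionFree ℤ A :=
    Function.Injective.moduleIsTorsionFree (R := ℤ) (f : A → B) hf (fun n a => by simp)
  exact ⟨Module.free_of_finite_type_torsion_free', hfin⟩

theorem Lat.of_iso {A B : GMod G} (hB : Lat B) (h : Iso A B) : Lat A :=
  hB.of_inj h.choose.toAddMonoidHom h.choose.injective

/-- Products. -/
def prod (A B : GMod G) : GMod G := ⟨A × B⟩

def inl (A B : GMod G) : A →+ prod A B := AddMonoidHom.inl A B
def inr (A B : GMod G) : B →+ prod A B := AddMonoidHom.inr A B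
def fst (A B : GMod G) : prod A B →+ A := AddMonoidHom.fst A B
def snd (A B : GMod G) : prod A B →+ B := AddMonoidHom.snd A B

theorem inl_eqv (A B : GMod G) : Eqv (inl A B) := fun g a => by
  change ((g • a, 0) : A × B) = (g • a, g • 0); simp
theorem inr_eqv (A B : GMod G) : Eqv (inr A B) := fun g a => by
  change ((0, g • a) : A × B) = (g • 0, g • a); simp
theorem fst_eqv (A B : GMod G) : Eqv (fst A B) := fun _ _ => rfl
theorem snd_eqv (A B : GMod G) : Eqv (snd A B) := fun _ _ => rfl

theorem Iso.prod {A A' B B' : GMod G} : Iso A A' → Iso B B' → Iso (prod A B) (prod A' B') := by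
  rintro ⟨e, he⟩ ⟨f, hf⟩
  exact ⟨e.prodCongr f, fun g a => Prod.ext (he g a.1) (hf g a.2)⟩

theorem prod_comm (A B : GMod G) : Iso (prod A B) (prod B A) :=
  ⟨AddEquiv.prodComm, fun _ _ => rfl⟩

theorem prod_assoc (A B C : GMod G) : Iso (prod (prod A B) C) (prod A (prod B C)) :=
  ⟨AddEquiv.prodAssoc, fun _ _ => rfl⟩

theorem Lat.prod {A B : GMod G} (hA : Lat A) (hB : Lat B) : Lat (prod A B) := by
  have := hA.1; have := hA.2; have := hB.1; have := hB.2
  exact ⟨inferInstanceAs (Module.Free ℤ (A × B)), inferInstanceAs (Module.Finite ℤ (A × B))⟩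

theorem IsProj.prod [Finite G] {A B : GMod G} (hA : IsProj A) (hB : IsProj B) :
    IsProj (prod A B) := by
  have h1 := ((hA.isTr_of_right (fst_eqv A B)).comp_left (inl_eqv A B)).add
    ((hB.isTr_of_right (snd_eqv A B)).comp_left (inr_eqv A B))
  have : (inl A B).comp (fst A B) + (inr A B).comp (snd A B) = AddMonoidHom.id (A.prod B) := by
    refine AddMonoidHom.ext fun x => ?_
    exact Prod.ext (add_zero (x.1 : A)) (zero_add (x.2 : B))
  rwa [this] at h1

/-- Trivial action. -/
@[reducible] def trivAct (M : Type) [AddCommGroup M] : DistribMulAction G M where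
  smul _ m := m
  one_smul _ := rfl
  mul_smul _ _ _ := rfl
  smul_zero _ := rfl
  smul_add _ _ _ := rfl

def triv (G : Type) [Group G] (M : Type) [AddCommGroup M] : GMod G :=
  { V := M, act := trivAct M }

theorem triv_iso {M N : Type} [AddCommGroup M] [AddCommGroup N] (e : M ≃+ N) :
    Iso (triv G M) (triv G N) := ⟨e, fun _ _ => rfl⟩

/-- The integers with trivial action. -/
def ZZ (G : Type) [Group G] : GMod G := triv G ℤ

theorem Lat.ZZ : Lat (ZZ G) :=
  ⟨inferInstanceAs (Module.Free ℤ ℤ), inferInstanceAs (Module.Finite ℤ ℤ)⟩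

/-- Functions on a `G`-set with diagonal action. -/
@[reducible] def indAct (Y : Type) [MulAction G Y] (A : GMod G) : DistribMulAction G (Y → A) where
  smul g f := fun y => g • f (g⁻¹ • y)
  one_smul f := by
    change (fun y => (1 : G) • f ((1 : G)⁻¹ • y)) = f
    simp
  mul_smul g h f := by
    change (fun y => (g * h) • f ((g * h)⁻¹ • y)) = fun y => g • h • f (h⁻¹ • g⁻¹ • y)
    simp [mul_smul]
  smul_zero g := by
    change (fun y => g • (0 : A)) = 0
    ext; simp
  smul_add g f h := by
    change (fun y => g • (f (g⁻¹ • y) + h (g⁻¹ • y))) = fun y => g • f (g⁻¹ • y) + g • h (g⁻¹ • y)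
    simp

def Ind (Y : Type) [MulAction G Y] (A : GMod G) : GMod G :=
  { V := Y → A, act := indAct Y A }

section Ind
variable {Y : Type} [MulAction G Y] {A B : GMod G}

theorem Ind.smul_apply (g : G) (f : Ind Y A) (y : Y) :
    (g • f : Ind Y A) y = g • (f (g⁻¹ • y) : A) := rfl

theorem Ind.add_apply (f h : Ind Y A) (y : Y) : (f + h : Ind Y A) y = (f y + h y : A) := rfl

/-- Functoriality. -/
def Ind.map (Y : Type) [MulAction G Y] {A B : GMod G} (φ : A →+ B) : Ind Y A →+ Ind Y B :=
  AddMonoidHom.mk' (M := Y → A) (G := Y → B) (fun f y => φ (f y)) (fun f h => by ext; simp)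

theorem Ind.iso (h : Iso A B) : Iso (Ind Y A) (Ind Y B) := by
  obtain ⟨e, he⟩ := h
  exact ⟨AddEquiv.piCongrRight (fun _ : Y => e), fun g f => funext fun y => he g _⟩

theorem Ind.prod_iso (Y : Type) [MulAction G Y] (A B : GMod G) :
    Iso (Ind Y (prod A B)) (prod (Ind Y A) (Ind Y B)) :=
  ⟨{ toFun := fun f => (fun y => (f y).1, fun y => (f y).2)
     invFun := fun p y => (p.1 y, p.2 y)
     left_inv := fun _ => rfl
     right_inv := fun _ => rfl
     map_add' := fun _ _ => rfl }, fun _ _ => rfl⟩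

theorem Ind.lat [Finite Y] (hA : Lat A) : Lat (Ind Y A) := by
  have := hA.1; have := hA.2
  exact ⟨inferInstanceAs (Module.Free ℤ (Y → A)), inferInstanceAs (Module.Finite ℤ (Y → A))⟩

end Ind

/-- A map that trivialises free orbits. -/
theorem exists_gamma (G : Type) [Group G] (X : Type) [MulAction G X] : ∃ γ : X → G,
    ∀ x, (∀ g : G, g • x = x → g = 1) → ∀ g : G, γ (g • x) = g * γ x := by
  have key : ∀ x : X, ∃ g : G, g • (Quotient.out (s := MulAction.orbitRel G X) ⟦x⟧) = x := by
    intro x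
    have := Quotient.mk_out (s := MulAction.orbitRel G X) x
    have h2 := (MulAction.orbitRel G X).symm this
    exact h2
  choose γ hγ using key
  refine ⟨γ, fun x hx g => ?_⟩
  have hq : (⟦g • x⟧ : Quotient (MulAction.orbitRel G X)) = ⟦x⟧ :=
    Quotient.sound ⟨g, rfl⟩
  have h1 := hγ (g • x)
  rw [hq] at h1
  set o := Quotient.out (s := MulAction.orbitRel G X) ⟦x⟧
  have h2 : γ x • o = x := hγ x
  have h3 : o = (γ x)⁻¹ • x := by rw [eq_inv_smul_iff, h2]
  rw [h3, ← mul_smul, ← inv_smul_eq_iff, ← mul_smul] at h1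
  have := hx _ h1
  rw [← mul_assoc] at this
  have h4 : g⁻¹ * γ (g • x) = γ x := by
    rwa [mul_inv_eq_one] at this
  rw [← h4]; simp

/-- Freeness of an action. -/
def FreeAct (G : Type) [Group G] (Y : Type) [MulAction G Y] : Prop :=
  ∀ (y : Y) (g : G), g • y = y → g = 1

/-- Multiplication of a function by a weight. -/
def Ind.wt {Y : Type} [MulAction G Y] {A : GMod G} (w : Y → ℤ) : Ind Y A →+ Ind Y A :=
  AddMonoidHom.mk' (M := Y → A) (G := Y → A) (fun f y => w y • f y) (fun f h => by ext; simp)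

theorem Ind.isProj [Finite G] {Y : Type} [MulAction G Y] (hY : FreeAct G Y) (A : GMod G) :
    IsProj (Ind Y A) := by
  classical
  cases nonempty_fintype G
  obtain ⟨γ, hγ⟩ := exists_gamma G Y
  refine ⟨Ind.wt (fun y => if γ y = 1 then 1 else 0), ?_⟩
  refine AddMonoidHom.ext fun f => funext fun y => ?_
  rw [tr_apply]
  have : ∀ g : G, (g • Ind.wt (fun y => if γ y = 1 then (1 : ℤ) else 0) (g⁻¹ • f) : Ind Y A) y =
      if g = γ y then f y else 0 := by
    intro g
    have h1 : (g • Ind.wt (fun y => if γ y = 1 then (1 : ℤ) else 0) (g⁻¹ • f) : Ind Y A) y =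
      g • ((if γ (g⁻¹ • y) = 1 then (1 : ℤ) else 0) • (g⁻¹ • f ((g⁻¹)⁻¹ • g⁻¹ • y) : A)) := rfl
    rw [h1, hγ y (hY y)]
    simp only [inv_mul_eq_one]
    split_ifs <;> simp
  have h2 : ∀ (s : Finset G) (F : G → Ind Y A), (∑ g ∈ s, F g : Ind Y A) y = ∑ g ∈ s, (F g y : A) :=
    fun s F => Finset.sum_apply (M := fun _ : Y => A.V) y s F
  rw [h2, Finset.sum_congr rfl (fun g _ => this g)]
  simp

/-- Free modules of finite rank. -/
def Fr (G : Type) [Group G] (a : ℕ) : GMod G := Ind G (triv G (Fin a → ℤ))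

theorem regular_free : FreeAct G G := fun y g h => by simpa using h

theorem Fr.isProj [Finite G] (a : ℕ) : IsProj (Fr G a) := Ind.isProj regular_free _

theorem triv_lat (M : Type) [AddCommGroup M] [h1 : Module.Free ℤ M] [h2 : Module.Finite ℤ M] :
    Lat (triv G M) := ⟨h1, h2⟩

theorem Fr.lat [Finite G] (a : ℕ) : Lat (Fr G a) := Ind.lat (triv_lat _)

def IsFr (A : GMod G) : Prop := ∃ a, Iso A (Fr G a)

theorem IsFr.of_iso {A B : GMod G} : IsFr B → Iso A B → IsFr A := by
  rintro ⟨a, h⟩ h2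
  exact ⟨a, h2.trans h⟩

theorem IsFr.isProj [Finite G] {A : GMod G} : IsFr A → IsProj A := by
  rintro ⟨a, h⟩; exact (Fr.isProj a).of_iso h

theorem IsFr.lat [Finite G] {A : GMod G} : IsFr A → Lat A := by
  rintro ⟨a, h⟩; exact (Fr.lat a).of_iso h

theorem isFr_ind_triv (M : Type) [AddCommGroup M] [Module.Free ℤ M] [Module.Finite ℤ M] :
    IsFr (Ind G (triv G M)) := by
  refine ⟨Module.finrank ℤ M, Ind.iso (triv_iso ?_)⟩
  exact (Module.finBasis ℤ M).equivFun.toAddEquiv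

theorem Fr.add (a b : ℕ) : Iso (prod (Fr G a) (Fr G b)) (Fr G (a + b)) := by
  refine (Iso.symm (Ind.prod_iso G (triv G (Fin a → ℤ)) (triv G (Fin b → ℤ)))).trans (Ind.iso ?_)
  refine (?_ : Iso _ (triv G ((Fin a → ℤ) × (Fin b → ℤ)))).trans (triv_iso ?_)
  · exact ⟨AddEquiv.refl _, fun _ _ => rfl⟩
  · exact (((LinearEquiv.sumArrowLequivProdArrow (Fin a) (Fin b) ℤ ℤ).symm).trans
      (LinearEquiv.funCongrLeft ℤ ℤ finSumFinEquiv.symm)).toAddEquiv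

theorem IsFr.prod {A B : GMod G} : IsFr A → IsFr B → IsFr (prod A B) := by
  rintro ⟨a, ha⟩ ⟨b, hb⟩
  exact ⟨a + b, (ha.prod hb).trans (Fr.add a b)⟩

/-- Inducing any lattice from a free `G`-set gives a free module. -/
theorem Ind.isFr {Y : Type} [Finite Y] [MulAction G Y] (hY : FreeAct G Y) {A : GMod G}
    (hA : Lat A) : IsFr (Ind Y A) := by
  obtain ⟨γ, hγ⟩ := exists_gamma G Y
  have hγ' : ∀ (g : G) (y : Y), γ (g • y) = g * γ y := fun g y => hγ y (hY y) g
  have := hA.1; have := hA.2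
  refine IsFr.of_iso (isFr_ind_triv ({y : Y // γ y = 1} → A)) ?_
  refine ⟨{ toFun := fun f g y => g⁻¹ • (f (g • y.1) : A)
            invFun := fun F y => (γ y) • (F (γ y) ⟨(γ y)⁻¹ • y, by rw [hγ']; simp⟩ : A)
            left_inv := fun f => ?_
            right_inv := fun F => ?_
            map_add' := fun f h => ?_ }, fun h f => ?_⟩
  · funext y
    simp [← mul_smul]
  · funext g y
    obtain ⟨y, hy⟩ := y
    have : γ (g • y) = g := by rw [hγ', hy, mul_one]
    dsimp only
    simp only [this, inv_smul_smul]
  · funext g y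
    exact smul_add (g⁻¹) (f (g • y.1) : A) (h (g • y.1))
  · funext g y
    change g⁻¹ • h • (f (h⁻¹ • g • y.1) : A) = (h⁻¹ * g)⁻¹ • (f ((h⁻¹ * g) • y.1) : A)
    simp [mul_smul]

/-- Restriction to a subgroup. -/
def res (H : Subgroup G) (A : GMod G) : GMod H := ⟨A.V⟩

theorem Iso.res (H : Subgroup G) {A B : GMod G} : Iso A B → Iso (res H A) (res H B) := by
  rintro ⟨e, he⟩; exact ⟨e, fun g a => he g a⟩

theorem Lat.res (H : Subgroup G) {A : GMod G} (hA : Lat A) : Lat (res H A) := hA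

theorem FreeAct.res (H : Subgroup G) {Y : Type} [MulAction G Y] (hY : FreeAct G Y) :
    FreeAct H Y := fun y g h => Subtype.ext (hY y g h)

theorem res_Fr [Finite G] (H : Subgroup G) (a : ℕ) : IsFr (GMod.res H (Fr G a)) :=
  Ind.isFr (FreeAct.res H (regular_free (G := G))) (Lat.res H (triv_lat (Fin a → ℤ)))

end GMod

namespace GMod

variable {G : Type} [Group G]

/-- The submodule given by an invariant subgroup. -/
def sub (A : GMod G) (S : AddSubgroup A) (hS : ∀ (g : G), ∀ a ∈ S, g • a ∈ S) : GMod G :=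
  { V := S
    act :=
      { smul := fun g a => ⟨g • (a : A), hS g a a.2⟩
        one_smul := fun a => Subtype.ext (one_smul G (a : A))
        mul_smul := fun g h a => Subtype.ext (mul_smul g h (a : A))
        smul_zero := fun g => Subtype.ext (smul_zero g)
        smul_add := fun g a b => Subtype.ext (smul_add g (a : A) (b : A)) } }

section sub
variable {A : GMod G} {S : AddSubgroup A} {hS : ∀ (g : G), ∀ a ∈ S, g • a ∈ S}

def sub.incl (A : GMod G) (S : AddSubgroup A) (hS : ∀ (g : G), ∀ a ∈ S, g • a ∈ S) :
    sub A S hS →+ A := S.subtype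

theorem sub.incl_eqv : Eqv (sub.incl A S hS) := fun _ _ => rfl

theorem sub.incl_inj : Function.Injective (sub.incl A S hS) := Subtype.val_injective

theorem Lat.sub (hA : Lat A) : Lat (sub A S hS) := hA.of_inj _ sub.incl_inj

end sub

theorem Eqv.ker_inv {A B : GMod G} {f : A →+ B} (hf : Eqv f) (g : G) (a : A) (ha : a ∈ f.ker) :
    g • a ∈ f.ker := by
  rw [AddMonoidHom.mem_ker] at ha ⊢
  rw [hf, ha, smul_zero]

/-- The kernel of an equivariant map. -/
def ker {A B : GMod G} (f : A →+ B) (hf : Eqv f) : GMod G := sub A f.ker hf.ker_inv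

/-- The image of an equivariant map. -/
def range {A B : GMod G} (f : A →+ B) (hf : Eqv f) : GMod G :=
  sub B f.range (fun g b hb => by
    obtain ⟨a, rfl⟩ := hb
    exact ⟨g • a, hf g a⟩)

/-- Additively split short exact sequences. -/
structure SES {A B C : GMod G} (i : A →+ B) (p : B →+ C) : Prop where
  ei : Eqv i
  ep : Eqv p
  inj : Function.Injective i
  exact : ∀ b, p b = 0 ↔ ∃ a, i a = b
  split : ∃ s : C →+ B, p.comp s = AddMonoidHom.id C

theorem exists_section {B C : GMod G} (hC : Lat C) (p : B →+ C) (hp : Function.Surjective p) :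
    ∃ s : C →+ B, p.comp s = AddMonoidHom.id C := by
  have := hC.1
  obtain ⟨s, hs⟩ := Module.projective_lifting_property p.toIntLinearMap
    (LinearMap.id : C →ₗ[ℤ] C) hp
  refine ⟨s.toAddMonoidHom, AddMonoidHom.ext fun c => ?_⟩
  exact LinearMap.congr_fun hs c

theorem SES.ker {B C : GMod G} (p : B →+ C) (hp : Eqv p)
    (hs : ∃ s : C →+ B, p.comp s = AddMonoidHom.id C) :
    SES (sub.incl B p.ker hp.ker_inv) p where
  ei := sub.incl_eqv
  ep := hp
  inj := sub.incl_inj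
  exact b := ⟨fun h => ⟨⟨b, h⟩, rfl⟩, by rintro ⟨a, rfl⟩; exact a.2⟩
  split := hs

section SES
variable {A F B : GMod G} {i : A →+ F} {p : F →+ B}

theorem SES.factor (h : SES i p) {X : GMod G} (φ : X →+ F) (hφ : p.comp φ = 0) :
    ∃ t : X →+ A, i.comp t = φ ∧ (Eqv φ → Eqv t) := by
  have : ∀ x, ∃ a, i a = φ x := fun x => (h.exact _).1 (DFunLike.congr_fun hφ x)
  choose t ht using this
  refine ⟨AddMonoidHom.mk' t fun x y => h.inj (by simp [ht]), AddMonoidHom.ext ht, ?_⟩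
  intro e g x
  apply h.inj
  change i (t _) = i (g • t x)
  rw [ht, h.ei, ht, e]

theorem SES.comp_eq_zero (h : SES i p) : p.comp i = 0 :=
  AddMonoidHom.ext fun a => (h.exact _).2 ⟨a, rfl⟩

theorem SES.pi (h : SES i p) (a : A) : p (i a) = 0 := (h.exact _).2 ⟨a, rfl⟩

theorem exists_lift [Finite G] {X : GMod G} (hX : IsProj X) (hp : Eqv p)
    (hs : ∃ s : B →+ F, p.comp s = AddMonoidHom.id B) {q : X →+ B} (hq : Eqv q) :
    ∃ L : X →+ F, Eqv L ∧ p.comp L = q := by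
  obtain ⟨s, hs⟩ := hs
  obtain ⟨φ, hφ⟩ := hX
  refine ⟨tr (s.comp (q.comp φ)), tr_eqv _, ?_⟩
  rw [comp_tr hp, ← AddMonoidHom.comp_assoc, hs, AddMonoidHom.id_comp, ← comp_tr hq, hφ,
    AddMonoidHom.comp_id]

theorem SES.iso_of_section (h : SES i p) {L : B →+ F} (hL : Eqv L)
    (hpL : p.comp L = AddMonoidHom.id B) : Iso F (prod A B) := by
  have hpL' : ∀ b, p (L b) = b := fun b => DFunLike.congr_fun hpL b
  obtain ⟨t, ht, hte⟩ := h.factor (AddMonoidHom.id F - L.comp p)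
    (by ext x; simp [hpL'])
  have ht' : ∀ x, i (t x) = x - L (p x) := fun x => DFunLike.congr_fun ht x
  have hte' := hte ((Eqv.id F).sub (hL.comp h.ep))
  refine ⟨{ toFun := fun x => ((t x, p x) : A × B)
            invFun := fun (y : A × B) => i y.1 + L y.2
            left_inv := fun x => ?_
            right_inv := fun y => ?_
            map_add' := fun x y => ?_ }, fun g x => ?_⟩
  · simp [ht']
  · obtain ⟨a, b⟩ := y
    refine Prod.ext (h.inj ?_) ?_
    · simp [ht', hpL', h.pi]
    · simp [hpL', h.pi]
  · exact Prod.ext (map_add t x y) (map_add p x y)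
  · exact Prod.ext (hte' g x) (h.ep g x)

theorem SES.iso_of_isProj [Finite G] (h : SES i p) (hB : IsProj B) : Iso F (prod A B) := by
  obtain ⟨L, hL, hpL⟩ := exists_lift hB h.ep h.split (Eqv.id B)
  exact h.iso_of_section hL hpL

theorem schanuel [Finite G] {A' F' : GMod G} {i' : A' →+ F'} {p' : F' →+ B}
    (h : SES i p) (h' : SES i' p') (hF : IsProj F) (hF' : IsProj F') :
    Iso (prod A F') (prod A' F) := by
  obtain ⟨L, hL, hpL⟩ := exists_lift hF h'.ep h'.split h.ep
  obtain ⟨L', hL', hpL'⟩ := exists_lift hF' h.ep h.split h'.ep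
  have e1 : ∀ x, p' (L x) = p x := fun x => DFunLike.congr_fun hpL x
  have e2 : ∀ x, p (L' x) = p' x := fun x => DFunLike.congr_fun hpL' x
  have q1 : ∀ x : prod A F', p' (x.2 - L (i x.1 + L' x.2)) = 0 := fun x => by
    simp [e1, h.pi, e2]
  have q2 : ∀ x : prod A' F, p (x.2 - L' (i' x.1 + L x.2)) = 0 := fun x => by
    simp [e1, h'.pi, e2]
  choose s hs using fun x => (h'.exact _).1 (q1 x)
  choose t ht using fun x => (h.exact _).1 (q2 x)
  refine ⟨{ toFun := fun x => ((s x, i x.1 + L' x.2) : A' × F)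
            invFun := fun x => ((t x, i' x.1 + L x.2) : A × F')
            left_inv := fun x => ?_
            right_inv := fun x => ?_
            map_add' := fun x y => ?_ }, fun g x => ?_⟩
  · refine Prod.ext (h.inj ?_) ?_
    · change i (t _) = _
      refine (ht _).trans ?_
      change (i x.1 + L' x.2) - L' (i' (s x) + L (i x.1 + L' x.2)) = _
      rw [hs]
      simp
    · change i' (s x) + L (i x.1 + L' x.2) = _
      simp [hs]
  · refine Prod.ext (h'.inj ?_) ?_
    · change i' (s _) = _
      refine (hs _).trans ?_
      change (i' x.1 + L x.2) - L (i (t x) + L' (i' x.1 + L x.2)) = _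
      rw [ht]
      simp
    · change i (t x) + L' (i' x.1 + L x.2) = _
      simp [ht]
  · refine Prod.ext (h'.inj ?_) ?_
    · change i' (s _) = i' (s x + s y)
      rw [map_add, hs, hs, hs]
      change (x.2 + y.2) - L (i (x.1 + y.1) + L' (x.2 + y.2)) = _
      simp only [map_add]
      abel
    · change i (x.1 + y.1) + L' (x.2 + y.2) = (i x.1 + L' x.2) + (i y.1 + L' y.2)
      simp only [map_add]
      abel
  · refine Prod.ext (h'.inj ?_) ?_
    · change i' (s _) = i' (g • s x)
      rw [h'.ei, hs, hs]
      change (g • x.2) - L (i (g • x.1) + L' (g • x.2)) = _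
      rw [h.ei, hL', ← smul_add, hL, smul_sub]
    · change i (g • x.1) + L' (g • x.2) = g • (i x.1 + L' x.2)
      rw [h.ei, hL', ← smul_add]

end SES

/-- Stable isomorphism: isomorphism modulo maps that are traces. -/
def StIso [Finite G] (A B : GMod G) : Prop :=
  ∃ (f : A →+ B) (x : B →+ A), Eqv f ∧ Eqv x ∧ IsTr (AddMonoidHom.id A - x.comp f) ∧
    IsTr (AddMonoidHom.id B - f.comp x)

section StIso
variable [Finite G] {A B C : GMod G}

theorem Iso.stIso (h : Iso A B) : StIso A B := by
  obtain ⟨e, he⟩ := h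
  refine ⟨e.toAddMonoidHom, e.symm.toAddMonoidHom, he, ?_, ?_, ?_⟩
  · intro g b
    apply e.injective
    simp [he]
  · convert IsTr.zero (A := A) (B := A) using 1
    ext; simp
  · convert IsTr.zero (A := B) (B := B) using 1
    ext; simp

theorem StIso.symm : StIso A B → StIso B A := by
  rintro ⟨f, x, h1, h2, h3, h4⟩
  exact ⟨x, f, h2, h1, h4, h3⟩

theorem StIso.trans : StIso A B → StIso B C → StIso A C := by
  rintro ⟨f, x, h1, h2, h3, h4⟩ ⟨f', x', h1', h2', h3', h4'⟩
  refine ⟨f'.comp f, x.comp x', h1'.comp h1, h2.comp h2', ?_, ?_⟩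
  · convert h3.add ((h3'.comp_right h1).comp_left h2) using 1
    ext; simp
  · convert h4'.add ((h4.comp_right h2').comp_left h1') using 1
    ext; simp

/-- Kernels of two projective covers of the same module are stably isomorphic. -/
theorem SES.stIso {A F B A' F' : GMod G} {i : A →+ F} {p : F →+ B} {i' : A' →+ F'} {p' : F' →+ B}
    (h : SES i p) (h' : SES i' p') (hF : IsProj F) (hF' : IsProj F') : StIso A A' := by
  obtain ⟨L, hL, hpL⟩ := exists_lift hF h'.ep h'.split h.ep
  obtain ⟨L', hL', hpL'⟩ := exists_lift hF' h.ep h.split h'.ep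
  obtain ⟨f, hf, hfe⟩ := h'.factor (L.comp i)
    (by rw [← AddMonoidHom.comp_assoc, hpL, h.comp_eq_zero])
  obtain ⟨x, hx, hxe⟩ := h.factor (L'.comp i')
    (by rw [← AddMonoidHom.comp_assoc, hpL', h'.comp_eq_zero])
  have key : ∀ {A F A' F' : GMod G} {i : A →+ F} {p : F →+ B} {i' : A' →+ F'} {p' : F' →+ B}
    (_ : SES i p) (_ : SES i' p') (_ : IsProj F) (L : F →+ F') (L' : F' →+ F)
    (_ : Eqv L) (_ : Eqv L') (_ : p'.comp L = p) (_ : p.comp L' = p') (f : A →+ A') (x : A' →+ A)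
    (_ : i'.comp f = L.comp i) (_ : i.comp x = L'.comp i'),
    IsTr (AddMonoidHom.id A - x.comp f) := by
    intro A F A' F' i p i' p' h h' hF L L' hL hL' hpL hpL' f x hf hx
    obtain ⟨t, ht, hte⟩ := h.factor (AddMonoidHom.id F - L'.comp L)
      (by rw [AddMonoidHom.comp_sub, ← AddMonoidHom.comp_assoc, hpL', hpL, AddMonoidHom.comp_id,
            sub_self])
    have hte' := hte ((Eqv.id F).sub (hL'.comp hL))
    have := (hF.isTr_of_left hte').comp_right h.ei
    convert this using 1
    refine AddMonoidHom.ext fun a => h.inj ?_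
    have e1 : i (t (i a)) = i a - L' (L (i a)) := DFunLike.congr_fun ht _
    have e2 : i' (f a) = L (i a) := DFunLike.congr_fun hf a
    have e3 : i (x (f a)) = L' (i' (f a)) := DFunLike.congr_fun hx _
    simp [e1, e3, e2]
  exact ⟨f, x, hfe (hL.comp h.ei), hxe (hL'.comp h'.ei),
    key h h' hF L L' hL hL' hpL hpL' f x hf hx, key h' h hF' L' L hL' hL hpL' hpL x f hx hf⟩

end StIso

/-- Summation over a finite `G`-set. -/
def Ind.sum (Y : Type) [Fintype Y] [MulAction G Y] (A : GMod G) : Ind Y A →+ A :=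
  AddMonoidHom.mk' (M := Y → A) (G := A) (fun f => ∑ y, f y)
    (fun f h => by simp [Finset.sum_add_distrib])

section D
variable (Y : Type) [Fintype Y] [MulAction G Y]

theorem Ind.sum_eqv (A : GMod G) : Eqv (Ind.sum Y A) := by
  intro g f
  refine Eq.trans ?_ (map_sum (A.sm g) (fun y => (f y : A)) Finset.univ).symm
  exact Fintype.sum_equiv (MulAction.toPerm g⁻¹) _ _ fun y => rfl

theorem Ind.sum_split [Nonempty Y] (A : GMod G) :
    ∃ s : A →+ Ind Y A, (Ind.sum Y A).comp s = AddMonoidHom.id A := by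
  classical
  obtain ⟨y0⟩ := ‹Nonempty Y›
  refine ⟨AddMonoidHom.mk' (G := Y → A) (fun a => Pi.single y0 a) (fun a b => Pi.single_add _ _ _),
    AddMonoidHom.ext fun a => ?_⟩
  change ∑ y, (Pi.single y0 a : Y → A) y = a
  simp

/-- The kernel of the summation map. -/
def D (A : GMod G) : GMod G := ker (Ind.sum Y A) (Ind.sum_eqv Y A)

theorem res_D (H : Subgroup G) (A : GMod G) : res H (D Y A) = D Y (res H A) := rfl

def D.incl (A : GMod G) : D Y A →+ Ind Y A := sub.incl (Ind Y A) (Ind.sum Y A).ker (Ind.sum_eqv Y A).ker_inv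

theorem D.ses [Nonempty Y] (A : GMod G) : SES (D.incl Y A) (Ind.sum Y A) :=
  SES.ker _ (Ind.sum_eqv Y A) (Ind.sum_split Y A)

variable {Y}

theorem D.sum_eq {A : GMod G} (u : D Y A) : ∑ y, (u.1 y : A) = 0 := u.2

theorem D.lat {A : GMod G} (hA : Lat A) : Lat (D Y A) := 
  Lat.sub (hS := (Ind.sum_eqv Y A).ker_inv) (Ind.lat hA)

variable (Y) in
def D.map {A B : GMod G} (φ : A →+ B) : D Y A →+ D Y B :=
  AddMonoidHom.mk' (fun u => ⟨Ind.map Y φ u.1, by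
    change ∑ y, φ (u.1 y) = 0
    exact (map_sum φ (fun y => (u.1 y : A)) Finset.univ).symm.trans
      ((congrArg φ (D.sum_eq u)).trans (map_zero φ))⟩) (fun u v => Subtype.ext (map_add (Ind.map Y φ) u.1 v.1))

theorem D.map_val {A B : GMod G} (φ : A →+ B) (u : D Y A) (y : Y) :
    (D.map Y φ u).1 y = φ (u.1 y) := rfl

theorem D.smul_val {A : GMod G} (g : G) (u : D Y A) (y : Y) :
    (g • u).1 y = g • (u.1 (g⁻¹ • y) : A) := rfl

theorem D.ext {A : GMod G} {u v : D Y A} (h : ∀ y, (u.1 y : A) = v.1 y) : u = v :=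
  Subtype.ext (funext h)

theorem D.map_eqv {A B : GMod G} {φ : A →+ B} (hφ : Eqv φ) : Eqv (D.map Y φ) :=
  fun g _ => D.ext fun _ => hφ g _

theorem D.map_comp {A B C : GMod G} (φ : A →+ B) (ψ : B →+ C) :
    (D.map Y ψ).comp (D.map Y φ) = D.map Y (ψ.comp φ) := rfl

theorem D.map_id (A : GMod G) : D.map Y (AddMonoidHom.id A) = AddMonoidHom.id _ := rfl

theorem D.map_sub {A B : GMod G} (φ ψ : A →+ B) : D.map Y (φ - ψ) = D.map Y φ - D.map Y ψ := rfl

theorem D.map_tr [Finite G] {A B : GMod G} (φ : A →+ B) : D.map Y (tr φ) = tr (D.map Y φ) := by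
  cases nonempty_fintype G
  refine AddMonoidHom.ext fun u => D.ext fun y => ?_
  rw [D.map_val, tr_apply, tr_apply]
  have h2 : ∀ (s : Finset G) (F : G → D Y B), ((∑ g ∈ s, F g : D Y B)).1 y =
      ∑ g ∈ s, ((F g).1 y : B) := by
    intro s F
    exact map_sum (AddMonoidHom.mk' (fun u : D Y B => (u.1 y : B)) (fun _ _ => rfl)) F s
  rw [h2]
  refine Finset.sum_congr rfl fun g _ => ?_
  rw [D.smul_val, D.map_val, D.smul_val]
  simp

theorem StIso.D [Finite G] {A B : GMod G} : StIso A B → StIso (D Y A) (D Y B) := by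
  rintro ⟨f, x, h1, h2, ⟨φ, h3⟩, ⟨ψ, h4⟩⟩
  refine ⟨D.map Y f, D.map Y x, D.map_eqv h1, D.map_eqv h2, ⟨D.map Y φ, ?_⟩, ⟨D.map Y ψ, ?_⟩⟩
  · rw [← D.map_tr, h3, D.map_sub, D.map_comp, D.map_id]
  · rw [← D.map_tr, h4, D.map_sub, D.map_comp, D.map_id]

theorem Iso.D {A B : GMod G} : Iso A B → Iso (D Y A) (D Y B) := by
  rintro ⟨e, he⟩
  refine ⟨{ toFun := D.map Y e.toAddMonoidHom
            invFun := D.map Y e.symm.toAddMonoidHom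
            left_inv := fun u => D.ext fun y => ?_
            right_inv := fun u => D.ext fun y => ?_
            map_add' := map_add _ }, fun g u => D.ext fun y => he g _⟩
  · simp [D.map_val]
  · simp [D.map_val]

theorem D.prod_iso (A B : GMod G) : Iso (D Y (prod A B)) (prod (D Y A) (D Y B)) := by
  refine ⟨{ toFun := fun u => (D.map Y (fst A B) u, D.map Y (snd A B) u)
            invFun := fun p => D.map Y (inl A B) p.1 + D.map Y (inr A B) p.2
            left_inv := fun u => D.ext fun y => ?_
            right_inv := fun p => Prod.ext (D.ext fun y => ?_) (D.ext fun y => ?_)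
            map_add' := fun _ _ => rfl }, fun g u => rfl⟩
  · exact Prod.ext (add_zero (u.1 y).1) (zero_add (u.1 y).2)
  · exact add_zero (p.1.1 y)
  · exact zero_add (p.2.1 y)

variable (Y) in
/-- Iterates of `D`. -/
def Dn (n : ℕ) (A : GMod G) : GMod G := (GMod.D Y)^[n] A

theorem Dn_succ (n : ℕ) (A : GMod G) : Dn Y (n + 1) A = GMod.D Y (Dn Y n A) :=
  Function.iterate_succ_apply' _ _ _

theorem Dn_add (m n : ℕ) (A : GMod G) : Dn Y (m + n) A = Dn Y m (Dn Y n A) :=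
  Function.iterate_add_apply _ _ _ _

theorem res_Dn (H : Subgroup G) (n : ℕ) (A : GMod G) :
    GMod.res H (Dn Y n A) = Dn Y n (GMod.res H A) := by
  induction n with
  | zero => rfl
  | succ n ih => rw [Dn_succ, Dn_succ, res_D, ih]

theorem Dn.lat {A : GMod G} (hA : Lat A) (n : ℕ) : Lat (Dn Y n A) := by
  induction n with
  | zero => exact hA
  | succ n ih => rw [Dn_succ]; exact D.lat ih

theorem StIso.Dn [Finite G] {A B : GMod G} (h : StIso A B) (n : ℕ) :
    StIso (Dn Y n A) (Dn Y n B) := by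
  induction n with
  | zero => exact h
  | succ n ih => rw [Dn_succ, Dn_succ]; exact ih.D

theorem Dn.prod_iso (n : ℕ) (A B : GMod G) :
    Iso (GMod.Dn Y n (prod A B)) (prod (GMod.Dn Y n A) (GMod.Dn Y n B)) := by
  induction n with
  | zero => exact Iso.refl _
  | succ n ih =>
    rw [Dn_succ, Dn_succ, Dn_succ]
    exact ih.D.trans (D.prod_iso _ _)

end D

/-- Twisting by a sign character. -/
def Tw (χ : G →* ℤˣ) (A : GMod G) : GMod G :=
  { V := A
    act :=
      { smul := fun g a => (χ g : ℤ) • (g • a : A)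
        one_smul := fun a => by change (χ 1 : ℤ) • ((1 : G) • a : A) = a; simp
        mul_smul := fun g h a => by
          change (χ (g * h) : ℤ) • ((g * h) • a : A) = (χ g : ℤ) • (g • ((χ h : ℤ) • (h • a : A)) : A)
          have := map_zsmul (A.sm g) (χ h : ℤ) (h • a)
          simp only [sm_apply] at this
          rw [this, map_mul, Units.val_mul, mul_smul (χ g : ℤ), mul_smul g h]
        smul_zero := fun g => by change (χ g : ℤ) • (g • (0 : A) : A) = 0; simp
        smul_add := fun g a b => by
          change (χ g : ℤ) • (g • (a + b : A) : A) = (χ g : ℤ) • (g • a : A) + (χ g : ℤ) • (g • b : A)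
          simp } }

section Tw
variable {χ : G →* ℤˣ} {A B : GMod G}

theorem Tw.eqv {f : A →+ B} (hf : Eqv f) : Eqv (A := Tw χ A) (B := Tw χ B) f := by
  intro g a
  change f ((χ g : ℤ) • (g • (show A from a) : A)) = (χ g : ℤ) • (g • f a)
  rw [map_zsmul, hf]

theorem Tw.tr [Finite G] (φ : A →+ B) : tr (A := Tw χ A) (B := Tw χ B) φ = tr φ := by
  cases nonempty_fintype G
  refine AddMonoidHom.ext fun a => ?_
  refine (tr_apply (A := GMod.Tw χ A) (B := GMod.Tw χ B) φ a).trans ?_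
  refine Eq.trans ?_ (tr_apply (A := A) (B := B) φ a).symm
  refine Finset.sum_congr rfl fun g _ => ?_
  change (χ g : ℤ) • (g • φ ((χ g⁻¹ : ℤ) • (g⁻¹ • (show A from a) : A)) : B) = _
  rw [map_zsmul]
  have := map_zsmul (B.sm g) (χ g⁻¹ : ℤ) (φ (g⁻¹ • (show A from a)))
  simp only [sm_apply] at this
  rw [this, smul_smul, ← Units.val_mul, ← map_mul]
  simp

theorem StIso.Tw [Finite G] : StIso A B → StIso (Tw χ A) (Tw χ B) := by
  rintro ⟨f, x, h1, h2, ⟨φ, h3⟩, ⟨ψ, h4⟩⟩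
  exact ⟨f, x, Tw.eqv h1, Tw.eqv h2, ⟨φ, (Tw.tr φ).trans h3⟩, ⟨ψ, (Tw.tr ψ).trans h4⟩⟩

theorem Tw.D (Y : Type) [Fintype Y] [MulAction G Y] (A : GMod G) :
    Iso (D Y (Tw χ A)) (Tw χ (D Y A)) :=
  ⟨AddEquiv.refl _, fun _ _ => rfl⟩

theorem Tw.Dn (Y : Type) [Fintype Y] [MulAction G Y] (n : ℕ) (A : GMod G) :
    Iso (Dn Y n (Tw χ A)) (Tw χ (Dn Y n A)) := by
  induction n with
  | zero => exact Iso.refl _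
  | succ n ih =>
    rw [Dn_succ, Dn_succ]
    exact ih.D.trans (Tw.D Y _)

theorem Tw.twice (A : GMod G) : Iso (Tw χ (GMod.Tw χ A)) A := by
  refine ⟨AddEquiv.refl _, fun g a => ?_⟩
  change (χ g : ℤ) • ((χ g : ℤ) • (g • (show A from a) : A)) = g • (show A from a)
  rw [smul_smul, ← Units.val_mul, ← map_mul]
  rcases Int.units_eq_one_or (χ g) with h | h <;> simp [h]

end Tw

end GMod

namespace Chains

variable {V : Type}

/-- Alternating functions on lists. -/
def Alt (c : List V → ℤ) : Prop := ∀ l₁ a b l₂, c (l₁ ++ a :: b :: l₂) = - c (l₁ ++ b :: a :: l₂)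

theorem Alt.cons {c : List V → ℤ} (h : Alt c) (v : V) : Alt fun l => c (v :: l) :=
  fun l₁ a b l₂ => h (v :: l₁) a b l₂

theorem Alt.swap {c : List V → ℤ} (h : Alt c) (a b : V) (l : List V) :
    c (a :: b :: l) = - c (b :: a :: l) := h [] a b l

theorem Alt.add {c d : List V → ℤ} (h : Alt c) (h' : Alt d) : Alt (c + d) := fun l₁ a b l₂ => by
  simp only [Pi.add_apply]; rw [h, h']; ring

theorem Alt.neg {c : List V → ℤ} (h : Alt c) : Alt (-c) := fun l₁ a b l₂ => by
  simp only [Pi.neg_apply]; rw [h]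

theorem Alt.perm {c : List V → ℤ} (h : Alt c) {l l' : List V} (p : l.Perm l') :
    c l = c l' ∨ c l = - c l' := by
  induction p generalizing c with
  | nil => exact Or.inl rfl
  | cons x _ ih => exact ih (h.cons x)
  | swap x y l => exact Or.inr (h.swap _ _ _)
  | trans _ _ ih1 ih2 =>
    have h1 := ih1 h
    have h2 := ih2 h
    lia

theorem Alt.perm_ne {c : List V → ℤ} (h : Alt c) {l l' : List V} (p : l.Perm l') (hl : c l ≠ 0) :
    c l' ≠ 0 := by
  have := h.perm p
  lia

theorem exists_perm_of_not_nodup {l : List V} (h : ¬ l.Nodup) : ∃ a l', l.Perm (a :: a :: l') := by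
  induction l with
  | nil => simp at h
  | cons x l ih =>
    by_cases hl : l.Nodup
    · have hx : x ∈ l := by
        by_contra hx
        exact h (List.nodup_cons.2 ⟨hx, hl⟩)
      obtain ⟨s, t, rfl⟩ := List.append_of_mem hx
      exact ⟨x, s ++ t, List.Perm.cons x List.perm_middle⟩
    · obtain ⟨a, l', h'⟩ := ih hl
      refine ⟨a, x :: l', (h'.cons x).trans ?_⟩
      exact (List.Perm.swap a x _).trans ((List.Perm.swap a x _).cons a)

theorem Alt.nodup {c : List V → ℤ} (h : Alt c) {l : List V} (hl : c l ≠ 0) : l.Nodup := by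
  by_contra hn
  obtain ⟨a, l', p⟩ := exists_perm_of_not_nodup hn
  have h1 := h.perm_ne p hl
  have h2 := h.swap a a l'
  lia

section bd
variable [Fintype V]

/-- The boundary operator. -/
def bd (c : List V → ℤ) (l : List V) : ℤ := ∑ v, c (v :: l)

theorem bd_add (c d : List V → ℤ) : bd (c + d) = bd c + bd d := by
  ext l; simp [bd, Finset.sum_add_distrib]

theorem bd_sub (c d : List V → ℤ) : bd (c - d) = bd c - bd d := by
  ext l; simp [bd, Finset.sum_sub_distrib]

theorem bd_neg (c : List V → ℤ) : bd (-c) = - bd c := by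
  ext l; simp [bd]

theorem bd_zsmul (n : ℤ) (c : List V → ℤ) : bd (n • c) = n • bd c := by
  ext l; simp [bd, Finset.mul_sum]

theorem bd_zero : bd (0 : List V → ℤ) = 0 := by
  ext l; simp [bd]

theorem Alt.bd {c : List V → ℤ} (h : Alt c) : Alt (bd c) := fun l₁ a b l₂ => by
  simp only [Chains.bd, ← Finset.sum_neg_distrib]
  exact Finset.sum_congr rfl fun v _ => h (v :: l₁) a b l₂

theorem bd_bd {c : List V → ℤ} (h : Alt c) : bd (bd c) = 0 := by
  ext l
  have : bd (bd c) l = - bd (bd c) l := by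
    simp only [bd, ← Finset.sum_neg_distrib]
    rw [Finset.sum_comm]
    exact Finset.sum_congr rfl fun v _ => Finset.sum_congr rfl fun w _ => h.swap _ _ _
  simp only [Pi.zero_apply]
  lia

theorem bd_cons {c : List V → ℤ} (h : Alt c) (v : V) (l : List V) :
    bd (fun l => c (v :: l)) l = - bd c (v :: l) := by
  simp only [bd, ← Finset.sum_neg_distrib]
  exact Finset.sum_congr rfl fun w _ => h.swap _ _ _

end bd

section wedge
variable [DecidableEq V]

/-- Exterior multiplication by a vertex. -/
def W (v : V) : (List V → ℤ) → List V → ℤ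
  | _, [] => 0
  | c, a :: l => (if a = v then c l else 0) - W v (fun m => c (a :: m)) l

variable (v : V)

theorem W_nil (c : List V → ℤ) : W v c [] = 0 := by rw [W]

theorem W_cons (c : List V → ℤ) (a : V) (l : List V) :
    W v c (a :: l) = (if a = v then c l else 0) - W v (fun m => c (a :: m)) l := by rw [W]

theorem W_zero (l : List V) : W v (fun _ => 0) l = 0 := by
  induction l with
  | nil => exact W_nil _ _
  | cons a l ih => rw [W_cons, ih]; simp

theorem W_add (c d : List V → ℤ) (l : List V) : W v (fun m => c m + d m) l = W v c l + W v d l := by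
  induction l generalizing c d with
  | nil => simp [W_nil]
  | cons a l ih =>
    rw [W_cons, W_cons, W_cons, ih (fun m => c (a :: m)) (fun m => d (a :: m))]
    split_ifs <;> ring

theorem W_neg (c : List V → ℤ) (l : List V) : W v (fun m => - c m) l = - W v c l := by
  have := W_add v c (fun m => - c m) l
  simp only [add_neg_cancel, W_zero] at this
  lia

theorem W_sum {ι : Type} (s : Finset ι) (c : ι → List V → ℤ) (l : List V) :
    W v (fun m => ∑ i ∈ s, c i m) l = ∑ i ∈ s, W v (c i) l := by
  classical
  induction s using Finset.induction_on with
  | empty => simp [W_zero]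
  | insert i s hi ih => simp only [Finset.sum_insert hi]; rw [W_add, ih]

theorem Alt.W {c : List V → ℤ} (h : Alt c) : Alt (W v c) := by
  intro l₁ a b l₂
  induction l₁ generalizing c with
  | nil =>
    simp only [List.nil_append, W_cons]
    have : (fun m => c (a :: b :: m)) = fun m => - c (b :: a :: m) := by
      ext m; exact h.swap _ _ _
    rw [this, W_neg]
    ring
  | cons x l₁ ih =>
    simp only [List.cons_append, W_cons]
    rw [ih (h.cons x), h]
    split_ifs <;> ring

theorem W_ne_zero {c : List V → ℤ} {l : List V} (h : W v c l ≠ 0) :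
    ∃ l', l.Perm (v :: l') ∧ c l' ≠ 0 := by
  induction l generalizing c with
  | nil => exact absurd (W_nil _ _) h
  | cons a l ih =>
    rw [W_cons] at h
    by_cases h1 : W v (fun m => c (a :: m)) l = 0
    · rw [h1, sub_zero] at h
      split_ifs at h with h2
      · exact ⟨l, by rw [h2], h⟩
      · exact absurd rfl h
    · obtain ⟨l', p, hc⟩ := ih h1
      exact ⟨a :: l', (p.cons a).trans (List.Perm.swap _ _ _), hc⟩

theorem bd_W [Fintype V] (c : List V → ℤ) : bd (W v c) = c - W v (bd c) := by
  ext l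
  simp only [bd, W_cons, Finset.sum_sub_distrib, Pi.sub_apply]
  rw [← W_sum]
  simp; rfl

end wedge

variable [DecidableEq V]

/-- Chains of degree `i` supported on faces in `F`. -/
structure Ch (F : Finset V → Prop) (i : ℕ) (c : List V → ℤ) : Prop where
  alt : Alt c
  supp : ∀ l, c l ≠ 0 → l.length = i ∧ F l.toFinset

theorem Ch.mono {F F' : Finset V → Prop} {i : ℕ} {c : List V → ℤ} (h : Ch F i c)
    (hF : ∀ s, F s → F' s) : Ch F' i c := ⟨h.alt, fun l hl => ⟨(h.supp l hl).1, hF _ (h.supp l hl).2⟩⟩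

theorem Ch.add {F : Finset V → Prop} {i : ℕ} {c d : List V → ℤ} (h : Ch F i c) (h' : Ch F i d) :
    Ch F i (c + d) := ⟨h.alt.add h'.alt, fun l hl => by
  by_cases hc : c l = 0
  · exact h'.supp l (by simpa [hc] using hl)
  · exact h.supp l hc⟩

theorem Ch.neg {F : Finset V → Prop} {i : ℕ} {c : List V → ℤ} (h : Ch F i c) :
    Ch F i (-c) := ⟨h.alt.neg, fun l hl => h.supp l (by simpa using hl)⟩

theorem Ch.sub {F : Finset V → Prop} {i : ℕ} {c d : List V → ℤ} (h : Ch F i c) (h' : Ch F i d) :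
    Ch F i (c - d) := by rw [sub_eq_add_neg]; exact h.add h'.neg

theorem Ch.zero (F : Finset V → Prop) (i : ℕ) : Ch F i 0 :=
  ⟨fun _ _ _ _ => by simp, fun l hl => absurd rfl hl⟩

theorem Ch.zsmul {F : Finset V → Prop} {i : ℕ} {c : List V → ℤ} (h : Ch F i c) (n : ℤ) :
    Ch F i (n • c) := by
  refine ⟨fun l₁ a b l₂ => ?_, fun l hl => h.supp l fun h0 => hl ?_⟩
  · simp only [Pi.smul_apply]; rw [h.alt]; simp
  · simp [h0]

theorem Ch.bd [Fintype V] {F : Finset V → Prop} (hF : ∀ s t, s ⊆ t → F t → F s) {i : ℕ}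
    {c : List V → ℤ} (h : Ch F (i + 1) c) : Ch F i (bd c) := by
  refine ⟨h.alt.bd, fun l hl => ?_⟩
  obtain ⟨v, _, hv⟩ := Finset.exists_ne_zero_of_sum_ne_zero hl
  obtain ⟨h1, h2⟩ := h.supp _ hv
  refine ⟨by simpa using h1, hF _ _ ?_ h2⟩
  simp

theorem Ch.W {F F' : Finset V → Prop} {i : ℕ} {c : List V → ℤ} (h : Ch F i c) (v : V)
    (hF : ∀ s, F s → F' (insert v s)) : Ch F' (i + 1) (W v c) := by
  refine ⟨h.alt.W v, fun l hl => ?_⟩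
  obtain ⟨l', p, hc⟩ := W_ne_zero v hl
  obtain ⟨h1, h2⟩ := h.supp _ hc
  refine ⟨by rw [p.length_eq]; simp [h1], ?_⟩
  rw [List.toFinset_eq_of_perm _ _ p, List.toFinset_cons]
  exact hF _ h2

theorem Ch.bd_zero_of_zero [Fintype V] {F : Finset V → Prop} {c : List V → ℤ} (h : Ch F 0 c) :
    Chains.bd c = 0 := by
  ext l
  refine Finset.sum_eq_zero fun v _ => ?_
  by_contra hv
  simpa using (h.supp _ hv).1

/-- The faces: subsets of `U` omitting a point of each live block. -/
def Face {κ : Type} (r : V → κ) (U : Finset V) (L : Finset κ) (s : Finset V) : Prop :=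
  s ⊆ U ∧ ∀ k ∈ L, ∃ u ∈ U, r u = k ∧ u ∉ s

theorem Face.down {V κ : Type} {r : V → κ} {U : Finset V} {L : Finset κ} (s t : Finset V)
    (h : s ⊆ t) (ht : Face r U L t) : Face r U L s := by
  refine ⟨h.trans ht.1, fun k hk => ?_⟩
  obtain ⟨u, hu, h1, h2⟩ := ht.2 k hk
  exact ⟨u, hu, h1, fun h3 => h2 (h h3)⟩

theorem Face.card_le {κ : Type} {r : V → κ} {U : Finset V} {L : Finset κ} {s : Finset V}
    (h : Face r U L s) : s.card + L.card ≤ U.card := by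
  classical
  have h1 : L ⊆ (U \ s).image r := fun k hk => by
    obtain ⟨u, hu, h1, h2⟩ := h.2 k hk
    exact Finset.mem_image.2 ⟨u, Finset.mem_sdiff.2 ⟨hu, h2⟩, h1⟩
  have h2 := (Finset.card_le_card h1).trans Finset.card_image_le
  rw [Finset.card_sdiff_of_subset h.1] at h2
  have := Finset.card_le_card h.1
  lia

theorem acyclic_cone [Fintype V] {κ : Type} {r : V → κ} {U : Finset V} {L : Finset κ} {v : V}
    (hv : v ∈ U) (hr : r v ∉ L) {i : ℕ} {c : List V → ℤ} (hc : Ch (Face r U L) i c)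
    (hb : bd c = 0) : ∃ b, Ch (Face r U L) (i + 1) b ∧ bd b = c := by
  refine ⟨W v c, hc.W v fun s hs => ?_, ?_⟩
  · refine ⟨Finset.insert_subset hv hs.1, fun k hk => ?_⟩
    obtain ⟨u, hu, h1, h2⟩ := hs.2 k hk
    refine ⟨u, hu, h1, ?_⟩
    rw [Finset.mem_insert, not_or]
    refine ⟨?_, h2⟩
    rintro rfl
    exact hr (h1 ▸ hk)
  · rw [bd_W, hb]
    ext l
    have := W_zero v l
    simp only [Pi.sub_apply]
    change c l - W v (fun _ => 0) l = _
    lia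

theorem sphere [Fintype V] {κ : Type} [DecidableEq κ] (r : V → κ) (n : ℕ) :
    ∀ (U : Finset V) (L : Finset κ), U.card = n → (∀ k ∈ L, ∃ u ∈ U, r u = k) →
      (∀ u ∈ U, r u ∈ L) →
      (∀ i, i + L.card < U.card → ∀ c, Ch (Face r U L) i c → bd c = 0 →
        ∃ b, Ch (Face r U L) (i + 1) b ∧ bd b = c) ∧
      (∀ N, N + L.card = U.card → ∃ z, Ch (Face r U L) N z ∧ bd z = 0 ∧ z ≠ 0 ∧
        ∀ c, Ch (Face r U L) N c → bd c = 0 → ∃ m : ℤ, c = m • z) := by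
  induction n with
  | zero =>
    intro U L hU hL _
    obtain rfl := Finset.card_eq_zero.1 hU
    have hL0 : L = ∅ := Finset.eq_empty_of_forall_notMem fun k hk => by
      obtain ⟨u, hu, _⟩ := hL k hk
      simp at hu
    subst hL0
    refine ⟨fun i hi => by simp at hi, fun N hN => ?_⟩
    have hN0 : N = 0 := by simpa using hN
    subst hN0
    have hz : Ch (Face r ∅ ∅) 0 (fun l : List V => if l = [] then 1 else 0) := by
      refine ⟨fun _ _ _ _ => by simp, fun l hl => ?_⟩
      have : l = [] := by by_contra h; simp [h] at hl
      subst this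
      exact ⟨rfl, by simp [Face]⟩
    refine ⟨_, hz, hz.bd_zero_of_zero, fun h => by simpa using congrFun h [], fun c hc _ =>
      ⟨c [], ?_⟩⟩
    ext l
    by_cases hl : l = []
    · subst hl; simp
    · have : c l = 0 := by
        by_contra h
        exact hl (List.length_eq_zero_iff.1 (hc.supp l h).1)
      simp [hl, this]
  | succ n ih =>
    intro U L hU hL hUL
    have hne : U.Nonempty := by
      rw [← Finset.card_pos]; lia
    obtain ⟨v, hv⟩ := hne
    have hUv : (U.erase v).card = n := by rw [Finset.card_erase_of_mem hv, hU]; rfl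
    have hLv := Finset.card_erase_of_mem (hUL v hv)
    have hLpos : 0 < L.card := Finset.card_pos.2 ⟨_, hUL v hv⟩
    by_cases hs : ∀ u ∈ U, r u = r v → u = v
    · have hF : Face r U L = Face r (U.erase v) (L.erase (r v)) := by
        ext s
        constructor
        · intro h
          obtain ⟨u, hu, h1, h2⟩ := h.2 _ (hUL v hv)
          obtain rfl := hs u hu h1
          refine ⟨fun x hx => Finset.mem_erase.2 ⟨fun e => h2 (e ▸ hx), h.1 hx⟩, fun k hk => ?_⟩
          obtain ⟨w, hw, h3, h4⟩ := h.2 k (Finset.mem_of_mem_erase hk)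
          refine ⟨w, Finset.mem_erase.2 ⟨?_, hw⟩, h3, h4⟩
          rintro rfl
          exact Finset.ne_of_mem_erase hk h3.symm
        · intro h
          refine ⟨h.1.trans (Finset.erase_subset _ _), fun k hk => ?_⟩
          by_cases hkv : k = r v
          · exact ⟨v, hv, hkv.symm, fun h' => by simpa using h.1 h'⟩
          · obtain ⟨u, hu, h1⟩ := h.2 k (Finset.mem_erase.2 ⟨hkv, hk⟩)
            exact ⟨u, Finset.mem_of_mem_erase hu, h1⟩
      have := ih (U.erase v) (L.erase (r v)) hUv (fun k hk => by
          obtain ⟨u, hu, h1⟩ := hL k (Finset.mem_of_mem_erase hk)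
          refine ⟨u, Finset.mem_erase.2 ⟨?_, hu⟩, h1⟩
          rintro rfl
          exact Finset.ne_of_mem_erase hk h1.symm) (fun u hu =>
          Finset.mem_erase.2 ⟨fun h => Finset.ne_of_mem_erase hu (hs u (Finset.mem_of_mem_erase hu) h),
            hUL u (Finset.mem_of_mem_erase hu)⟩)
      rw [← hF] at this
      refine ⟨fun i hi => this.1 i (by lia), fun N hN => this.2 N (by lia)⟩
    · push Not at hs
      obtain ⟨w, hw, hwr, hwv⟩ := hs
      have hwU : w ∈ U.erase v := Finset.mem_erase.2 ⟨hwv, hw⟩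
      have hLk := ih (U.erase v) L hUv (fun k hk => by
        by_cases hkv : k = r v
        · exact ⟨w, hwU, hwr.trans hkv.symm⟩
        · obtain ⟨u, hu, h1⟩ := hL k hk
          refine ⟨u, Finset.mem_erase.2 ⟨?_, hu⟩, h1⟩
          rintro rfl
          exact hkv h1.symm) (fun u hu => hUL u (Finset.mem_of_mem_erase hu))
      have hcardlk : L.card ≤ n := by
        have : Face r (U.erase v) L ∅ := ⟨by simp, fun k hk => by
          by_cases hkv : k = r v
          · exact ⟨w, hwU, hwr.trans hkv.symm, by simp⟩
          · obtain ⟨u, hu, h1⟩ := hL k hk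
            refine ⟨u, Finset.mem_erase.2 ⟨?_, hu⟩, h1, by simp⟩
            rintro rfl
            exact hkv h1.symm⟩
        have := this.card_le
        simpa [hUv] using this
      set Lk := Face r (U.erase v) L with hLkdef
      set Del := Face r (U.erase v) (L.erase (r v)) with hDel
      set K := Face r U L with hK
      have hdel : ∀ {i : ℕ} {c : List V → ℤ}, Ch Del i c → bd c = 0 →
          ∃ b, Ch Del (i + 1) b ∧ bd b = c := fun hc hb =>
        acyclic_cone hwU (by rw [hwr]; simp) hc hb
      have hDK : ∀ s, Del s → K s := by
        intro s h
        refine ⟨h.1.trans (Finset.erase_subset _ _), fun k hk => ?_⟩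
        by_cases hkv : k = r v
        · exact ⟨v, hv, hkv.symm, fun h' => by simpa using h.1 h'⟩
        · obtain ⟨u, hu, h1⟩ := h.2 k (Finset.mem_erase.2 ⟨hkv, hk⟩)
          exact ⟨u, Finset.mem_of_mem_erase hu, h1⟩
      have hLD : ∀ s, Lk s → Del s := fun s h =>
        ⟨h.1, fun k hk => h.2 k (Finset.mem_of_mem_erase hk)⟩
      have hLW : ∀ s, Lk s → K (insert v s) := by
        intro s h
        refine ⟨Finset.insert_subset hv (h.1.trans (Finset.erase_subset _ _)), fun k hk => ?_⟩
        obtain ⟨u, hu, h1, h2⟩ := h.2 k hk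
        refine ⟨u, Finset.mem_of_mem_erase hu, h1, ?_⟩
        rw [Finset.mem_insert, not_or]
        exact ⟨Finset.ne_of_mem_erase hu, h2⟩
      have hcv : ∀ {i : ℕ} {c : List V → ℤ}, Ch K (i + 1) c → Ch Lk i fun l => c (v :: l) := by
        intro i c hc
        refine ⟨hc.alt.cons v, fun l hl => ?_⟩
        obtain ⟨h1, h2⟩ := hc.supp _ hl
        have hnd := List.nodup_cons.1 (hc.alt.nodup hl)
        refine ⟨by simpa using h1, fun x hx => ?_, fun k hk => ?_⟩
        · refine Finset.mem_erase.2 ⟨?_, h2.1 (by simp at hx; simp [hx])⟩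
          rintro rfl
          exact hnd.1 (by simpa using hx)
        · obtain ⟨u, hu, h3, h4⟩ := h2.2 k hk
          simp only [List.toFinset_cons, Finset.mem_insert, not_or] at h4
          exact ⟨u, Finset.mem_erase.2 ⟨h4.1, hu⟩, h3, h4.2⟩
      have hKD : ∀ {i : ℕ} {c : List V → ℤ}, Ch K i c → (∀ l, c (v :: l) = 0) → Ch Del i c := by
        intro i c hc h0
        refine ⟨hc.alt, fun l hl => ?_⟩
        obtain ⟨h1, h2⟩ := hc.supp _ hl
        have hvl : v ∉ l := by
          intro hvl
          obtain ⟨s, t, rfl⟩ := List.append_of_mem hvl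
          exact hc.alt.perm_ne List.perm_middle hl (h0 _)
        refine ⟨h1, fun x hx => Finset.mem_erase.2 ⟨?_, h2.1 hx⟩, fun k hk => ?_⟩
        · rintro rfl
          exact hvl (by simpa using hx)
        · obtain ⟨u, hu, h3, h4⟩ := h2.2 k (Finset.mem_of_mem_erase hk)
          refine ⟨u, Finset.mem_erase.2 ⟨?_, hu⟩, h3, h4⟩
          rintro rfl
          exact Finset.ne_of_mem_erase hk h3.symm
      have hDv : ∀ {i : ℕ} {c : List V → ℤ}, Ch Del i c → ∀ l, c (v :: l) = 0 := by
        intro i c hc l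
        by_contra h
        simpa using (hc.supp _ h).2.1 (show v ∈ (v :: l).toFinset by simp)
      have hWv : ∀ {i : ℕ} {c : List V → ℤ}, Ch Del i c → ∀ l, W v c (v :: l) = c l := by
        intro i c hc l
        rw [W_cons]
        have : (fun m => c (v :: m)) = fun _ => 0 := by
          ext m; exact hDv hc m
        rw [this, W_zero]; simp
      refine ⟨fun i hi c hc hb => ?_, fun N hN => ?_⟩
      · cases i with
        | zero =>
          have : Ch Del 0 c := hKD hc fun l => by
            by_contra h
            simpa using (hc.supp _ h).1
          obtain ⟨b, hb1, hb2⟩ := hdel this hb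
          exact ⟨b, hb1.mono hDK, hb2⟩
        | succ i =>
          have hbv : bd (fun l => c (v :: l)) = 0 := by
            ext l
            rw [bd_cons hc.alt, hb]; simp
          obtain ⟨h, hh1, hh2⟩ := hLk.1 i (by lia) _ (hcv hc) hbv
          have hWh : Ch K (i + 1 + 1) (W v h) := hh1.W v hLW
          have hc' : Ch K (i + 1) (c + bd (W v h)) := hc.add (hWh.bd Face.down)
          have hc'' : Ch Del (i + 1) (c + bd (W v h)) := hKD hc' fun l => by
            have e2 := hWv ((hcv hc).mono hLD) l
            have e3 := hDv (hh1.mono hLD) l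
            rw [bd_W, hh2]
            simp only [Pi.add_apply, Pi.sub_apply]
            rw [e2, e3]; ring
          obtain ⟨b, hb1, hb2⟩ := hdel hc'' (by rw [bd_add, hb, bd_bd hWh.alt, add_zero])
          refine ⟨b - W v h, (hb1.mono hDK).sub hWh, ?_⟩
          rw [bd_sub, hb2]; simp
      · obtain ⟨M, rfl⟩ : ∃ M, N = M + 1 := ⟨N - 1, by lia⟩
        obtain ⟨z, hz, hbz, hz0, hzu⟩ := hLk.2 M (by lia)
        obtain ⟨h, hh1, hh2⟩ := hdel (hz.mono hLD) hbz
        have hWz : Ch K (M + 1) (W v z) := hz.W v hLW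
        have hbW : bd (W v z) = z := by
          rw [bd_W, hbz]
          ext l
          have := W_zero v l
          simp only [Pi.sub_apply]
          change z l - W v (fun _ => 0) l = _
          lia
        have hev : ∀ l, (W v z - h) (v :: l) = z l := fun l => by
          have e2 := hWv (hz.mono hLD) l
          have e3 := hDv hh1 l
          simp only [Pi.sub_apply]
          rw [e2, e3]; ring
        have hzz : Ch K (M + 1) (W v z - h) := hWz.sub (hh1.mono hDK)
        have hbzz : bd (W v z - h) = 0 := by rw [bd_sub, hbW, hh2]; simp
        refine ⟨W v z - h, hzz, hbzz, fun h0 => hz0 ?_, fun c hc hb => ?_⟩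
        · ext l
          rw [← hev, h0]; rfl
        · have hbv : bd (fun l => c (v :: l)) = 0 := by
            ext l
            rw [bd_cons hc.alt, hb]; simp
          obtain ⟨m, hm⟩ := hzu _ (hcv hc) hbv
          refine ⟨m, ?_⟩
          have hd : Ch Del (M + 1) (c - m • (W v z - h)) := hKD (hc.sub (hzz.zsmul m)) fun l => by
            have := congrFun hm l
            simp only [Pi.smul_apply] at this
            have e := hev l
            simp only [Pi.sub_apply, Pi.smul_apply] at e ⊢
            rw [this, e]; simp
          obtain ⟨b, hb1, hb2⟩ := hdel hd (by rw [bd_sub, bd_zsmul, hb, hbzz]; simp)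
          have hb0 : b = 0 := by
            ext l
            by_contra hl
            obtain ⟨h1, h2⟩ := hb1.supp l hl
            have h3 := (hDK _ h2).card_le
            rw [List.toFinset_card_of_nodup (hb1.alt.nodup hl)] at h3
            lia
          rw [hb0, bd_zero] at hb2
          exact sub_eq_zero.1 hb2.symm

end Chains

namespace GMod

open Chains

section
variable (P : Type) [Group P]

/-- Integral functions on lists. -/
def LF : GMod P :=
  { V := List P → ℤ
    act :=
      { smul := fun g c l => c (l.map (g⁻¹ * ·))
        one_smul := fun c => by
          funext l
          change c (l.map ((1 : P)⁻¹ * ·)) = c l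
          simp
        mul_smul := fun g h c => by
          funext l
          change c (l.map ((g * h)⁻¹ * ·)) = c ((l.map (g⁻¹ * ·)).map (h⁻¹ * ·))
          congr 1
          rw [List.map_map]
          congr 1
          funext x
          simp [mul_assoc]
        smul_zero := fun g => rfl
        smul_add := fun g a b => rfl } }

variable {P}

variable [DecidableEq P]

/-- Invariance of a family of faces under translation. -/
def InvF (F : Finset P → Prop) : Prop := ∀ (g : P) (s : Finset P), F s → F (s.image (g * ·))

theorem map_toFinset (g : P) (l : List P) :
    (l.map (g * ·)).toFinset = l.toFinset.image (g * ·) := by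
  ext x
  simp only [List.mem_toFinset, List.mem_map, Finset.mem_image]

theorem ch_smul {F : Finset P → Prop} (hF : InvF F) {i : ℕ} {c : LF P} (h : Ch F i c) (g : P) :
    Ch F i (g • c : LF P) := by
  refine ⟨fun l₁ a b l₂ => ?_, fun l hl => ?_⟩
  · change (c : List P → ℤ) ((l₁ ++ a :: b :: l₂).map _) = - (c : List P → ℤ) ((l₁ ++ b :: a :: l₂).map _)
    simp only [List.map_append, List.map_cons]
    exact h.alt _ _ _ _
  · obtain ⟨h1, h2⟩ := h.supp _ hl
    refine ⟨by simpa using h1, ?_⟩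
    have := hF g _ h2
    rw [map_toFinset, Finset.image_image] at this
    convert this
    ext x; simp

/-- The module of chains of degree `i`. -/
def CM (F : Finset P → Prop) (hF : InvF F) (i : ℕ) : GMod P :=
  sub (LF P) { carrier := {c | Ch F i c}
               zero_mem' := Ch.zero F i
               add_mem' := fun h h' => h.add h'
               neg_mem' := fun h => h.neg } (fun g _ h => ch_smul hF h g)

variable [Fintype P]

theorem bd_smul {P : Type} [Group P] [Fintype P] (g : P) (c : LF P) : bd (g • c : LF P) = (g • (show LF P from bd c) : LF P) := by
  funext l
  change ∑ v, (c : List P → ℤ) (g⁻¹ * v :: l.map _) = ∑ v, (c : List P → ℤ) (v :: l.map _)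
  exact Fintype.sum_equiv (Equiv.mulLeft g⁻¹) _ _ fun v => rfl

/-- The module of cycles of degree `i`. -/
def ZM (F : Finset P → Prop) (hF : InvF F) (i : ℕ) : GMod P :=
  sub (LF P) { carrier := {c | Ch F i c ∧ bd c = 0}
               zero_mem' := ⟨Ch.zero F i, bd_zero⟩
               add_mem' := fun h h' => ⟨h.1.add h'.1, (bd_add _ _).trans (by rw [h.2, h'.2, add_zero])⟩
               neg_mem' := fun {c} h => ⟨h.1.neg, (bd_neg c).trans (by rw [h.2, neg_zero])⟩ } (fun g c h => ⟨ch_smul hF h.1 g,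
                  (bd_smul g c).trans (by rw [h.2]; rfl)⟩)

theorem ZM.lat (F : Finset P → Prop) (hF : InvF F) (i : ℕ) : Lat (ZM F hF i) := by
  have : Lat (triv P ((Fin i → P) → ℤ)) := triv_lat _
  refine this.of_inj (AddMonoidHom.mk' (fun c f => (c.1 : List P → ℤ) (List.ofFn f)) fun _ _ => rfl) ?_
  intro c d hcd
  refine Subtype.ext (funext fun l => ?_)
  by_cases hl : l.length = i
  · subst hl
    have : (c.1 : List P → ℤ) (List.ofFn l.get) = (d.1 : List P → ℤ) (List.ofFn l.get) :=
      congrFun hcd l.get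
    rwa [List.ofFn_get] at this
  · have h1 : (c.1 : List P → ℤ) l = 0 := by
      by_contra h
      exact hl (c.2.1.supp l h).1
    have h2 : (d.1 : List P → ℤ) l = 0 := by
      by_contra h
      exact hl (d.2.1.supp l h).1
    rw [h1, h2]

theorem ZM.ses (F : Finset P → Prop) (hF : InvF F) (hdown : ∀ s t, s ⊆ t → F t → F s) (i : ℕ)
    (hac : ∀ c, Ch F i c → bd c = 0 → ∃ b, Ch F (i + 1) b ∧ bd b = c) :
    ∃ (j : ZM F hF (i + 1) →+ CM F hF (i + 1)) (p : CM F hF (i + 1) →+ ZM F hF i), SES j p := by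
  refine ⟨AddMonoidHom.mk' (fun c => ⟨c.1, c.2.1⟩) fun _ _ => rfl,
    AddMonoidHom.mk' (fun c => ⟨bd c.1, c.2.bd hdown, bd_bd c.2.alt⟩)
      fun a b => Subtype.ext (bd_add a.1 b.1), ?_, ?_, ?_, ?_, ?_⟩
  · exact fun _ _ => rfl
  · exact fun g c => Subtype.ext (bd_smul g c.1)
  · exact fun a b h => Subtype.ext (congrArg (fun x => x.1) h)
  · intro c
    constructor
    · exact fun h => ⟨⟨c.1, c.2, congrArg (fun x => x.1) h⟩, rfl⟩
    · rintro ⟨d, rfl⟩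
      exact Subtype.ext d.2.2
  · refine exists_section (ZM.lat F hF i) _ fun c => ?_
    obtain ⟨b, h1, h2⟩ := hac c.1 c.2.1 c.2.2
    exact ⟨⟨b, h1⟩, Subtype.ext h2⟩

theorem CM.isProj {P : Type} [Group P] [DecidableEq P] [Finite P] (F : Finset P → Prop) (hF : InvF F) (i : ℕ)
    (hfree : ∀ s, F s → s.Nonempty → ∀ g : P, s.image (g * ·) = s → g = 1) :
    IsProj (CM F hF (i + 1)) := by
  cases nonempty_fintype P
  let _ : MulAction P (Finset P) :=
    { smul := fun g s => s.image (g * ·)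
      one_smul := fun s => by change s.image ((1 : P) * ·) = s; simp
      mul_smul := fun g h s => by
        change s.image ((g * h) * ·) = (s.image (h * ·)).image (g * ·)
        rw [Finset.image_image]; congr 1; funext x; simp [mul_assoc] }
  obtain ⟨γ, hγ⟩ := exists_gamma P (Finset P)
  have hsupp : ∀ c : CM F hF (i + 1), ∀ l, (c.1 : List P → ℤ) l ≠ 0 → ∀ g : P,
      γ ((l.map (g * ·)).toFinset) = g * γ l.toFinset := by
    intro c l hl g
    obtain ⟨h1, h2⟩ := c.2.supp l hl
    rw [map_toFinset]
    refine hγ _ (fun g hg => hfree _ h2 ?_ g hg) g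
    rw [Finset.nonempty_iff_ne_empty, Ne, List.toFinset_eq_empty_iff]
    rintro rfl
    simp at h1
  refine ⟨AddMonoidHom.mk' (fun c => ⟨fun l => if γ l.toFinset = 1 then (c.1 : List P → ℤ) l else 0,
    fun l₁ a b l₂ => ?_, fun l hl => ?_⟩) fun a b => Subtype.ext (funext fun l => ?_), ?_⟩
  · have : (l₁ ++ a :: b :: l₂).toFinset = (l₁ ++ b :: a :: l₂).toFinset := by
      ext x; simp; tauto
    rw [this]
    have h3 := c.2.alt l₁ a b l₂
    split_ifs
    · exact h3
    · rfl
  · refine c.2.supp l fun h0 => hl ?_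
    simp [h0]
  · change (if γ l.toFinset = 1 then ((a.1 : List P → ℤ) l + (b.1 : List P → ℤ) l) else 0) = (if _ then _ else _) + (if _ then _ else _)
    split_ifs <;> simp
  · refine AddMonoidHom.ext fun c => Subtype.ext (funext fun l => ?_)
    rw [tr_apply]
    let ev : CM F hF (i + 1) →+ ℤ := AddMonoidHom.mk' (fun c => (c.1 : List P → ℤ) l) fun _ _ => rfl
    refine (map_sum ev _ _).trans ?_
    have : ∀ g : P, ((l.map (g⁻¹ * ·)).map ((g⁻¹)⁻¹ * ·)) = l := fun g => by
      rw [List.map_map]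
      convert List.map_id l
      funext x; simp
    have h2 : ∀ g : P, (if γ ((l.map (g⁻¹ * ·)).toFinset) = 1 then
        (c.1 : List P → ℤ) ((l.map (g⁻¹ * ·)).map ((g⁻¹)⁻¹ * ·)) else 0) =
        if g = γ l.toFinset then (c.1 : List P → ℤ) l else 0 := by
      intro g
      rw [this]
      by_cases h0 : (c.1 : List P → ℤ) l = 0
      · simp [h0]
      · rw [hsupp c l h0]
        congr 1
        rw [inv_mul_eq_one]
    refine (Finset.sum_congr rfl fun g _ => h2 g).trans ?_
    simp

theorem ZM.zero_iso (F : Finset P → Prop) (hF : InvF F) (h0 : F ∅) : Iso (ZM F hF 0) (ZZ P) := by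
  have h : Ch F 0 (fun l : List P => if l = [] then (1 : ℤ) else 0) := by
    refine ⟨fun _ _ _ _ => by simp, fun l hl => ?_⟩
    have : l = [] := by by_contra h; simp [h] at hl
    subst this
    exact ⟨rfl, by simpa using h0⟩
  refine ⟨AddEquiv.ofBijective (AddMonoidHom.mk' (M := ZM F hF 0) (G := ℤ)
    (fun c => (c.1 : List P → ℤ) []) fun _ _ => rfl) ⟨?_, ?_⟩, ?_⟩
  · intro c d hcd
    refine Subtype.ext (funext fun l => ?_)
    cases l with
    | nil => exact hcd
    | cons x l =>
      have h1 : (c.1 : List P → ℤ) (x :: l) = 0 := by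
        by_contra h
        simpa using (c.2.1.supp _ h).1
      have h2 : (d.1 : List P → ℤ) (x :: l) = 0 := by
        by_contra h
        simpa using (d.2.1.supp _ h).1
      rw [h1, h2]
  · suffices H : ∀ m : ℤ, ∃ c : ZM F hF 0, (c.1 : List P → ℤ) [] = m from H
    intro m
    have hm := h.zsmul m
    refine ⟨⟨_, hm, hm.bd_zero_of_zero⟩, ?_⟩
    simp
  · intro g c
    rfl

theorem iso_Tw_ZZ {P : Type} [Group P] {A : GMod P} (z : A) (hz : ∀ m : ℤ, m • z = 0 → m = 0)
    (hg : ∀ a : A, ∃ m : ℤ, a = m • z) : ∃ χ : P →* ℤˣ, Iso A (Tw χ (ZZ P)) := by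
  have hinj : ∀ m n : ℤ, m • z = n • z → m = n := fun m n h => by
    have := hz (m - n) (by rw [sub_smul, h, sub_self])
    lia
  choose m hm using hg
  let χ : P →* ℤ :=
    { toFun := fun g => m (g • z)
      map_one' := hinj _ _ (by rw [← hm]; simp)
      map_mul' := fun g h => hinj _ _ (by
        rw [← hm, mul_smul, hm (h • z), ← hm (h • z), mul_comm, mul_smul, ← hm (g • z)]
        conv_lhs => rw [hm (h • z)]
        exact map_zsmul (A.sm g) _ _) }
  have hχ : ∀ g, (χ g) • z = g • z := fun g => (hm _).symm
  refine ⟨χ.toHomUnits, Iso.symm ⟨AddEquiv.ofBijective (AddMonoidHom.mk' (M := ℤ) (G := A)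
    (fun n => n • z) fun a b => add_smul a b z) ⟨fun a b h => hinj a b h, fun a => ⟨m a, (hm a).symm⟩⟩, ?_⟩⟩
  suffices h : ∀ (g : P) (n : ℤ), (χ g * n) • z = g • (n • z) by
    intro g n
    exact h g n
  intro g n
  rw [mul_comm, mul_smul, hχ]
  exact (map_zsmul (A.sm g) _ _).symm

end

theorem period_of_central {P : Type} [Group P] [Finite P] {Y : Type} [Fintype Y] [Nonempty Y]
    [MulAction P Y] (hY : FreeAct P Y) (z : P) (hz : z ≠ 1) (hc : ∀ g, g * z = z * g)
    (hg : ∀ g : P, g ≠ 1 → z ∈ Subgroup.zpowers g) :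
    ∃ N, StIso (Dn Y (2 * (N + 1)) (ZZ P)) (ZZ P) := by
  classical
  cases nonempty_fintype P
  have hn : (Subgroup.zpowers z).Normal := ⟨fun n hn g => by
    obtain ⟨k, rfl⟩ := hn
    refine ⟨k, ?_⟩
    have : Commute g (z ^ k) := (show Commute g z from hc g).zpow_right k
    change z ^ k = g * z ^ k * g⁻¹
    rw [this.eq]; simp⟩
  let Q := P ⧸ Subgroup.zpowers z
  let r : P → Q := QuotientGroup.mk
  let F : Finset P → Prop := Face r Finset.univ Finset.univ
  have hF : InvF F := by
    intro g s hs
    refine ⟨Finset.subset_univ _, fun k _ => ?_⟩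
    obtain ⟨u, -, h1, h2⟩ := hs.2 ((r g)⁻¹ * k) (Finset.mem_univ _)
    refine ⟨g * u, Finset.mem_univ _, ?_, ?_⟩
    · change r g * r u = k
      rw [h1]; simp
    · simpa using h2
  have h0 : F ∅ := ⟨Finset.subset_univ _, fun k _ => by
    obtain ⟨u, hu⟩ := QuotientGroup.mk_surjective k
    exact ⟨u, Finset.mem_univ _, hu, by simp⟩⟩
  have hfree : ∀ s, F s → s.Nonempty → ∀ g : P, s.image (g * ·) = s → g = 1 := by
    intro s hs hne g hgs
    by_contra hg1
    obtain ⟨x, hx⟩ := hne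
    have hpow : ∀ h ∈ Subgroup.zpowers g, ∀ y ∈ s, h * y ∈ s := by
      intro h hh y hy
      rw [← mem_powers_iff_mem_zpowers] at hh
      obtain ⟨k, rfl⟩ := hh
      induction k with
      | zero => simpa using hy
      | succ k ih =>
        dsimp only at ih ⊢
        rw [← hgs, pow_succ', mul_assoc]
        exact Finset.mem_image_of_mem _ ih
    have hzg : Subgroup.zpowers z ≤ Subgroup.zpowers g := by
      rw [Subgroup.zpowers_le]; exact hg g hg1
    obtain ⟨u, -, h1, h2⟩ := hs.2 (r x) (Finset.mem_univ _)
    have h3 : x⁻¹ * u ∈ Subgroup.zpowers z := QuotientGroup.eq.1 h1.symm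
    refine h2 ?_
    have h4 : u = (u * x⁻¹) * x := by simp
    have h5 : u * x⁻¹ ∈ Subgroup.zpowers z := by
      have := hn.conj_mem _ h3 x
      simpa [mul_assoc] using this
    rw [h4]
    exact hpow _ (hzg h5) x hx
  obtain ⟨hac, htop⟩ := sphere r _ Finset.univ Finset.univ rfl (fun k _ => by
    obtain ⟨u, hu⟩ := QuotientGroup.mk_surjective k
    exact ⟨u, Finset.mem_univ _, hu⟩) (fun _ _ => Finset.mem_univ _)
  have hlt : (Finset.univ : Finset Q).card < (Finset.univ : Finset P).card := by
    rw [Finset.card_univ, Finset.card_univ]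
    refine Fintype.card_lt_of_surjective_not_injective r QuotientGroup.mk_surjective fun hinj => ?_
    refine hz (hinj ?_)
    refine (QuotientGroup.eq.2 ?_)
    simp
  obtain ⟨N, hN⟩ : ∃ N, (Finset.univ : Finset P).card = N + 1 + (Finset.univ : Finset Q).card :=
    ⟨(Finset.univ : Finset P).card - (Finset.univ : Finset Q).card - 1, by lia⟩
  have hst : ∀ i, i ≤ N + 1 → StIso (ZM F hF i) (Dn Y i (ZZ P)) := by
    intro i
    induction i with
    | zero => exact fun _ => (ZM.zero_iso F hF h0).stIso
    | succ i ih =>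
      intro hi
      obtain ⟨j, p, hses⟩ := ZM.ses F hF Face.down i (hac i (by lia))
      rw [Dn_succ]
      exact (hses.stIso (D.ses Y (ZM F hF i)) (CM.isProj F hF i hfree)
        (Ind.isProj hY _)).trans (ih (by lia)).D
  obtain ⟨c0, hc0, hb0, hne, hall⟩ := htop (N + 1) (by lia)
  obtain ⟨χ, hχ⟩ := iso_Tw_ZZ (A := ZM F hF (N + 1)) ⟨c0, hc0, hb0⟩ (fun m hm => by
      have : m • c0 = 0 := congrArg (fun x => x.1) hm
      exact (smul_eq_zero.1 this).resolve_right hne)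
    (fun c => by
      obtain ⟨m, hm⟩ := hall c.1 c.2.1 c.2.2
      exact ⟨m, Subtype.ext hm⟩)
  have h1 : StIso (Dn Y (N + 1) (ZZ P)) (Tw χ (ZZ P)) := (hst _ le_rfl).symm.trans hχ.stIso
  refine ⟨N, ?_⟩
  rw [two_mul, Dn_add]
  exact (h1.Dn _).trans ((Tw.Dn Y (N + 1) (ZZ P)).stIso.trans (h1.Tw.trans (Tw.twice _).stIso))

end GMod

namespace GMod

theorem mem_zpowers_of_order_eq {G : Type} [Group G] [Finite G] {p : ℕ} (hp : 0 < p) {z h : G}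
    (hz : orderOf z = p) (hh : h ^ p = 1) (hc : z * h = h * z)
    (hcyc : ∀ A : Subgroup G, (∀ a b : A, a * b = b * a) → IsCyclic A) :
    h ∈ Subgroup.zpowers z := by
  classical
  let A := Subgroup.closure ({z, h} : Set G)
  have hcomm : ∀ a b : A, a * b = b * a := by
    have : ∀ x ∈ ({z, h} : Set G), ∀ y ∈ ({z, h} : Set G), x * y = y * x := by
      rintro x (rfl | rfl) y (rfl | rfl) <;> simp [hc]
    have hA := Subgroup.isMulCommutative_closure (k := ({z, h} : Set G)) this
    exact fun a b => hA.is_comm.comm a b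
  have := hcyc A hcomm
  cases nonempty_fintype A
  have hle := IsCyclic.card_pow_eq_one_le (α := A) hp
  have hzA : z ∈ A := Subgroup.subset_closure (by simp)
  have hhA : h ∈ A := Subgroup.subset_closure (by simp)
  by_contra hn
  have hsub : insert (⟨h, hhA⟩ : A) ((Finset.range p).image fun i => (⟨z, hzA⟩ : A) ^ i) ⊆
      Finset.univ.filter fun a : A => a ^ p = 1 := by
    intro x hx
    rw [Finset.mem_filter]
    refine ⟨Finset.mem_univ _, ?_⟩
    rcases Finset.mem_insert.1 hx with rfl | hx
    · exact Subtype.ext hh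
    · obtain ⟨i, -, rfl⟩ := Finset.mem_image.1 hx
      rw [← pow_mul, mul_comm, pow_mul]
      have : (⟨z, hzA⟩ : A) ^ p = 1 := Subtype.ext (by simp [← hz, pow_orderOf_eq_one])
      rw [this, one_pow]
  have hcard := (Finset.card_le_card hsub).trans hle
  rw [Finset.card_insert_of_notMem, Finset.card_image_of_injOn, Finset.card_range] at hcard
  · lia
  · intro i hi j hj hij
    have : z ^ i = z ^ j := congrArg Subtype.val hij
    exact pow_injOn_Iio_orderOf (by simpa [hz] using hi) (by simpa [hz] using hj) this
  · intro hx
    obtain ⟨i, -, hi⟩ := Finset.mem_image.1 hx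
    exact hn ⟨i, by simpa using congrArg Subtype.val hi⟩

theorem exists_central {P : Type} [Group P] [Finite P] [Nontrivial P] {p : ℕ} [hp : Fact p.Prime]
    (hP : IsPGroup p P) (hcyc : ∀ A : Subgroup P, (∀ a b : A, a * b = b * a) → IsCyclic A) :
    ∃ z : P, z ≠ 1 ∧ (∀ g, g * z = z * g) ∧ ∀ g : P, g ≠ 1 → z ∈ Subgroup.zpowers g := by
  have hord : ∀ (H : Subgroup P) [Nontrivial H], ∃ h ∈ H, orderOf h = p := by
    intro H _
    obtain ⟨n, hn, hc⟩ := (IsPGroup.nontrivial_iff_card (hP.to_subgroup H)).1 inferInstance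
    obtain ⟨x, hx⟩ := exists_prime_orderOf_dvd_card' (G := H) p (by
      rw [hc]; exact dvd_pow_self p hn.ne')
    exact ⟨x, x.2, by rw [← hx, Subgroup.orderOf_coe]⟩
  have := hP.center_nontrivial
  obtain ⟨z, hzc, hz⟩ := hord (Subgroup.center P)
  have hzc := Subgroup.mem_center_iff.1 hzc
  refine ⟨z, ?_, hzc, fun g hg => ?_⟩
  · rintro rfl
    rw [orderOf_one] at hz
    exact hp.out.one_lt.ne hz
  · have : Nontrivial (Subgroup.zpowers g) := by
      rw [Subgroup.nontrivial_iff_ne_bot, Ne, Subgroup.zpowers_eq_bot]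
      exact hg
    obtain ⟨h, hhg, hh⟩ := hord (Subgroup.zpowers g)
    have := mem_zpowers_of_order_eq hp.out.pos hh (by rw [← hz]; exact pow_orderOf_eq_one z)
      (hzc h) hcyc
    exact (Subgroup.zpowers_le.2 hhg) this

section Dnmap
variable {G : Type} [Group G] {Y : Type} [Fintype Y] [MulAction G Y]

theorem exists_Dn_map_aux (n : ℕ) (F : GMod G → GMod G) (hF : F = Dn Y n) :
    ∃ T : ∀ (A B : GMod G), (A →+ B) → (F A →+ F B),
    (∀ (A B C : GMod G) (φ : A →+ B) (ψ : B →+ C), (T _ _ ψ).comp (T _ _ φ) = T _ _ (ψ.comp φ)) ∧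
    (∀ (A : GMod G) (m : ℤ), T A A (m • AddMonoidHom.id A) = m • AddMonoidHom.id _) ∧
    ∀ (A B : GMod G) (φ ψ : A →+ B) (g : G), (∀ a, ψ (g • a) = g • φ a) →
      ∀ a, T _ _ ψ (g • a) = g • T _ _ φ a := by
  induction n generalizing F with
  | zero =>
    subst hF
    exact ⟨fun A B φ => φ, fun _ _ _ _ _ => rfl, fun _ _ => rfl, fun _ _ _ _ _ h => h⟩
  | succ n ih =>
    obtain ⟨T, h1, h2, h3⟩ := ih _ rfl
    have : F = fun A => GMod.D Y (Dn Y n A) := hF.trans (funext fun A => Dn_succ n A)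
    subst this
    refine ⟨fun A B φ => D.map Y (T A B φ), fun A B C φ ψ => ?_, fun A m => ?_,
      fun A B φ ψ g h a => ?_⟩
    · exact (D.map_comp _ _).trans (congrArg (D.map Y) (h1 A B C φ ψ))
    · refine (congrArg (D.map Y) (h2 A m)).trans ?_
      exact AddMonoidHom.ext fun a => D.ext fun y => rfl
    · exact D.ext fun y => h3 A B φ ψ g h _

theorem exists_Dn_map (n : ℕ) : ∃ T : ∀ (A B : GMod G), (A →+ B) → (Dn Y n A →+ Dn Y n B),
    (∀ (A B C : GMod G) (φ : A →+ B) (ψ : B →+ C), (T _ _ ψ).comp (T _ _ φ) = T _ _ (ψ.comp φ)) ∧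
    (∀ (A : GMod G) (m : ℤ), T A A (m • AddMonoidHom.id A) = m • AddMonoidHom.id _) ∧
    ∀ (A B : GMod G) (φ ψ : A →+ B) (g : G), (∀ a, ψ (g • a) = g • φ a) →
      ∀ a, T _ _ ψ (g • a) = g • T _ _ φ a :=
  exists_Dn_map_aux n _ rfl

/-- A pair of a `P`-invariant functional and a `P`-invariant vector with given matrix coefficient. -/
def Coeff (Y : Type) [Fintype Y] [MulAction G Y] (P : Subgroup G) (n : ℕ) (c : G → ℤ) : Prop :=
  ∃ (f : Dn Y n (ZZ G) →+ ZZ G) (x : ZZ G →+ Dn Y n (ZZ G)),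
    (∀ h ∈ P, ∀ a, f (h • a) = h • f a) ∧ (∀ h ∈ P, ∀ a, x (h • a) = h • x a) ∧
    ∀ g : G, ∀ m, f (g • x m) = c g • m

theorem Coeff.mul {P : Subgroup G} {m n : ℕ} {c d : G → ℤ} (h : Coeff Y P m c)
    (h' : Coeff Y P n d) : Coeff Y P (m + n) fun g => c g * d g := by
  obtain ⟨f, x, hf, hx, hc⟩ := h
  obtain ⟨f', x', hf', hx', hc'⟩ := h'
  obtain ⟨T, h1, h2, h3⟩ := exists_Dn_map (Y := Y) (G := G) m
  unfold Coeff
  rw [Dn_add]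
  refine ⟨f.comp (T _ _ f'), (T _ _ x').comp x, fun p hp a => ?_, fun p hp a => ?_, fun g a => ?_⟩
  · change f (T _ _ f' (p • a)) = p • f (T _ _ f' a)
    rw [h3 _ _ f' f' p (hf' p hp), hf p hp]
  · change T _ _ x' (x (p • a)) = p • T _ _ x' (x a)
    rw [hx p hp, h3 _ _ x' x' p (hx' p hp)]
  · change f (T _ _ f' (g • T _ _ x' (x a))) = _
    let y : ZZ G →+ Dn Y n (ZZ G) := ((Dn Y n (ZZ G)).sm g).comp x'
    rw [← h3 _ _ x' y g (fun a => rfl)]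
    have : (T _ _ f').comp (T _ _ y) = d g • AddMonoidHom.id _ := by
      rw [h1, ← h2]
      congr 1
      exact AddMonoidHom.ext fun a => hc' g a
    have := DFunLike.congr_fun this (g • x a)
    rw [AddMonoidHom.comp_apply] at this
    rw [this]
    change f (d g • (g • x a)) = _
    rw [map_zsmul, hc]
    change _ = (c g * d g) • a
    rw [mul_comm, mul_smul]

theorem Coeff.congr {P : Subgroup G} {n : ℕ} {c d : G → ℤ} (h : Coeff Y P n c)
    (hcd : ∀ g, c g = d g) : Coeff Y P n d := funext hcd ▸ h

theorem Coeff.pow {P : Subgroup G} {n : ℕ} {c : G → ℤ} (h : Coeff Y P n c) (m : ℕ) :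
    Coeff Y P (n * m) fun g => c g ^ m := by
  induction m with
  | zero =>
    refine ⟨AddMonoidHom.id _, AddMonoidHom.id _, fun _ _ _ => rfl, fun _ _ _ => rfl, fun g a => ?_⟩
    have h0 : (c g ^ 0 : ℤ) • a = a := by rw [pow_zero, one_smul]
    exact h0.symm
  | succ m ih => exact (ih.mul h).congr fun g => (pow_succ _ _).symm

theorem Coeff.left_mul {P : Subgroup G} {n : ℕ} {c : G → ℤ} (h : Coeff Y P n c) {p : G} (hp : p ∈ P)
    (g : G) : c (p * g) = c g := by
  obtain ⟨f, x, hf, hx, hc⟩ := h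
  let o : ZZ G := (1 : ℤ)
  have h1 : c (p * g) • o = c g • o :=
    (hc (p * g) o).symm.trans ((congrArg f (mul_smul p g (x o))).trans
      ((hf p hp (g • x o)).trans (hc g o)))
  simpa [o] using show c (p * g) • (1 : ℤ) = c g • (1 : ℤ) from h1

theorem Coeff.right_mul {P : Subgroup G} {n : ℕ} {c : G → ℤ} (h : Coeff Y P n c) {p : G} (hp : p ∈ P)
    (g : G) : c (g * p) = c g := by
  obtain ⟨f, x, hf, hx, hc⟩ := h
  let o : ZZ G := (1 : ℤ)
  have h1 : c (g * p) • o = c g • o :=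
    (hc (g * p) o).symm.trans ((congrArg f ((mul_smul g p (x o)).trans
      (congrArg (g • ·) (hx p hp o).symm))).trans (hc g o))
  simpa using show c (g * p) • (1 : ℤ) = c g • (1 : ℤ) from h1

end Dnmap

end GMod

namespace GMod

section Transfer
variable {G : Type} [Group G] {Y : Type} [Fintype Y] [MulAction G Y]

/-- Coefficients at normalizing elements are units. -/
theorem coeff_unit [Finite G] {P : Subgroup G} {A : GMod G} (h : StIso (res P A) (ZZ P)) :
    ∃ (f : A →+ ℤ) (v : A), (∀ g ∈ P, ∀ a, f (g • a) = f a) ∧ (∀ g ∈ P, g • v = v) ∧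
      ∀ g : G, (∀ q ∈ P, g * q * g⁻¹ ∈ P) →
        (Nat.card P : ℤ) ∣ f (g • v) * f (g⁻¹ • v) - 1 := by
  cases nonempty_fintype P
  obtain ⟨f, x, hf, hx, ⟨φ, hφ⟩, ⟨ψ, hψ⟩⟩ := h
  let f' : A →+ ℤ := f
  let x' : ℤ →+ A := x
  have hf' : ∀ g ∈ P, ∀ a : A, f' (g • a) = f' a := fun g hg a => hf ⟨g, hg⟩ a
  have hx' : ∀ g ∈ P, g • x' 1 = x' 1 := fun g hg => (hx ⟨g, hg⟩ (1 : ℤ)).symm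
  have h1 : (Nat.card P : ℤ) ∣ f' (x' 1) - 1 := by
    have : (1 : ℤ) - f' (x' 1) = ∑ _g : P, (show ℤ from ψ (1 : ℤ)) :=
      ((tr_apply ψ (1 : ℤ)).symm.trans (DFunLike.congr_fun hψ (1 : ℤ))).symm
    rw [Finset.sum_const, Finset.card_univ, ← Nat.card_eq_fintype_card] at this
    rw [← dvd_neg, neg_sub, this]
    exact ⟨_, by rw [nsmul_eq_mul]⟩
  have h2 : ∀ a : A, a - x' (f' a) = ∑ g : P, (g : G) • (show A from φ ((g⁻¹ : P) • a)) :=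
    fun a => ((tr_apply φ a).symm.trans (DFunLike.congr_fun hφ a)).symm
  refine ⟨f', x' 1, hf', hx', fun g hg => ?_⟩
  have hx1 : ∀ n : ℤ, x' n = n • x' 1 := fun n => by rw [← map_zsmul, smul_eq_mul, mul_one]
  let v : A := g⁻¹ • x' 1
  have hv : ∀ q ∈ P, q • v = v := by
    intro q hq
    change q • g⁻¹ • x' 1 = g⁻¹ • x' 1
    rw [← mul_smul]
    have : q * g⁻¹ = g⁻¹ * (g * q * g⁻¹) := by group
    rw [this, mul_smul, hx' _ (hg q hq)]
  let b : A := φ v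
  have h3 : f' (g • v) - f' v * f' (g • x' 1) = (Nat.card P : ℤ) * f' (g • b) := by
    have := congrArg (fun a : A => f' (g • a)) (h2 v)
    simp only [smul_sub, map_sub, Finset.smul_sum, map_sum] at this
    have e1 : f' (g • x' (f' v)) = f' v * f' (g • x' 1) := by
      rw [hx1 (f' v)]
      have := map_zsmul (f'.comp (A.sm g)) (f' v) (x' 1)
      simpa using this
    rw [e1] at this
    rw [this]
    have e2 : ∀ q : P, f' (g • (q : G) • (show A from φ ((q⁻¹ : P) • v))) = f' (g • b) := by
      intro q
      have : (show A from φ ((q⁻¹ : P) • v)) = b := congrArg φ (hv _ (q⁻¹).2)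
      rw [this, ← mul_smul]
      have : g * (q : G) = g * q * g⁻¹ * g := by group
      rw [this, mul_smul, hf' _ (hg q q.2)]
    rw [Finset.sum_congr rfl fun q _ => e2 q, Finset.sum_const, Finset.card_univ,
      ← Nat.card_eq_fintype_card, nsmul_eq_mul]
  have e3 : g • v = x' 1 := smul_inv_smul g _
  rw [e3] at h3
  have : f' (g • x' 1) * f' (g⁻¹ • x' 1) - 1 = f' (x' 1) - 1 - (Nat.card P : ℤ) * f' (g • b) := by
    rw [← h3]; ring
  rw [this]
  exact h1.sub ⟨_, rfl⟩

theorem exists_coeff [Finite G] {P : Subgroup G} {n : ℕ}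
    (h : StIso (res P (Dn Y n (ZZ G))) (ZZ P)) :
    ∃ c, Coeff Y P n c ∧ ∀ g : G, (∀ q ∈ P, g * q * g⁻¹ ∈ P) →
        (Nat.card P : ℤ) ∣ c g * c g⁻¹ - 1 := by
  obtain ⟨f, v, hf, hv, h⟩ := coeff_unit h
  refine ⟨fun g => f (g • v), ⟨f, (zmultiplesHom _) v, hf, fun g hg m => ?_, fun g m => ?_⟩, h⟩
  · let m' : ℤ := m
    change m' • v = g • (m' • v)
    have := map_zsmul ((Dn Y n (ZZ G)).sm g) m' v
    exact ((congrArg (m' • ·) (hv g hg)).symm.trans this.symm)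
  · let m' : ℤ := m
    change f (g • (m' • v)) = f (g • v) * m'
    have := map_zsmul (f.comp ((Dn Y n (ZZ G)).sm g)) m' v
    exact this.trans (mul_comm _ _)

theorem sum_modEq {p : ℕ} [hp : Fact p.Prime] {X : Type} [Fintype X] {P : Type} [Group P]
    [Finite P] [MulAction P X] (hP : IsPGroup p P) (d : X → ℤ) (hd : ∀ (g : P) x, d (g • x) = d x)
    (hfix : ∀ x, (∀ g : P, g • x = x) → ¬ (p : ℤ) ∣ d x) {m : ℕ} (hm : 0 < m) :
    ((∑ x, d x ^ ((p - 1) * m) : ℤ) : ZMod p) = (Fintype.card X : ZMod p) := by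
  classical
  let N := {x : X // (p : ℤ) ∣ d x}
  let _ : MulAction P N :=
    { smul := fun g x => ⟨g • x.1, by rw [hd]; exact x.2⟩
      one_smul := fun x => Subtype.ext (one_smul _ _)
      mul_smul := fun a b x => Subtype.ext (mul_smul _ _ _) }
  have h0 : Nat.card N ≡ 0 [MOD p] := by
    have := hP.card_modEq_card_fixedPoints N
    have h2 : Nat.card (MulAction.fixedPoints P N) = 0 := by
      rw [Nat.card_eq_zero]
      left
      refine ⟨fun x => hfix x.1.1 (fun g => ?_) x.1.2⟩
      exact congrArg Subtype.val (x.2 g)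
    rwa [h2] at this
  have hN : ((Finset.univ.filter fun x => (p : ℤ) ∣ d x).card : ZMod p) = 0 := by
    rw [← Fintype.card_subtype, ← Nat.card_eq_fintype_card]
    rw [← Nat.cast_zero, ZMod.natCast_eq_natCast_iff]
    exact h0
  have hpm : (p - 1) * m ≠ 0 := by
    have := hp.out.one_lt
    exact Nat.mul_ne_zero (by lia) hm.ne'
  have key : ∀ x, ((d x ^ ((p - 1) * m) : ℤ) : ZMod p) = 1 - if (p : ℤ) ∣ d x then 1 else 0 := by
    intro x
    have hz := ZMod.intCast_zmod_eq_zero_iff_dvd (d x) p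
    push_cast
    split_ifs with h
    · rw [hz.2 h, zero_pow hpm, sub_self]
    · rw [pow_mul, ZMod.pow_card_sub_one_eq_one (fun e => h (hz.1 e)), one_pow, sub_zero]
  rw [Int.cast_sum, Finset.sum_congr rfl fun x _ => key x, Finset.sum_sub_distrib,
    Finset.sum_boole, hN]
  simp

theorem exists_transfer [Finite G] {p : ℕ} [hp : Fact p.Prime] (P : Sylow p G) {n : ℕ} {c : G → ℤ}
    (hc : Coeff Y (P : Subgroup G) n c)
    (hu : ∀ g : G, (∀ q ∈ P, g * q * g⁻¹ ∈ P) → (Nat.card P : ℤ) ∣ c g * c g⁻¹ - 1)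
    (hpG : p ∣ Nat.card G) {k : ℕ} (hk : 0 < k) :
    ∃ (f : Dn Y (n * ((p - 1) * k)) (ZZ G) →+ ℤ) (v : Dn Y (n * ((p - 1) * k)) (ZZ G)),
      (∀ (g : G) a, f (g • a) = f a) ∧ (∀ g : G, g • v = v) ∧ ¬ (p : ℤ) ∣ f v := by
  classical
  set m := (p - 1) * k with hm
  obtain ⟨F, x, hF, hx, hFx⟩ := hc.pow m
  generalize Dn Y (n * m) (ZZ G) = A at F x hF hx hFx
  let F' : A →+ ℤ := F
  let v : A := x (1 : ℤ)
  have hF' : ∀ h ∈ P, ∀ a : A, F' (h • a) = F' a := hF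
  have hv : ∀ h ∈ P, h • v = v := fun h hh => (hx h hh (1 : ℤ)).symm
  have hFv : ∀ g : G, F' (g • v) = c g ^ m := fun g => (hFx g (1 : ℤ)).trans (mul_one (c g ^ m))
  clear_value F' v
  clear hF hx hFx F x
  cases nonempty_fintype (G ⧸ (P : Subgroup G))
  let V : G ⧸ (P : Subgroup G) → A := fun q => Quotient.liftOn' q (fun g => g • v) (by
    intro a b hab
    rw [QuotientGroup.leftRel_apply] at hab
    have : b = a * (a⁻¹ * b) := by group
    change a • v = b • v
    rw [this, mul_smul, hv _ hab])
  let Φ : G ⧸ (P : Subgroup G) → A →+ ℤ := fun q =>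
    Quotient.liftOn' q (fun g => F'.comp (A.sm g⁻¹)) (by
    intro a b hab
    rw [QuotientGroup.leftRel_apply] at hab
    refine AddMonoidHom.ext fun y => ?_
    have : b⁻¹ = (a⁻¹ * b)⁻¹ * a⁻¹ := by group
    change F' (a⁻¹ • y) = F' (b⁻¹ • y)
    rw [this, mul_smul, hF' _ (inv_mem hab)])
  let e : G ⧸ (P : Subgroup G) → ℤ := fun q => Quotient.liftOn' q c (by
    intro a b hab
    rw [QuotientGroup.leftRel_apply] at hab
    have : b = a * (a⁻¹ * b) := by group
    rw [this, hc.right_mul hab])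
  have hV : ∀ (g : G) q, g • V q = V (g • q) := by
    intro g q
    induction q using QuotientGroup.induction_on with
    | H a => exact (mul_smul g a v).symm
  have hΦ : ∀ (g : G) q a, Φ q (g • a) = Φ (g⁻¹ • q) a := by
    intro g q a
    induction q using QuotientGroup.induction_on with
    | H b =>
      change F' (b⁻¹ • g • a) = F' ((g⁻¹ * b)⁻¹ • a)
      rw [← mul_smul]; congr 2; group
  have he : ∀ q, F' (V q) = e q ^ m := by
    intro q
    induction q using QuotientGroup.induction_on with
    | H b => exact hFv b
  refine ⟨∑ q, Φ q, ∑ q, V q, fun g a => ?_, fun g => ?_, ?_⟩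
  · rw [AddMonoidHom.finsetSum_apply, AddMonoidHom.finsetSum_apply]
    exact Fintype.sum_equiv (MulAction.toPerm g⁻¹) _ _ fun q => hΦ g q a
  · rw [Finset.smul_sum]
    exact Fintype.sum_equiv (MulAction.toPerm g) _ _ fun q => hV g q
  · have h1 : (∑ q, Φ q) (∑ q, V q) = (Fintype.card (G ⧸ (P : Subgroup G)) : ℤ) * ∑ q, e q ^ m := by
      rw [AddMonoidHom.finsetSum_apply, ← nsmul_eq_mul, ← Finset.card_univ, ← Finset.sum_const]
      refine Finset.sum_congr rfl fun q _ => ?_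
      induction q using QuotientGroup.induction_on with
      | H b =>
        change F' (b⁻¹ • ∑ q, V q) = _
        rw [Finset.smul_sum, map_sum]
        refine Fintype.sum_equiv (MulAction.toPerm b⁻¹) _ _ fun q => ?_
        rw [hV, he]; rfl
    have h2 := sum_modEq (X := G ⧸ (P : Subgroup G)) P.2 e (by
      rintro ⟨g, hg⟩ q
      induction q using QuotientGroup.induction_on with
      | H b => exact hc.left_mul hg b) (by
      intro q hq
      induction q using QuotientGroup.induction_on with
      | H b =>
        have hb : ∀ h ∈ (P : Subgroup G), b⁻¹ * h * b ∈ (P : Subgroup G) := by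
          intro h hh
          have : ((h * b : G) : G ⧸ (P : Subgroup G)) = b := hq ⟨h, hh⟩
          have := QuotientGroup.eq.1 this
          have h2 := inv_mem this
          have e : b⁻¹ * h * b = ((h * b)⁻¹ * b)⁻¹ := by group
          rwa [e]
        have hb' : ∀ h ∈ (P : Subgroup G), b⁻¹ * h * b⁻¹⁻¹ ∈ (P : Subgroup G) := by simpa using hb
        have hd := hu b⁻¹ hb'
        intro hpb
        have hpP : (p : ℤ) ∣ Nat.card P :=
          Int.natCast_dvd_natCast.2 (P.dvd_card_of_dvd_card hpG)
        have h3 := hpP.trans hd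
        rw [inv_inv] at h3
        have h4 : (p : ℤ) ∣ c b⁻¹ * c b := Dvd.dvd.mul_left hpb _
        have h5 : (p : ℤ) ∣ 1 := by
          have := h4.sub h3
          simpa using this
        have := Int.natCast_dvd_natCast.1 (by exact_mod_cast h5 : (p : ℤ) ∣ ((1 : ℕ) : ℤ))
        exact hp.out.one_lt.ne' (Nat.dvd_one.1 this)) hk
    intro hdvd
    rw [h1] at hdvd
    have h3 := (ZMod.intCast_zmod_eq_zero_iff_dvd _ p).2 hdvd
    rw [Int.cast_mul, ← hm] at *
    rw [h2, Int.cast_natCast] at h3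
    have h4 : (Fintype.card (G ⧸ (P : Subgroup G)) : ZMod p) = 0 := by
      rcases mul_eq_zero.1 h3 with h | h <;> exact h
    rw [ZMod.natCast_eq_zero_iff] at h4
    refine P.not_dvd_index ?_
    rwa [Subgroup.index, Nat.card_eq_fintype_card]

end Transfer

end GMod

namespace GMod

variable {G : Type} [Group G] {Y : Type} [Fintype Y] [MulAction G Y]

theorem StIso.Dn_mul [Finite G] {A : GMod G} {a : ℕ} (h : StIso (GMod.Dn Y a A) A) (b : ℕ) :
    StIso (GMod.Dn Y (a * b) A) A := by
  induction b with
  | zero => exact (Iso.refl A).stIso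
  | succ b ih =>
    rw [Nat.mul_succ, GMod.Dn_add]
    exact (h.Dn (a * b)).trans ih

theorem StIso.Dn_of_dvd [Finite G] {A : GMod G} {a b : ℕ} (h : StIso (GMod.Dn Y a A) A) (hab : a ∣ b) :
    StIso (GMod.Dn Y b A) A := by
  obtain ⟨c, rfl⟩ := hab
  exact h.Dn_mul c

theorem exists_sylow_period [Finite G] [Nonempty Y] (hY : FreeAct G Y)
    (hcyc : ∀ A : Subgroup G, (∀ a b : A, a * b = b * a) → IsCyclic A) (p : ℕ) [hp : Fact p.Prime]
    (hpG : p ∣ Nat.card G) (P : Sylow p G) :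
    ∃ N, StIso (res P (Dn Y (2 * (N + 1)) (ZZ G))) (ZZ P) := by
  have hne : Nontrivial P := by
    rw [← Finite.one_lt_card_iff_nontrivial]
    exact hp.out.one_lt.trans_le (Nat.le_of_dvd Nat.card_pos (P.dvd_card_of_dvd_card hpG))
  obtain ⟨z, hz, hc, hg⟩ := exists_central (P := P) P.2 (by
    intro A hA
    let B := A.map (P : Subgroup G).subtype
    let e : A ≃* B := A.equivMapOfInjective _ Subtype.val_injective
    have : IsCyclic B := hcyc B (fun a b => by
      have := hA (e.symm a) (e.symm b)
      have := congrArg e this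
      simpa using this)
    exact isCyclic_of_surjective e.symm e.symm.surjective)
  obtain ⟨N, hN⟩ := period_of_central (hY.res (P : Subgroup G)) z hz hc hg
  refine ⟨N, ?_⟩
  rw [res_Dn]
  exact hN

theorem exists_period [Finite G] [Nonempty Y] (hY : FreeAct G Y)
    (hcyc : ∀ A : Subgroup G, (∀ a b : A, a * b = b * a) → IsCyclic A) :
    ∃ n : ℕ, 0 < n ∧ Even n ∧
      (∀ p, p.Prime → p ∣ Nat.card G → ∃ P : Subgroup G, ¬ p ∣ P.index ∧
        StIso (res P (Dn Y n (ZZ G))) (ZZ P)) ∧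
      ∃ (f : Dn Y n (ZZ G) →+ ℤ) (v : Dn Y n (ZZ G)), (∀ (g : G) a, f (g • a) = f a) ∧
        (∀ g : G, g • v = v) ∧ IsCoprime (f v) (Nat.card G : ℤ) := by
  classical
  let S := (Nat.card G).primeFactors
  have hS : ∀ p ∈ S, p.Prime ∧ p ∣ Nat.card G := fun p hp =>
    ⟨Nat.prime_of_mem_primeFactors hp, Nat.dvd_of_mem_primeFactors hp⟩
  have h1 : ∀ p : S, ∃ (P : Sylow p.1 G) (N : ℕ),
      StIso (res P (Dn Y (2 * (N + 1)) (ZZ G))) (ZZ P) := by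
    intro p
    have : Fact p.1.Prime := ⟨(hS p p.2).1⟩
    let P : Sylow p.1 G := default
    exact ⟨P, exists_sylow_period hY hcyc p (hS p p.2).2 P⟩
  choose P N hPN using h1
  let a : S → ℕ := fun p => 2 * (N p + 1) * (p.1 - 1)
  have ha : ∀ p, 0 < a p := fun p => by
    have := (hS p p.2).1.one_lt
    exact Nat.mul_pos (by lia) (by lia)
  let n := 2 * ∏ p, a p
  have hn : 0 < n := Nat.mul_pos two_pos (Finset.prod_pos fun p _ => ha p)
  have hdv : ∀ p : S, ∃ k, 0 < k ∧ n = 2 * (N p + 1) * ((p.1 - 1) * k) := by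
    intro p
    have : a p ∣ n := (Finset.dvd_prod_of_mem a (Finset.mem_univ p)).mul_left _
    obtain ⟨k, hk⟩ := this
    refine ⟨k, Nat.pos_of_ne_zero ?_, by rw [hk]; exact mul_assoc _ _ _⟩
    rintro rfl
    lia
  refine ⟨n, hn, even_two_mul _, ?_, ?_⟩
  · intro p hp hpG
    have : Fact p.Prime := ⟨hp⟩
    have hpS : p ∈ S := Nat.mem_primeFactors.2 ⟨hp, hpG, Nat.card_pos.ne'⟩
    refine ⟨P ⟨p, hpS⟩, (P ⟨p, hpS⟩).not_dvd_index, ?_⟩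
    obtain ⟨k, -, hk⟩ := hdv ⟨p, hpS⟩
    have := hPN ⟨p, hpS⟩
    rw [res_Dn] at this ⊢
    exact this.Dn_of_dvd ⟨_, hk⟩
  · have h2 : ∀ p : S, ∃ (f : Dn Y n (ZZ G) →+ ℤ) (v : Dn Y n (ZZ G)),
        (∀ (g : G) a, f (g • a) = f a) ∧ (∀ g : G, g • v = v) ∧ ¬ (p.1 : ℤ) ∣ f v := by
      intro p
      have : Fact p.1.Prime := ⟨(hS p p.2).1⟩
      obtain ⟨k, hk, hnk⟩ := hdv p
      obtain ⟨c, hc, hu⟩ := exists_coeff (hPN p)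
      rw [hnk]
      exact exists_transfer (P p) hc hu (hS p p.2).2 hk
    choose f v hf hv hfv using h2
    let b : S → ℤ := fun p => ∏ q ∈ Finset.univ.erase p, (q.1 : ℤ)
    refine ⟨∑ p, b p • f p, ∑ p, b p • v p, fun g x => ?_, fun g => ?_, ?_⟩
    · simp [AddMonoidHom.finsetSum_apply, hf]
    · rw [Finset.smul_sum]
      refine Finset.sum_congr rfl fun p _ => ?_
      have := map_zsmul ((Dn Y n (ZZ G)).sm g) (b p) (v p)
      exact this.trans (congrArg (b p • ·) (hv p g))
    · rw [Int.isCoprime_iff_gcd_eq_one]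
      by_contra hne
      obtain ⟨p, hp, hpd⟩ := Nat.exists_prime_and_dvd hne
      have hp1 : (p : ℤ) ∣ (∑ p, b p • f p) (∑ p, b p • v p) :=
        (Int.natCast_dvd_natCast.2 hpd).trans (Int.gcd_dvd_left _ _)
      have hp2 : p ∣ Nat.card G := Int.natCast_dvd_natCast.1
        ((Int.natCast_dvd_natCast.2 hpd).trans (Int.gcd_dvd_right _ _))
      let p' : S := ⟨p, Nat.mem_primeFactors.2 ⟨hp, hp2, Nat.card_pos.ne'⟩⟩
      have hb : ∀ q : S, q ≠ p' → (p : ℤ) ∣ b q := fun q hq =>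
        Finset.dvd_prod_of_mem (fun q : S => (q.1 : ℤ)) (a := p') (by simp [hq.symm])
      have hbp : ¬ (p : ℤ) ∣ b p' := by
        intro h
        obtain ⟨q, hq, hd⟩ := (Prime.dvd_finsetProd_iff (Nat.prime_iff_prime_int.1 hp) _).1 h
        have hd := (Nat.prime_dvd_prime_iff_eq hp (hS q q.2).1).1 (Int.natCast_dvd_natCast.1 hd)
        exact (Finset.mem_erase.1 hq).1 (Subtype.ext hd.symm)
      have e : (∑ p, b p • f p) (∑ p, b p • v p) = ∑ q, ∑ r, b q * (b r * f q (v r)) := by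
        rw [Finset.sum_comm]
        simp [AddMonoidHom.finsetSum_apply, map_sum]
      rw [e] at hp1
      have h3 : (p : ℤ) ∣ b p' * (b p' * f p' (v p')) := by
        rw [← Finset.add_sum_erase _ _ (Finset.mem_univ p'),
          ← Finset.add_sum_erase _ _ (Finset.mem_univ p')] at hp1
        have h4 : (p : ℤ) ∣ ∑ r ∈ Finset.univ.erase p', b p' * (b r * f p' (v r)) :=
          Finset.dvd_sum fun r hr =>
            ((hb r (Finset.mem_erase.1 hr).1).mul_right _).mul_left _
        have h5 : (p : ℤ) ∣ ∑ q ∈ Finset.univ.erase p', ∑ r, b q * (b r * f q (v r)) :=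
          Finset.dvd_sum fun q hq => Finset.dvd_sum fun r _ =>
            (hb q (Finset.mem_erase.1 hq).1).mul_right _
        exact (dvd_add_left h4).1 ((dvd_add_left h5).1 hp1)
      have hpp := Nat.prime_iff_prime_int.1 hp
      rcases hpp.dvd_or_dvd h3 with h | h
      · exact hbp h
      · rcases hpp.dvd_or_dvd h with h | h
        · exact hbp h
        · exact hfv p' h

/-- A trace over `G` expressed by traces over subgroups. -/
theorem isTr_zsmul_index [Finite G] {A : GMod G} (hA : Lat A) (P : Subgroup G)
    (hP : IsProj (res P A)) : IsTr ((P.index : ℤ) • AddMonoidHom.id A) := by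
  cases nonempty_fintype G
  cases nonempty_fintype P
  obtain ⟨φ, hφ⟩ := hP
  let φ' : A →+ A := φ
  refine ⟨φ', ?_⟩
  have h1 : ∀ a : A, ∑ q : P, (q : G) • φ' ((q : G)⁻¹ • a) = a := fun a =>
    (tr_apply φ a).symm.trans (DFunLike.congr_fun hφ a)
  have hfree := hA.1
  refine AddMonoidHom.ext fun a => ?_
  have hc : (Nat.card P : ℤ) ≠ 0 := Int.natCast_ne_zero.2 Nat.card_pos.ne'
  refine smul_right_injective A hc ?_
  change (Nat.card P : ℤ) • tr φ' a = (Nat.card P : ℤ) • ((P.index : ℤ) • a)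
  rw [smul_smul, ← Int.natCast_mul, Subgroup.card_mul_index, tr_apply]
  have h2 : ∀ q : P, ∑ g : G, g • φ' (g⁻¹ • a) =
      ∑ g : G, (g * q) • φ' ((g * q)⁻¹ • a) := fun q =>
    (Fintype.sum_equiv (Equiv.mulRight (q : G)) _ _ fun g => rfl).symm
  have h3 : ∑ q : P, ∑ g : G, g • φ' (g⁻¹ • a) = ∑ g : G, a := by
    rw [Finset.sum_congr rfl fun q _ => h2 q, Finset.sum_comm]
    refine Finset.sum_congr rfl fun g _ => ?_
    have := congrArg (g • ·) (h1 (g⁻¹ • a))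
    simp only [Finset.smul_sum, smul_inv_smul] at this
    refine Eq.trans (Finset.sum_congr rfl fun q _ => ?_) this
    rw [mul_smul, mul_inv_rev, mul_smul]
  rw [Finset.sum_const, Finset.sum_const, Finset.card_univ, Finset.card_univ,
    ← Nat.card_eq_fintype_card, ← Nat.card_eq_fintype_card] at h3
  rw [natCast_zsmul, natCast_zsmul]
  exact h3

theorem isProj_of_sylow [Finite G] {A : GMod G} (hA : Lat A)
    (h : ∀ p, p.Prime → p ∣ Nat.card G → ∃ P : Subgroup G, ¬ p ∣ P.index ∧ IsProj (res P A)) :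
    IsProj A := by
  let I : Ideal ℤ :=
    { carrier := {n | IsTr (n • AddMonoidHom.id A)}
      zero_mem' := by
        change IsTr ((0 : ℤ) • AddMonoidHom.id A)
        rw [zero_smul]; exact IsTr.zero
      add_mem' := fun {a b} ha hb => by
        change IsTr ((a + b) • AddMonoidHom.id A)
        rw [add_smul]; exact ha.add hb
      smul_mem' := fun c a ha => by
        change IsTr ((c * a) • AddMonoidHom.id A)
        have := IsTr.comp_left ((Eqv.id A).zsmul c) ha
        convert this using 1
        refine AddMonoidHom.ext fun x => ?_
        exact mul_smul c a x }
  have hG : (Nat.card G : ℤ) ∈ I := IsTr.of_dvd (Eqv.id A) dvd_rfl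
  suffices h1 : (1 : ℤ) ∈ I by
    have : IsTr ((1 : ℤ) • AddMonoidHom.id A) := h1
    rwa [one_smul] at this
  obtain ⟨d, hd⟩ := (IsPrincipalIdealRing.principal I).principal
  have hdm : ∀ m, m ∈ I ↔ d ∣ m := fun m => by rw [hd]; exact Ideal.mem_span_singleton
  rw [hdm]
  by_contra hu
  have hu' : d.natAbs ≠ 1 := fun e => hu (isUnit_iff_dvd_one.1 (Int.isUnit_iff_natAbs_eq.2 e))
  obtain ⟨p, hp, hpd⟩ := Nat.exists_prime_and_dvd hu'
  have hpd' : (p : ℤ) ∣ d := Int.natCast_dvd.2 hpd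
  obtain ⟨P, hP, hPA⟩ := h p hp (Int.natCast_dvd_natCast.1 (hpd'.trans ((hdm _).1 hG)))
  exact hP (Int.natCast_dvd_natCast.1
    (hpd'.trans ((hdm _).1 (isTr_zsmul_index hA P hPA))))

/-- A retraction onto the integers that is a stable isomorphism has projective kernel. -/
theorem isProj_ker [Finite G] {A K : GMod G} {i : K →+ A} {F : A →+ ZZ G} {y : ZZ G →+ A}
    (hS : SES i F) (hy : Eqv y) (hFy : F.comp y = AddMonoidHom.id _)
    (ht : IsTr (AddMonoidHom.id A - y.comp F)) : IsProj K := by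
  obtain ⟨r, hr, hr'⟩ := hS.factor (AddMonoidHom.id A - y.comp F) (by
    refine AddMonoidHom.ext fun a => ?_
    change F (a - y (F a)) = 0
    rw [map_sub, sub_eq_zero]
    exact (DFunLike.congr_fun hFy (F a)).symm)
  have he := hr' ((Eqv.id A).sub (hy.comp hS.ep))
  obtain ⟨φ, hφ⟩ := ht
  have hri : r.comp i = AddMonoidHom.id K := by
    refine AddMonoidHom.ext fun k => hS.inj ?_
    have := DFunLike.congr_fun hr (i k)
    refine this.trans ?_
    change i k - y (F (i k)) = i k
    rw [hS.pi]; simp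
  have hrt : r.comp (AddMonoidHom.id A - y.comp F) = r := by
    refine AddMonoidHom.ext fun a => hS.inj ?_
    have h1 := DFunLike.congr_fun hr a
    have h2 := DFunLike.congr_fun hr (a - y (F a))
    refine h2.trans (Eq.trans ?_ h1.symm)
    change a - y (F a) - y (F (a - y (F a))) = a - y (F a)
    have : F (a - y (F a)) = 0 := by
      rw [map_sub, sub_eq_zero]
      exact (DFunLike.congr_fun hFy (F a)).symm
    rw [this]; simp
  have : IsTr ((r.comp (AddMonoidHom.id A - y.comp F)).comp i) :=
    IsTr.comp_right hS.ei (IsTr.comp_left he ⟨φ, hφ⟩)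
  rwa [hrt, hri] at this

end GMod

namespace GMod

variable {G : Type} [Group G]

theorem SES.res (P : Subgroup G) {A B C : GMod G} {i : A →+ B} {p : B →+ C} (h : SES i p) :
    SES (A := GMod.res P A) (B := GMod.res P B) (C := GMod.res P C) i p where
  ei := fun g a => h.ei g a
  ep := fun g a => h.ep g a
  inj := h.inj
  exact := h.exact
  split := h.split

theorem isTr_of_inverse [Finite G] {A : GMod G} {f f' : A →+ ZZ G} {x y : ZZ G →+ A}
    (hf : Eqv f) (hf' : Eqv f') (hx : Eqv x) (hy : Eqv y)
    (h : IsTr (AddMonoidHom.id A - x.comp f))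
    (h' : IsTr (AddMonoidHom.id (ZZ G) - f'.comp y)) :
    IsTr (AddMonoidHom.id A - y.comp f') := by
  have hcomm : ∀ a b : ℤ →+ ℤ, a.comp b = b.comp a := fun a b => by
    ext; simp
    have h1 : ∀ (c : ℤ →+ ℤ) (m : ℤ), c m = m * c 1 := fun c m => by
      rw [← smul_eq_mul, ← map_zsmul, smul_eq_mul, mul_one]
    rw [h1 a (b 1), h1 b (a 1), mul_comm]
  have e1 : (f.comp y).comp (f'.comp x) = (f'.comp x).comp (f.comp y) := hcomm _ _
  have h1 : IsTr (AddMonoidHom.id (ZZ G) - (f.comp y).comp (f'.comp x)) := by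
    rw [e1]
    have h2 := IsTr.comp_right (B := A) hy (IsTr.comp_left hf' h)
    have h3 := h'.add h2
    convert h3 using 1
    refine AddMonoidHom.ext fun m => ?_
    change m - f' (x (f (y m))) = m - f' (y m) + f' (y m - x (f (y m)))
    rw [map_sub]; abel
  have h2 := IsTr.comp_right (B := ZZ G) hf (IsTr.comp_left hx h1)
  have h3 := IsTr.comp_right (B := A) (hy.comp (hf'.comp (hx.comp hf))) h
  have h4 := IsTr.comp_left (hy.comp hf') h
  convert ((h.add h2).sub h3).sub h4 using 1
  refine AddMonoidHom.ext fun a => ?_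
  change a - y (f' a) = (a - x (f a) + x (f a - f (y (f' (x (f a))))) -
    (y (f' (x (f a))) - x (f (y (f' (x (f a))))))) - y (f' (a - x (f a)))
  simp only [map_sub]; abel

theorem isTr_prod [Finite G] {A B : GMod G} (hB : IsProj B) {f : A →+ ZZ G} {e : B →+ ZZ G}
    {x : ZZ G →+ A} {z : ZZ G →+ B} (hf : Eqv f) (he : Eqv e) (hx : Eqv x) (hz : Eqv z)
    (h : IsTr (AddMonoidHom.id A - x.comp f)) :
    IsTr (AddMonoidHom.id (prod A B) - ((inl A B).comp x + (inr A B).comp z).comp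
      (f.comp (fst A B) + e.comp (snd A B))) := by
  have h1 := IsTr.comp_right (fst_eqv A B) (IsTr.comp_left (inl_eqv A B) h)
  have h2 : IsTr ((inr A B).comp (AddMonoidHom.id B - z.comp e)) :=
    hB.isTr_of_left ((inr_eqv A B).comp ((Eqv.id B).sub (hz.comp he)))
  have h3 : IsTr (z.comp (f.comp (fst A B))) :=
    hB.isTr_of_right (hz.comp (hf.comp (fst_eqv A B)))
  have h4 : IsTr (x.comp e) := hB.isTr_of_left (hx.comp he)
  have h2' := IsTr.comp_right (snd_eqv A B) h2
  have h3' := IsTr.comp_left (inr_eqv A B) h3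
  have h4' := IsTr.comp_right (snd_eqv A B) (IsTr.comp_left (inl_eqv A B) h4)
  convert ((h1.add h2').sub h3').sub h4' using 1
  refine AddMonoidHom.ext fun a => Prod.ext ?_ ?_
  · change a.1 - (x (f a.1 + e a.2) + 0) = a.1 - x (f a.1) + 0 - 0 - x (e a.2)
    rw [map_add]; abel
  · change a.2 - (0 + z (f a.1 + e a.2)) = 0 + (a.2 - z (e a.2)) - z (f a.1) - 0
    rw [map_add]; abel

theorem isTr_ZZ [Finite G] {t : ZZ G →+ ZZ G} {s : ℤ} (ht : ∀ m : ℤ, (show ℤ from t m) = ((Nat.card G : ℤ) * s) * m) :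
    IsTr t := by
  refine ⟨AddMonoidHom.mulLeft s, ?_⟩
  cases nonempty_fintype G
  refine AddMonoidHom.ext fun m => (tr_apply _ m).trans ?_
  refine Eq.trans ?_ (ht m).symm
  change ∑ g : G, s * (show ℤ from m) = _
  rw [Finset.sum_const, Finset.card_univ, ← Nat.card_eq_fintype_card, nsmul_eq_mul]
  exact (mul_assoc _ _ _).symm

theorem exists_complement [Finite G] {A : GMod G} (hA : Lat A)
    (hP : ∀ p, p.Prime → p ∣ Nat.card G → ∃ P : Subgroup G, ¬ p ∣ P.index ∧
        StIso (res P A) (ZZ P))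
    {f : A →+ ℤ} {v : A} (hf : ∀ (g : G) a, f (g • a) = f a) (hv : ∀ g : G, g • v = v)
    (hc : IsCoprime (f v) (Nat.card G : ℤ)) :
    ∃ K : GMod G, Lat K ∧ IsProj K ∧ Iso (prod A (Fr G 1)) (prod (ZZ G) K) := by
  cases nonempty_fintype G
  obtain ⟨s, t, hst⟩ := hc
  let B : GMod G := Ind G (ZZ G)
  have hB : IsProj B := Ind.isProj regular_free _
  have hBl : Lat B := Ind.lat Lat.ZZ
  let f' : A →+ ZZ G := f
  let e : B →+ ZZ G := Ind.sum G (ZZ G)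
  let x : ZZ G →+ A := zmultiplesHom A (s • v)
  let z : ZZ G →+ B := AddMonoidHom.mk' (M := ℤ) (G := G → ℤ) (fun m _ => t * m)
    (fun a b => funext fun _ => mul_add _ _ _)
  have hf' : Eqv f' := hf
  have he : Eqv e := Ind.sum_eqv G _
  have hx : Eqv x := by
    intro g m
    change (show ℤ from m) • (s • v) = g • ((show ℤ from m) • (s • v))
    have := map_zsmul (A.sm g) (show ℤ from m) (s • v)
    refine Eq.trans ?_ this.symm
    have h2 := map_zsmul (A.sm g) s v
    refine congrArg _ (Eq.trans ?_ h2.symm)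
    exact congrArg _ (hv g).symm
  have hz : Eqv z := fun g m => rfl
  let F : prod A B →+ ZZ G := f'.comp (fst A B) + e.comp (snd A B)
  let y : ZZ G →+ prod A B := (inl A B).comp x + (inr A B).comp z
  have hF : Eqv F := (hf'.comp (fst_eqv A B)).add (he.comp (snd_eqv A B))
  have hy : Eqv y := ((inl_eqv A B).comp hx).add ((inr_eqv A B).comp hz)
  have hfx : ∀ m : ℤ, f' (x m) = m * (s * f v) := fun m => by
    change f (m • (s • v)) = _
    rw [map_zsmul, map_zsmul]; rfl
  have hFy : F.comp y = AddMonoidHom.id _ := by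
    refine AddMonoidHom.ext fun m => ?_
    change f' (x m + 0) + e (0 + z m) = m
    rw [add_zero, zero_add]
    refine (congrArg (· + e (z m)) (hfx m)).trans ?_
    change (show ℤ from m) * (s * f v) + ∑ g : G, t * (show ℤ from m) = (show ℤ from m)
    rw [Finset.sum_const, Finset.card_univ, ← Nat.card_eq_fintype_card, nsmul_eq_mul]
    linear_combination (show ℤ from m) * hst
  have hS : SES (sub.incl (prod A B) F.ker hF.ker_inv) F := SES.ker F hF ⟨y, hFy⟩
  have hKl : Lat (ker F hF) := Lat.sub (hS := hF.ker_inv) (hA.prod hBl)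
  refine ⟨ker F hF, hKl, isProj_of_sylow hKl fun p hp hpG => ?_, ?_⟩
  · obtain ⟨P, hPi, f₀, x₀, hf₀, hx₀, h₁, -⟩ := hP p hp hpG
    refine ⟨P, hPi, ?_⟩
    have hBP : IsProj (res P B) := (Ind.isProj (regular_free.res P) (res P (ZZ G)))
    have hfP : Eqv (A := res P A) (B := ZZ P) f' := fun g a => hf' g a
    have heP : Eqv (A := res P B) (B := ZZ P) e := fun g a => he g a
    have hxP : Eqv (A := ZZ P) (B := res P A) x := fun g a => hx g a
    have hzP : Eqv (A := ZZ P) (B := res P B) z := fun g a => hz g a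
    have h2 : IsTr (A := ZZ P) (B := ZZ P) (AddMonoidHom.id (ZZ P) -
        (show ZZ P →+ ZZ P from f'.comp x)) := by
      refine isTr_ZZ (s := t * P.index) fun m => ?_
      change m - (show ℤ from f' (x m)) = _
      refine (congrArg (m - ·) (hfx m)).trans ?_
      have h3 : (Nat.card P : ℤ) * P.index = Nat.card G := by
        rw [← Int.natCast_mul, Subgroup.card_mul_index]
      linear_combination (-m) * hst - m * t * h3
    have h3 := isTr_of_inverse hf₀ hfP hx₀ hxP h₁ h2
    have h4 := isTr_prod hBP hfP heP hxP hzP h3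
    exact isProj_ker (A := res P (prod A B)) (hS.res P) (fun g a => hy g a) hFy h4
  · have h1 : Iso (Fr G 1) B := Ind.iso (triv_iso (AddEquiv.funUnique (Fin 1) ℤ))
    exact ((Iso.refl A).prod h1).trans ((hS.iso_of_section hy hFy).trans (prod_comm _ _))

theorem exists_period_complement [Finite G] {Y : Type} [Fintype Y] [MulAction G Y] [Nonempty Y]
    (hY : FreeAct G Y) (hcyc : ∀ A : Subgroup G, (∀ a b : A, a * b = b * a) → IsCyclic A) :
    ∃ n : ℕ, 0 < n ∧ Even n ∧ ∃ K : GMod G, Lat K ∧ IsProj K ∧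
      Iso (prod (Dn Y n (ZZ G)) (Fr G 1)) (prod (ZZ G) K) := by
  obtain ⟨n, hn, he, hP, f, v, hf, hv, hc⟩ := exists_period hY hcyc
  exact ⟨n, hn, he, exists_complement (Dn.lat Lat.ZZ n) hP hf hv hc⟩

end GMod

namespace GMod

variable {G : Type} [Group G]

/-- Stable isomorphism modulo free modules. -/
def Steq (A B : GMod G) : Prop := ∃ a b, Iso (prod A (Fr G a)) (prod B (Fr G b))

theorem prod_left_comm (A B C : GMod G) : Iso (prod A (prod B C)) (prod B (prod A C)) :=
  ⟨{ toFun := fun x => (x.2.1, x.1, x.2.2), invFun := fun x => (x.2.1, x.1, x.2.2),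
     left_inv := fun _ => rfl, right_inv := fun _ => rfl, map_add' := fun _ _ => rfl },
     fun _ _ => rfl⟩

theorem prod_prod_comm (A B C E : GMod G) :
    Iso (prod (prod A B) (prod C E)) (prod (prod A C) (prod B E)) :=
  ⟨{ toFun := fun x => ((x.1.1, x.2.1), (x.1.2, x.2.2)),
     invFun := fun x => ((x.1.1, x.2.1), (x.1.2, x.2.2)),
     left_inv := fun _ => rfl, right_inv := fun _ => rfl, map_add' := fun _ _ => rfl },
     fun _ _ => rfl⟩

theorem Fr.zero_subsingleton : Subsingleton (Fr G 0) :=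
  inferInstanceAs (Subsingleton (G → Fin 0 → ℤ))

theorem prod_of_subsingleton (A B : GMod G) [Subsingleton B] : Iso (prod A B) A :=
  ⟨{ toFun := fun x => x.1, invFun := fun a => (a, 0),
     left_inv := fun _ => Prod.ext rfl (Subsingleton.elim (α := B) _ _), right_inv := fun _ => rfl,
     map_add' := fun _ _ => rfl }, fun _ _ => rfl⟩

theorem prod_Fr_zero (A : GMod G) : Iso (prod A (Fr G 0)) A :=
  have := Fr.zero_subsingleton (G := G)
  prod_of_subsingleton A _

section Steq
variable {A B C E : GMod G}

theorem Steq.of_iso (h : Iso A B) : Steq A B := ⟨0, 0, h.prod (Iso.refl _)⟩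

theorem Steq.refl (A : GMod G) : Steq A A := .of_iso (.refl A)

theorem Steq.symm : Steq A B → Steq B A := fun ⟨a, b, h⟩ => ⟨b, a, h.symm⟩

theorem prod_Fr_add (A : GMod G) (a b : ℕ) :
    Iso (prod (prod A (Fr G a)) (Fr G b)) (prod A (Fr G (a + b))) :=
  (prod_assoc _ _ _).trans ((Iso.refl A).prod (Fr.add a b))

theorem Steq.trans : Steq A B → Steq B C → Steq A C := by
  rintro ⟨a, b, h⟩ ⟨c, d, h'⟩
  refine ⟨a + c, d + b, (prod_Fr_add A a c).symm.trans ?_⟩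
  refine (h.prod (.refl _)).trans ((prod_Fr_add B b c).trans ?_)
  rw [add_comm b c]
  exact (prod_Fr_add B c b).symm.trans ((h'.prod (.refl _)).trans (prod_Fr_add C d b))

theorem Steq.prod : Steq A B → Steq C E → Steq (prod A C) (prod B E) := by
  rintro ⟨a, b, h⟩ ⟨c, d, h'⟩
  refine ⟨a + c, b + d, ?_⟩
  exact ((Iso.refl _).prod (Fr.add a c).symm).trans ((prod_prod_comm _ _ _ _).trans
    ((h.prod h').trans ((prod_prod_comm _ _ _ _).trans ((Iso.refl _).prod (Fr.add b d)))))

theorem Steq.of_isFr (hA : IsFr A) (hB : IsFr B) : Steq A B := by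
  obtain ⟨a, ha⟩ := hA
  obtain ⟨b, hb⟩ := hB
  refine ⟨b, a, (ha.prod (.refl _)).trans ((prod_comm _ _).trans (hb.symm.prod (.refl _)))⟩

theorem Steq.prod_isFr (hB : IsFr B) : Steq (GMod.prod A B) A := by
  obtain ⟨b, hb⟩ := hB
  exact ⟨0, b, (prod_Fr_zero _).trans ((Iso.refl A).prod hb)⟩

end Steq

theorem D_prod_iso [Finite G] {Y : Type} [Fintype Y] [MulAction G Y] [Nonempty Y] {K : GMod G}
    (hK : IsProj K) : Iso (Ind Y K) (prod (D Y K) K) :=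
  (D.ses Y K).iso_of_isProj hK

section D
variable [Finite G] {Y : Type} [Fintype Y] [MulAction G Y] [Nonempty Y]

theorem D.isProj (hY : FreeAct G Y) {K : GMod G} (hK : IsProj K) : IsProj (D Y K) := by
  have h := (Ind.isProj hY K).of_iso (D_prod_iso (Y := Y) hK).symm
  exact h.of_retract (inl_eqv _ _) (fst_eqv _ _) rfl

theorem Steq.D (hY : FreeAct G Y) {A B : GMod G} : Steq A B → Steq (D Y A) (D Y B) := by
  have key : ∀ a, IsFr (GMod.prod (GMod.D Y (Fr G a)) (Fr G a)) := fun a =>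
    (Ind.isFr hY (Fr.lat a)).of_iso (D_prod_iso (Fr.isProj a)).symm
  rintro ⟨a, b, h⟩
  have h1 := (D.prod_iso (Y := Y) A (Fr G a)).symm.trans (h.D.trans (D.prod_iso B (Fr G b)))
  have h2 : ∀ (A : GMod G) (a : ℕ), Steq (GMod.prod (GMod.prod (GMod.D Y A) (GMod.D Y (Fr G a))) (Fr G a))
      (GMod.D Y A) := fun A a =>
    (Steq.of_iso (prod_assoc _ _ _)).trans (Steq.prod_isFr (key a))
  have h3 : ∀ (A : GMod G) (a : ℕ), Steq (GMod.prod (GMod.D Y A) (GMod.D Y (Fr G a))) (GMod.D Y A) :=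
    fun A a => (Steq.prod_isFr ⟨a, .refl _⟩).symm.trans (h2 A a)
  exact (h3 A a).symm.trans ((Steq.of_iso h1).trans (h3 B b))

theorem Steq.Dn (hY : FreeAct G Y) {A B : GMod G} (h : Steq A B) (n : ℕ) :
    Steq (Dn Y n A) (Dn Y n B) := by
  induction n with
  | zero => exact h
  | succ n ih => rw [Dn_succ, Dn_succ]; exact ih.D hY

theorem Steq.DD (hY : FreeAct G Y) {K : GMod G} (hK : IsProj K) (hl : Lat K) :
    Steq (GMod.D Y (GMod.D Y K)) K := by
  have h1 : IsFr (GMod.prod (GMod.D Y K) K) :=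
    (Ind.isFr hY hl).of_iso (D_prod_iso hK).symm
  have h2 : IsFr (GMod.prod (GMod.D Y (GMod.D Y K)) (GMod.D Y K)) :=
    (Ind.isFr hY (D.lat hl)).of_iso (D_prod_iso (D.isProj hY hK)).symm
  refine (Steq.prod_isFr h1).symm.trans ((Steq.of_iso (prod_assoc _ _ _).symm).trans ?_)
  exact (Steq.of_iso (prod_comm _ _)).trans (Steq.prod_isFr h2)

theorem Dn.isProj (hY : FreeAct G Y) {K : GMod G} (hK : IsProj K) (n : ℕ) : IsProj (Dn Y n K) := by
  induction n with
  | zero => exact hK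
  | succ n ih => rw [Dn_succ]; exact D.isProj hY ih

theorem Steq.Dn_even (hY : FreeAct G Y) {K : GMod G} (hK : IsProj K) (hl : Lat K) {n : ℕ}
    (hn : Even n) : Steq (GMod.Dn Y n K) K := by
  obtain ⟨m, rfl⟩ := hn
  rw [← two_mul]
  induction m with
  | zero => exact .refl _
  | succ m ih =>
    rw [show 2 * (m + 1) = 2 + 2 * m by ring, Dn_add]
    exact (Steq.DD hY (Dn.isProj hY hK _) (Dn.lat hl _)).trans ih

end D

/-- Powers of a module. -/
def pw (K : GMod G) : ℕ → GMod G
  | 0 => Fr G 0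
  | j + 1 => prod (pw K j) K

theorem pw.lat {K : GMod G} [Finite G] (hK : Lat K) (j : ℕ) : Lat (pw K j) := by
  induction j with
  | zero => exact Fr.lat 0
  | succ j ih => exact ih.prod hK

theorem pw.isProj {K : GMod G} [Finite G] (hK : IsProj K) (j : ℕ) : IsProj (pw K j) := by
  induction j with
  | zero => exact Fr.isProj 0
  | succ j ih => exact ih.prod hK

theorem Steq.Dn_mul [Finite G] {Y : Type} [Fintype Y] [MulAction G Y] [Nonempty Y]
    (hY : FreeAct G Y) {n : ℕ} (hn : Even n) {Z K : GMod G} (hl : Lat K) (hK : IsProj K)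
    (h : Steq (GMod.Dn Y n Z) (GMod.prod Z K)) (j : ℕ) :
    Steq (GMod.Dn Y (n * j) Z) (GMod.prod Z (pw K j)) := by
  induction j with
  | zero => exact .of_iso (prod_Fr_zero Z).symm
  | succ j ih =>
    rw [Nat.mul_succ, add_comm, Dn_add]
    refine (ih.Dn hY n).trans ((Steq.of_iso (Dn.prod_iso n Z (pw K j))).trans ?_)
    refine (h.prod (Steq.Dn_even hY (pw.isProj hK j) (pw.lat hl j) hn)).trans (Steq.of_iso ?_)
    exact (prod_assoc _ _ _).trans ((Iso.refl Z).prod (prod_comm _ _))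

section Kt

/-- Projective lattices. -/
structure PL (G : Type) [Group G] [Finite G] where
  M : GMod G
  lat : Lat M
  proj : IsProj M

variable [Finite G]

instance PL.setoid (G : Type) [Group G] [Finite G] : Setoid (PL G) where
  r A B := Steq A.M B.M
  iseqv := ⟨fun _ => .refl _, fun h => h.symm, fun h h' => h.trans h'⟩

/-- The reduced projective class group. -/
def Kt (G : Type) [Group G] [Finite G] : Type 1 := Quotient (PL.setoid G)

def PL.add (A B : PL G) : PL G := ⟨prod A.M B.M, A.lat.prod B.lat, A.proj.prod B.proj⟩

noncomputable def PL.neg (A : PL G) : PL G :=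
  letI := Fintype.ofFinite G
  ⟨GMod.D G A.M, D.lat A.lat, D.isProj regular_free A.proj⟩

theorem PL.neg_spec (A : PL G) : IsFr (prod A.neg.M A.M) :=
  letI := Fintype.ofFinite G
  (Ind.isFr (Y := G) regular_free A.lat).of_iso (D_prod_iso A.proj).symm

instance Kt.hasAdd (G : Type) [Group G] [Finite G] : Add (Kt G) :=
  ⟨Quotient.map₂ PL.add fun _ _ h _ _ h' => Steq.prod h h'⟩

instance Kt.hasZero (G : Type) [Group G] [Finite G] : Zero (Kt G) :=
  ⟨Quotient.mk _ ⟨Fr G 0, Fr.lat 0, Fr.isProj 0⟩⟩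

noncomputable instance Kt.hasNeg (G : Type) [Group G] [Finite G] : Neg (Kt G) :=
  ⟨Quotient.map PL.neg fun A B (h : Steq A.M B.M) => by
    change Steq A.neg.M B.neg.M
    have h1 := (Steq.prod_isFr (A := A.neg.M) B.neg_spec).symm
    have h2 := (Steq.prod_isFr (A := B.neg.M) A.neg_spec)
    refine h1.trans (Steq.trans ?_ h2)
    refine ((Steq.refl _).prod ((Steq.refl _).prod h.symm)).trans ?_
    exact .of_iso (prod_left_comm _ _ _)⟩

noncomputable instance Kt.group (G : Type) [Group G] [Finite G] : AddCommGroup (Kt G) where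
  nsmul := nsmulRec
  zsmul := zsmulRec
  add_assoc := by
    rintro ⟨A⟩ ⟨B⟩ ⟨C⟩
    exact Quotient.sound (.of_iso (prod_assoc _ _ _))
  zero_add := by
    rintro ⟨A⟩
    exact Quotient.sound (.of_iso ((prod_comm _ _).trans (prod_Fr_zero _)))
  add_zero := by
    rintro ⟨A⟩
    exact Quotient.sound (.of_iso (prod_Fr_zero _))
  neg_add_cancel := by
    rintro ⟨A⟩
    exact Quotient.sound (Steq.of_isFr A.neg_spec ⟨0, .refl _⟩)
  add_comm := by
    rintro ⟨A⟩ ⟨B⟩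
    exact Quotient.sound (.of_iso (prod_comm _ _))

open Classical in
/-- The class of a module in the reduced projective class group. -/
noncomputable def cls (A : GMod G) : Kt G :=
  if h : Lat A ∧ IsProj A then Quotient.mk _ ⟨A, h.1, h.2⟩ else 0

theorem cls_eq_mk {A : GMod G} (h : Lat A) (h' : IsProj A) :
    cls A = Quotient.mk (PL.setoid G) ⟨A, h, h'⟩ := dif_pos ⟨h, h'⟩

theorem cls_eq_iff {A B : GMod G} (hA : Lat A) (hA' : IsProj A) (hB : Lat B) (hB' : IsProj B) :
    cls A = cls B ↔ Steq A B := by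
  rw [cls_eq_mk hA hA', cls_eq_mk hB hB']
  exact Quotient.eq

theorem cls_prod {A B : GMod G} (hA : Lat A) (hA' : IsProj A) (hB : Lat B) (hB' : IsProj B) :
    cls (prod A B) = cls A + cls B := by
  rw [cls_eq_mk hA hA', cls_eq_mk hB hB', cls_eq_mk (hA.prod hB) (hA'.prod hB')]
  rfl

theorem cls_isFr {A : GMod G} (h : IsFr A) : cls A = 0 := by
  rw [cls_eq_mk h.lat h.isProj]
  exact Quotient.sound (Steq.of_isFr h ⟨0, .refl _⟩)

theorem cls_iso {A B : GMod G} (h : Iso A B) : cls A = cls B := by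
  by_cases hA : Lat A ∧ IsProj A
  · rw [cls_eq_iff hA.1 hA.2 (hA.1.of_iso h.symm) (hA.2.of_iso h.symm)]
    exact .of_iso h
  · have hB : ¬ (Lat B ∧ IsProj B) := fun hB => hA ⟨hB.1.of_iso h, hB.2.of_iso h⟩
    exact (show cls A = 0 from dif_neg hA).trans (show cls B = 0 from dif_neg hB).symm

theorem cls_ses {A B C : GMod G} {i : A →+ B} {p : B →+ C} (h : SES i p) (hA : Lat A)
    (hA' : IsProj A) (hC : Lat C) (hC' : IsProj C) : cls B = cls A + cls C :=
  (cls_iso (h.iso_of_isProj hC')).trans (cls_prod hA hA' hC hC')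

theorem cls_eq_zero_iff {A : GMod G} (hA : Lat A) (hA' : IsProj A) :
    cls A = 0 ↔ ∃ a b, Iso (prod A (Fr G a)) (Fr G b) := by
  rw [← cls_isFr (A := Fr G 0) ⟨0, .refl _⟩, cls_eq_iff hA hA' (Fr.lat 0) (Fr.isProj 0)]
  constructor
  · rintro ⟨a, b, h⟩
    exact ⟨a, b, h.trans ((prod_comm _ _).trans (prod_Fr_zero _))⟩
  · rintro ⟨a, b, h⟩
    exact ⟨a, b, h.trans ((prod_comm _ _).trans (prod_Fr_zero _)).symm⟩

theorem cls_pw {K : GMod G} (hl : Lat K) (hK : IsProj K) (j : ℕ) : cls (pw K j) = j • cls K := by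
  induction j with
  | zero => rw [zero_smul]; exact cls_isFr ⟨0, .refl _⟩
  | succ j ih => rw [succ_nsmul, ← ih]; exact cls_prod (pw.lat hl j) (pw.isProj hK j) hl hK

end Kt

end GMod

namespace GMod

variable {G : Type} [Group G]

section Cyclic

theorem exists_sub_translate_eq [Fintype G] {t : G} (ht : ∀ g, g ∈ Submonoid.powers t)
    (u : G → ℤ) (hu : ∑ g, u g = 0) : ∃ f : G → ℤ, ∀ y, f y - f (y * t⁻¹) = u y := by
  classical
  let L : (G → ℤ) →+ (G → ℤ) :=
    AddMonoidHom.mk' (fun f y => f y - f (y * t⁻¹)) fun f h => by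
      ext y; simp only [Pi.add_apply]; ring
  suffices h : u ∈ L.range by
    obtain ⟨f, hf⟩ := h
    exact ⟨f, fun y => congrFun hf y⟩
  have key : ∀ g : G, (Pi.single g 1 - Pi.single 1 1 : G → ℤ) ∈ L.range := by
    intro g
    obtain ⟨k, rfl⟩ := ht g
    induction k with
    | zero => simp
    | succ k ih =>
      have h1 : L (-Pi.single (t ^ k) 1) = Pi.single (t ^ (k + 1)) 1 - Pi.single (t ^ k) 1 := by
        ext y
        change (-Pi.single (t ^ k) (1 : ℤ) : G → ℤ) y - (-Pi.single (t ^ k) (1 : ℤ) : G → ℤ) (y * t⁻¹) = _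
        simp only [Pi.neg_apply, Pi.sub_apply, Pi.single_apply, mul_inv_eq_iff_eq_mul, ← pow_succ]
        ring
      have h2 := L.range.add_mem ⟨_, h1⟩ ih
      simpa using h2
  have h3 : u = ∑ g, u g • (Pi.single g 1 - Pi.single 1 1 : G → ℤ) := by
    simp only [smul_sub, Finset.sum_sub_distrib, ← Finset.sum_smul, hu, zero_smul, sub_zero]
    ext y
    simp [Pi.single_apply]
  rw [h3]
  exact L.range.sum_mem fun g _ => L.range.zsmul_mem (key g) _

/-- Difference of a function and its right translate. -/
def diffMap [Fintype G] (t : G) : Ind G (ZZ G) →+ D G (ZZ G) :=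
  AddMonoidHom.mk' (M := G → ℤ) (G := D G (ZZ G))
    (fun f => ⟨fun y => (f y - f (y * t⁻¹) : ℤ), by
      change ∑ y, (f y - f (y * t⁻¹)) = 0
      rw [Finset.sum_sub_distrib, sub_eq_zero]
      exact (Equiv.sum_comp (Equiv.mulRight t⁻¹) fun y => (show ℤ from f y)).symm⟩)
    fun f h => Subtype.ext (funext fun y =>
      show (f y + h y) - (f (y * t⁻¹) + h (y * t⁻¹)) = (f y - f (y * t⁻¹)) + (h y - h (y * t⁻¹))
        from by ring)

/-- Constant functions. -/
def constMap (G : Type) [Group G] : ZZ G →+ Ind G (ZZ G) :=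
  AddMonoidHom.mk' (M := ℤ) (G := G → ℤ) (fun m _ => m) fun _ _ => rfl

theorem diffMap_ses [Fintype G] {t : G} (ht : ∀ g, g ∈ Submonoid.powers t) :
    SES (constMap G) (diffMap t) where
  ei := fun g m => rfl
  ep := fun g f => Subtype.ext (funext fun y => by
    change f (g⁻¹ * y) - f (g⁻¹ * (y * t⁻¹)) = f (g⁻¹ * y) - f (g⁻¹ * y * t⁻¹)
    rw [mul_assoc])
  inj := fun m m' h => congrFun h 1
  exact := fun f => by
    constructor
    · intro h
      have h1 : ∀ y, (f y - f (y * t⁻¹) : ℤ) = 0 := fun y => congrFun (congrArg Subtype.val h) y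
      refine ⟨f 1, funext fun y => ?_⟩
      obtain ⟨k, rfl⟩ := ht y
      change f 1 = f (t ^ k)
      induction k with
      | zero => simp
      | succ k ih =>
        have := h1 (t ^ (k + 1))
        rw [pow_succ, mul_inv_cancel_right] at this
        rw [ih, pow_succ]
        exact (sub_eq_zero.1 this).symm
    · rintro ⟨m, rfl⟩
      exact Subtype.ext (funext fun y => sub_self (show ℤ from m))
  split := by
    refine exists_section (D.lat Lat.ZZ) _ fun u => ?_
    obtain ⟨f, hf⟩ := exists_sub_translate_eq ht u.1 u.2
    exact ⟨f, Subtype.ext (funext hf)⟩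

theorem Steq.of_schanuel [Finite G] {A F B A' F' : GMod G} {i : A →+ F} {p : F →+ B}
    {i' : A' →+ F'} {p' : F' →+ B} (h : SES i p) (h' : SES i' p') (hF : IsFr F) (hF' : IsFr F') :
    Steq A A' :=
  (Steq.prod_isFr hF').symm.trans ((Steq.of_iso (schanuel h h' hF.isProj hF'.isProj)).trans
    (Steq.prod_isFr hF))

variable {Y : Type} [Fintype Y] [MulAction G Y] [Nonempty Y]

theorem Steq.DD_ZZ [Finite G] [IsCyclic G] (hY : FreeAct G Y) :
    Steq (GMod.D Y (GMod.D Y (ZZ G))) (ZZ G) := by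
  have := Fintype.ofFinite G
  obtain ⟨t, ht⟩ := IsCyclic.exists_monoid_generator (α := G)
  have h1 : Steq (GMod.D Y (ZZ G)) (GMod.D G (ZZ G)) :=
    .of_schanuel (D.ses Y _) (D.ses G _) (Ind.isFr hY Lat.ZZ) (Ind.isFr regular_free Lat.ZZ)
  refine (h1.D hY).trans ?_
  exact .of_schanuel (D.ses Y _) (diffMap_ses ht) (Ind.isFr hY (D.lat Lat.ZZ))
    (Ind.isFr regular_free Lat.ZZ)

theorem Steq.Dn_ZZ [Finite G] [IsCyclic G] (hY : FreeAct G Y) {n : ℕ} (hn : Even n) :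
    Steq (GMod.Dn Y n (ZZ G)) (ZZ G) := by
  obtain ⟨m, rfl⟩ := hn
  rw [← two_mul]
  induction m with
  | zero => exact .refl _
  | succ m ih =>
    rw [show 2 * (m + 1) = 2 + 2 * m by ring, GMod.Dn_add]
    exact (ih.Dn hY 2).trans (Steq.DD_ZZ hY)

end Cyclic

section EqvE

/-- Equivariance of an additive equivalence. -/
def EqvE {A B : GMod G} (e : A ≃+ B) : Prop := ∀ (g : G) (a : A), e (g • a) = g • e a

variable {A B C : GMod G} {e : A ≃+ B} {f : B ≃+ C}

theorem EqvE.trans (he : EqvE e) (hf : EqvE f) : EqvE (A := A) (B := C) (e.trans f) :=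
  fun g a => (congrArg f (he g a)).trans (hf g (e a))

theorem EqvE.symm (he : EqvE e) : EqvE (A := B) (B := A) e.symm := fun g b =>
  e.injective (by rw [he]; simp)

/-- Product of an equivalence with an identity. -/
def EqvE.pr (e : A ≃+ B) (C : GMod G) : prod A C ≃+ prod B C :=
  AddEquiv.prodCongr e (AddEquiv.refl C)

theorem EqvE.prodr (he : EqvE e) (C : GMod G) : EqvE (EqvE.pr e C) :=
  fun g x => Prod.ext (he g x.1) rfl

/-- Shear automorphism of a product. -/
def shear {A B : GMod G} (h : B →+ A) : prod A B ≃+ prod A B :=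
  { toFun := fun x => (x.1 + h x.2, x.2), invFun := fun x => (x.1 - h x.2, x.2)
    left_inv := fun x => Prod.ext (add_sub_cancel_right x.1 (h x.2)) rfl
    right_inv := fun x => Prod.ext (sub_add_cancel x.1 (h x.2)) rfl
    map_add' := fun x x' => Prod.ext
      ((congrArg (fun z => x.1 + x'.1 + z) (map_add h x.2 x'.2)).trans (add_add_add_comm _ _ _ _)) rfl }

theorem shear_eqv {A B : GMod G} {h : B →+ A} (hh : Eqv h) : EqvE (shear h) := fun g x =>
  Prod.ext ((congrArg (fun z => g • x.1 + z) (hh g x.2)).trans (smul_add g x.1 (h x.2)).symm) rfl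

/-- Shear automorphism of a product, in the other direction. -/
def shear' {A B : GMod G} (h : A →+ B) : prod A B ≃+ prod A B :=
  { toFun := fun x => (x.1, x.2 + h x.1), invFun := fun x => (x.1, x.2 - h x.1)
    left_inv := fun x => Prod.ext rfl (add_sub_cancel_right x.2 (h x.1))
    right_inv := fun x => Prod.ext rfl (sub_add_cancel x.2 (h x.1))
    map_add' := fun x x' => Prod.ext rfl
      ((congrArg (fun z => x.2 + x'.2 + z) (map_add h x.1 x'.1)).trans (add_add_add_comm _ _ _ _)) }

theorem shear'_eqv {A B : GMod G} {h : A →+ B} (hh : Eqv h) : EqvE (shear' h) := fun g x =>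
  Prod.ext rfl ((congrArg (fun z => g • x.2 + z) (hh g x.1)).trans (smul_add g x.2 (h x.1)).symm)

/-- An isomorphism `Z × A ≅ Z × B` which is the identity on `Z` induces `A ≅ B`. -/
theorem iso_of_fixes {Z A B : GMod G} {Φ : prod Z A ≃+ prod Z B} (hΦ : EqvE Φ)
    (h1 : ∀ z, Φ (inl Z A z) = inl Z B z) : Iso A B := by
  have h1' : ∀ z, Φ.symm (inl Z B z) = inl Z A z := fun z => Φ.injective (by
    rw [h1, AddEquiv.apply_symm_apply])
  have e : ∀ (C : GMod G) (x : prod Z C), inr Z C (snd Z C x) = x - inl Z C (fst Z C x) := fun C x =>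
    Prod.ext (sub_self _).symm (sub_zero _).symm
  have e1 : ∀ (C : GMod G) (z : Z), snd Z C (inl Z C z) = 0 := fun _ _ => rfl
  have e2 : ∀ (C : GMod G) (c : C), snd Z C (inr Z C c) = c := fun _ _ => rfl
  refine ⟨{ toFun := fun a => snd Z B (Φ (inr Z A a)), invFun := fun b => snd Z A (Φ.symm (inr Z B b))
            left_inv := fun a => ?_, right_inv := fun b => ?_
            map_add' := fun a a' => by simp only [map_add] }, fun g a => ?_⟩
  · change snd Z A (Φ.symm (inr Z B (snd Z B (Φ (inr Z A a))))) = a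
    rw [e, map_sub, map_sub, h1', e1, AddEquiv.symm_apply_apply, e2, sub_zero]
  · change snd Z B (Φ (inr Z A (snd Z A (Φ.symm (inr Z B b))))) = b
    rw [e, map_sub, map_sub, h1, e1, AddEquiv.apply_symm_apply, e2, sub_zero]
  · exact (congrArg (fun x => snd Z B (Φ x)) (inr_eqv Z A g a)).trans
      ((congrArg (snd Z B) (hΦ g _)).trans (snd_eqv Z B g _))

end EqvE

section Degree
variable {K L : GMod G} {d e : ℤ}

/-- The generator of the trivial module. -/
def one (G : Type) [Group G] : ZZ G := (1 : ℤ)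

/-- Elements of the trivial module are integers. -/
def val (G : Type) [Group G] : ZZ G →+ ℤ := AddMonoidHom.id ℤ

theorem val_one : val G (one G) = 1 := rfl

theorem val_inj : Function.Injective (val G) := Function.injective_id

theorem val_smul (g : G) (z : ZZ G) : val G (g • z) = val G z := rfl

theorem smul_one' (g : G) : g • one G = one G := rfl

theorem eq_val_smul (z : ZZ G) : z = val G z • one G :=
  val_inj (by rw [map_zsmul, val_one]; simp)

theorem inl_add_inr {A B : GMod G} (x : prod A B) : inl A B (fst A B x) + inr A B (snd A B x) = x :=
  Prod.ext (add_zero _) (zero_add _)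

theorem fst_inl {A B : GMod G} (a : A) : fst A B (inl A B a) = a := rfl
theorem fst_inr {A B : GMod G} (b : B) : fst A B (inr A B b) = 0 := rfl
theorem snd_inl {A B : GMod G} (a : A) : snd A B (inl A B a) = 0 := rfl
theorem snd_inr {A B : GMod G} (b : B) : snd A B (inr A B b) = b := rfl

theorem isCoprime_degree [Finite G] {A B : GMod G} (hA : IsProj A) {θ : prod (ZZ G) A ≃+ prod (ZZ G) B}
    (hθ : EqvE θ) (h1 : val G (fst _ _ (θ (inl _ _ (one G)))) = d) :
    IsCoprime d (Nat.card G : ℤ) := by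
  have := Fintype.ofFinite G
  set y := θ.symm (inl _ _ (one G)) with hy
  have hyi : ∀ g : G, g • y = y := fun g => by
    rw [hy, ← hθ.symm, ← inl_eqv, smul_one']
  have hyi' : ∀ g : G, g • snd _ _ y = snd _ _ y := fun g => by
    rw [← snd_eqv, hyi]
  let j : A →+ ZZ G := (fst _ _).comp (θ.toAddMonoidHom.comp (inr _ _))
  have hj : Eqv j := (fst_eqv _ _).comp ((show Eqv θ.toAddMonoidHom from hθ).comp (inr_eqv _ _))
  obtain ⟨ψ, hψ⟩ := hA.isTr_of_left hj
  have h2 : val G (j (snd _ _ y)) = (Nat.card G : ℤ) * val G (ψ (snd _ _ y)) := by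
    rw [← hψ, tr_apply, map_sum]
    simp only [val_smul, hyi', Finset.sum_const, Finset.card_univ, Nat.card_eq_fintype_card,
      nsmul_eq_mul]
  have h3 : val G (fst _ _ (θ y)) = 1 := by rw [hy, AddEquiv.apply_symm_apply, fst_inl, val_one]
  rw [← inl_add_inr y, map_add, map_add, map_add, eq_val_smul (fst _ _ y), map_zsmul, map_zsmul,
    map_zsmul, map_zsmul, h1] at h3
  change _ + val G (j (snd _ _ y)) = 1 at h3
  rw [h2, smul_eq_mul] at h3
  exact ⟨val G (fst _ _ y), val G (ψ (snd _ _ y)), by rw [← h3]; ring⟩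

/-- Degrees of stable isomorphisms `ℤ × K ≅ ℤ`. -/
def Deg (d : ℤ) (K : GMod G) : Prop :=
  ∃ F F' : GMod G, IsFr F ∧ IsFr F' ∧ ∃ θ : prod (ZZ G) (prod K F) ≃+ prod (ZZ G) F',
    EqvE θ ∧ val G (fst _ _ (θ (inl _ _ (one G)))) = d

theorem Deg.of_steq (h : Steq (prod (ZZ G) K) (ZZ G)) : ∃ d, Deg d K := by
  obtain ⟨a, b, h⟩ := h
  obtain ⟨θ, hθ⟩ := (prod_assoc _ _ _).symm.trans h
  exact ⟨_, _, _, ⟨a, .refl _⟩, ⟨b, .refl _⟩, θ, hθ, rfl⟩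

theorem Deg.zero : Deg 1 (Fr G 0) :=
  ⟨Fr G 0, prod (Fr G 0) (Fr G 0), ⟨0, .refl _⟩, (IsFr.prod ⟨0, .refl _⟩ ⟨0, .refl _⟩),
    AddEquiv.refl _, fun _ _ => rfl, rfl⟩

theorem Deg.prod (hK : Deg d K) (hL : Deg e L) : Deg (d * e) (prod K L) := by
  obtain ⟨F, F', hF, hF', θ, hθ, h1⟩ := hK
  obtain ⟨E, E', hE, hE', η, hη, h2⟩ := hL
  let a : GMod.prod (ZZ G) (GMod.prod (GMod.prod K L) (GMod.prod F E)) ≃+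
      GMod.prod (GMod.prod (ZZ G) (GMod.prod K F)) (GMod.prod L E) :=
    { toFun := fun x => ((x.1, (x.2.1.1, x.2.2.1)), (x.2.1.2, x.2.2.2))
      invFun := fun x => (x.1.1, ((x.1.2.1, x.2.1), (x.1.2.2, x.2.2)))
      left_inv := fun _ => rfl, right_inv := fun _ => rfl, map_add' := fun _ _ => rfl }
  let b : GMod.prod (GMod.prod (ZZ G) F') (GMod.prod L E) ≃+
      GMod.prod (GMod.prod (ZZ G) (GMod.prod L E)) F' :=
    { toFun := fun x => ((x.1.1, x.2), x.1.2)
      invFun := fun x => ((x.1.1, x.2), x.1.2)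
      left_inv := fun _ => rfl, right_inv := fun _ => rfl, map_add' := fun _ _ => rfl }
  let c : GMod.prod (GMod.prod (ZZ G) E') F' ≃+ GMod.prod (ZZ G) (GMod.prod E' F') :=
    AddEquiv.prodAssoc
  have ha : EqvE a := fun _ _ => rfl
  have hb : EqvE b := fun _ _ => rfl
  have hc : EqvE c := fun _ _ => rfl
  let θ' := EqvE.pr θ (L.prod E)
  let η' := EqvE.pr η F'
  refine ⟨_, _, hF.prod hE, hE'.prod hF', a.trans (θ'.trans (b.trans (η'.trans c))),
    ha.trans ((hθ.prodr _).trans (hb.trans ((hη.prodr _).trans hc))), ?_⟩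
  change val G (fst _ _ (η (inl _ _ (fst _ _ (θ (inl _ _ (one G))))))) = d * e
  rw [eq_val_smul (fst _ _ (θ _)), h1, map_zsmul, map_zsmul, map_zsmul, map_zsmul, h2, smul_eq_mul]

theorem Deg.pw (hK : Deg d K) (j : ℕ) : Deg (d ^ j) (GMod.pw K j) := by
  induction j with
  | zero => rw [pow_zero]; exact Deg.zero
  | succ j ih => rw [pow_succ]; exact ih.prod hK

theorem Deg.isCoprime [Finite G] (hP : IsProj K) (hK : Deg d K) :
    IsCoprime d (Nat.card G : ℤ) := by
  obtain ⟨F, F', hF, hF', θ, hθ, h1⟩ := hK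
  exact isCoprime_degree (hP.prod hF.isProj) hθ h1

theorem Deg.steq [Finite G] (hK : Deg d K) {k : ℤ} (hk : d + k * Nat.card G = 1) :
    Steq K (Fr G 0) := by
  obtain ⟨F, F', hF, hF', θ, hθ, h1⟩ := hK
  have := Fintype.ofFinite G
  let R : GMod G := Ind G (ZZ G)
  have hR : IsFr R := isFr_ind_triv ℤ
  set x := snd _ _ (θ (inl _ _ (one G))) with hx
  have hxi : ∀ g : G, g • x = x := fun g => by
    rw [hx, ← snd_eqv, ← hθ, ← inl_eqv, smul_one']
  let ℓ : GMod.prod (ZZ G) F' →+ ZZ G := (fst _ _).comp θ.symm.toAddMonoidHom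
  have hℓ : Eqv ℓ := (fst_eqv _ _).comp (show Eqv θ.symm.toAddMonoidHom from hθ.symm)
  let X : ZZ G →+ F' := (zmultiplesHom F' x).comp (val G)
  have hX : Eqv X := fun g z => by
    change val G (g • z) • x = g • (val G z • x)
    rw [val_smul, smul_comm, hxi]
  have hX1 : X (one G) = x := one_zsmul x
  let N : ZZ G →+ R := constMap G
  have hN : Eqv N := fun _ _ => rfl
  let ε : R →+ ZZ G := k • Ind.sum G (ZZ G)
  have hε : Eqv ε := (Ind.sum_eqv G (ZZ G)).zsmul k
  have hεN : val G (ε (N (one G))) = k * Nat.card G := by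
    have h2 : val G (Ind.sum G (ZZ G) (N (one G))) = Nat.card G := by
      change ∑ _ : G, (1 : ℤ) = _
      simp [Nat.card_eq_fintype_card]
    change val G (k • Ind.sum G (ZZ G) (N (one G))) = _
    rw [map_zsmul, h2, smul_eq_mul]
  let a : GMod.prod (ZZ G) (GMod.prod (GMod.prod K F) R) ≃+ GMod.prod (GMod.prod (ZZ G) (GMod.prod K F)) R :=
    AddEquiv.prodAssoc.symm
  let c : GMod.prod (GMod.prod (ZZ G) F') R ≃+ GMod.prod (ZZ G) (GMod.prod F' R) :=
    AddEquiv.prodAssoc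
  have ha : EqvE a := fun _ _ => rfl
  have hc : EqvE c := fun _ _ => rfl
  let S1 : GMod.prod (GMod.prod (ZZ G) F') R ≃+ GMod.prod (GMod.prod (ZZ G) F') R :=
    shear' (N.comp ℓ)
  let S2 : GMod.prod (GMod.prod (ZZ G) F') R ≃+ GMod.prod (GMod.prod (ZZ G) F') R :=
    shear ((inl _ _).comp ε)
  let S3 : GMod.prod (GMod.prod (ZZ G) F') R ≃+ GMod.prod (GMod.prod (ZZ G) F') R :=
    shear' ((-N).comp (fst _ _))
  let S4 : GMod.prod (GMod.prod (ZZ G) F') R ≃+ GMod.prod (GMod.prod (ZZ G) F') R :=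
    EqvE.pr (shear' (-X)) R
  have h1' : fst _ _ (θ (inl _ _ (one G))) = d • one G := (eq_val_smul _).trans (by rw [h1])
  have hy : θ (inl _ _ (one G)) = inl _ _ (d • one G) + inr _ _ x := by
    rw [← h1', hx, inl_add_inr]
  have hl1 : ℓ (θ (inl _ _ (one G))) = one G := by
    change fst _ _ (θ.symm (θ _)) = _
    rw [AddEquiv.symm_apply_apply, fst_inl]
  have hneg : ∀ {A B : GMod G} {f : A →+ B}, Eqv f → Eqv (-f) := fun hf => by
    simpa using hf.zsmul (-1)
  have hiso : Iso (GMod.prod (GMod.prod K F) R) (GMod.prod F' R) := by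
    refine iso_of_fixes (Φ := a.trans ((EqvE.pr θ R).trans (S1.trans (S2.trans (S3.trans
      (S4.trans c)))))) (ha.trans ((hθ.prodr R).trans ((shear'_eqv (hN.comp hℓ)).trans
      ((shear_eqv ((inl_eqv _ _).comp hε)).trans ((shear'_eqv ((hneg hN).comp (fst_eqv _ _))).trans
      (((shear'_eqv (hneg hX)).prodr R).trans hc)))))) fun z => ?_
    rw [eq_val_smul z]
    simp only [map_zsmul]
    congr 1
    set y := θ (inl _ _ (one G)) with hyd
    have e1 : S1 ((y, 0) : GMod.prod (GMod.prod (ZZ G) F') R) = (y, N (one G)) :=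
      Prod.ext rfl ((zero_add _).trans (congrArg N hl1))
    have e2 : S2 (y, N (one G)) = (inl _ _ (one G) + inr _ _ x, N (one G)) := by
      refine Prod.ext ?_ rfl
      change y + inl _ _ (ε (N (one G))) = inl _ _ (one G) + inr _ _ x
      rw [hy, add_right_comm, ← map_add]
      congr 2
      apply val_inj
      rw [map_add, hεN, map_zsmul, val_one, smul_eq_mul, mul_one, hk]
    have e3 : S3 (inl _ _ (one G) + inr _ _ x, N (one G)) = (inl _ _ (one G) + inr _ _ x, 0) := by
      refine Prod.ext rfl ?_
      change N (one G) + -N (fst _ _ (inl _ _ (one G) + inr _ _ x)) = 0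
      rw [map_add, fst_inl, fst_inr, add_zero, add_neg_cancel]
    have e4 : S4 (inl _ _ (one G) + inr _ _ x, 0) = (inl _ _ (one G), 0) := by
      refine Prod.ext (Prod.ext (add_zero _) ?_) rfl
      change snd _ _ (inl _ _ (one G) + inr _ _ x) + - X (fst _ _ (inl _ _ (one G) + inr _ _ x)) = 0
      rw [map_add, map_add, snd_inl, snd_inr, fst_inl, fst_inr, zero_add, add_zero, hX1, add_neg_cancel]
    change c (S4 (S3 (S2 (S1 (y, 0))))) = _
    refine (congrArg (fun t => c (S4 (S3 (S2 t)))) e1).trans ?_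
    refine (congrArg (fun t => c (S4 (S3 t))) e2).trans ?_
    refine (congrArg (fun t => c (S4 t)) e3).trans ?_
    exact congrArg c e4
  refine (Steq.prod_isFr hF).symm.trans ((Steq.prod_isFr hR).symm.trans ?_)
  exact (Steq.of_iso hiso).trans (Steq.of_isFr (hF'.prod hR) ⟨0, .refl _⟩)

end Degree

end GMod

namespace GMod

variable {G : Type} [Group G]

theorem IsProj.res [Finite G] {K : GMod G} (hK : IsProj K) (H : Subgroup G) : IsProj (res H K) := by
  have := Fintype.ofFinite G
  have h : Iso (GMod.res H (Ind G K)) (GMod.res H (GMod.prod (D G K) K)) := (D_prod_iso hK).res H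
  have h1 : IsProj (GMod.res H (Ind G K)) := Ind.isProj (regular_free.res H) (GMod.res H K)
  exact (h1.of_iso h.symm).of_retract (A := GMod.res H K) (i := inr (GMod.res H (D G K)) (GMod.res H K))
    (r := snd (GMod.res H (D G K)) (GMod.res H K)) (inr_eqv _ _) (snd_eqv _ _) rfl

theorem Steq.res [Finite G] (H : Subgroup G) {A B : GMod G} : Steq A B → Steq (res H A) (res H B) := by
  rintro ⟨a, b, h⟩
  refine (Steq.prod_isFr (res_Fr H a)).symm.trans (Steq.trans ?_ (Steq.prod_isFr (res_Fr H b)))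
  exact .of_iso (show Iso (GMod.res H (GMod.prod A (Fr G a))) (GMod.res H (GMod.prod B (Fr G b))) from h.res H)

theorem pw_Fr (a j : ℕ) : Iso (pw (Fr G a) j) (Fr G (j * a)) := by
  induction j with
  | zero => rw [zero_mul]; exact .refl _
  | succ j ih => rw [Nat.succ_mul]; exact (ih.prod (.refl _)).trans (Fr.add _ _)

theorem Iso.pw {A B : GMod G} (h : Iso A B) (j : ℕ) : Iso (pw A j) (pw B j) := by
  induction j with
  | zero => exact .refl _
  | succ j ih => exact ih.prod h

theorem pw_prod (A B : GMod G) (j : ℕ) : Iso (pw (prod A B) j) (prod (pw A j) (pw B j)) := by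
  induction j with
  | zero => exact (prod_Fr_zero _).symm
  | succ j ih => exact (ih.prod (.refl _)).trans (prod_prod_comm _ _ _ _)

theorem res_Fr_zero (H : Subgroup G) : Iso (res H (Fr G 0)) (Fr H 0) := by
  have := Fr.zero_subsingleton (G := H)
  have : Subsingleton (res H (Fr G 0)) := Fr.zero_subsingleton (G := G)
  exact ⟨{ toFun := fun _ => 0, invFun := fun _ => 0, left_inv := fun _ => Subsingleton.elim _ _,
           right_inv := fun _ => Subsingleton.elim _ _, map_add' := fun _ _ => (zero_add _).symm },
         fun g a => (smul_zero g).symm⟩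

theorem res_pw (H : Subgroup G) (K : GMod G) (j : ℕ) : Iso (res H (pw K j)) (pw (res H K) j) := by
  induction j with
  | zero => exact res_Fr_zero H
  | succ j ih => exact (show Iso (res H (prod (pw K j) K)) _ from ih.prod (Iso.refl (res H K)))

theorem finrank_Fr [Finite G] (a : ℕ) : Module.finrank ℤ (Fr G a) = Nat.card G * a := by
  have := Fintype.ofFinite G
  change Module.finrank ℤ (G → Fin a → ℤ) = _
  rw [Module.finrank_pi_fintype]
  simp [Nat.card_eq_fintype_card]

theorem res_Fr_index [Finite G] (H : Subgroup G) (a : ℕ) :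
    Iso (res H (Fr G (Nat.card H * a))) (Fr H (Nat.card G * a)) := by
  obtain ⟨r, e, he⟩ := res_Fr H (Nat.card H * a)
  have h1 : Module.finrank ℤ (Fr G (Nat.card H * a)) = Module.finrank ℤ (Fr H r) :=
    e.toIntLinearEquiv.finrank_eq
  rw [finrank_Fr, finrank_Fr] at h1
  have h2 : Nat.card G * a = r := by
    have : 0 < Nat.card H := Nat.card_pos
    apply Nat.eq_of_mul_eq_mul_left this
    rw [← h1]; ring
  rw [h2]
  exact ⟨e, he⟩

section Frobenius

theorem Ind.iso_of_res (H : Subgroup G) {A B : GMod G} (h : Iso (res H A) (res H B)) :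
    Iso (Ind (G ⧸ H) A) (Ind (G ⧸ H) B) := by
  obtain ⟨e, he⟩ := h
  have key : ∀ (e : A ≃+ B), (∀ (c : H) (a : A), e ((c : G) • a) = (c : G) • e a) → 
      ∀ (g : G) (a : A), g • e (g⁻¹ • a) = (g : G ⧸ H).out • e ((g : G ⧸ H).out⁻¹ • a) := by
    intro e he g a
    obtain ⟨c, hc⟩ := QuotientGroup.mk_out_eq_mul H g
    rw [hc, mul_smul, mul_inv_rev, mul_smul, ← Subgroup.coe_inv, he, Subgroup.coe_inv, smul_inv_smul]
  have he1 : ∀ (c : H) (a : A), (show A ≃+ B from e) ((c : G) • a) = (c : G) • (show A ≃+ B from e) a := he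
  generalize (show A ≃+ B from e) = e' at he1
  have he2 : ∀ (c : H) (a : B), e'.symm ((c : G) • a) = (c : G) • e'.symm a := fun c a =>
    e'.injective (by rw [he1]; simp)
  refine ⟨{ toFun := fun f q => q.out • e' (q.out⁻¹ • (f q : A))
            invFun := fun f q => q.out • e'.symm (q.out⁻¹ • (f q : B))
            left_inv := fun f => ?_
            right_inv := fun f => ?_
            map_add' := fun f f' => ?_ }, fun g f => ?_⟩
  · funext q; simp
  · funext q; simp
  · funext q
    change q.out • e' (q.out⁻¹ • (f q + f' q : A)) = q.out • e' (q.out⁻¹ • (f q : A)) + q.out • e' (q.out⁻¹ • (f' q : A))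
    simp
  · funext q
    change q.out • e' (q.out⁻¹ • g • (f (g⁻¹ • q) : A)) = g • (g⁻¹ • q).out • e' ((g⁻¹ • q).out⁻¹ • (f (g⁻¹ • q) : A))
    have h1 : ((g⁻¹ * q.out : G) : G ⧸ H) = g⁻¹ • q := by
      conv_rhs => rw [← q.out_eq']
      rfl
    have h2 := key e' he1 (g⁻¹ * q.out) (f (g⁻¹ • q) : A)
    rw [h1] at h2
    rw [← h2]
    simp [mul_smul]

theorem Ind.comm (Y X : Type) [MulAction G Y] [MulAction G X] (A : GMod G) :
    Iso (Ind Y (Ind X A)) (Ind X (Ind Y A)) :=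
  ⟨{ toFun := fun f x y => f y x, invFun := fun f y x => f x y, left_inv := fun _ => rfl
     right_inv := fun _ => rfl, map_add' := fun _ _ => rfl }, fun _ _ => rfl⟩

theorem Ind.isFr_Fr [Finite G] (Y : Type) [Finite Y] [MulAction G Y] (a : ℕ) : IsFr (Ind Y (Fr G a)) :=
  (Ind.isFr regular_free (Ind.lat (triv_lat (Fin a → ℤ)))).of_iso (Ind.comm Y G _)

theorem Steq.ind_of_res [Finite G] (H : Subgroup G) {P : GMod G}
    (h : Steq (GMod.res H P) (Fr H 0)) : Steq (Ind (G ⧸ H) (GMod.pw P (Nat.card G))) (Fr G 0) := by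
  obtain ⟨a, b, h⟩ := h
  have h1 : Iso (GMod.prod (GMod.res H P) (Fr H a)) (Fr H b) :=
    h.trans ((prod_comm _ _).trans (prod_Fr_zero _))
  have h2 : Iso (GMod.res H (GMod.prod (GMod.pw P (Nat.card G)) (Fr G (Nat.card H * a))))
      (GMod.res H (Fr G (Nat.card H * b))) := by
    refine Iso.trans ?_ (res_Fr_index H b).symm
    refine (show Iso (GMod.res H (GMod.prod (GMod.pw P (Nat.card G)) (Fr G (Nat.card H * a)))) _ from
      (res_pw H P (Nat.card G)).prod (res_Fr_index H a)).trans ?_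
    refine ((Iso.refl _).prod (pw_Fr a _).symm).trans ?_
    exact (pw_prod _ _ _).symm.trans ((h1.pw _).trans (pw_Fr b _))
  have h3 := (Ind.prod_iso _ _ _).symm.trans (Ind.iso_of_res H h2)
  refine (Steq.prod_isFr (Ind.isFr_Fr (G ⧸ H) (Nat.card H * a))).symm.trans ((Steq.of_iso h3).trans ?_)
  exact .of_isFr (Ind.isFr_Fr _ _) ⟨0, .refl _⟩

end Frobenius

theorem exists_period_cyclic [Finite G] {Y : Type} [Fintype Y] [MulAction G Y] [Nonempty Y]
    (hY : FreeAct G Y) (hcyc : ∀ A : Subgroup G, (∀ a b : A, a * b = b * a) → IsCyclic A) :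
    ∃ n : ℕ, 0 < n ∧ Even n ∧ ∃ K : GMod G, Lat K ∧ IsProj K ∧
      Steq (Dn Y n (ZZ G)) (prod (ZZ G) K) ∧
      ∀ C : Subgroup G, IsCyclic C → Steq (Ind (G ⧸ C) K) (Fr G 0) := by
  obtain ⟨n, hn, hev, K, hl, hP, hK⟩ := exists_period_complement hY hcyc
  have hK' : Steq (Dn Y n (ZZ G)) (prod (ZZ G) K) :=
    (Steq.prod_isFr ⟨1, .refl _⟩).symm.trans (.of_iso hK)
  set m := Nat.totient (Nat.card G) with hm
  have hG : 0 < Nat.card G := Nat.card_pos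
  have hm0 : 0 < m := Nat.totient_pos.2 hG
  have h1 := Steq.Dn_mul hY hev hl hP hK' m
  have h2 := Steq.Dn_mul hY (hev.mul_right m) (pw.lat hl m) (pw.isProj hP m) h1 (Nat.card G)
  refine ⟨n * m * Nat.card G, by positivity, (hev.mul_right m).mul_right _, _,
    pw.lat (pw.lat hl m) _, pw.isProj (pw.isProj hP m) _, h2, fun C hC => ?_⟩
  refine Steq.ind_of_res C ?_
  have h3 : Steq (GMod.prod (ZZ C) (GMod.res C K)) (ZZ C) :=
    (hK'.res C).symm.trans (by
      rw [res_Dn]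
      exact Steq.Dn_ZZ (G := C) (hY.res C) hev)
  obtain ⟨d, hd⟩ := Deg.of_steq h3
  have h4 : IsCoprime d (Nat.card C : ℤ) := hd.isCoprime (hP.res C)
  refine (Steq.of_iso (res_pw C K m)).trans ?_
  have h5 : ∃ k : ℤ, d ^ m + k * Nat.card C = 1 := by
    obtain ⟨u, hu⟩ := (ZMod.coe_int_isUnit_iff_isCoprime d (Nat.card C)).2 h4.symm
    have h6 : Nat.totient (Nat.card C) ∣ m := Nat.totient_dvd_of_dvd C.card_subgroup_dvd_card
    have h7 : u ^ m = 1 := by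
      obtain ⟨r, hr⟩ := h6
      rw [hr, pow_mul, ZMod.pow_totient, one_pow]
    have h8 : ((d ^ m : ℤ) : ZMod (Nat.card C)) = ((1 : ℤ) : ZMod (Nat.card C)) := by
      rw [Int.cast_pow, ← hu, ← Units.val_pow_eq_pow_val, h7]; simp
    obtain ⟨k, hk⟩ := (ZMod.intCast_eq_intCast_iff_dvd_sub _ _ _).1 h8
    exact ⟨k, by linear_combination -hk⟩
  obtain ⟨k, hk⟩ := h5
  exact (hd.pw m).steq hk

end GMod

namespace GMod

variable {G : Type} [Group G]

/-- The tensor product with diagonal action. -/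
@[reducible] noncomputable def tensAct (A B : GMod G) :
    DistribMulAction G (TensorProduct ℤ A B) where
  smul g x := TensorProduct.map (A.sm g).toIntLinearMap (B.sm g).toIntLinearMap x
  one_smul x := by
    change TensorProduct.map _ _ x = x
    induction x using TensorProduct.induction_on with
    | zero => simp
    | tmul a b => simp
    | add x y hx hy => rw [map_add, hx, hy]
  mul_smul g h x := by
    change TensorProduct.map _ _ x = TensorProduct.map _ _ (TensorProduct.map _ _ x)
    induction x using TensorProduct.induction_on with
    | zero => simp
    | tmul a b => simp [mul_smul]
    | add x y hx hy => rw [map_add, hx, hy, ← map_add, ← map_add]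
  smul_zero g := map_zero (TensorProduct.map _ _)
  smul_add g x y := map_add (TensorProduct.map _ _) x y

noncomputable def tens (A B : GMod G) : GMod G :=
  { V := TensorProduct ℤ A B, act := tensAct A B }

section tens
variable {A B A' B' A'' B'' : GMod G}

/-- Pure tensors. -/
noncomputable def pt (A B : GMod G) (a : A) (b : B) : tens A B := TensorProduct.tmul ℤ a b

theorem pt_smul (g : G) (a : A) (b : B) : g • pt A B a b = pt A B (g • a) (g • b) :=
  TensorProduct.map_tmul _ _ a b

theorem tens.hom_ext {C : Type} [AddCommGroup C] {f h : tens A B →+ C}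
    (H : ∀ a b, f (pt A B a b) = h (pt A B a b)) : f = h := by
  have : (AddMonoidHom.toIntLinearMap (M := TensorProduct ℤ A B) f) =
      AddMonoidHom.toIntLinearMap (M := TensorProduct ℤ A B) h :=
    TensorProduct.ext' H
  exact AddMonoidHom.ext fun x => LinearMap.congr_fun this x

/-- Functoriality of the tensor product. -/
noncomputable def tm (f : A →+ A') (h : B →+ B') : tens A B →+ tens A' B' :=
  (TensorProduct.map f.toIntLinearMap h.toIntLinearMap).toAddMonoidHom

theorem tm_pt (f : A →+ A') (h : B →+ B') (a : A) (b : B) :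
    tm f h (pt A B a b) = pt A' B' (f a) (h b) := TensorProduct.map_tmul _ _ a b

theorem pt_add' (a a' : A) (b : B) : pt A B (a + a') b = pt A B a b + pt A B a' b :=
  TensorProduct.add_tmul a a' b

theorem pt_zsmul (n : ℤ) (a : A) (b : B) : pt A B a (n • b) = n • pt A B a b :=
  TensorProduct.tmul_smul n a b

theorem pt_zsmul' (n : ℤ) (a : A) (b : B) : pt A B (n • a) b = n • pt A B a b :=
  (TensorProduct.smul_tmul' n a b).symm

theorem tens.eqv_of {C : GMod G} {f : tens A B →+ C}
    (H : ∀ (g : G) a b, f (pt A B (g • a) (g • b)) = g • f (pt A B a b)) : Eqv f := by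
  intro g
  have : f.comp ((tens A B).sm g) = (C.sm g).comp f := by
    refine tens.hom_ext fun a b => ?_
    simp only [AddMonoidHom.comp_apply, sm_apply, pt_smul, H]
  exact fun x => DFunLike.congr_fun this x

theorem tm_comp (f : A →+ A') (h : B →+ B') (f' : A' →+ A'') (h' : B' →+ B'') :
    (tm f' h').comp (tm f h) = tm (f'.comp f) (h'.comp h) :=
  tens.hom_ext fun a b => by simp only [AddMonoidHom.comp_apply, tm_pt]

theorem tm_tm (f : A →+ A') (h : B →+ B') (f' : A' →+ A'') (h' : B' →+ B'') (x : tens A B) :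
    tm f' h' (tm f h x) = tm (f'.comp f) (h'.comp h) x := DFunLike.congr_fun (tm_comp f h f' h') x

theorem tm_id : tm (AddMonoidHom.id A) (AddMonoidHom.id B) = AddMonoidHom.id (tens A B) :=
  tens.hom_ext fun a b => by simp only [tm_pt, AddMonoidHom.id_apply]

theorem tm_add_left (f f' : A →+ A') (h : B →+ B') : tm (f + f') h = tm f h + tm f' h :=
  tens.hom_ext fun a b => by simp only [tm_pt, AddMonoidHom.add_apply, pt_add']

theorem tm_zsmul_left (n : ℤ) (f : A →+ A') (h : B →+ B') : tm (n • f) h = n • tm f h :=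
  tens.hom_ext fun a b => by simp only [tm_pt, AddMonoidHom.smul_apply, pt_zsmul']

theorem tm_zsmul_right (n : ℤ) (f : A →+ A') (h : B →+ B') : tm f (n • h) = n • tm f h :=
  tens.hom_ext fun a b => by simp only [tm_pt, AddMonoidHom.smul_apply, pt_zsmul]

theorem tm_eqv {f : A →+ A'} {h : B →+ B'} (hf : Eqv f) (hh : Eqv h) : Eqv (tm f h) :=
  tens.eqv_of fun g a b => by rw [tm_pt, tm_pt, pt_smul, hf, hh]

theorem tens.lat (hA : Lat A) (hB : Lat B) : Lat (tens A B) := by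
  have := hA.1; have := hA.2; have := hB.1; have := hB.2
  have h1 : @Module.Free ℤ (TensorProduct ℤ A B) _ _ TensorProduct.leftModule :=
    Module.Free.tensor ..
  have h2 : @Module.Finite ℤ (TensorProduct ℤ A B) _ _ TensorProduct.leftModule :=
    Module.Finite.tensorProduct ..
  have e : (TensorProduct.leftModule : Module ℤ (TensorProduct ℤ A B)) =
    AddCommGroup.toIntModule (TensorProduct ℤ A B) := Subsingleton.elim _ _
  rw [e] at h1 h2
  exact ⟨h1, h2⟩

theorem tens.isProj [Finite G] (hB : IsProj B) : IsProj (tens A B) := by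
  cases nonempty_fintype G
  obtain ⟨φ, hφ⟩ := hB
  refine ⟨tm (AddMonoidHom.id A) φ, ?_⟩
  refine tens.hom_ext fun a b => ?_
  rw [tr_apply]
  simp only [pt_smul, tm_pt, AddMonoidHom.id_apply, smul_inv_smul]
  have h1 : b = ∑ g : G, g • φ (g⁻¹ • b) := by
    rw [← tr_apply, hφ]; rfl
  have h2 : ∀ s : Finset G, ∀ u : G → B, pt A B a (∑ g ∈ s, u g) = ∑ g ∈ s, pt A B a (u g) :=
    fun s u => TensorProduct.tmul_sum a s u
  conv_rhs => rw [h1, h2]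

/-- An additive equivalence built from mutually inverse maps. -/
theorem Iso.of_inverse {A B : GMod G} (f : A →+ B) (h : B →+ A) (hf : Eqv f)
    (h1 : h.comp f = AddMonoidHom.id A) (h2 : f.comp h = AddMonoidHom.id B) : Iso A B :=
  ⟨AddMonoidHom.toAddEquiv f h h1 h2, hf⟩

theorem Iso.tens : Iso A A' → Iso B B' → Iso (tens A B) (tens A' B') := by
  rintro ⟨e, he⟩ ⟨f, hf⟩
  refine Iso.of_inverse (tm e.toAddMonoidHom f.toAddMonoidHom)
    (tm e.symm.toAddMonoidHom f.symm.toAddMonoidHom) (tm_eqv he hf) ?_ ?_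
  · rw [tm_comp, ← tm_id]; congr 1 <;> ext <;> simp
  · rw [tm_comp, ← tm_id]; congr 1 <;> ext <;> simp

theorem tens_comm (A B : GMod G) : Iso (tens A B) (tens B A) := by
  let e := TensorProduct.comm ℤ A B
  refine ⟨e.toAddEquiv, ?_⟩
  exact tens.eqv_of (C := tens B A) (f := e.toAddEquiv.toAddMonoidHom) fun g a b =>
    (pt_smul (A := B) (B := A) g b a).symm

theorem tens_ZZ (A : GMod G) : Iso (tens A (ZZ G)) A := by
  let e := TensorProduct.rid ℤ A
  refine ⟨e.toAddEquiv, ?_⟩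
  refine tens.eqv_of (B := ZZ G) (C := A) (f := e.toAddEquiv.toAddMonoidHom) fun g a b => ?_
  refine (TensorProduct.rid_tmul (R := ℤ) (M := A) (g • a) b).trans ?_
  refine Eq.trans ?_ (congrArg (g • ·) (TensorProduct.rid_tmul (R := ℤ) (M := A) a b)).symm
  exact (map_zsmul (DistribSMul.toAddMonoidHom A g) _ _).symm

theorem tens_Ind (Y : Type) [Finite Y] [MulAction G Y] (A B : GMod G) :
    Iso (tens A (Ind Y B)) (Ind Y (tens A B)) := by
  classical
  cases nonempty_fintype Y
  let e := TensorProduct.piRight ℤ ℤ A (fun _ : Y => B)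
  refine ⟨e.toAddEquiv, ?_⟩
  refine tens.eqv_of (B := Ind Y B) (C := Ind Y (tens A B))
    (f := e.toAddEquiv.toAddMonoidHom) fun g a b => ?_
  funext y
  exact (pt_smul (A := A) (B := B) g a (b (g⁻¹ • y))).symm

theorem tens_prod (A B C : GMod G) : Iso (tens A (prod B C)) (prod (tens A B) (tens A C)) := by
  let e := TensorProduct.prodRight ℤ ℤ A B C
  refine ⟨e.toAddEquiv, ?_⟩
  refine tens.eqv_of (B := prod B C) (C := prod (tens A B) (tens A C))
    (f := e.toAddEquiv.toAddMonoidHom) fun g a b => ?_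
  exact Prod.ext (pt_smul g a b.1).symm (pt_smul g a b.2).symm

theorem prod_tens (A B C : GMod G) : Iso (tens (prod A B) C) (prod (tens A C) (tens B C)) :=
  (tens_comm _ _).trans ((tens_prod _ _ _).trans ((tens_comm _ _).prod (tens_comm _ _)))

theorem tens_isFr [Finite G] (hA : Lat A) (hB : IsFr B) : IsFr (tens A B) := by
  obtain ⟨a, h⟩ := hB
  have h1 := ((Iso.refl A).tens h).trans (tens_Ind G A (triv G (Fin a → ℤ)))
  exact (Ind.isFr regular_free (tens.lat hA (triv_lat _))).of_iso h1

theorem SES.retract {A F B : GMod G} {i : A →+ F} {p : F →+ B} (h : SES i p) :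
    ∃ (r : F →+ A) (s : B →+ F), r.comp i = AddMonoidHom.id A ∧ p.comp s = AddMonoidHom.id B ∧
      i.comp r + s.comp p = AddMonoidHom.id F := by
  obtain ⟨s, hs⟩ := h.split
  have hs' : ∀ b, p (s b) = b := fun b => DFunLike.congr_fun hs b
  obtain ⟨r, hr, -⟩ := h.factor (AddMonoidHom.id F - s.comp p) (by ext x; simp [hs'])
  have hr' : ∀ x, i (r x) = x - s (p x) := fun x => DFunLike.congr_fun hr x
  refine ⟨r, s, ?_, hs, by rw [hr]; simp⟩
  ext a
  apply h.inj
  simp [hr', h.pi]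

theorem SES.tens {A F B : GMod G} {i : A →+ F} {p : F →+ B} (h : SES i p) (K : GMod G) :
    SES (tm i (AddMonoidHom.id K)) (tm p (AddMonoidHom.id K)) := by
  obtain ⟨r, s, h1, h2, h3⟩ := h.retract
  have e1 : ∀ x, tm r (AddMonoidHom.id K) (tm i (AddMonoidHom.id K) x) = x := fun x => by
    rw [tm_tm, h1]; exact DFunLike.congr_fun tm_id x
  have e3 : ∀ x, tm i (AddMonoidHom.id K) (tm r (AddMonoidHom.id K) x) +
      tm s (AddMonoidHom.id K) (tm p (AddMonoidHom.id K) x) = x := fun x => by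
    rw [tm_tm, tm_tm, ← AddMonoidHom.add_apply, ← tm_add_left, h3]
    exact DFunLike.congr_fun tm_id x
  refine ⟨tm_eqv h.ei (Eqv.id _), tm_eqv h.ep (Eqv.id _),
    Function.LeftInverse.injective e1, fun b => ⟨fun hb => ⟨tm r (AddMonoidHom.id K) b, ?_⟩, ?_⟩,
    ⟨tm s (AddMonoidHom.id K), ?_⟩⟩
  · have := e3 b
    rwa [hb, map_zero, add_zero] at this
  · rintro ⟨a, rfl⟩
    rw [tm_tm, h.comp_eq_zero]
    have h0 : tm (0 : A →+ B) ((AddMonoidHom.id K).comp (AddMonoidHom.id K)) = 0 := by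
      have := tm_zsmul_left 0 (0 : A →+ B) ((AddMonoidHom.id K).comp (AddMonoidHom.id K))
      rwa [zero_smul, zero_smul] at this
    rw [h0]; rfl
  · rw [tm_comp, h2]; exact tm_id

end tens

section psi
variable [Finite G] {K : GMod G}

/-- The class of the tensor product with a fixed projective lattice. -/
noncomputable def psi (K X : GMod G) : Kt G := cls (tens X K)

theorem psi_iso {A B : GMod G} (h : Iso A B) : psi K A = psi K B :=
  cls_iso (h.tens (Iso.refl K))

theorem psi_ses (hK : Lat K) (hK' : IsProj K) {A B C : GMod G} {i : A →+ B} {p : B →+ C}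
    (h : SES i p) (hA : Lat A) (hC : Lat C) : psi K B = psi K A + psi K C :=
  cls_ses (h.tens K) (tens.lat hA hK) (tens.isProj hK') (tens.lat hC hK) (tens.isProj hK')

theorem psi_prod (hK : Lat K) (hK' : IsProj K) {A B : GMod G} (hA : Lat A) (hB : Lat B) :
    psi K (prod A B) = psi K A + psi K B :=
  (cls_iso (prod_tens A B K)).trans
    (cls_prod (tens.lat hA hK) (tens.isProj hK') (tens.lat hB hK) (tens.isProj hK'))

theorem psi_ZZ : psi K (ZZ G) = cls K :=
  cls_iso ((tens_comm _ _).trans (tens_ZZ K))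

theorem psi_ind {Y : Type} [Finite Y] [MulAction G Y] (hK : Lat K)
    (h : Steq (Ind Y K) (Fr G 0)) {F : GMod G} (hF : Lat F) (hI : IsProj (Ind Y K)) :
    psi K (tens F (Ind Y (ZZ G))) = 0 := by
  have i1 : Iso (tens (tens F (Ind Y (ZZ G))) K) (tens F (Ind Y K)) := by
    refine Iso.trans (((tens_Ind Y F (ZZ G)).trans (Ind.iso (tens_ZZ F))).tens (Iso.refl K)) ?_
    refine (tens_comm _ _).trans ((tens_Ind Y K F).trans ?_)
    exact (Ind.iso (tens_comm K F)).trans (tens_Ind Y F K).symm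
  refine (cls_iso i1).trans ?_
  obtain ⟨a, b, e⟩ := h
  have hl := tens.lat hF (Ind.lat (Y := Y) hK)
  have hp : IsProj (tens F (Ind Y K)) := tens.isProj hI
  have hfa : IsFr (tens F (Fr G a)) := tens_isFr hF ⟨a, .refl _⟩
  have h1 := cls_prod hl hp hfa.lat hfa.isProj
  rw [cls_isFr hfa, add_zero] at h1
  rw [← h1, ← cls_iso (tens_prod _ _ _), cls_iso ((Iso.refl F).tens e)]
  exact cls_isFr (tens_isFr hF (IsFr.prod ⟨0, .refl _⟩ ⟨b, .refl _⟩))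

end psi

end GMod

namespace GMod

variable {G : Type} [Group G]

theorem Lat.cancel {A : GMod G} (hA : Lat A) {n : ℤ} (hn : n ≠ 0) {a b : A} (h : n • a = n • b) :
    a = b := by
  have := hA.1
  exact smul_right_injective A hn h

/-- Mutually inverse maps up to the factor `n`. -/
structure EmbMaps (n : ℤ) {L F : GMod G} (i : L →+ F) (b : F →+ L) : Prop where
  ei : Eqv i
  eb : Eqv b
  ib : ∀ x, i (b x) = n • x
  bi : ∀ x, b (i x) = n • x

theorem EmbMaps.swap {n : ℤ} {L F : GMod G} {i : L →+ F} {b : F →+ L} (h : EmbMaps n i b) :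
    EmbMaps n b i := ⟨h.eb, h.ei, h.bi, h.ib⟩

theorem EmbMaps.inj {n : ℤ} {L F : GMod G} {i : L →+ F} {b : F →+ L} (h : EmbMaps n i b)
    (hn : n ≠ 0) (hL : Lat L) : Function.Injective i := fun x y e => by
  refine hL.cancel hn ?_
  rw [← h.bi, ← h.bi, e]

def Emb (n : ℕ) (L F : GMod G) : Prop := ∃ i b, EmbMaps (n : ℤ) (L := L) (F := F) i b

theorem Emb.iso {L F : GMod G} (h : Emb 1 L F) : Iso L F := by
  obtain ⟨i, b, h⟩ := h
  exact Iso.of_inverse i b h.ei (by ext x; simp [h.bi]) (by ext x; simp [h.ib])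

theorem Emb.split {m n : ℕ} (hm : m ≠ 0) (hn : n ≠ 0) {L F : GMod G} (hL : Lat L) (hF : Lat F)
    (h : Emb (m * n) L F) : ∃ M, Lat M ∧ Emb m L M ∧ Emb n M F := by
  obtain ⟨i, b, h⟩ := h
  have hmn : ((m * n : ℕ) : ℤ) ≠ 0 := by exact_mod_cast Nat.mul_ne_zero hm hn
  have hi := h.inj hmn hL
  let S : AddSubgroup F :=
    { carrier := {x | ∃ l y, x = i l + (n : ℤ) • y}
      zero_mem' := ⟨0, 0, by simp⟩
      add_mem' := by
        rintro _ _ ⟨l, y, rfl⟩ ⟨l', y', rfl⟩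
        exact ⟨l + l', y + y', by rw [map_add, smul_add]; abel⟩
      neg_mem' := by
        rintro _ ⟨l, y, rfl⟩
        exact ⟨-l, -y, by rw [map_neg, smul_neg]; abel⟩ }
  have hsm : ∀ (g : G) (k : ℤ) (y : F), g • (k • y) = k • g • y := fun g k y =>
    map_zsmul (F.sm g) k y
  have hS : ∀ (g : G), ∀ a ∈ S, g • a ∈ S := by
    rintro g _ ⟨l, y, rfl⟩
    exact ⟨g • l, g • y, by rw [smul_add, h.ei, hsm]⟩
  let M := sub F S hS
  let ι : M →+ F := sub.incl F S hS
  have hι : Function.Injective ι := sub.incl_inj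
  have eι : Eqv ι := sub.incl_eqv
  have h1 : ∀ l, ∃ x : M, ι x = i l := fun l => ⟨⟨i l, l, 0, by simp⟩, rfl⟩
  have h2 : ∀ x : M, ∃ l, i l = (m : ℤ) • ι x := by
    rintro ⟨x, l, y, rfl⟩
    refine ⟨(m : ℤ) • l + b y, ?_⟩
    rw [map_add, map_zsmul, h.ib]
    change _ = (m : ℤ) • (i l + (n : ℤ) • y)
    rw [smul_add, smul_smul, Nat.cast_mul]
  have h3 : ∀ y : F, ∃ x : M, ι x = (n : ℤ) • y := fun y => ⟨⟨(n : ℤ) • y, 0, y, by simp⟩, rfl⟩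
  choose u hu using h1
  choose v hv using h2
  choose w hw using h3
  refine ⟨M, hF.sub, ⟨AddMonoidHom.mk' u fun x y => hι (by simp [hu]),
    AddMonoidHom.mk' v fun x y => hi (by simp [hv]), ?_, ?_, ?_, ?_⟩,
    ⟨ι, AddMonoidHom.mk' w fun x y => hι (by simp [hw]), eι, ?_, hw, ?_⟩⟩
  · intro g x
    apply hι
    change ι (u _) = ι (g • u x)
    rw [hu, eι, hu, h.ei]
  · intro g x
    apply hi
    change i (v _) = i (g • v x)
    rw [hv, h.ei, hv, hsm, eι]
  · intro x
    apply hι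
    change ι (u (v x)) = _
    rw [hu, hv, map_zsmul]
  · intro x
    apply hi
    change i (v (u x)) = _
    rw [hv, hu, map_zsmul]
  · intro g x
    apply hι
    change ι (w _) = ι (g • w x)
    rw [hw, eι, hw, hsm]
  · intro x
    apply hι
    change ι (w (ι x)) = _
    rw [hw, map_zsmul]

theorem Emb.chain {Q : GMod G → GMod G → Prop}
    (h1 : ∀ L F, Lat L → Lat F → Iso L F → Q L F)
    (h2 : ∀ L M F, Lat L → Lat M → Lat F → Q L M → Q M F → Q L F)
    (h3 : ∀ p : ℕ, p.Prime → ∀ L F, Lat L → Lat F → Emb p L F → Q L F)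
    {n : ℕ} (hn : n ≠ 0) {L F : GMod G} (hL : Lat L) (hF : Lat F) (h : Emb n L F) : Q L F := by
  induction n using Nat.recOnMul generalizing L F with
  | zero => exact absurd rfl hn
  | one => exact h1 _ _ hL hF h.iso
  | prime p hp => exact h3 p hp _ _ hL hF h
  | mul a b ha hb =>
    obtain ⟨ha0, hb0⟩ := Nat.mul_ne_zero_iff.1 hn
    obtain ⟨M, hM, e1, e2⟩ := h.split ha0 hb0 hL hF
    exact h2 _ _ _ hL hM hF (ha ha0 hL hM e1) (hb hb0 hM hF e2)

theorem exists_retraction_of_prime {p : ℕ} (hp : p.Prime) {A B : Type} [AddCommGroup A]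
    [AddCommGroup B] (hA : ∀ x : A, p • x = 0) (hB : ∀ x : B, p • x = 0) (j : A →+ B)
    (hj : Function.Injective j) : ∃ r : B →+ A, ∀ x, r (j x) = x := by
  have : Fact p.Prime := ⟨hp⟩
  let : Module (ZMod p) A := AddCommGroup.zmodModule hA
  let : Module (ZMod p) B := AddCommGroup.zmodModule hB
  obtain ⟨r, hr⟩ := LinearMap.exists_leftInverse_of_injective (j.toZModLinearMap p)
    (LinearMap.ker_eq_bot.2 hj)
  exact ⟨r.toAddMonoidHom, fun x => LinearMap.congr_fun hr x⟩

theorem EmbMaps.exists_split {p : ℕ} (hp : p.Prime) {L F : GMod G} (hL : Lat L) (hF : Lat F)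
    {i : L →+ F} {b : F →+ L} (h : EmbMaps (p : ℤ) i b) :
    ∃ (u : F →+ L) (k : L →+ F), ∀ x, u (i x) = x + b (k x) := by
  have hp0 : (p : ℤ) ≠ 0 := by exact_mod_cast hp.ne_zero
  have hi := h.inj hp0 hL
  have hb := h.swap.inj hp0 hF
  let P : F →+ F := (p : ℤ) • AddMonoidHom.id F
  have hP : ∀ x, P x = (p : ℤ) • x := fun x => rfl
  let QF := F ⧸ P.range
  let QL := L ⧸ b.range
  let mF : F →+ QF := QuotientAddGroup.mk' _
  let mL : L →+ QL := QuotientAddGroup.mk' _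
  have mL0 : ∀ l, mL l = 0 ↔ ∃ f, b f = l := fun l =>
    (QuotientAddGroup.eq_zero_iff l).trans AddMonoidHom.mem_range
  have mF0 : ∀ l, mF l = 0 ↔ ∃ f, P f = l := fun l =>
    (QuotientAddGroup.eq_zero_iff l).trans AddMonoidHom.mem_range
  have sF : Function.Surjective mF := QuotientAddGroup.mk'_surjective _
  have sL : Function.Surjective mL := QuotientAddGroup.mk'_surjective _
  have tF : ∀ x : QF, p • x = 0 := fun x => by
    obtain ⟨x, rfl⟩ := sF x
    rw [← map_nsmul, mF0]
    exact ⟨x, by rw [hP]; exact natCast_zsmul x p⟩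
  have tL : ∀ x : QL, p • x = 0 := fun x => by
    obtain ⟨x, rfl⟩ := sL x
    rw [← map_nsmul, mL0]
    exact ⟨i x, by rw [h.bi]; exact natCast_zsmul x p⟩
  let j : QL →+ QF := QuotientAddGroup.map b.range P.range i (by
    rintro _ ⟨f, rfl⟩
    exact ⟨f, by rw [h.ib]; rfl⟩)
  have hj : ∀ l, j (mL l) = mF (i l) := fun l => rfl
  have jinj : Function.Injective j := by
    rw [injective_iff_map_eq_zero]
    intro x hx
    obtain ⟨x, rfl⟩ := sL x
    rw [hj, mF0] at hx
    obtain ⟨f, hf⟩ := hx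
    rw [mL0]
    exact ⟨f, hi (by rw [h.ib, ← hf, hP])⟩
  obtain ⟨r, hr'⟩ := exists_retraction_of_prime hp tL tF j jinj
  have := hF.1
  obtain ⟨u, hu⟩ := Module.projective_lifting_property mL.toIntLinearMap
    ((r.comp mF).toIntLinearMap) sL
  have hu' : ∀ x, mL (u x) = r (mF x) := fun x => LinearMap.congr_fun hu x
  have key : ∀ x, ∃ f, b f = u (i x) - x := fun x => by
    rw [← mL0, map_sub, hu', ← hj, hr', sub_self]
  choose k hk using key
  refine ⟨u.toAddMonoidHom, AddMonoidHom.mk' k fun x y => hb ?_, fun x => ?_⟩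
  · simp only [map_add, hk]; abel
  · change u (i x) = x + b (k x)
    rw [hk]; abel

/-- A commuting square of maps invertible up to integer factors. -/
structure Sq (p q : ℤ) {N X Y W : GMod G} (iN : N →+ Y) (iX : X →+ W) (jN : N →+ X) (jY : Y →+ W)
    (bY : Y →+ N) (bW : W →+ X) (cX : X →+ N) (cW : W →+ Y) : Prop where
  p0 : p ≠ 0
  q0 : q ≠ 0
  lN : Lat N
  lX : Lat X
  lY : Lat Y
  lW : Lat W
  emN : EmbMaps p iN bY
  emX : EmbMaps p iX bW
  ejN : EmbMaps q jN cX
  ejY : EmbMaps q jY cW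
  ij : ∀ u, jY (iN u) = iX (jN u)
  ic : ∀ x, iN (cX x) = cW (iX x)
  bj : ∀ y, jN (bY y) = bW (jY y)
  bc : ∀ w, bY (cW w) = cX (bW w)

/-- The map out of a product. -/
def sumMap {X Y W : GMod G} (f : X →+ W) (h : Y →+ W) : prod X Y →+ W :=
  f.comp (fst X Y) + h.comp (snd X Y)

theorem sumMap_eqv {X Y W : GMod G} {f : X →+ W} {h : Y →+ W} (hf : Eqv f) (hh : Eqv h) :
    Eqv (sumMap f h) := (hf.comp (fst_eqv X Y)).add (hh.comp (snd_eqv X Y))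

/-- The map into a product. -/
def prMap {W X Y : GMod G} (f : W →+ X) (h : W →+ Y) : W →+ prod X Y :=
  AddMonoidHom.prod (N := X) (P := Y) f h

theorem prMap_apply {W X Y : GMod G} (f : W →+ X) (h : W →+ Y) (w : W) :
    prMap f h w = ((f w, h w) : X × Y) := rfl

theorem prMap_eqv {W X Y : GMod G} {f : W →+ X} {h : W →+ Y} (hf : Eqv f) (hh : Eqv h) :
    Eqv (prMap f h) := fun g w => Prod.ext (hf g w) (hh g w)

theorem Eqv.neg {A B : GMod G} {f : A →+ B} (hf : Eqv f) : Eqv (-f) := by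
  have := (Eqv.zero A B).sub hf
  rwa [zero_sub] at this

section
variable {p q : ℤ} {N X Y W : GMod G} {iN : N →+ Y} {iX : X →+ W} {jN : N →+ X} {jY : Y →+ W}
  {bY : Y →+ N} {bW : W →+ X} {cX : X →+ N} {cW : W →+ Y}

theorem Sq.ses_coprime (h : Sq p q iN iX jN jY bY bW cX cW) {s t : ℤ} (hst : s * p + t * q = 1) :
    SES (prMap jN (-iN)) (sumMap iX jY) where
  ei := prMap_eqv h.ejN.ei h.emN.ei.neg
  ep := sumMap_eqv h.emX.ei h.ejY.ei
  inj u v e := by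
    rw [prMap_apply, prMap_apply] at e
    exact h.ejN.inj h.q0 h.lN (congrArg Prod.fst e)
  exact := by
    rintro ⟨x, y⟩
    constructor
    · intro e
      have e' : iX x + jY y = 0 := e
      have ex : iX x = - jY y := eq_neg_of_add_eq_zero_left e'
      have ey : jY y = - iX x := eq_neg_of_add_eq_zero_right e'
      refine ⟨t • cX x - s • bY y, ?_⟩
      rw [prMap_apply]
      refine Prod.ext ?_ ?_
      · change jN (t • cX x - s • bY y) = x
        rw [map_sub, map_zsmul, map_zsmul, h.ejN.ib, h.bj, ey, map_neg, h.emX.bi, smul_neg,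
          sub_neg_eq_add, smul_smul, smul_smul, ← add_smul, add_comm, hst, one_smul]
      · change - iN (t • cX x - s • bY y) = y
        rw [map_sub, map_zsmul, map_zsmul, h.ic, ex, map_neg, h.ejY.bi, h.emN.ib, smul_neg,
          neg_sub, sub_neg_eq_add, smul_smul, smul_smul, ← add_smul, hst, one_smul]
    · rintro ⟨u, e⟩
      rw [prMap_apply] at e
      rw [← e]
      change iX (jN u) + jY (- iN u) = 0
      rw [map_neg, h.ij, add_neg_cancel]
  split := by
    refine ⟨prMap (s • bW) (t • cW), AddMonoidHom.ext fun w => ?_⟩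
    rw [AddMonoidHom.comp_apply, prMap_apply]
    change iX (s • bW w) + jY (t • cW w) = w
    rw [map_zsmul, map_zsmul, h.emX.ib, h.ejY.ib, smul_smul, smul_smul, ← add_smul, hst, one_smul]

theorem Sq.ses_same (h : Sq p p iN iX jN jY bY bW cX cW) {uY : Y →+ N} {uW : W →+ X}
    {kN : N →+ Y} {kX : X →+ W} (huX : ∀ x, uW (iX x) = x + bW (kX x))
    (hju : ∀ y, uW (jY y) = jN (uY y)) (hjk : ∀ u, kX (jN u) = jY (kN u)) :
    ∃ (A B : GMod G) (i1 : A →+ prod X Y) (p1 : prod X Y →+ B) (i2 : B →+ prod W N)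
      (p2 : prod W N →+ A), SES i1 p1 ∧ SES i2 p2 := by
  have jinj := h.ejY.inj h.p0 h.lY
  have jNinj := h.ejN.inj h.p0 h.lN
  have iinj := h.emX.inj h.p0 h.lX
  let f : prod X Y →+ W := sumMap iX jY
  have ef : Eqv f := sumMap_eqv h.emX.ei h.ejY.ei
  let B := range f ef
  let ιB : B →+ W := sub.incl W f.range _
  have ιBinj : Function.Injective ιB := sub.incl_inj
  have hιB : ∀ w : W, (∃ b, ιB b = w) ↔ ∃ x y, iX x + jY y = w := fun w =>
    ⟨by rintro ⟨⟨_, ⟨x, y⟩, rfl⟩, rfl⟩; exact ⟨x, y, rfl⟩,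
     by rintro ⟨x, y, rfl⟩; exact ⟨⟨_, ((x, y) : X × Y), rfl⟩, rfl⟩⟩
  have lB : Lat B := h.lW.sub
  have ex1 : ∀ z, ∃ b, ιB b = f z := fun z => (hιB _).2 ⟨z.1, z.2, rfl⟩
  choose f' hf' using ex1
  let p1 : prod X Y →+ B := AddMonoidHom.mk' f' fun x y => ιBinj (by simp [hf'])
  have hp1 : ∀ z, ιB (p1 z) = f z := hf'
  have ep1 : Eqv p1 := fun g z => ιBinj (by
    rw [hp1, ef]
    exact (congrArg (g • ·) (hp1 z)).symm)
  have sp1 : Function.Surjective p1 := fun b => by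
    obtain ⟨x, y, e⟩ := (hιB (ιB b)).1 ⟨b, rfl⟩
    exact ⟨((x, y) : X × Y), ιBinj ((hp1 _).trans e)⟩
  have S1 := SES.ker p1 ep1 (exists_section lB p1 sp1)
  set A := GMod.sub (prod X Y) p1.ker ep1.ker_inv with hA
  set i1 := sub.incl (prod X Y) p1.ker ep1.ker_inv with hi1
  have hker : ∀ x y, (∃ a, i1 a = ((x, y) : X × Y)) ↔ iX x + jY y = 0 := fun x y => by
    refine (S1.exact _).symm.trans ?_
    constructor
    · intro e
      have := hp1 ((x, y) : X × Y)
      rw [e, map_zero] at this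
      exact this.symm
    · intro e
      exact ιBinj ((hp1 _).trans (e.trans (map_zero ιB).symm))
  let hh : prod W N →+ prod X Y := prMap (sumMap bW jN) (-(sumMap cW iN))
  have ehh : Eqv hh := prMap_eqv (sumMap_eqv h.emX.eb h.ejN.ei) (sumMap_eqv h.ejY.eb h.emN.ei).neg
  have hhh : ∀ w u, hh ((w, u) : W × N) = ((bW w + jN u, -(cW w + iN u)) : X × Y) :=
    fun w u => prMap_apply _ _ _
  have ex2 : ∀ z, ∃ a, i1 a = hh z := by
    rintro ⟨w, u⟩
    rw [hhh, hker, map_neg, map_add, map_add, h.emX.ib, h.ejY.ib, h.ij, add_neg_cancel]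
  choose t ht using ex2
  let p2 : prod W N →+ A := AddMonoidHom.mk' t fun x y => S1.inj (by simp [ht])
  have hp2 : ∀ z, i1 (p2 z) = hh z := ht
  have ep2 : Eqv p2 := fun g z => S1.inj (by
    rw [hp2, ehh]
    exact (congrArg (g • ·) (hp2 z)).symm)
  have hz : ∀ w u, p2 ((w, u) : W × N) = 0 ↔ p • w = - iX (jN u) := by
    intro w u
    have e0 : p2 ((w, u) : W × N) = 0 ↔ hh ((w, u) : W × N) = 0 := by
      exact ⟨fun e => (hp2 _).symm.trans ((congrArg i1 e).trans (map_zero i1)),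
        fun e => S1.inj ((hp2 _).trans (e.trans (map_zero i1).symm))⟩
    rw [e0, hhh]
    constructor
    · intro e
      have e1 : bW w + jN u = 0 := congrArg Prod.fst e
      rw [← h.emX.ib, eq_neg_of_add_eq_zero_left e1, map_neg]
    · intro e
      refine Prod.ext (iinj ?_) (jinj ?_)
      · change iX (bW w + jN u) = iX 0
        rw [map_add, h.emX.ib, e, map_zero, neg_add_cancel]
      · change jY (-(cW w + iN u)) = jY 0
        rw [map_neg, map_add, h.ejY.ib, e, map_zero, h.ij, neg_add_cancel, neg_zero]
  have ex3 : ∀ b : B, ∃ u, p • ιB b = - iX (jN u) := by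
    intro b
    obtain ⟨x, y, e⟩ := (hιB (ιB b)).1 ⟨b, rfl⟩
    refine ⟨-(cX x + bY y), ?_⟩
    rw [← e, map_neg, map_neg, neg_neg, map_add, map_add, h.ejN.ib, h.bj, h.emX.ib, smul_add,
      map_zsmul]
  choose v hv using ex3
  have vinj : ∀ u u', iX (jN u) = iX (jN u') → u = u' := fun u u' e => jNinj (iinj e)
  have hv' : ∀ b, iX (jN (v b)) = -(p • ιB b) := fun b => by rw [hv, neg_neg]
  let v' : B →+ N := AddMonoidHom.mk' v fun x y => vinj _ _ (by
    simp only [map_add, hv', smul_add]; abel)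
  have ev' : Eqv v' := fun g b => vinj _ _ (by
    change iX (jN (v _)) = iX (jN (g • v b))
    rw [h.ejN.ei, h.emX.ei, hv', hv', smul_neg]
    refine congrArg Neg.neg ?_
    exact (map_zsmul (W.sm g) p (ιB b)).symm)
  have S2 : SES (prMap ιB v') p2 := by
    refine ⟨prMap_eqv sub.incl_eqv ev', ep2, fun x y e => ?_, ?_, ?_⟩
    · rw [prMap_apply, prMap_apply] at e
      exact ιBinj (congrArg Prod.fst e)
    · rintro ⟨w, u⟩
      rw [hz]
      constructor
      · intro e
        have : ∃ b, ιB b = w := by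
          rw [hιB]
          refine ⟨uW w, kN u, ?_⟩
          apply h.lW.cancel h.p0
          rw [smul_add, ← map_zsmul, ← map_zsmul, e, map_neg, huX, map_neg, map_add,
            h.emX.ib, hjk]
          abel
        obtain ⟨b, rfl⟩ := this
        refine ⟨b, ?_⟩
        rw [prMap_apply]
        refine Prod.ext rfl (vinj _ _ ?_)
        change iX (jN (v b)) = iX (jN u)
        rw [hv', e, neg_neg]
      · rintro ⟨b, e⟩
        rw [prMap_apply] at e
        obtain ⟨rfl, rfl⟩ := Prod.ext_iff.1 e
        exact hv b
    · refine exists_section (Lat.sub (h.lX.prod h.lY)) p2 fun a => ?_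
      obtain ⟨⟨x, y⟩, hxy⟩ : ∃ z : X × Y, i1 a = z := ⟨_, rfl⟩
      have e : iX x + jY y = 0 := (hker x y).1 ⟨a, hxy⟩
      refine ⟨((-kX x, -uY y) : W × N), S1.inj ?_⟩
      refine ((hp2 _).trans (hhh _ _)).trans (Eq.trans ?_ hxy.symm)
      have ex : x = - bW (kX x) - jN (uY y) := by
        rw [← hju, eq_neg_of_add_eq_zero_right e, map_neg, huX]
        abel
      refine Prod.ext ?_ (jinj ?_)
      · change bW (-kX x) + jN (-uY y) = x
        rw [map_neg, map_neg]; conv_rhs => rw [ex]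
        abel
      · change jY (-(cW (-kX x) + iN (-uY y))) = jY y
        rw [map_neg, map_neg, map_add, map_neg, map_neg, map_neg, h.ejY.ib, h.ij,
          eq_neg_of_add_eq_zero_right e]
        have : jN (uY y) = - bW (kX x) - x := eq_sub_of_add_eq' (by
          rw [← eq_sub_iff_add_eq]; exact ex)
        rw [this, map_sub, map_neg, h.emX.ib]
        abel
  exact ⟨A, B, i1, p1, _, p2, S1, S2⟩

end

end GMod

namespace GMod

variable {G : Type} [Group G]

theorem comp_eq_zsmul {n : ℤ} {L F : GMod G} {i : L →+ F} {b : F →+ L}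
    (h : ∀ x, i (b x) = n • x) : i.comp b = n • AddMonoidHom.id F :=
  AddMonoidHom.ext fun x => by simp [h]

theorem EmbMaps.tens_left {n : ℤ} {L F : GMod G} {i : L →+ F} {b : F →+ L} (h : EmbMaps n i b)
    (A : GMod G) : EmbMaps n (tm i (AddMonoidHom.id A)) (tm b (AddMonoidHom.id A)) := by
  refine ⟨tm_eqv h.ei (.id _), tm_eqv h.eb (.id _), fun x => ?_, fun x => ?_⟩
  · rw [tm_tm, comp_eq_zsmul h.ib, tm_zsmul_left]
    exact congrArg (n • ·) (DFunLike.congr_fun tm_id x)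
  · rw [tm_tm, comp_eq_zsmul h.bi, tm_zsmul_left]
    exact congrArg (n • ·) (DFunLike.congr_fun tm_id x)

theorem EmbMaps.tens_right {n : ℤ} {L F : GMod G} {i : L →+ F} {b : F →+ L} (h : EmbMaps n i b)
    (A : GMod G) : EmbMaps n (tm (AddMonoidHom.id A) i) (tm (AddMonoidHom.id A) b) := by
  refine ⟨tm_eqv (.id _) h.ei, tm_eqv (.id _) h.eb, fun x => ?_, fun x => ?_⟩
  · rw [tm_tm, comp_eq_zsmul h.ib, tm_zsmul_right]
    exact congrArg (n • ·) (DFunLike.congr_fun tm_id x)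
  · rw [tm_tm, comp_eq_zsmul h.bi, tm_zsmul_right]
    exact congrArg (n • ·) (DFunLike.congr_fun tm_id x)

theorem tm_swap {L F A A1 : GMod G} (f : L →+ F) (h : A →+ A1) (x : tens L A) :
    tm (AddMonoidHom.id F) h (tm f (AddMonoidHom.id A) x) =
      tm f (AddMonoidHom.id A1) (tm (AddMonoidHom.id L) h x) := by
  rw [tm_tm, tm_tm]; rfl

theorem EmbMaps.sq {p q : ℤ} (hp : p ≠ 0) (hq : q ≠ 0) {L F A A1 : GMod G} (hL : Lat L)
    (hF : Lat F) (hA : Lat A) (hA1 : Lat A1) {i : L →+ F} {b : F →+ L} (h : EmbMaps p i b)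
    {j : A →+ A1} {c : A1 →+ A} (h' : EmbMaps q j c) :
    Sq p q (tm i (AddMonoidHom.id A)) (tm i (AddMonoidHom.id A1)) (tm (AddMonoidHom.id L) j)
      (tm (AddMonoidHom.id F) j) (tm b (AddMonoidHom.id A)) (tm b (AddMonoidHom.id A1))
      (tm (AddMonoidHom.id L) c) (tm (AddMonoidHom.id F) c) where
  p0 := hp
  q0 := hq
  lN := tens.lat hL hA
  lX := tens.lat hL hA1
  lY := tens.lat hF hA
  lW := tens.lat hF hA1
  emN := h.tens_left A
  emX := h.tens_left A1
  ejN := h'.tens_right L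
  ejY := h'.tens_right F
  ij u := tm_swap i j u
  ic x := (tm_swap i c x).symm
  bj y := tm_swap b j y
  bc w := (tm_swap b c w).symm

section psi
variable [Finite G] {K : GMod G}

/-- Additivity of the class of a tensor product along two commensurable pairs. -/
def Rel (K L F A A1 : GMod G) : Prop :=
  psi K (tens F A1) + psi K (tens L A) = psi K (tens L A1) + psi K (tens F A)

theorem Rel.base (hK : Lat K) (hK' : IsProj K) {p q : ℕ} (hp : p.Prime) (hq : q.Prime)
    {L F A A1 : GMod G} (hL : Lat L) (hF : Lat F) (hA : Lat A) (hA1 : Lat A1)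
    (h : Emb p L F) (h' : Emb q A A1) : Rel K L F A A1 := by
  obtain ⟨i, b, h⟩ := h
  obtain ⟨j, c, h'⟩ := h'
  have hp0 : (p : ℤ) ≠ 0 := by exact_mod_cast hp.ne_zero
  have hq0 : (q : ℤ) ≠ 0 := by exact_mod_cast hq.ne_zero
  have S := h.sq hp0 hq0 hL hF hA hA1 h'
  have hXY := psi_prod hK hK' S.lX S.lY
  by_cases hpq : p = q
  · subst hpq
    obtain ⟨u, k, huk⟩ := h.exists_split hp hL hF
    obtain ⟨P, Q, i1, p1, i2, p2, S1, S2⟩ := S.ses_same (uY := tm u (AddMonoidHom.id A))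
      (uW := tm u (AddMonoidHom.id A1)) (kN := tm k (AddMonoidHom.id A))
      (kX := tm k (AddMonoidHom.id A1)) (fun x => by
        have e : u.comp i = AddMonoidHom.id L + b.comp k := AddMonoidHom.ext fun x => by
          simp [huk]
        rw [tm_tm, tm_tm, e, tm_add_left]
        refine congrArg₂ (· + ·) (DFunLike.congr_fun tm_id x) rfl) (fun y => (tm_swap u j y).symm)
        (fun y => (tm_swap k j y).symm)
    have lP : Lat P := (S.lX.prod S.lY).of_inj i1 S1.inj
    have lQ : Lat Q := (S.lW.prod S.lN).of_inj i2 S2.inj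
    have e1 := psi_ses hK hK' S1 lP lQ
    have e2 := psi_ses hK hK' S2 lQ lP
    rw [psi_prod hK hK' S.lW S.lN] at e2
    rw [hXY] at e1
    rw [Rel, e1, e2, add_comm]
  · have hc : IsCoprime (p : ℤ) (q : ℤ) :=
      Nat.isCoprime_iff_coprime.2 ((Nat.coprime_primes hp hq).2 hpq)
    obtain ⟨s, t, hst⟩ := hc
    have := psi_ses hK hK' (S.ses_coprime hst) S.lN S.lW
    rw [hXY] at this
    rw [Rel, this, add_comm]


theorem Rel.of_emb (hK : Lat K) (hK' : IsProj K) {m n : ℕ} (hm : m ≠ 0) (hn : n ≠ 0)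
    {L F A A1 : GMod G} (hL : Lat L) (hF : Lat F) (hA : Lat A) (hA1 : Lat A1)
    (h : Emb m L F) (h' : Emb n A A1) : Rel K L F A A1 := by
  refine Emb.chain (Q := fun L F => Rel K L F A A1) ?_ ?_ ?_ hm hL hF h
  · intro L F _ _ e
    unfold Rel
    rw [psi_iso (e.tens (.refl A1)), psi_iso (e.tens (.refl A))]
  · intro L M F _ _ _ h1 h2
    unfold Rel at *
    refine add_right_cancel (b := psi K (tens M A) + psi K (tens M A1)) ?_
    calc _ = (psi K (tens F A1) + psi K (tens M A)) + (psi K (tens M A1) + psi K (tens L A)) := by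
          abel
      _ = _ := by rw [h1, h2]; abel
  · intro p hp L F hL hF h
    refine Emb.chain (Q := fun A A1 => Rel K L F A A1) ?_ ?_ ?_ hn hA hA1 h'
    · intro A A1 _ _ e
      unfold Rel
      rw [psi_iso ((Iso.refl L).tens e), psi_iso ((Iso.refl F).tens e), add_comm]
    · intro A B A1 _ _ _ h1 h2
      unfold Rel at *
      refine add_right_cancel (b := psi K (tens L B) + psi K (tens F B)) ?_
      calc _ = (psi K (tens F A1) + psi K (tens L B)) + (psi K (tens F B) + psi K (tens L A)) := by
            abel
        _ = _ := by rw [h1, h2]; abel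
    · intro q hq A A1 hA hA1 h'
      exact Rel.base hK hK' hp hq hL hF hA hA1 h h'

end psi

end GMod

namespace GMod

variable {G : Type} [Group G]

theorem Emb.symm {n : ℕ} {L F : GMod G} : Emb n L F → Emb n F L := by
  rintro ⟨i, b, h⟩; exact ⟨b, i, h.swap⟩

theorem Emb.of_iso {L F : GMod G} (h : Iso L F) : Emb 1 L F := by
  obtain ⟨e, he⟩ := h
  refine ⟨e.toAddMonoidHom, e.symm.toAddMonoidHom, he, fun g b => e.injective ?_, ?_, ?_⟩
  · change e (e.symm (g • b)) = e (g • e.symm b)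
    rw [he]; simp
  · intro x; simp
  · intro x; simp

theorem Emb.trans {m n : ℕ} {L M F : GMod G} : Emb m L M → Emb n M F → Emb (m * n) L F := by
  rintro ⟨i, b, h⟩ ⟨j, c, h'⟩
  refine ⟨j.comp i, b.comp c, h'.ei.comp h.ei, h.eb.comp h'.eb, fun x => ?_, fun x => ?_⟩
  · rw [AddMonoidHom.comp_apply, AddMonoidHom.comp_apply, h.ib, map_zsmul, h'.ib, smul_smul]
    push_cast; rfl
  · rw [AddMonoidHom.comp_apply, AddMonoidHom.comp_apply, h'.bi, map_zsmul, h.bi, smul_smul,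
      mul_comm]
    push_cast; rfl

theorem EmbMaps.mul {n : ℤ} {L F : GMod G} {i : L →+ F} {b : F →+ L} (h : EmbMaps n i b) (k : ℤ) :
    EmbMaps (k * n) i (k • b) :=
  ⟨h.ei, h.eb.zsmul k, fun x => by simp [h.ib, mul_smul], fun x => by simp [h.bi, mul_smul]⟩

theorem Emb.prod {m n : ℕ} {L F L' F' : GMod G} :
    Emb m L F → Emb n L' F' → Emb (m * n) (prod L L') (prod F F') := by
  rintro ⟨i, b, h⟩ ⟨j, c, h'⟩
  have h := h.mul n
  have h' := h'.mul m
  refine ⟨prMap (i.comp (fst _ _)) (j.comp (snd _ _)),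
    prMap (((n : ℤ) • b).comp (fst _ _)) (((m : ℤ) • c).comp (snd _ _)),
    prMap_eqv (h.ei.comp (fst_eqv _ _)) (h'.ei.comp (snd_eqv _ _)),
    prMap_eqv (h.eb.comp (fst_eqv _ _)) (h'.eb.comp (snd_eqv _ _)), fun x => ?_, fun x => ?_⟩
  · have e1 := h.ib x.1
    have e2 := h'.ib x.2
    rw [mul_comm, ← Nat.cast_mul] at e1
    rw [← Nat.cast_mul] at e2
    exact Prod.ext e1 e2
  · have e1 := h.bi x.1
    have e2 := h'.bi x.2
    rw [mul_comm, ← Nat.cast_mul] at e1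
    rw [← Nat.cast_mul] at e2
    exact Prod.ext e1 e2

/-- Commensurability. -/
def Com (L F : GMod G) : Prop := ∃ n, n ≠ 0 ∧ Emb n L F

theorem Com.symm {L F : GMod G} : Com L F → Com F L := fun ⟨n, hn, h⟩ => ⟨n, hn, h.symm⟩

theorem Com.trans {L M F : GMod G} : Com L M → Com M F → Com L F :=
  fun ⟨n, hn, h⟩ ⟨m, hm, h'⟩ => ⟨n * m, Nat.mul_ne_zero hn hm, h.trans h'⟩

theorem Com.of_iso {L F : GMod G} (h : Iso L F) : Com L F := ⟨1, one_ne_zero, .of_iso h⟩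

theorem Com.prod {L F L' F' : GMod G} : Com L F → Com L' F' → Com (prod L L') (prod F F') :=
  fun ⟨n, hn, h⟩ ⟨m, hm, h'⟩ => ⟨n * m, Nat.mul_ne_zero hn hm, h.prod h'⟩

/-- The character of a lattice. -/
noncomputable def chi (A : GMod G) (g : G) : ℤ := LinearMap.trace ℤ A (A.sm g).toIntLinearMap

theorem chi_prod {A B : GMod G} (hA : Lat A) (hB : Lat B) (g : G) :
    chi (prod A B) g = chi A g + chi B g := by
  have := hA.1; have := hA.2; have := hB.1; have := hB.2
  exact LinearMap.trace_prodMap' (R := ℤ) (M := A) (N := B) (A.sm g).toIntLinearMap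
    (B.sm g).toIntLinearMap

theorem chi_one {A : GMod G} (hA : Lat A) : chi A 1 = Module.finrank ℤ A := by
  have := hA.1; have := hA.2
  have h : (A.sm 1).toIntLinearMap = LinearMap.id := by ext; simp
  rw [chi, h, LinearMap.trace_id]

theorem Com.chi_eq {L F : GMod G} (hL : Lat L) (hF : Lat F) (h : Com L F) (g : G) :
    chi L g = chi F g := by
  have := hL.1; have := hL.2; have := hF.1; have := hF.2
  obtain ⟨n, hn, i, b, h⟩ := h
  have h1 := LinearMap.trace_comp_comm' (R := ℤ) (M := L) (N := F)
    ((i.toIntLinearMap).comp (L.sm g).toIntLinearMap) b.toIntLinearMap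
  have e1 : b.toIntLinearMap ∘ₗ (i.toIntLinearMap ∘ₗ (L.sm g).toIntLinearMap) =
      (n : ℤ) • (L.sm g).toIntLinearMap := by
    ext x; exact h.bi (g • x)
  have e2 : (i.toIntLinearMap ∘ₗ (L.sm g).toIntLinearMap) ∘ₗ b.toIntLinearMap =
      (n : ℤ) • (F.sm g).toIntLinearMap := by
    ext x
    change i (g • b x) = (n : ℤ) • g • x
    rw [h.ei, h.ib]
    exact map_zsmul (F.sm g) n x
  rw [e1, e2, map_smul, map_smul] at h1
  have : (n : ℤ) ≠ 0 := by exact_mod_cast hn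
  exact mul_left_cancel₀ this h1

theorem Com.of_section {X S : GMod G} {s : S →+ X} {p : X →+ S} (hs : Eqv s) (hp : Eqv p) {n : ℤ}
    (hn : n ≠ 0) (h : ∀ x, p (s x) = n • x) : Com (GMod.prod S (ker p hp)) X := by
  have key : EmbMaps n (sumMap s (sub.incl X p.ker (Eqv.ker_inv hp)))
      (prMap p (AddMonoidHom.mk' (fun l => (⟨n • l - s (p l), by
        simp [AddMonoidHom.mem_ker, h]⟩ : p.ker)) fun l l' => Subtype.ext (by
          change n • (l + l') - s (p (l + l')) = n • l - s (p l) + (n • l' - s (p l'))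
          rw [map_add, map_add, smul_add]; abel))) := by
    have es : ∀ (g : G) (x : X), g • (n • x) = n • g • x := fun g x => map_zsmul (X.sm g) n x
    refine ⟨sumMap_eqv hs sub.incl_eqv, prMap_eqv hp fun g x => Subtype.ext ?_, fun x => ?_,
      fun x => ?_⟩
    · change n • g • x - s (p (g • x)) = g • (n • x - s (p x))
      rw [smul_sub, es, hp, hs]
    · change s (p x) + (n • x - s (p x)) = n • x
      abel
    · obtain ⟨x, k, hk⟩ := x
      have hk' : p k = 0 := hk
      refine Prod.ext ?_ (Subtype.ext ?_)
      · change p (s x + k) = n • x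
        rw [map_add, h, hk', add_zero]
      · change n • (s x + k) - s (p (s x + k)) = n • k
        rw [map_add p, h, hk', add_zero, map_zsmul, smul_add]
        abel
  rcases Int.natAbs_eq n with e | e
  · exact ⟨n.natAbs, by simpa using hn, _, _, by rw [← e]; exact key⟩
  · have := key.mul (-1)
    rw [neg_one_mul, show -n = (n.natAbs : ℤ) by omega] at this
    exact ⟨n.natAbs, by simpa using hn, _, _, this⟩

theorem exists_quasi_retraction {F : Type} [AddCommGroup F] [Module.Free ℤ F] [Module.Finite ℤ F]
    (S : Submodule ℤ F) : ∃ (n : ℤ) (r : F →ₗ[ℤ] S), n ≠ 0 ∧ ∀ x : S, r x = n • x := by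
  classical
  obtain ⟨k, snf⟩ := Submodule.smithNormalForm (Module.finBasis ℤ F) S
  obtain ⟨bM, bN, f, a, hs⟩ := snf
  have ha : ∀ i, a i ≠ 0 := fun i h0 => bN.ne_zero i (Subtype.ext (by rw [hs, h0]; simp))
  refine ⟨∏ i, a i, bM.constr ℤ fun j =>
    ∑ i, if f i = j then (∏ l ∈ Finset.univ.erase i, a l) • bN i else 0,
    Finset.prod_ne_zero_iff.2 fun i _ => ha i, ?_⟩
  suffices h : (bM.constr ℤ fun j =>
      ∑ i, if f i = j then (∏ l ∈ Finset.univ.erase i, a l) • bN i else 0) ∘ₗ S.subtype =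
      (∏ i, a i) • LinearMap.id from fun x => DFunLike.congr_fun h x
  refine bN.ext fun i => ?_
  rw [LinearMap.comp_apply, Submodule.subtype_apply, hs, map_smul, Module.Basis.constr_basis]
  rw [Finset.sum_eq_single i]
  · rw [if_pos rfl, smul_smul, Finset.mul_prod_erase _ _ (Finset.mem_univ i)]; rfl
  · intro j _ hj
    rw [if_neg fun e => hj (f.injective e)]
  · simp

theorem exists_com_of_hom [Finite G] {L F : GMod G} (hL : Lat L) (hF : Lat F) {φ : L →+ F}
    (hφ : Eqv φ) (h0 : φ ≠ 0) : ∃ S K F' : GMod G, Lat S ∧ Lat K ∧ Lat F' ∧ Nontrivial S ∧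
      Com (prod S K) L ∧ Com (prod S F') F := by
  have hc : (Nat.card G : ℤ) ≠ 0 := by exact_mod_cast Nat.card_pos.ne'
  let S := range φ hφ
  let ι : S →+ F := sub.incl F _ _
  have eι : Eqv ι := sub.incl_eqv
  have lS : Lat S := hF.of_inj ι sub.incl_inj
  let q : L →+ S := φ.rangeRestrict
  have eq : Eqv q := fun g a => Subtype.ext (hφ g a)
  obtain ⟨s, hs⟩ := exists_section lS q φ.rangeRestrict_surjective
  have hs' : ∀ x, q (tr s x) = (Nat.card G : ℤ) • x := by
    have h1 : q.comp (tr s) = (Nat.card G : ℤ) • AddMonoidHom.id S := by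
      rw [comp_tr eq, ← tr_of_eqv (Eqv.id S), hs]
    exact fun x => DFunLike.congr_fun h1 x
  have := hF.1; have := hF.2
  obtain ⟨n, r, hn, hr⟩ := exists_quasi_retraction (AddSubgroup.toIntSubmodule φ.range)
  let r' : F →+ S := r.toAddMonoidHom
  have hr' : ∀ x, tr r' (ι x) = ((Nat.card G : ℤ) * n) • x := by
    have h1 : (tr r').comp ι = ((Nat.card G : ℤ) * n) • AddMonoidHom.id S := by
      rw [tr_comp eι, mul_smul, ← tr_of_eqv ((Eqv.id S).zsmul n)]
      congr 1
      refine AddMonoidHom.ext fun x => hr x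
    exact fun x => DFunLike.congr_fun h1 x
  refine ⟨S, ker q eq, ker (tr r') (tr_eqv r'), lS, hL.sub .., hF.sub .., ?_,
    Com.of_section (tr_eqv s) eq hc hs',
    Com.of_section eι (tr_eqv r') (mul_ne_zero hc hn) hr'⟩
  obtain ⟨x, hx⟩ := DFunLike.ne_iff.1 h0
  exact ⟨q x, 0, fun h => hx (congrArg Subtype.val h)⟩

theorem isEmpty_of_sum_trace_eq_zero [Fintype G] {ι : Type} [Fintype ι] [DecidableEq ι]
    (R : G →* Matrix ι ι ℚ) (h : ∑ g, (R g).trace * (R g⁻¹).trace = 0) : IsEmpty ι := by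
  classical
  let c : ℚ := Fintype.card G
  have hc : c ≠ 0 := by
    have : (Fintype.card G : ℚ) ≠ 0 := by exact_mod_cast Fintype.card_ne_zero
    exact this
  let N : Matrix ι ι ℚ →ₗ[ℚ] Matrix ι ι ℚ := c⁻¹ • ∑ g : G,
    (LinearMap.mulLeft ℚ (R g)).comp (LinearMap.mulRight ℚ (R g⁻¹))
  have N_apply : ∀ X, N X = c⁻¹ • ∑ g : G, R g * (X * R g⁻¹) := fun X => by
    simp [N, LinearMap.sum_apply]
  have hinv : ∀ (k : G) X, R k * (N X * R k⁻¹) = N X := fun k X => by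
    rw [N_apply, Matrix.smul_mul, Matrix.mul_smul, Finset.sum_mul, Finset.mul_sum]
    congr 1
    refine Fintype.sum_equiv (Equiv.mulLeft k) _ _ fun g => ?_
    simp [mul_assoc]
  have hid : IsIdempotentElem N := by
    refine LinearMap.ext fun X => ?_
    rw [Module.End.mul_apply, N_apply (N X), Finset.sum_congr rfl fun g _ => hinv g X]
    rw [Finset.sum_const, Finset.card_univ, ← Nat.cast_smul_eq_nsmul ℚ, smul_smul]
    rw [inv_mul_cancel₀ hc, one_smul]
  have htr : LinearMap.trace ℚ _ N = 0 := by
    rw [LinearMap.trace_eq_matrix_trace ℚ (Matrix.stdBasis ℚ ι ι), Matrix.trace]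
    have e : ∀ p : ι × ι, (LinearMap.toMatrix (Matrix.stdBasis ℚ ι ι) (Matrix.stdBasis ℚ ι ι) N).diag p
        = c⁻¹ * ∑ g, R g p.1 p.1 * R g⁻¹ p.2 p.2 := by
      rintro ⟨i, j⟩
      rw [Matrix.diag_apply, LinearMap.toMatrix_apply, Matrix.stdBasis_eq_single, N_apply]
      have e1 : ∀ g, (R g * (Matrix.single i j 1 * R g⁻¹) : Matrix ι ι ℚ) i j =
          R g i i * R g⁻¹ j j := fun g => by
        rw [Matrix.mul_apply, Finset.sum_eq_single i]
        · rw [Matrix.mul_apply, Finset.sum_eq_single j]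
          · simp
          · intro l _ hl
            simp [hl.symm]
          · simp
        · intro k _ hk
          rw [Matrix.mul_apply, Finset.sum_eq_zero, mul_zero]
          intro l _
          simp [hk.symm]
        · simp
      have e2 : ∀ M : Matrix ι ι ℚ, (Matrix.stdBasis ℚ ι ι).repr M (i, j) = M i j := fun M => by
        simp [Matrix.stdBasis]
      rw [e2, Matrix.smul_apply, Matrix.sum_apply, smul_eq_mul]
      simp_rw [e1]
    rw [Finset.sum_congr rfl fun p _ => e p, ← Finset.mul_sum, Finset.sum_comm]
    convert mul_zero c⁻¹
    rw [← h]
    refine Finset.sum_congr rfl fun g _ => ?_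
    rw [Fintype.sum_prod_type, Matrix.trace, Matrix.trace, Finset.sum_mul_sum]
    rfl
  have h0 : N = 0 := LinearMap.IsIdempotentElem.eq_zero_of_trace_eq_zero hid htr
  have h1 : N 1 = 1 := by
    rw [N_apply]
    simp only [one_mul, ← map_mul, mul_inv_cancel, map_one]
    rw [Finset.sum_const, Finset.card_univ, ← Nat.cast_smul_eq_nsmul ℚ, smul_smul]
    rw [inv_mul_cancel₀ hc, one_smul]
  rw [h0, LinearMap.zero_apply] at h1
  by_contra hne
  rw [not_isEmpty_iff] at hne
  exact zero_ne_one h1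

theorem exists_hom [Finite G] {L F : GMod G} (hL : Lat L) (hF : Lat F)
    (h : ∀ g, chi L g = chi F g) [Nontrivial L] : ∃ φ : L →+ F, Eqv φ ∧ φ ≠ 0 := by
  classical
  cases nonempty_fintype G
  have := hL.1; have := hL.2; have := hF.1; have := hF.2
  by_contra! hno
  let b := Module.Free.chooseBasis ℤ L
  let f := Module.Free.chooseBasis ℤ F
  let R : G →* Matrix (Module.Free.ChooseBasisIndex ℤ L) (Module.Free.ChooseBasisIndex ℤ L) ℚ :=
    { toFun := fun g => (LinearMap.toMatrix b b (L.sm g).toIntLinearMap).map (Int.castRingHom ℚ)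
      map_one' := by
        have e : (L.sm 1).toIntLinearMap = LinearMap.id := by ext; simp
        rw [e, LinearMap.toMatrix_id, Matrix.map_one] <;> simp
      map_mul' := fun g k => by
        have e : (L.sm (g * k)).toIntLinearMap =
          (L.sm g).toIntLinearMap ∘ₗ (L.sm k).toIntLinearMap := by ext; simp [mul_smul]
        rw [e, LinearMap.toMatrix_comp b b b, Matrix.map_mul] }
  have hR : ∀ g, (R g).trace = chi L g := fun g => by
    rw [chi, LinearMap.trace_eq_matrix_trace ℤ b, Matrix.trace, Matrix.trace]
    simp [R]
  have key : ∑ g, chi F g * chi L g⁻¹ = 0 := by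
    have e : ∀ j k, ∑ g, f.repr (g • f j) j * b.repr (g⁻¹ • b k) k = 0 := fun j k => by
      let φ : L →+ F := ((LinearMap.toSpanSingleton ℤ F (f j)).comp (b.coord k)).toAddMonoidHom
      have h1 := DFunLike.congr_fun (hno (tr φ) (tr_eqv φ)) (b k)
      rw [tr_apply, AddMonoidHom.zero_apply] at h1
      have h2 := congrArg (f.coord j) h1
      rw [map_sum, map_zero] at h2
      rw [← h2]
      refine Finset.sum_congr rfl fun g _ => ?_
      have h3 : g • φ (g⁻¹ • b k) = (b.repr (g⁻¹ • b k) k) • (g • f j) :=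
        map_zsmul (F.sm g) _ _
      rw [h3, mul_comm]
      exact (map_smul (f.coord j) (b.repr (g⁻¹ • b k) k) (g • f j)).symm
    have e1 : ∀ g, chi F g = ∑ j, f.repr (g • f j) j := fun g => by
      rw [chi, LinearMap.trace_eq_matrix_trace ℤ f, Matrix.trace]
      simp [LinearMap.toMatrix_apply]
    have e2 : ∀ g, chi L g = ∑ j, b.repr (g • b j) j := fun g => by
      rw [chi, LinearMap.trace_eq_matrix_trace ℤ b, Matrix.trace]
      simp [LinearMap.toMatrix_apply]
    simp_rw [e1, e2, Finset.sum_mul_sum]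
    rw [Finset.sum_comm]
    refine Finset.sum_eq_zero fun j _ => ?_
    rw [Finset.sum_comm]
    exact Finset.sum_eq_zero fun k _ => e j k
  have := isEmpty_of_sum_trace_eq_zero R (by
    simp_rw [hR]
    simp_rw [← h] at key
    exact_mod_cast key)
  have : Subsingleton L := b.repr.toEquiv.subsingleton
  exact not_subsingleton L this

/-- Lattices with the same character are commensurable. -/
theorem Com.of_chi [Finite G] {L F : GMod G} (hL : Lat L) (hF : Lat F)
    (h : ∀ g, chi L g = chi F g) : Com L F := by
  induction hn : Module.finrank ℤ L using Nat.strong_induction_on generalizing L F with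
  | _ n ih =>
  have := hL.1; have := hL.2; have := hF.1; have := hF.2
  have hr : Module.finrank ℤ L = Module.finrank ℤ F := by
    have := h 1
    rw [chi_one hL, chi_one hF] at this
    exact_mod_cast this
  rcases subsingleton_or_nontrivial L with hs | hs
  · have hF0 : Subsingleton F := by
      rw [← Module.finrank_eq_zero_iff_of_free (R := ℤ), ← hr]
      exact Module.finrank_zero_of_subsingleton
    exact ⟨1, one_ne_zero, 0, 0, Eqv.zero _ _, Eqv.zero _ _, fun x => Subsingleton.elim _ _,
      fun x => Subsingleton.elim _ _⟩
  · obtain ⟨φ, hφ, h0⟩ := exists_hom hL hF h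
    obtain ⟨S, K, F', lS, lK, lF, nS, c1, c2⟩ := exists_com_of_hom hL hF hφ h0
    have d1 := fun g => c1.chi_eq (lS.prod lK) hL g
    have d2 := fun g => c2.chi_eq (lS.prod lF) hF g
    simp only [chi_prod lS lK, chi_prod lS lF] at d1 d2
    refine c1.symm.trans (((Com.of_iso (Iso.refl S)).prod (ih _ ?_ lK lF (fun g => ?_) rfl)).trans c2)
    · have := d1 1
      rw [chi_one lS, chi_one lK, chi_one hL] at this
      have := lS.1; have := lS.2
      have : 0 < Module.finrank ℤ S := Module.finrank_pos
      omega
    · have := d1 g; have := d2 g; have := h g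
      omega

end GMod

namespace GMod

variable {G : Type} [Group G]

theorem chi_Ind {Y : Type} [Fintype Y] [DecidableEq Y] [MulAction G Y] (g : G) :
    chi (Ind Y (ZZ G)) g = ∑ y : Y, if g • y = y then 1 else 0 := by
  let b : Module.Basis Y ℤ (Y → ℤ) := Pi.basisFun ℤ Y
  let φ : (Y → ℤ) →ₗ[ℤ] (Y → ℤ) := LinearMap.funLeft ℤ ℤ fun y => g⁻¹ • y
  have h : chi (Ind Y (ZZ G)) g = LinearMap.trace ℤ (Y → ℤ) φ := rfl
  rw [h, LinearMap.trace_eq_matrix_trace ℤ b, Matrix.trace]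
  refine Finset.sum_congr rfl fun y _ => ?_
  rw [Matrix.diag_apply, LinearMap.toMatrix_apply, Pi.basisFun_repr, Pi.basisFun_apply,
    LinearMap.funLeft_apply, Pi.single_apply]
  refine if_congr ?_ rfl rfl
  rw [inv_smul_eq_iff, eq_comm]

section Artin

/-- Functions that are differences of sums of characters induced from cyclic subgroups. -/
def Art (f : G → ℤ) : Prop := ∃ l l' : List (Subgroup G), (∀ C ∈ l, IsCyclic C) ∧
  (∀ C ∈ l', IsCyclic C) ∧ ∀ g, f g + (l.map fun C => chi (Ind (G ⧸ C) (ZZ G)) g).sum =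
    (l'.map fun C => chi (Ind (G ⧸ C) (ZZ G)) g).sum

theorem Art.zero : Art (0 : G → ℤ) := ⟨[], [], by simp, by simp, by simp⟩

theorem Art.neg {f : G → ℤ} : Art f → Art (-f) := by
  rintro ⟨l, l', h, h', e⟩
  refine ⟨l', l, h', h, fun g => ?_⟩
  rw [← e g, Pi.neg_apply]; ring

theorem Art.add {f f' : G → ℤ} : Art f → Art f' → Art (f + f') := by
  rintro ⟨l, l', h, h', e⟩ ⟨k, k', hk, hk', e'⟩
  refine ⟨l ++ k, l' ++ k', by simpa [or_imp, forall_and] using ⟨h, hk⟩,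
    by simpa [or_imp, forall_and] using ⟨h', hk'⟩, fun g => ?_⟩
  rw [List.map_append, List.map_append, List.sum_append, List.sum_append, ← e, ← e', Pi.add_apply]
  ring

theorem Art.sum {ι : Type} (s : Finset ι) (f : ι → G → ℤ) (h : ∀ i ∈ s, Art (f i)) :
    Art (∑ i ∈ s, f i) := by
  classical
  induction s using Finset.induction_on with
  | empty => simpa using Art.zero
  | insert a s ha ih =>
    rw [Finset.sum_insert ha]
    exact (h a (by simp)).add (ih fun i hi => h i (by simp [hi]))

theorem Art.nsmul {f : G → ℤ} (h : Art f) (n : ℕ) : Art (n • f) := by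
  have := Art.sum (Finset.range n) (fun _ => f) fun _ _ => h
  rwa [Finset.sum_const, Finset.card_range] at this

variable [Fintype G]

open Classical in
theorem card_mul_chi (C : Subgroup G) (g : G) :
    ∑ x : G, (if x⁻¹ * g * x ∈ C then 1 else 0) = Nat.card C * chi (Ind (G ⧸ C) (ZZ G)) g := by
  rw [chi_Ind]
  have h : ∀ x : G, (if x⁻¹ * g * x ∈ C then (1 : ℤ) else 0) =
      if g • (x : G ⧸ C) = x then 1 else 0 := fun x => by
    refine if_congr ?_ rfl rfl
    change _ ↔ ((g * x : G) : G ⧸ C) = x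
    rw [eq_comm, QuotientGroup.eq, mul_assoc]
  have h2 : ∑ x : G, (if g • (x : G ⧸ C) = x then (1 : ℤ) else 0) =
      ∑ p : (G ⧸ C) × C, if g • p.1 = p.1 then 1 else 0 :=
    Fintype.sum_equiv Subgroup.groupEquivQuotientProdSubgroup _ _ fun x => rfl
  rw [Finset.sum_congr rfl fun x _ => h x, h2, Fintype.sum_prod_type, Finset.mul_sum]
  refine Finset.sum_congr rfl fun q _ => ?_
  change (∑ _y : C, if g • q = q then (1 : ℤ) else 0) = _
  rw [Finset.sum_const, Finset.card_univ, Nat.card_eq_fintype_card, nsmul_eq_mul]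

open Classical in
theorem Art.card : Art fun _ : G => (Nat.card G : ℤ) := by
  let gen : Subgroup G → G → ℤ := fun C g =>
    ∑ x : G, if Subgroup.zpowers (x⁻¹ * g * x) = C then 1 else 0
  have h1 : ∀ (s : Finset (Subgroup G)) (g : G), (∑ C ∈ s, gen C) g =
      ∑ x : G, if Subgroup.zpowers (x⁻¹ * g * x) ∈ s then 1 else 0 := fun s g => by
    rw [Finset.sum_apply, Finset.sum_comm]
    refine Finset.sum_congr rfl fun x _ => ?_
    rw [Finset.sum_ite_eq]
  have h2 : ∀ C, Art (gen C) := by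
    intro C
    induction C using WellFoundedLT.induction with
    | ind C ih =>
    by_cases hC : IsCyclic C
    · have a1 : Art fun g => (Nat.card C : ℤ) * chi (Ind (G ⧸ C) (ZZ G)) g := by
        have : Art fun g => chi (Ind (G ⧸ C) (ZZ G)) g :=
          ⟨[], [C], by simp, by simpa using hC, by simp⟩
        have := this.nsmul (Nat.card C)
        convert this using 1
        ext g; simp
      have a2 := Art.sum (Finset.univ.filter (· < C)) gen fun D hD => ih D (by simpa using hD)
      convert a1.add a2.neg using 1
      ext g
      rw [Pi.add_apply, Pi.neg_apply, h1, ← card_mul_chi, eq_add_neg_iff_add_eq,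
        ← Finset.sum_add_distrib]
      refine Finset.sum_congr rfl fun x _ => ?_
      simp only [Finset.mem_filter, Finset.mem_univ, true_and]
      rw [← Subgroup.zpowers_le]
      by_cases e : Subgroup.zpowers (x⁻¹ * g * x) = C
      · simp [e]
      · simp [e, lt_iff_le_and_ne]
    · have : gen C = 0 := by
        ext g
        refine Finset.sum_eq_zero fun x _ => if_neg fun e => hC ?_
        rw [← e]; infer_instance
      rw [this]
      exact .zero
  convert Art.sum Finset.univ gen fun C _ => h2 C using 1
  ext g
  rw [h1]; simp

end Artin

/-- The direct sum of permutation modules on cosets. -/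
def PM : List (Subgroup G) → GMod G
  | [] => Fr G 0
  | C :: l => prod (Ind (G ⧸ C) (ZZ G)) (PM l)

theorem Ind_top_iso : Iso (Ind (G ⧸ (⊤ : Subgroup G)) (ZZ G)) (ZZ G) := by
  have : Subsingleton (G ⧸ (⊤ : Subgroup G)) := QuotientGroup.subsingleton_quotient_top
  let e : ((G ⧸ (⊤ : Subgroup G)) → ℤ) ≃+ ℤ :=
    { toFun := fun f => f ((1 : G) : G ⧸ (⊤ : Subgroup G))
      invFun := fun n _ => n
      left_inv := fun f => funext fun y => congrArg f (Subsingleton.elim _ _)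
      right_inv := fun _ => rfl
      map_add' := fun _ _ => rfl }
  exact ⟨e, fun g f => congrArg (show (G ⧸ (⊤ : Subgroup G)) → ℤ from f) (Subsingleton.elim _ _)⟩

section PM
variable [Finite G]

theorem PM.lat (l : List (Subgroup G)) : Lat (PM l) := by
  induction l with
  | nil => exact Fr.lat 0
  | cons C l ih => exact (Ind.lat Lat.ZZ).prod ih

theorem chi_PM (l : List (Subgroup G)) (g : G) :
    chi (PM l) g = (l.map fun C => chi (Ind (G ⧸ C) (ZZ G)) g).sum := by
  induction l with
  | nil =>
    have := Fr.zero_subsingleton (G := G)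
    have h : (GMod.sm (Fr G 0) g).toIntLinearMap = 0 := LinearMap.ext fun x => Subsingleton.elim _ _
    exact (congrArg _ h).trans (map_zero _)
  | cons C l ih =>
    rw [List.map_cons, List.sum_cons, ← ih]
    exact chi_prod (Ind.lat Lat.ZZ) (PM.lat l) g

variable {K : GMod G}

theorem psi_PM (hK : Lat K) (hK' : IsProj K) {F : GMod G} (hF : Lat F) (l : List (Subgroup G)) :
    psi K (tens F (PM l)) = (l.map fun C => psi K (tens F (Ind (G ⧸ C) (ZZ G)))).sum := by
  induction l with
  | nil =>
    refine cls_isFr (IsFr.of_iso ?_ (tens_comm _ _))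
    exact tens_isFr hK (tens_isFr hF ⟨0, .refl _⟩)
  | cons C l ih =>
    rw [List.map_cons, List.sum_cons, ← ih]
    exact (psi_iso (tens_prod _ _ _)).trans
      (psi_prod hK hK' (tens.lat hF (Ind.lat Lat.ZZ)) (tens.lat hF (PM.lat l)))

/-- Artin induction: the class of a lattice that becomes trivial after inducing from all cyclic
subgroups is torsion. -/
theorem exists_torsion (hK : Lat K) (hK' : IsProj K)
    (hC : ∀ C : Subgroup G, IsCyclic C → Steq (Ind (G ⧸ C) K) (Fr G 0)) :
    ∃ M, 0 < M ∧ M • cls K = 0 := by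
  cases nonempty_fintype G
  obtain ⟨l, l', hl, hl', h⟩ := Art.card (G := G)
  let m := Nat.card G
  have hm : 0 < m := Nat.card_pos
  let A := PM (List.replicate m (⊤ : Subgroup G) ++ l)
  let B := PM l'
  have lA : Lat A := PM.lat _
  have lB : Lat B := PM.lat _
  obtain ⟨N, hN, E⟩ : Com A B := by
    refine Com.of_chi lA lB fun g => ?_
    rw [chi_PM, chi_PM, List.map_append, List.sum_append, ← h g, List.map_replicate,
      List.sum_replicate]
    congr 1
    rw [Com.chi_eq (Ind.lat Lat.ZZ) Lat.ZZ (.of_iso Ind_top_iso) g]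
    have : chi (ZZ G) g = 1 := by
      have e : chi (ZZ G) g = chi (ZZ G) 1 := rfl
      rw [e, chi_one Lat.ZZ]
      exact congrArg _ (Module.finrank_self ℤ)
    rw [this]; simp [m]
  have hproj : ∀ C : Subgroup G, IsProj (Ind (G ⧸ C) K) := fun C =>
    (tens.isProj hK').of_iso (((Ind.iso ((tens_ZZ K).symm)).trans
      (tens_Ind (G ⧸ C) K (ZZ G)).symm).trans (tens_comm _ _))
  have hz : ∀ F : GMod G, Lat F → ∀ l : List (Subgroup G), (∀ C ∈ l, IsCyclic C) →
      psi K (tens F (PM l)) = 0 := fun F hF l hl => by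
    rw [psi_PM hK hK' hF]
    refine List.sum_eq_zero fun x hx => ?_
    obtain ⟨C, hC', rfl⟩ := List.mem_map.1 hx
    exact psi_ind hK (hC C (hl C hC')) hF (hproj C)
  have hA : ∀ F : GMod G, Lat F → psi K (tens F A) = m • psi K F := fun F hF => by
    rw [psi_PM hK hK' hF, List.map_append, List.sum_append, ← psi_PM hK hK' hF l, hz F hF l hl,
      add_zero, List.map_replicate, List.sum_replicate]
    congr 1
    exact psi_iso (((Iso.refl F).tens Ind_top_iso).trans (tens_ZZ F))
  have R : Rel K A B A B := Rel.of_emb hK hK' hN hN lA lB lA lB E E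
  rw [Rel, hz B lB l' hl', hz A lA l' hl', psi_iso (tens_comm B A), hz A lA l' hl', zero_add,
    zero_add, hA A lA, ← psi_iso ((tens_comm _ _).trans (tens_ZZ A)), hA _ Lat.ZZ, psi_ZZ,
    smul_smul] at R
  exact ⟨m * m, Nat.mul_pos hm hm, R⟩

end PM

end GMod

namespace GMod
variable {G : Type} [Group G]

section stab
variable {Y S : Type} [Fintype Y] [Fintype S] [MulAction G Y] [MulAction G S]

theorem D_sum_iso (A : GMod G) (π : S → Y) (hπ : ∀ (g : G) s, π (g • s) = g • π s) :
    Iso (D (Y ⊕ S) A) (prod (D Y A) (Ind S A)) := by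
  classical
  have hs : ∀ u : S → A, ∑ y, ∑ s, (if π s = y then u s else 0) = ∑ s, u s := fun u => by
    rw [Finset.sum_comm]; simp
  have key : ∀ u : Y ⊕ S → A, ∑ y, (u (Sum.inl y) + ∑ s, if π s = y then u (Sum.inr s) else 0)
      = ∑ z, u z := fun u => by
    rw [Finset.sum_add_distrib, hs, Fintype.sum_sum_type]
  have key' : ∀ (v : Y → A) (f : S → A),
      ∑ z, (Sum.elim (fun y => v y - ∑ s, if π s = y then f s else 0) f z) = ∑ y, v y :=
    fun v f => by
      rw [Fintype.sum_sum_type]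
      simp [Finset.sum_sub_distrib, hs]
  refine ⟨{ toFun := fun u => (⟨fun y => u.1 (Sum.inl y) +
                ∑ s, if π s = y then (u.1 (Sum.inr s) : A) else 0, ?_⟩, fun s => u.1 (Sum.inr s))
            invFun := fun p => ⟨Sum.elim (fun y => (p.1.1 y : A) -
                ∑ s, if π s = y then (p.2 s : A) else 0) (fun s => (p.2 s : A)), ?_⟩
            left_inv := fun u => D.ext fun z => ?_
            right_inv := fun p => Prod.ext (D.ext fun y => ?_) rfl
            map_add' := fun u v => Prod.ext (D.ext fun y => ?_) rfl }, fun g u => ?_⟩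
  · exact (key (fun z => (u.1 z : A))).trans (D.sum_eq u)
  · exact (key' (fun y => (p.1.1 y : A)) (fun s => (p.2 s : A))).trans (D.sum_eq p.1)
  · rcases z with y | s
    · exact add_sub_cancel_right _ _
    · rfl
  · exact sub_add_cancel _ _
  · change ((u.1 (Sum.inl y) : A) + (v.1 (Sum.inl y) : A) +
      ∑ s, if π s = y then ((u.1 (Sum.inr s) : A) + (v.1 (Sum.inr s) : A)) else 0) =
      ((u.1 (Sum.inl y) : A) + ∑ s, if π s = y then (u.1 (Sum.inr s) : A) else 0) +
      ((v.1 (Sum.inl y) : A) + ∑ s, if π s = y then (v.1 (Sum.inr s) : A) else 0)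
    rw [add_add_add_comm, ← Finset.sum_add_distrib]
    congr 1
    exact Finset.sum_congr rfl fun s _ => by split_ifs <;> simp
  · refine Prod.ext (D.ext fun y => ?_) rfl
    change g • (u.1 (Sum.inl (g⁻¹ • y)) : A) +
        ∑ s, (if π s = y then g • (u.1 (Sum.inr (g⁻¹ • s)) : A) else 0) =
      g • ((u.1 (Sum.inl (g⁻¹ • y)) : A) +
        ∑ s, if π s = g⁻¹ • y then (u.1 (Sum.inr s) : A) else 0)
    rw [smul_add, Finset.smul_sum]
    congr 1
    refine Fintype.sum_equiv (MulAction.toPerm g⁻¹) _ _ fun s => ?_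
    rw [MulAction.toPerm_apply, hπ, smul_ite, smul_zero]
    exact if_congr ⟨fun h => by rw [h], fun h => smul_left_cancel _ h⟩ rfl rfl

theorem D_isFr {A : GMod G} (hA : IsFr A) : IsFr (D Y A) := by
  obtain ⟨a, ha⟩ := hA
  let L : (Y → Fin a → ℤ) →ₗ[ℤ] (Fin a → ℤ) := ∑ y, LinearMap.proj y
  have hL : ∀ v, L v = ∑ y, v y := fun v => by simp [L, LinearMap.sum_apply]
  refine .of_iso (isFr_ind_triv (LinearMap.ker L)) (ha.D.trans ?_)
  refine ⟨{ toFun := fun u g => ⟨fun y => u.1 (g • y) g, ?_⟩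
            invFun := fun F => ⟨fun y g => (F g).1 (g⁻¹ • y), ?_⟩
            left_inv := fun u => D.ext fun y => funext fun g => ?_
            right_inv := fun F => funext fun g => Subtype.ext (funext fun y => ?_)
            map_add' := fun u v => rfl }, fun h u => ?_⟩
  · refine LinearMap.mem_ker.2 ((hL _).trans ?_)
    refine (Fintype.sum_equiv (MulAction.toPerm g) _ (fun y => (u.1 y g : Fin a → ℤ))
      fun y => rfl).trans ?_
    exact (Finset.sum_apply (M := fun _ : G => Fin a → ℤ) g Finset.univ fun y => u.1 y).symm.trans (congrFun (D.sum_eq u) g)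
  · refine funext fun g => ?_
    refine (Finset.sum_apply (M := fun _ : G => Fin a → ℤ) g Finset.univ
      fun y g => (F g).1 (g⁻¹ • y)).trans ?_
    have := (hL _).symm.trans (LinearMap.mem_ker.1 (F g).2)
    refine Eq.trans (Fintype.sum_equiv (MulAction.toPerm g⁻¹) _ (fun y => (F g).1 y)
      fun y => rfl) this
  · exact congrArg (fun z => (u.1 z g : Fin a → ℤ)) (smul_inv_smul g y)
  · exact congrArg (F g).1 (inv_smul_smul g y)
  · refine funext fun g => Subtype.ext (funext fun y => ?_)
    exact congrArg (fun z => (u.1 z (h⁻¹ * g) : Fin a → ℤ)) (mul_smul h⁻¹ g y).symm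

theorem D_nontrivial [Nontrivial Y] {A : GMod G} [Nontrivial A] : Nontrivial (D Y A) := by
  classical
  obtain ⟨y, y', h⟩ := exists_pair_ne Y
  obtain ⟨a, ha⟩ := exists_ne (0 : A)
  have hs : ∑ z, (Pi.single y a - Pi.single y' a : Y → A) z = 0 := by simp
  let u : D Y A := ⟨(Pi.single y a - Pi.single y' a : Y → A), hs⟩
  refine ⟨⟨u, 0, fun e => ha ?_⟩⟩
  have e' := congrFun (congrArg Subtype.val e) y
  have : (Pi.single y a - Pi.single y' a : Y → A) y = 0 := e'
  simpa [Pi.single_eq_of_ne h] using this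

theorem Dn_nontrivial [Nontrivial Y] {A : GMod G} [h : Nontrivial A] (n : ℕ) :
    Nontrivial (Dn Y n A) := by
  induction n with
  | zero => exact h
  | succ n ih => rw [Dn_succ]; exact D_nontrivial

theorem Dn_sum_iso [Finite G] (hS : FreeAct G S) {A : GMod G} (hA : Lat A) (π : S → Y)
    (hπ : ∀ (g : G) s, π (g • s) = g • π s) (n : ℕ) :
    ∃ F, IsFr F ∧ Iso (Dn (Y ⊕ S) n A) (prod (Dn Y n A) F) := by
  induction n with
  | zero => exact ⟨Fr G 0, ⟨0, .refl _⟩, (prod_Fr_zero A).symm⟩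
  | succ n ih =>
    obtain ⟨F, hF, i⟩ := ih
    have hl := (Dn.lat (Y := Y) hA n).prod hF.lat
    refine ⟨prod (D Y F) (Ind S (prod (Dn Y n A) F)), (D_isFr hF).prod (Ind.isFr hS hl), ?_⟩
    rw [Dn_succ, Dn_succ]
    refine i.D.trans ((D_sum_iso _ π hπ).trans (Iso.trans ?_ (prod_assoc _ _ _)))
    exact (D.prod_iso _ _).prod (.refl _)

end stab

theorem isFr_large [Finite G] {c : ℕ} {A : GMod G} (hA : Lat A) [Nontrivial A] :
    ∃ r, c ≤ r ∧ Iso (Ind (Σ _ : Fin c, G) A) (Fr G r) := by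
  have := Fintype.ofFinite G
  have hf : FreeAct G (Σ _ : Fin c, G) := fun y g h => by
    obtain ⟨i, x⟩ := y
    have h' : (⟨i, g • x⟩ : Σ _ : Fin c, G) = ⟨i, x⟩ := h
    simpa using h'
  obtain ⟨r, e, he⟩ := Ind.isFr hf hA
  refine ⟨r, ?_, e, he⟩
  have := hA.1; have := hA.2
  have h1 : Module.finrank ℤ ((Σ _ : Fin c, G) → A) = Module.finrank ℤ (G → Fin r → ℤ) :=
    LinearEquiv.finrank_eq e.toIntLinearEquiv
  have h2 : Module.finrank ℤ (G → Fin r → ℤ) = Fintype.card G * r := by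
    rw [Module.finrank_pi_fintype]; simp
  have h3 : Module.finrank ℤ ((Σ _ : Fin c, G) → A) =
      c * Fintype.card G * Module.finrank ℤ A := by
    rw [Module.finrank_pi_fintype]; simp
  have h4 : 0 < Module.finrank ℤ A := Module.finrank_pos
  have h5 : 0 < Fintype.card G := Fintype.card_pos
  nlinarith [mul_le_mul_of_nonneg_left h4 (Nat.zero_le (c * Fintype.card G))]

theorem exists_period_free [Finite G]
    (h : ∀ A : Subgroup G, (∀ a b : A, a * b = b * a) → IsCyclic A) :
    ∃ (Y : Type) (_ : Fintype Y) (_ : MulAction G Y) (_ : Nonempty Y) (n b : ℕ), 3 ≤ n ∧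
      FreeAct G Y ∧ Iso (Dn Y n (ZZ G)) (prod (ZZ G) (Fr G b)) := by
  have := Fintype.ofFinite G
  have hS : ∀ {α β : Type} [MulAction G α] [MulAction G β], FreeAct G α → FreeAct G β →
      FreeAct G (α ⊕ β) := fun ha hb y g e => by
    rcases y with y | y
    · exact ha y g (Sum.inl_injective e)
    · exact hb y g (Sum.inr_injective e)
  have hY : FreeAct G (G ⊕ G) := hS regular_free regular_free
  have hnt : Nontrivial (G ⊕ G) := ⟨Sum.inl 1, Sum.inr 1, by simp⟩
  have hZ : Nontrivial (ZZ G) := inferInstanceAs (Nontrivial ℤ)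
  obtain ⟨n, hn, hev, K, hl, hK, hst, hC⟩ := exists_period_cyclic hY h
  obtain ⟨M, hM, hMK⟩ := exists_torsion hl hK hC
  have h1 := Steq.Dn_mul hY hev hl hK hst (M * 3)
  obtain ⟨a₀, b₀, h2⟩ := (cls_eq_zero_iff (pw.lat hl (M * 3)) (pw.isProj hK _)).1
    (by rw [cls_pw hl hK, mul_comm, mul_smul, hMK, smul_zero])
  obtain ⟨a, b, e⟩ : Steq (Dn (G ⊕ G) (n * (M * 3)) (ZZ G)) (ZZ G) :=
    h1.trans ((Steq.prod (.refl _) ⟨a₀, b₀, h2.trans (Fr.add 0 b₀ |>.trans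
      (by rw [zero_add]; exact .refl _)).symm⟩).trans (.of_iso (prod_Fr_zero _)))
  obtain ⟨N, hN⟩ : ∃ N, n * (M * 3) = N + 1 := ⟨n * (M * 3) - 1, by
    have := Nat.mul_pos hn (Nat.mul_pos hM (by norm_num : 0 < 3)); omega⟩
  have hN3 : 3 ≤ N + 1 := by rw [← hN]; nlinarith [Nat.mul_pos hn hM]
  rw [hN] at e
  have hf : FreeAct G (Σ _ : Fin a, G) := fun y g h => by
    obtain ⟨i, x⟩ := y
    have h' : (⟨i, g • x⟩ : Σ _ : Fin a, G) = ⟨i, x⟩ := h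
    simpa using h'
  have hπ : ∀ (g : G) (s : Σ _ : Fin a, G), (Sum.inl (g • s).2 : G ⊕ G) = g • Sum.inl s.2 :=
    fun _ _ => rfl
  obtain ⟨F, hF, i⟩ := Dn_sum_iso (Y := G ⊕ G) hf (Lat.ZZ (G := G)) (fun s => Sum.inl s.2) hπ N
  have hD := (Dn.lat (Y := G ⊕ G) (Lat.ZZ (G := G)) N)
  have : Nontrivial (prod (Dn (G ⊕ G) N (ZZ G)) F) :=
    have := Dn_nontrivial (Y := G ⊕ G) (A := ZZ G) N
    inferInstanceAs (Nontrivial (_ × F))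
  obtain ⟨r, har, j⟩ := isFr_large (c := a) (hD.prod hF.lat)
  obtain ⟨s, hs⟩ := D_isFr (Y := G ⊕ G) hF
  refine ⟨(G ⊕ G) ⊕ Σ _ : Fin a, G, inferInstance, inferInstance, inferInstance, N + 1,
    b + (r - a + s), hN3, hS hY hf, ?_⟩
  rw [Dn_succ]
  refine i.D.trans ((D_sum_iso _ (fun s => Sum.inl s.2) hπ).trans (((D.prod_iso _ _).prod j).trans
    ((prod_assoc _ _ _).trans ?_)))
  rw [Dn_succ] at e
  obtain ⟨t, rfl⟩ := Nat.exists_eq_add_of_le har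
  refine ((Iso.refl _).prod ((hs.prod (.refl _)).trans (Fr.add _ _))).trans ?_
  have : s + (a + t) = a + (t + s) := by omega
  rw [this, show a + t - a = t by omega]
  exact (prod_Fr_add _ _ _).symm.trans ((e.prod (.refl _)).trans (prod_Fr_add _ _ _))

end GMod

namespace GMod

/-- Functions on `Y^n` all of whose marginals vanish. -/
def Marg {n : ℕ} {Y : Type} [Fintype Y] (f : (Fin n → Y) → ℤ) : Prop :=
  ∀ (a : Fin n → Y) (i : Fin n), ∑ y, f (Function.update a i y) = 0

/-- The product of the differences of delta functions. -/
def dd {n : ℕ} {Y : Type} [DecidableEq Y] (a b c : Fin n → Y) : ℤ :=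
  ∏ i, ((if c i = a i then 1 else 0) - (if c i = b i then 1 else 0))

section marg
variable {n : ℕ} {Y : Type} [Fintype Y]

theorem Marg.sum_mul {f : (Fin n → Y) → ℤ} (hf : Marg f) (i : Fin n) (w : (Fin n → Y) → ℤ)
    (hw : ∀ a y, w (Function.update a i y) = w a) : ∑ a, f a * w a = 0 := by
  classical
  rw [← Equiv.sum_comp (Equiv.funSplitAt i Y).symm, Fintype.sum_prod_type, Finset.sum_comm]
  refine Finset.sum_eq_zero fun r _ => ?_
  rcases isEmpty_or_nonempty Y with h | ⟨⟨y₁⟩⟩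
  · simp
  have : ∀ y, (Equiv.funSplitAt i Y).symm (y, r) =
      Function.update ((Equiv.funSplitAt i Y).symm (y₁, r)) i y := fun y => by
    ext j
    by_cases h : j = i
    · subst h; simp [Equiv.funSplitAt, Equiv.piSplitAt]
    · simp [Equiv.funSplitAt, Equiv.piSplitAt, h]
  refine (Finset.sum_congr rfl fun y _ => by rw [this y, hw]).trans ?_
  rw [← Finset.sum_mul, hf, zero_mul]

variable [DecidableEq Y]

theorem Marg.expand {f : (Fin n → Y) → ℤ} (hf : Marg f) (y₀ : Fin n → Y) (c : Fin n → Y) :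
    ∑ a, f a * dd a y₀ c = f c := by
  have key : ∀ s : Finset (Fin n), ∑ a, f a * ∏ i, ((if c i = a i then 1 else 0) -
      (if i ∈ s then (if c i = y₀ i then 1 else 0) else 0)) = f c := fun s => by
    induction s using Finset.induction_on with
    | empty =>
      simp only [Finset.notMem_empty, if_false, sub_zero, Finset.prod_ite_zero, Finset.prod_const_one]
      simp [← funext_iff]
    | insert i s hi ih =>
      rw [← ih, ← sub_eq_zero, ← Finset.sum_sub_distrib]
      refine Eq.trans (Finset.sum_congr rfl fun a _ => ?_) (hf.sum_mul i
        (fun a => - (if c i = y₀ i then 1 else 0) * ∏ j ∈ Finset.univ.erase i,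
          ((if c j = a j then 1 else 0) - (if j ∈ s then (if c j = y₀ j then 1 else 0) else 0)))
        fun a y => ?_)
      · rw [← mul_sub, ← Finset.mul_prod_erase _ _ (Finset.mem_univ i),
          ← Finset.mul_prod_erase _ _ (Finset.mem_univ i)]
        have : ∀ j ∈ Finset.univ.erase i, (j ∈ insert i s ↔ j ∈ s) := fun j hj => by
          simp [Finset.ne_of_mem_erase hj]
        rw [Finset.prod_congr rfl fun j hj => by rw [if_congr (this j hj) rfl rfl]]
        simp only [Finset.mem_insert_self, if_true, hi, if_false]
        ring
      · congr 1
        exact Finset.prod_congr rfl fun j hj => by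
          rw [Function.update_of_ne (Finset.ne_of_mem_erase hj)]
  simpa [dd] using key Finset.univ

theorem dd_marg (a b : Fin n → Y) : Marg (dd a b) := fun c i => by
  have : ∀ y, dd a b (Function.update c i y) = ((if y = a i then 1 else 0) -
      (if y = b i then 1 else 0)) * ∏ j ∈ Finset.univ.erase i,
        ((if c j = a j then 1 else 0) - (if c j = b j then 1 else 0)) := fun y => by
    rw [dd, ← Finset.mul_prod_erase _ _ (Finset.mem_univ i), Function.update_self]
    congr 1
    exact Finset.prod_congr rfl fun j hj => by
      rw [Function.update_of_ne (Finset.ne_of_mem_erase hj)]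
  simp only [this]
  rw [← Finset.sum_mul]
  simp

end marg

theorem exists_Dn_embed {G Y : Type} [Group G] [Fintype Y] [MulAction G Y] (n : ℕ) : ∃ φ : Dn Y n (ZZ G) →+ ((Fin n → Y) → ℤ),
    Function.Injective φ ∧ (∀ f, Marg f ↔ ∃ u, φ u = f) ∧
    ∀ (g : G) u a, φ (g • u) a = φ u (fun i => g⁻¹ • a i) := by
  induction n with
  | zero =>
    refine ⟨AddMonoidHom.mk' (M := ℤ) (fun k _ => k) fun _ _ => rfl,
      fun k l h => congrFun h (fun i => i.elim0), fun f => ⟨fun _ => ⟨f default,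
        funext fun a => congrArg f (Subsingleton.elim _ _)⟩, fun _ _ i => i.elim0⟩, fun g u a => rfl⟩
  | succ n ih =>
    obtain ⟨φ, hi, hm, he⟩ := ih
    rw [Dn_succ]
    let ψ : D Y (Dn Y n (ZZ G)) →+ ((Fin (n + 1) → Y) → ℤ) :=
      AddMonoidHom.mk' (fun u a => φ (u.1 (a 0)) (Fin.tail a)) fun u v => funext fun a =>
        congrFun (map_add φ (u.1 (a 0)) (v.1 (a 0))) _
    refine ⟨ψ, (injective_iff_map_eq_zero ψ).2 fun u hu => D.ext fun y => ?_, fun f =>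
      ⟨fun hf => ?_, ?_⟩, fun g u a => he _ _ _⟩
    · refine (injective_iff_map_eq_zero φ).1 hi _ (funext fun a => ?_)
      have := congrFun hu (Fin.cons y a)
      simpa [ψ] using this
    · have h1 : ∀ y, Marg fun a => f (Fin.cons y a) := fun y a i => by
        rw [← hf (Fin.cons y a) i.succ]
        simp [Fin.cons_update]
      choose u hu using fun y => (hm _).1 (h1 y)
      have h2 : ∑ y, u y = 0 := (injective_iff_map_eq_zero φ).1 hi _ (funext fun a => by
        rw [map_sum, Finset.sum_apply]
        simp_rw [hu]
        rcases isEmpty_or_nonempty Y with h | ⟨⟨y₁⟩⟩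
        · simp
        rw [Pi.zero_apply, ← hf (Fin.cons y₁ a) 0]
        simp [Fin.update_cons_zero])
      refine ⟨⟨u, h2⟩, funext fun a => ?_⟩
      exact (congrFun (hu (a 0)) (Fin.tail a)).trans (by simp)
    · rintro ⟨u, rfl⟩ a i
      refine Fin.cases ?_ (fun i => ?_) i
      · have h1 : ∀ y, ψ u (Function.update a 0 y) = φ (u.1 y) (Fin.tail a) := fun y => by
          change φ (u.1 (Function.update a 0 y 0)) _ = _
          rw [Function.update_self]
          exact congrArg _ (Fin.tail_update_zero a y)
        rw [Finset.sum_congr rfl fun y _ => h1 y, ← Finset.sum_apply]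
        refine (congrFun (map_sum φ (fun y => u.1 y) Finset.univ).symm _).trans ?_
        rw [D.sum_eq u, map_zero, Pi.zero_apply]
      · rw [← (hm _).2 ⟨u.1 (a 0), rfl⟩ (Fin.tail a) i]
        refine Finset.sum_congr rfl fun y _ => ?_
        change φ (u.1 (Function.update a i.succ y 0)) _ = _
        rw [Function.update_of_ne (Fin.succ_ne_zero i).symm]
        exact congrArg _ (Fin.tail_update_succ a i y)

/-- A free `G`-set whose `n`-fold join has one-dimensional plus free homology. -/
theorem exists_marg_basis (G : Type) [Group G] [Fintype G] [DecidableEq G]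
    (h : ∀ A : Subgroup G, (∀ a b : A, a * b = b * a) → IsCyclic A) :
    ∃ (Y : Type) (_ : Fintype Y) (_ : DecidableEq Y) (_ : MulAction G Y) (y₀ : Y) (n b : ℕ)
      (z : Option (Fin b × G) → (Fin n → Y) → ℤ)
      (Q : (Fin n → Y) → Option (Fin b × G) → ℤ),
      3 ≤ n ∧ FreeAct G Y ∧ (∀ j, Marg (z j)) ∧
      (∀ i g a, z (some (i, g)) a = z (some (i, 1)) (fun k => g⁻¹ • a k)) ∧
      (∀ a c, ∑ j, Q a j * z j c = dd a (fun _ => y₀) c) ∧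
      ∀ i j, ∑ a, z i a * Q a j = Pi.single (M := fun _ => ℤ) i 1 j := by
  classical
  obtain ⟨Y, _, _, ⟨y₀⟩, n, b, hn, hY, e, he⟩ := exists_period_free h
  obtain ⟨φ, hi, hm, hφ⟩ := exists_Dn_embed (Y := Y) (G := G) n
  let c : (Option (Fin b × G) → ℤ) →+ prod (ZZ G) (Fr G b) :=
    AddMonoidHom.mk' (G := ℤ × (G → Fin b → ℤ)) (fun u => (u none, fun g i => u (some (i, g))))
      fun u v => rfl
  have hc : Function.Bijective c := ⟨fun u v huv => funext fun j => by
    have h1 := congrArg (fun p : ℤ × (G → Fin b → ℤ) => p.1) huv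
    have h2 := congrArg (fun p : ℤ × (G → Fin b → ℤ) => p.2) huv
    rcases j with _ | ⟨i, g⟩
    · exact h1
    · exact congrFun (congrFun h2 g) i, fun p => ⟨fun j => j.elim (p.1 : ℤ) fun q => p.2 q.2 q.1,
      rfl⟩⟩
  let Ψ : (Option (Fin b × G) → ℤ) →+ ((Fin n → Y) → ℤ) := φ.comp (e.symm.toAddMonoidHom.comp c)
  have hΨ : Function.Injective Ψ := hi.comp (e.symm.injective.comp hc.1)
  have hΨm : ∀ f, Marg f ↔ ∃ u, Ψ u = f := fun f => by
    rw [hm]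
    refine ⟨fun ⟨u, hu⟩ => ?_, fun ⟨u, hu⟩ => ⟨_, hu⟩⟩
    obtain ⟨v, hv⟩ := hc.2 (e u)
    exact ⟨v, by rw [← hu]; exact congrArg φ ((congrArg e.symm hv).trans (e.symm_apply_apply u))⟩
  have hΨs : ∀ u, Ψ u = ∑ j, u j • Ψ (Pi.single j 1) := fun u => by
    conv_lhs => rw [pi_eq_sum_univ' u]
    rw [map_sum]
    exact Finset.sum_congr rfl fun j _ => by rw [map_zsmul]
  choose Q hQ using fun a : Fin n → Y => (hΨm _).1 (dd_marg a (fun _ => y₀))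
  refine ⟨Y, inferInstance, inferInstance, inferInstance, y₀, n, b, fun j => Ψ (Pi.single j 1), Q,
    hn, hY, fun j => (hΨm _).2 ⟨_, rfl⟩, fun i g a => ?_, fun a d => ?_, fun i j => ?_⟩
  · refine Eq.trans ?_ (hφ g _ a)
    have : g • c (Pi.single (some (i, 1)) 1) = c (Pi.single (some (i, g)) 1) := by
      refine Prod.ext ?_ (funext fun h => funext fun k => ?_)
      · change (Pi.single (M := fun _ => ℤ) (some (i, 1)) 1 : Option (Fin b × G) → ℤ) none =
          (Pi.single (M := fun _ => ℤ) (some (i, g)) 1 : Option (Fin b × G) → ℤ) none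
        simp
      · change (Pi.single (M := fun _ => ℤ) (some (i, 1)) 1 : Option (Fin b × G) → ℤ)
          (some (k, g⁻¹ * h)) = (Pi.single (M := fun _ => ℤ) (some (i, g)) 1 :
          Option (Fin b × G) → ℤ) (some (k, h))
        simp [Pi.single_apply, inv_mul_eq_one, eq_comm]
    refine congrFun (congrArg φ ?_) a
    refine e.injective ?_
    rw [he]
    exact (e.apply_symm_apply _).trans (this.symm.trans
      (congrArg (fun x => g • x) (e.apply_symm_apply _).symm))
  · rw [← hQ, hΨs]
    simp
  · have h1 : Ψ (∑ a, Ψ (Pi.single i 1) a • Q a) = Ψ (Pi.single i 1) := by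
      rw [map_sum]
      refine funext fun d => ?_
      rw [Finset.sum_apply, ← ((hΨm (Ψ (Pi.single i 1))).2 ⟨_, rfl⟩).expand (fun _ => y₀) d]
      exact Finset.sum_congr rfl fun a _ => by rw [map_zsmul, hQ]; simp
    have := congrFun (hΨ h1) j
    simpa using this

end GMod

namespace Swan
open unitInterval Topology

instance (n : ℕ) : LocallyCompactSpace (CellBoundary n) :=
  haveI : CompactSpace (CellBoundary n) := inferInstance
  haveI : R1Space (CellBoundary n) := inferInstance
  haveI : WeaklyLocallyCompactSpace (CellBoundary n) := inferInstance
  inferInstance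

section cones
variable {m k : ℕ} {X Y Z : Type} [TopologicalSpace X] [TopologicalSpace Y] [TopologicalSpace Z]

/-- Polar coordinates on the cell. -/
def pol (m : ℕ) : C(I × CellBoundary (m + 1), Cell (m + 1)) where
  toFun x := ⟨(1 - (x.1 : ℝ)) • x.2.1, by
    rw [mem_closedBall_zero_iff, norm_smul, norm_eq_of_mem_sphere, mul_one, Real.norm_eq_abs,
      abs_of_nonneg (by linarith [x.1.2.2])]
    linarith [x.1.2.1]⟩
  continuous_toFun := by fun_prop

theorem pol_val (t : I) (s : CellBoundary (m + 1)) : (pol m (t, s)).1 = (1 - (t : ℝ)) • s.1 := rfl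

theorem norm_pol (t : I) (s : CellBoundary (m + 1)) : ‖(pol m (t, s)).1‖ = 1 - t := by
  rw [pol_val, norm_smul, norm_eq_of_mem_sphere, mul_one, Real.norm_eq_abs,
      abs_of_nonneg (by linarith [t.2.2])]

theorem pol_surj : Function.Surjective (pol m) := fun p => by
  have hp := mem_closedBall_zero_iff.1 p.2
  by_cases h : p.1 = 0
  · refine ⟨(1, ⟨EuclideanSpace.single 0 1, by simp⟩), Subtype.ext ?_⟩
    rw [pol_val, h]; simp
  · refine ⟨(⟨1 - ‖p.1‖, by linarith, by linarith [norm_nonneg p.1]⟩, ⟨‖p.1‖⁻¹ • p.1, ?_⟩), Subtype.ext ?_⟩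
    · rw [mem_sphere_zero_iff_norm, norm_smul, norm_inv, norm_norm, inv_mul_cancel₀]
      simpa using h
    · rw [pol_val]
      simp [smul_smul, h]

theorem pol_quot : IsQuotientMap (pol m) :=
  (pol m).continuous.isClosedMap.isQuotientMap (pol m).continuous pol_surj

theorem pol_eq {t t' : I} {s s' : CellBoundary (m + 1)} (h : pol m (t, s) = pol m (t', s')) :
    t = t' ∧ (t = 1 ∨ s = s') := by
  have h1 : t = t' := by
    have := congrArg (fun p => ‖p.1‖) h
    simp only [norm_pol] at this
    exact Subtype.ext (by linarith)
  subst h1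
  refine ⟨rfl, or_iff_not_imp_left.2 fun ht => Subtype.ext ?_⟩
  have h2 := congrArg Subtype.val h
  rw [pol_val, pol_val] at h2
  refine smul_right_injective _ (sub_ne_zero.2 fun e => ht (Subtype.ext e.symm)) h2

variable {f : Fin k → C(CellBoundary (m + 1), X)}

/-- The inclusion of the base. -/
def inn (f : Fin k → C(CellBoundary (m + 1), X)) : C(X, AttachCells (m + 1) k X f) :=
  ⟨fun x => Quot.mk _ (Sum.inl x), continuous_quot_mk.comp continuous_inl⟩

/-- The characteristic maps. -/
def chr (f : Fin k → C(CellBoundary (m + 1), X)) (j : Fin k) :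
    C(Cell (m + 1), AttachCells (m + 1) k X f) :=
  ⟨fun p => Quot.mk _ (Sum.inr ⟨j, p⟩), continuous_quot_mk.comp
    (continuous_inr.comp continuous_sigmaMk)⟩

theorem chr_pol_zero (j : Fin k) (s : CellBoundary (m + 1)) :
    chr f j (pol m (0, s)) = inn f (f j s) := by
  refine (Quot.sound ⟨j, s, rfl, ?_⟩).symm
  have : pol m (0, s) = ⟨s.1, sphere_subset_closedBall s.2⟩ := Subtype.ext (by simp [pol_val])
  rw [this]

/-- The path of maps from the sphere given by a cell. -/
def tau (f : Fin k → C(CellBoundary (m + 1), X)) (j : Fin k) :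
    Path ((inn f).comp (f j)) (ContinuousMap.const _ (chr f j ⟨0, by simp⟩)) where
  toContinuousMap := ((chr f j).comp (pol m)).curry
  source' := ContinuousMap.ext fun s => chr_pol_zero j s
  target' := ContinuousMap.ext fun s => congrArg (chr f j) (Subtype.ext (by simp [pol_val]))

theorem cellOf_wd {a : C(CellBoundary (m + 1), Z)} {z : Z}
    (γ : Path a (ContinuousMap.const _ z)) :
    Function.FactorsThrough (fun p => γ p.1 p.2) (pol m) :=
  fun ⟨t, s⟩ ⟨t', s'⟩ h => by
    obtain ⟨rfl, rfl | rfl⟩ := pol_eq h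
    · change γ 1 s = γ 1 s'
      rw [γ.target]; rfl
    · rfl

/-- A map on the cell from a null homotopy. -/
noncomputable def cellOf {a : C(CellBoundary (m + 1), Z)} {z : Z}
    (γ : Path a (ContinuousMap.const _ z)) : C(Cell (m + 1), Z) :=
  pol_quot.lift (ContinuousMap.uncurry γ.toContinuousMap) (cellOf_wd γ)

theorem cellOf_pol {a : C(CellBoundary (m + 1), Z)} {z : Z}
    (γ : Path a (ContinuousMap.const _ z)) (t : I) (s) : cellOf γ (pol m (t, s)) = γ t s :=
  DFunLike.congr_fun (pol_quot.lift_comp (ContinuousMap.uncurry γ.toContinuousMap)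
    (cellOf_wd γ)) (t, s)

/-- Maps out of a space with cells attached. -/
noncomputable def desc (u : C(X, Z)) (z : Fin k → Z)
    (γ : ∀ j, Path (u.comp (f j)) (ContinuousMap.const _ (z j))) :
    C(AttachCells (m + 1) k X f, Z) where
  toFun := Quot.lift (Sum.elim u fun p => cellOf (γ p.1) p.2) fun _ _ ⟨j, s, h, h'⟩ => by
    subst h h'
    have : (⟨s.1, sphere_subset_closedBall s.2⟩ : Cell (m + 1)) = pol m (0, s) :=
      Subtype.ext (by simp [pol_val])
    simp only [Sum.elim_inl, Sum.elim_inr]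
    rw [this, cellOf_pol, (γ j).source]; rfl
  continuous_toFun := continuous_quot_lift _ (u.continuous.sumElim
    (continuous_sigma fun j => (cellOf (γ j)).continuous))

theorem desc_chr (u : C(X, Z)) (z : Fin k → Z)
    (γ : ∀ j, Path (u.comp (f j)) (ContinuousMap.const _ (z j))) (j t s) :
    desc u z γ (chr f j (pol m (t, s))) = γ j t s := cellOf_pol _ _ _

theorem att_ext {g h : C(AttachCells (m + 1) k X f, Z)} (h1 : ∀ x, g (inn f x) = h (inn f x))
    (h2 : ∀ j t s, g (chr f j (pol m (t, s))) = h (chr f j (pol m (t, s)))) : g = h := by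
  refine ContinuousMap.ext fun w => ?_
  induction w using Quot.ind with | _ w
  rcases w with x | ⟨j, p⟩
  · exact h1 x
  · obtain ⟨⟨t, s⟩, rfl⟩ := pol_surj p
    exact h2 j t s

theorem homotopic_of_path {A : Type} [TopologicalSpace A] (φ : C(A, C(I, Z))) {g h : C(A, Z)}
    (hg : ∀ a, φ a 0 = g a) (hh : ∀ a, φ a 1 = h a) : g.Homotopic h :=
  ⟨{ toContinuousMap := φ.uncurry.comp ContinuousMap.prodSwap
     map_zero_left := hg
     map_one_left := hh }⟩

theorem desc_homotopic (F : C(X, C(I, Z))) {u u' : C(X, Z)} (h0 : ∀ x, F x 0 = u x)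
    (h1 : ∀ x, F x 1 = u' x) {z z' : Fin k → Z}
    {γ : ∀ j, Path (u.comp (f j)) (ContinuousMap.const _ (z j))}
    {γ' : ∀ j, Path (u'.comp (f j)) (ContinuousMap.const _ (z' j))}
    (K : ∀ _ : Fin k, C(I × I, C(CellBoundary (m + 1), Z))) (c : Fin k → C(I, Z))
    (hs : ∀ j r s, K j (r, 0) s = F (f j s) r) (ht : ∀ j r s, K j (r, 1) s = c j r)
    (hK0 : ∀ j t, K j (0, t) = γ j t) (hK1 : ∀ j t, K j (1, t) = γ' j t) :
    (desc u z γ).Homotopic (desc u' z' γ') := by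
  let Γ : ∀ j, Path (F.comp (f j)) (ContinuousMap.const _ (c j)) := fun j =>
    { toContinuousMap := (ContinuousMap.curry ⟨fun p : (I × CellBoundary (m + 1)) × I =>
        K j (p.2, p.1.1) p.1.2, by fun_prop⟩).curry
      source' := ContinuousMap.ext fun s => ContinuousMap.ext fun r => hs j r s
      target' := ContinuousMap.ext fun s => ContinuousMap.ext fun r => ht j r s }
  have hd : ∀ (r : I) (v : C(X, Z)) (w : Fin k → Z)
      (δ : ∀ j, Path (v.comp (f j)) (ContinuousMap.const _ (w j))), (∀ x, F x r = v x) →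
      (∀ j t, K j (r, t) = δ j t) → ∀ a, desc F c Γ a r = desc v w δ a := fun r v w δ hv hδ a => by
    let e : C(C(I, Z), Z) := ⟨fun γ => γ r, by fun_prop⟩
    refine DFunLike.congr_fun (f := e.comp (desc F c Γ)) (g := desc v w δ)
      (att_ext (fun x => hv x) fun j t s => ?_) a
    change desc F c Γ (chr f j (pol m (t, s))) r = _
    rw [desc_chr, desc_chr, ← hδ]
    rfl
  exact homotopic_of_path (desc F c Γ) (hd 0 u z γ h0 hK0) (hd 1 u' z' γ' h1 hK1)

theorem desc_homotopic_rel {u : C(X, Z)} {z : Fin k → Z}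
    {γ γ' : ∀ j, Path (u.comp (f j)) (ContinuousMap.const _ (z j))}
    (h : ∀ j, (γ j).Homotopic (γ' j)) : (desc u z γ).Homotopic (desc u z γ') := by
  exact desc_homotopic ⟨fun x => .const I (u x), by fun_prop⟩ (fun _ => rfl) (fun _ => rfl)
    (fun j => (h j).some.toContinuousMap) (fun j => .const I (z j))
    (fun j r s => by
      have := (h j).some.source r
      exact DFunLike.congr_fun this s)
    (fun j r s => by
      have := (h j).some.target r
      exact DFunLike.congr_fun this s)
    (fun j t => (h j).some.apply_zero t) (fun j t => (h j).some.apply_one t)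

/-- The larger of `r / 2` and `t`. -/
noncomputable def mx (q : I × I) : I :=
  ⟨max ((q.1 : ℝ) / 2) q.2, le_max_of_le_right q.2.2.1, max_le (by linarith [q.1.2.2]) q.2.2.2⟩

theorem continuous_mx : Continuous mx := by unfold mx; fun_prop

theorem trans_mx_zero {x y z : X} (p : Path x y) (q : Path y z) (r : I) :
    p.trans q (mx (r, 0)) = p r := by
  have h : (mx (r, 0) : ℝ) = r / 2 := max_eq_left (div_nonneg r.2.1 zero_le_two)
  rw [Path.trans_apply, dif_pos (by rw [h]; linarith [r.2.2])]
  exact congrArg p (Subtype.ext (by simp only [h]; ring))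

theorem mx_one (r : I) : mx (r, 1) = 1 :=
  Subtype.ext (max_eq_right (by simp only [Set.Icc.coe_one]; linarith [r.2.2]))

theorem mx_zero (t : I) : mx (0, t) = t :=
  Subtype.ext (max_eq_right (by simp only [Set.Icc.coe_zero]; linarith [t.2.1]))

theorem trans_mx_one {x y z : X} (p : Path x y) (q : Path y z) (t : I) :
    p.trans q (mx (1, t)) = (Path.refl y).trans q t := by
  have h : (mx (1, t) : ℝ) = max (1 / 2) (t : ℝ) := rfl
  rw [Path.trans_apply, Path.trans_apply]
  by_cases ht : (t : ℝ) ≤ 1 / 2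
  · rw [max_eq_left ht] at h
    rw [dif_pos ht, dif_pos h.le]
    exact (congrArg p (Subtype.ext (by simp only [h]; norm_num))).trans p.target
  · rw [max_eq_right (not_le.1 ht).le] at h
    rw [dif_neg ht, dif_neg (by rwa [h])]
    exact congrArg q (Subtype.ext (by simp only [h]))

theorem desc_homotopic_trans (F : C(X, C(I, Z))) {u u' : C(X, Z)} (h0 : ∀ x, F x 0 = u x)
    (h1 : ∀ x, F x 1 = u' x) {z : Fin k → Z} (p : ∀ j, Path (u.comp (f j)) (u'.comp (f j)))
    (hp : ∀ j r s, p j r s = F (f j s) r)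
    (γ : ∀ j, Path (u'.comp (f j)) (ContinuousMap.const _ (z j))) :
    (desc u z fun j => (p j).trans (γ j)).Homotopic (desc u' z γ) := by
  refine (desc_homotopic F (γ := fun j => (p j).trans (γ j)) h0 h1
    (γ' := fun j => (Path.refl _).trans (γ j))
    (fun j => ⟨fun q => (p j).trans (γ j) (mx q),
      ((p j).trans (γ j)).continuous.comp continuous_mx⟩)
    (fun j => .const I (z j)) (fun j r s => ?_) (fun j r s => ?_) (fun j t => ?_)
    (fun j t => trans_mx_one _ _ _)).trans (desc_homotopic_rel fun j => ⟨.reflTrans _⟩)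
  · rw [← hp]
    exact DFunLike.congr_fun (trans_mx_zero (p j) (γ j) r) s
  · change (p j).trans (γ j) (mx (r, 1)) s = _
    rw [mx_one, Path.target]
    rfl
  · change (p j).trans (γ j) (mx (0, t)) = _
    rw [mx_zero]

/-- Composition with a fixed map. -/
def post (S : Type) [TopologicalSpace S] (g : C(X, Z)) : C(C(S, X), C(S, Z)) :=
  ⟨fun a => g.comp a, by fun_prop⟩

variable {f' : Fin k → C(CellBoundary (m + 1), Y)}

/-- The map of adjunction spaces induced by a map of bases and homotopies. -/
noncomputable def adj (h : C(X, Y)) (P : ∀ j, Path (h.comp (f j)) (f' j)) :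
    C(AttachCells (m + 1) k X f, AttachCells (m + 1) k Y f') :=
  desc ((inn f').comp h) (fun j => chr f' j ⟨0, by simp⟩)
    fun j => ((P j).map (post _ (inn f')).continuous).trans (tau f' j)

theorem adj_left_inverse {h : C(X, Y)} (P : ∀ j, Path (h.comp (f j)) (f' j)) {h' : C(Y, X)}
    (H : (h'.comp h).Homotopic (.id X)) : ∃ Q : ∀ j, Path (h'.comp (f' j)) (f j),
      ((adj h' Q).comp (adj h P)).Homotopic (.id _) := by
  obtain ⟨H⟩ := H
  let F : C(X, C(I, X)) := (H.toContinuousMap.comp ContinuousMap.prodSwap).curry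
  let p : ∀ j, Path ((h'.comp h).comp (f j)) (f j) := fun j =>
    { toContinuousMap := (H.toContinuousMap.comp ((ContinuousMap.id I).prodMap (f j))).curry
      source' := ContinuousMap.ext fun s => H.apply_zero (f j s)
      target' := ContinuousMap.ext fun s => H.apply_one (f j s) }
  let Q : ∀ j, Path (h'.comp (f' j)) (f j) := fun j =>
    ((P j).map (post _ h').continuous).symm.trans (p j)
  refine ⟨Q, ?_⟩
  let q : ∀ j, Path (((inn f).comp (h'.comp h)).comp (f j)) ((inn f).comp (f j)) := fun j =>
    (p j).map (post _ (inn f)).continuous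
  let P' : ∀ j, Path (((inn f).comp (h'.comp h)).comp (f j)) (((inn f).comp h').comp (f' j)) :=
    fun j => ((P j).map (post _ h').continuous).map (post _ (inn f)).continuous
  have e1 : (adj h' Q).comp (adj h P) = desc ((inn f).comp (h'.comp h))
      (fun j => chr f j ⟨0, by simp⟩) fun j =>
        (P' j).trans (((P' j).symm.trans (q j)).trans (tau f j)) := by
    refine att_ext (fun x => rfl) fun j t s => ?_
    rw [desc_chr]
    refine (congrArg (adj h' Q) (desc_chr _ _ _ _ _ _)).trans ?_
    refine (congrArg (fun w : C(_, _) => adj h' Q (w s)) (Path.trans_apply _ _ t)).trans ?_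
    rw [Path.trans_apply]
    by_cases ht : (t : ℝ) ≤ 1 / 2
    · rw [dif_pos ht, dif_pos ht]; rfl
    · rw [dif_neg ht, dif_neg ht]
      refine (desc_chr _ _ _ _ _ _).trans ?_
      have hQ : (Q j).map (post _ (inn f)).continuous = (P' j).symm.trans (q j) :=
        (Path.map_trans _ _ (post _ (inn f)).continuous).trans rfl
      exact congrArg (fun w : Path (((inn f).comp h').comp (f' j)) ((inn f).comp (f j)) =>
        w.trans (tau f j) ⟨2 * t - 1, _⟩ s) hQ
  have e2 : desc (inn f) (fun j => chr f j ⟨0, by simp⟩) (tau f) = .id _ :=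
    att_ext (fun x => rfl) fun j t s => desc_chr _ _ _ _ _ _
  rw [e1, ← e2]
  refine (desc_homotopic_rel (γ' := fun j => (q j).trans (tau f j)) fun j => ?_).trans
    (desc_homotopic_trans ((ContinuousMap.comp (post I (inn f)) F)) (fun x => ?_) (fun x => ?_) q
      (fun j r s => rfl) (tau f))
  · rw [← Path.Homotopic.Quotient.eq]
    simp only [Path.Homotopic.Quotient.mk_trans, Path.Homotopic.Quotient.mk_symm]
    rw [← Path.Homotopic.Quotient.trans_assoc, ← Path.Homotopic.Quotient.trans_assoc,
      Path.Homotopic.Quotient.trans_symm, Path.Homotopic.Quotient.refl_trans]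
  · exact congrArg (inn f) (H.apply_zero x)
  · exact congrArg (inn f) (H.apply_one x)

theorem attach_homotopyEquiv (e : ContinuousMap.HomotopyEquiv X Y)
    (hf : ∀ j, (e.toFun.comp (f j)).Homotopic (f' j)) :
    Nonempty (ContinuousMap.HomotopyEquiv (AttachCells (m + 1) k X f)
      (AttachCells (m + 1) k Y f')) := by
  let P : ∀ j, Path (e.toFun.comp (f j)) (f' j) := fun j =>
    { toContinuousMap := (hf j).some.toContinuousMap.curry
      source' := ContinuousMap.ext fun s => (hf j).some.apply_zero s
      target' := ContinuousMap.ext fun s => (hf j).some.apply_one s }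
  obtain ⟨Q, hQ⟩ := adj_left_inverse P e.left_inv
  obtain ⟨P', hP⟩ := adj_left_inverse Q e.right_inv
  refine ⟨⟨adj _ P, adj _ Q, hQ, ?_⟩⟩
  have h1 : (adj e.toFun P).Homotopic (adj e.toFun P') := by
    have h2 := ContinuousMap.Homotopic.comp hP (.refl (adj e.toFun P))
    have h3 := ContinuousMap.Homotopic.comp (.refl (adj e.toFun P')) hQ
    exact h2.symm.trans h3
  exact (h1.comp (.refl _)).trans hP

end cones
end Swan

namespace Swan
open unitInterval Topology

/-- The base point of the sphere. -/
noncomputable def bp (m : ℕ) : CellBoundary (m + 1) := ⟨-EuclideanSpace.single 0 1, by simp⟩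

theorem bp_zero {m : ℕ} : (bp m).1 0 = -1 := by simp [bp]

theorem bp_succ {m : ℕ} (i : Fin m) : (bp m).1 i.succ = 0 := by simp [bp]

theorem sph_sum {m : ℕ} (x : CellBoundary (m + 1)) :
    x.1 0 ^ 2 + ∑ i : Fin m, x.1 i.succ ^ 2 = 1 := by
  rw [← Fin.sum_univ_succ (fun i => x.1 i ^ 2), ← EuclideanSpace.real_norm_sq_eq,
    norm_eq_of_mem_sphere, one_pow]

theorem sph_eq {m : ℕ} {x y : CellBoundary (m + 1)} (h : ∀ i, x.1 i = y.1 i) : x = y :=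
  Subtype.ext (PiLp.ext h)

theorem eq_bp {m : ℕ} {x : CellBoundary (m + 1)} (h : x.1 0 = -1) : x = bp m := by
  have hs := sph_sum x
  rw [h] at hs
  have h0 : ∑ i : Fin m, x.1 i.succ ^ 2 = 0 := by linarith
  rw [Finset.sum_eq_zero_iff_of_nonneg fun i _ => sq_nonneg _] at h0
  refine sph_eq fun i => ?_
  cases i using Fin.cases with
  | zero => rw [h, bp_zero]
  | succ i => rw [bp_succ]; exact pow_eq_zero_iff two_ne_zero |>.1 (h0 i (Finset.mem_univ _))

section cube
variable {m : ℕ}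

/-- Centred coordinates on the cube. -/
def uu (y : Fin m → I) : Fin m → ℝ := fun i => 2 * y i - 1

/-- The distance to the boundary of the cube. -/
noncomputable def mm (y : Fin m → I) : ℝ := 1 - ‖uu y‖

/-- The squared Euclidean distance to the centre. -/
noncomputable def ee (y : Fin m → I) : ℝ := ∑ i, uu y i ^ 2

theorem continuous_uu : Continuous (uu (m := m)) := by unfold uu; fun_prop

theorem continuous_mm : Continuous (mm (m := m)) := continuous_const.sub continuous_uu.norm

theorem continuous_ee : Continuous (ee (m := m)) :=
  continuous_finsetSum _ fun i _ => ((continuous_apply i).comp continuous_uu).pow 2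

theorem abs_uu (y : Fin m → I) (i) : |uu y i| ≤ 1 :=
  abs_le.2 ⟨by unfold uu; linarith [(y i).2.1], by unfold uu; linarith [(y i).2.2]⟩

theorem mm_nonneg (y : Fin m → I) : 0 ≤ mm y :=
  sub_nonneg.2 ((pi_norm_le_iff_of_nonneg zero_le_one).2 (abs_uu y))

theorem ee_nonneg (y : Fin m → I) : 0 ≤ ee y := Finset.sum_nonneg fun _ _ => sq_nonneg _

theorem ww_pos (y : Fin m → I) : 0 < mm y ^ 2 + ee y := by
  rcases (ee_nonneg y).eq_or_lt with h | h
  · have h0 : uu y = 0 := by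
      rw [ee, eq_comm, Finset.sum_eq_zero_iff_of_nonneg fun i _ => sq_nonneg _] at h
      exact funext fun i => pow_eq_zero_iff two_ne_zero |>.1 (h i (Finset.mem_univ _))
    rw [mm, h0, ← h]; norm_num
  · positivity

theorem mem_bdry {y : Fin m → I} : y ∈ Cube.boundary (Fin m) ↔ mm y = 0 := by
  constructor
  · rintro ⟨i, h⟩
    refine le_antisymm (sub_nonpos.2 ?_) (mm_nonneg y)
    refine le_trans ?_ (norm_le_pi_norm (uu y) i)
    rcases h with h | h <;> norm_num [uu, h]
  · intro h
    by_contra hy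
    have : ‖uu y‖ < 1 := by
      refine (pi_norm_lt_iff zero_lt_one).2 fun i => abs_lt.2 ?_
      have h0 : y i ≠ 0 := fun h => hy ⟨i, .inl h⟩
      have h1 : y i ≠ 1 := fun h => hy ⟨i, .inr h⟩
      have h0' := (unitInterval.pos_iff_ne_zero.2 h0)
      have h1' := (unitInterval.lt_one_iff_ne_one.2 h1)
      rw [← Subtype.coe_lt_coe] at h0' h1'
      simp only [Set.Icc.coe_zero, Set.Icc.coe_one] at h0' h1'
      unfold uu
      constructor <;> linarith
    unfold mm at h
    linarith

/-- The quotient map from the cube to the sphere. -/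
noncomputable def qq (m : ℕ) : C(Fin m → I, CellBoundary (m + 1)) where
  toFun y := ⟨WithLp.toLp 2 (Fin.cons ((mm y ^ 2 - ee y) / (mm y ^ 2 + ee y))
    fun i => 2 * mm y * uu y i / (mm y ^ 2 + ee y)), by
      have hw := ww_pos y
      have h : ∀ w, ∑ i, (2 * mm y * uu y i / w) ^ 2 = 4 * mm y ^ 2 * ee y / w ^ 2 := fun w => by
        rw [ee, Finset.mul_sum, Finset.sum_div]
        exact Finset.sum_congr rfl fun i _ => by ring
      rw [mem_sphere_zero_iff_norm, ← sq_eq_sq₀ (norm_nonneg _) zero_le_one, one_pow,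
        EuclideanSpace.real_norm_sq_eq, Fin.sum_univ_succ]
      simp only [Fin.cons_zero, Fin.cons_succ]
      rw [h]
      field_simp
      ring⟩
  continuous_toFun := by
    refine ((PiLp.continuous_toLp 2 _).comp (continuous_pi fun i => ?_)).subtype_mk _
    have hw : Continuous fun y : Fin m → I => mm y ^ 2 + ee y :=
      (continuous_mm.pow 2).add continuous_ee
    cases i using Fin.cases with
    | zero => exact ((continuous_mm.pow 2).sub continuous_ee).div hw fun y => (ww_pos y).ne'
    | succ i => exact ((continuous_const.mul continuous_mm).mul
        ((continuous_apply i).comp continuous_uu)).div hw fun y => (ww_pos y).ne'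

theorem qq_zero (y : Fin m → I) : (qq m y).1 0 = (mm y ^ 2 - ee y) / (mm y ^ 2 + ee y) := rfl

theorem qq_succ (y : Fin m → I) (i : Fin m) :
    (qq m y).1 i.succ = 2 * mm y * uu y i / (mm y ^ 2 + ee y) := rfl

theorem qq_eq_bp {y : Fin m → I} : qq m y = bp m ↔ y ∈ Cube.boundary (Fin m) := by
  have hw := ww_pos y
  rw [mem_bdry]
  constructor
  · intro h
    have h0 : (qq m y).1 0 = -1 := by rw [h, bp_zero]
    rw [qq_zero, div_eq_iff hw.ne'] at h0
    exact pow_eq_zero_iff two_ne_zero |>.1 (by linarith)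
  · intro h
    refine eq_bp ?_
    rw [qq_zero, div_eq_iff hw.ne', h]
    ring

theorem qq_inj {y y' : Fin m → I} (h : qq m y = qq m y') (hy : y ∉ Cube.boundary (Fin m)) :
    y = y' := by
  have hy' : y' ∉ Cube.boundary (Fin m) := by rwa [← qq_eq_bp, ← h, qq_eq_bp]
  rw [mem_bdry] at hy hy'
  have hm := lt_of_le_of_ne (mm_nonneg y) (Ne.symm hy)
  have hm' := lt_of_le_of_ne (mm_nonneg y') (Ne.symm hy')
  have hw := ww_pos y
  have hw' := ww_pos y'
  have h0 : (qq m y).1 0 = (qq m y').1 0 := by rw [h]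
  rw [qq_zero, qq_zero, div_eq_div_iff hw.ne' hw'.ne'] at h0
  have h1 : mm y ^ 2 * ee y' = mm y' ^ 2 * ee y := by linarith
  have h2 : ∀ i, mm y' * uu y i = mm y * uu y' i := fun i => by
    have h2 : (qq m y).1 i.succ = (qq m y').1 i.succ := by rw [h]
    rw [qq_succ, qq_succ, div_eq_div_iff hw.ne' hw'.ne'] at h2
    have h3 : (mm y' * uu y i - mm y * uu y' i) * (mm y * mm y' + mm y * ee y' / mm y') = 0 := by
      field_simp
      linear_combination (mm y' / 2) * h2 - uu y' i * h1
    have h4 := (mul_eq_zero.1 h3).resolve_right (ne_of_gt (add_pos_of_pos_of_nonneg (mul_pos hm hm')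
      (div_nonneg (mul_nonneg hm.le (ee_nonneg _)) hm'.le)))
    linarith
  have h3 : mm y' • uu y = mm y • uu y' := funext h2
  have h4 := congrArg norm h3
  rw [norm_smul, norm_smul, Real.norm_of_nonneg hm.le, Real.norm_of_nonneg hm'.le] at h4
  have h5 : mm y = mm y' := by unfold mm at h4 ⊢; linarith
  rw [h5] at h3
  have h6 := smul_right_injective _ hm'.ne' h3
  refine funext fun i => Subtype.ext ?_
  have h7 := congrFun h6 i
  unfold uu at h7
  linarith

theorem qq_surj (hm : 0 < m) : Function.Surjective (qq m) := fun x => by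
  by_cases hx : x.1 0 = -1
  · exact ⟨fun _ => 0, by rw [eq_bp hx, qq_eq_bp]; exact ⟨⟨0, hm⟩, .inl rfl⟩⟩
  have hs := sph_sum x
  have hx1 : 0 < 1 + x.1 0 := by
    have : -1 ≤ x.1 0 := by
      have := Finset.sum_nonneg fun (i : Fin m) (_ : i ∈ Finset.univ) => sq_nonneg (x.1 i.succ)
      nlinarith
    rcases this.eq_or_lt with h | h
    · exact (hx h.symm).elim
    · linarith
  let p : Fin m → ℝ := fun i => x.1 i.succ / (1 + x.1 0)
  have hp : ∑ i, p i ^ 2 = (1 - x.1 0) / (1 + x.1 0) := by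
    simp only [p, div_pow, ← Finset.sum_div]
    rw [div_eq_div_iff (by positivity) hx1.ne']
    linear_combination (1 + x.1 0) * hs
  have hr := norm_nonneg p
  have hr1 : 0 < 1 + ‖p‖ := by linarith
  have hb : ∀ i, |p i / (1 + ‖p‖)| ≤ 1 := fun i => by
    rw [abs_div, abs_of_pos hr1, div_le_one hr1]
    linarith [norm_le_pi_norm p i, Real.norm_eq_abs (p i)]
  let y : Fin m → I := fun i => ⟨(p i / (1 + ‖p‖) + 1) / 2, by linarith [abs_le.1 (hb i)],
    by linarith [abs_le.1 (hb i)]⟩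
  have hu : uu y = (1 + ‖p‖)⁻¹ • p := funext fun i => by
    simp only [uu, y, Pi.smul_apply, smul_eq_mul]; ring
  have hM : mm y = (1 + ‖p‖)⁻¹ := by
    rw [mm, hu, norm_smul, norm_inv, Real.norm_of_nonneg hr1.le]
    field_simp
    ring
  have he : ee y = (1 + ‖p‖)⁻¹ ^ 2 * ((1 - x.1 0) / (1 + x.1 0)) := by
    rw [← hp, ee, hu, Finset.mul_sum]
    exact Finset.sum_congr rfl fun i _ => by rw [Pi.smul_apply, smul_eq_mul, mul_pow]
  refine ⟨y, sph_eq fun i => ?_⟩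
  have hw := ww_pos y
  have hw' : mm y ^ 2 + ee y = (1 + ‖p‖)⁻¹ ^ 2 * (2 / (1 + x.1 0)) := by
    rw [hM, he]; field_simp; ring
  cases i using Fin.cases with
  | zero =>
    rw [qq_zero, hw', hM, he]
    field_simp
    ring
  | succ i =>
    rw [qq_succ, hw', hM, hu]
    simp only [p, Pi.smul_apply, smul_eq_mul]
    field_simp

theorem qq_quot (hm : 0 < m) : IsQuotientMap (qq m) :=
  (qq m).continuous.isClosedMap.isQuotientMap (qq m).continuous (qq_surj hm)

theorem qq_flip (y : Fin m → I) (i : Fin m) :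
    (qq m (Function.update y i (σ (y i)))).1 0 = (qq m y).1 0 ∧ ∀ j,
    (qq m (Function.update y i (σ (y i)))).1 j.succ =
      if j = i then -(qq m y).1 j.succ else (qq m y).1 j.succ := by
  have hu : ∀ j, uu (Function.update y i (σ (y i))) j = if j = i then -uu y j else uu y j := by
    intro j
    split_ifs with h
    · subst h; simp only [uu, Function.update_self, unitInterval.coe_symm_eq]; ring
    · simp only [uu, Function.update_of_ne h]
  have hM : mm (Function.update y i (σ (y i))) = mm y := by
    simp only [mm, Pi.norm_def]
    congr 3
    refine funext fun j => ?_
    rw [hu]; split_ifs <;> simp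
  have he : ee (Function.update y i (σ (y i))) = ee y :=
    Finset.sum_congr rfl fun j _ => by rw [hu]; split_ifs <;> simp
  refine ⟨by rw [qq_zero, qq_zero, hM, he], fun j => ?_⟩
  rw [qq_succ, qq_succ, hM, he, hu]
  split_ifs <;> ring

theorem qq_sign (y : Fin m → I) (i : Fin m) : ((y i : ℝ) ≤ 1 / 2 → (qq m y).1 i.succ ≤ 0) ∧
    ((1 / 2 : ℝ) ≤ y i → 0 ≤ (qq m y).1 i.succ) := by
  have hM := mm_nonneg y
  rw [qq_succ]
  refine ⟨fun h => div_nonpos_of_nonpos_of_nonneg (mul_nonpos_of_nonneg_of_nonpos (by positivity) ?_)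
    (ww_pos y).le, fun h => div_nonneg (mul_nonneg (by positivity) ?_) (ww_pos y).le⟩ <;>
  · unfold uu; linarith

end cube
end Swan

namespace Swan
open unitInterval Topology

section genloop
variable {N : Type} [DecidableEq N] {X : Type} [TopologicalSpace X] {x : X}

/-- A reparametrisation of the interval that is constant in the middle, joined to the identity. -/
noncomputable def lam (q : I × I) : I :=
  ⟨(1 - q.1) * q.2 + q.1 * (min (2 * (q.2 : ℝ)) (1 / 2) + max (2 * (q.2 : ℝ) - 3 / 2) 0), by
    have h1 := q.1.2.1
    have h2 := q.1.2.2
    have h3 := q.2.2.1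
    have h4 := q.2.2.2
    have h5 : 0 ≤ min (2 * (q.2 : ℝ)) (1 / 2) + max (2 * (q.2 : ℝ) - 3 / 2) 0 :=
      add_nonneg (le_min (by linarith) (by norm_num)) (le_max_right _ _)
    have h6 : min (2 * (q.2 : ℝ)) (1 / 2) + max (2 * (q.2 : ℝ) - 3 / 2) 0 ≤ 1 := by
      have := min_le_right (2 * (q.2 : ℝ)) (1 / 2)
      have : max (2 * (q.2 : ℝ) - 3 / 2) 0 ≤ 1 / 2 := max_le (by linarith) (by norm_num)
      linarith
    constructor <;> nlinarith⟩

theorem continuous_lam : Continuous lam := by unfold lam; fun_prop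

theorem lam_zero (t : I) : lam (0, t) = t := Subtype.ext (by simp [lam])

theorem lam_at_zero (s : I) : lam (s, 0) = 0 :=
  Subtype.ext (by simpa [lam] using Or.inr (by norm_num))

theorem lam_at_one (s : I) : lam (s, 1) = 1 := Subtype.ext (by norm_num [lam])

theorem lam_one (t : I) : (lam (1, t) : ℝ) = min (2 * (t : ℝ)) (1 / 2) + max (2 * (t : ℝ) - 3 / 2) 0 := by
  simp [lam]

/-- The class of a generalised loop. -/
def piMk (f : GenLoop N X x) : HomotopyGroup N X x := Quotient.mk _ f

theorem genLoop_split [Nonempty N] (i : N) {f f₁ f₂ : GenLoop N X x}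
    (h₁ : ∀ y : N → I, (y i : ℝ) ≤ 1 / 2 → f y = f₁ y ∧ f₂ y = x)
    (h₂ : ∀ y : N → I, (1 / 2 : ℝ) ≤ y i → f y = f₂ y ∧ f₁ y = x) :
    piMk f = piMk f₂ * piMk f₁ := by
  refine Eq.trans ?_ (HomotopyGroup.mul_spec (i := i) (p := f₂) (q := f₁)).symm
  refine Quotient.sound ⟨?_⟩
  refine
    { toFun := fun p => f (Function.update p.2 i (lam (p.1, p.2 i)))
      continuous_toFun := f.1.continuous.comp (continuous_snd.update i (continuous_lam.comp
        (continuous_fst.prodMk ((continuous_apply i).comp continuous_snd))))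
      map_zero_left := fun y => ?_
      map_one_left := fun y => ?_
      prop' := fun s y hy => ?_ }
  · change f _ = f y
    rw [lam_zero, Function.update_eq_self]
  · change f _ = if ((y i : ℝ) ≤ 1 / 2)
      then f₁ (Function.update y i <| Set.projIcc 0 1 zero_le_one (2 * (y i : ℝ)))
      else f₂ (Function.update y i <| Set.projIcc 0 1 zero_le_one (2 * (y i : ℝ) - 1))
    have h0 := (y i).2.1
    have h1 := (y i).2.2
    have hl := lam_one (y i)
    split_ifs with h
    · have hm : (Set.projIcc 0 1 zero_le_one (2 * (y i : ℝ)) : I) =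
        ⟨2 * (y i : ℝ), by linarith, by linarith⟩ := Set.projIcc_of_mem _ _
      rw [hm]
      rw [max_eq_right (by linarith), add_zero] at hl
      rw [(h₁ _ (by rw [Function.update_self, hl]; exact min_le_right _ _)).1]
      rcases le_total (2 * (y i : ℝ)) (1 / 2) with h' | h'
      · rw [min_eq_left h'] at hl
        congr 2
        exact Subtype.ext hl
      · rw [min_eq_right h'] at hl
        rw [(h₂ _ (by rw [Function.update_self, hl])).2,
          (h₂ _ (by rw [Function.update_self]; exact h')).2]
    · have h := (not_le.1 h).le
      have hm : (Set.projIcc 0 1 zero_le_one (2 * (y i : ℝ) - 1) : I) =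
        ⟨2 * (y i : ℝ) - 1, by linarith, by linarith⟩ := Set.projIcc_of_mem _ _
      rw [hm]
      rw [min_eq_right (by linarith)] at hl
      rw [(h₂ _ (by rw [Function.update_self, hl]; linarith [le_max_right (2 * (y i : ℝ) - 3 / 2) 0])).1]
      rcases le_total (2 * (y i : ℝ) - 1) (1 / 2) with h' | h'
      · rw [max_eq_right (by linarith), add_zero] at hl
        rw [(h₁ _ (by rw [Function.update_self, hl])).2,
          (h₁ _ (by rw [Function.update_self]; exact h')).2]
      · rw [max_eq_left (by linarith)] at hl
        congr 2
        exact Subtype.ext (by rw [hl]; ring)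
  · refine Eq.trans ?_ (f.2 y hy).symm
    obtain ⟨j, hj⟩ := hy
    refine f.2 _ ⟨j, ?_⟩
    rcases eq_or_ne j i with rfl | hji
    · rw [Function.update_self]
      rcases hj with hj | hj
      · exact .inl ((congrArg (fun w => lam (s, w)) hj).trans (lam_at_zero s))
      · exact .inr ((congrArg (fun w => lam (s, w)) hj).trans (lam_at_one s))
    · rwa [Function.update_of_ne hji]

variable {Y : Type} [TopologicalSpace Y]

/-- Functoriality of generalised loops. -/
def glMap (g : C(X, Y)) {y : Y} (h : g x = y) (f : GenLoop N X x) : GenLoop N Y y :=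
  ⟨g.comp f.1, fun t ht => (congrArg g (f.2 t ht)).trans h⟩

/-- Functoriality of homotopy groups. -/
noncomputable def piMap [Nonempty N] (g : C(X, Y)) {y : Y} (h : g x = y) :
    HomotopyGroup N X x →* HomotopyGroup N Y y :=
  MonoidHom.mk' (Quotient.map (glMap g h) fun _ _ ⟨H⟩ => ⟨H.compContinuousMap g⟩) fun a b => by
    induction a using Quotient.inductionOn with | _ p
    induction b using Quotient.inductionOn with | _ q
    let i : N := Classical.arbitrary N
    refine (congrArg (Quotient.map (glMap g h) _)
      (HomotopyGroup.mul_spec (i := i) (p := p) (q := q))).trans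
      (Eq.trans ?_ (HomotopyGroup.mul_spec (i := i) (p := glMap g h p) (q := glMap g h q)).symm)
    refine congrArg (Quotient.mk _) (GenLoop.ext _ _ fun y => ?_)
    exact apply_ite g _ _ _

end genloop

section classes
variable {m : ℕ} {X Y : Type} [TopologicalSpace X] [TopologicalSpace Y] {x : X} {y : Y}

/-- The homotopy group of dimension `m + 2`. -/
abbrev Pi (m : ℕ) (X : Type) [TopologicalSpace X] (x : X) : Type := HomotopyGroup (Fin (m + 2)) X x

/-- Pointed maps from the sphere. -/
abbrev PM (m : ℕ) (X : Type) [TopologicalSpace X] (x : X) : Type :=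
  {φ : C(CellBoundary (m + 3), X) // φ (bp (m + 2)) = x}

/-- The loop of a pointed map. -/
noncomputable def loopOf (φ : PM m X x) : GenLoop (Fin (m + 2)) X x :=
  ⟨φ.1.comp (qq (m + 2)), fun y hy => by
    rw [ContinuousMap.comp_apply, qq_eq_bp.2 hy, φ.2]⟩

/-- The homotopy class of a pointed map. -/
noncomputable def cl (φ : PM m X x) : Pi m X x := piMk (loopOf φ)

theorem descend_wd {Z : Type} {x : Z} (g : (Fin (m + 2) → I) → Z) (hg : ∀ y ∈ Cube.boundary (Fin (m + 2)), g y = x) :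
    Function.FactorsThrough g (qq (m + 2)) := fun y y' h => by
  by_cases hy : y ∈ Cube.boundary (Fin (m + 2))
  · rw [hg y hy, hg y' (by rwa [← qq_eq_bp, ← h, qq_eq_bp])]
  · rw [qq_inj h hy]

/-- The map on the sphere given by a map on the cube. -/
noncomputable def descend (g : C(Fin (m + 2) → I, X))
    (hg : ∀ y ∈ Cube.boundary (Fin (m + 2)), g y = x) : PM m X x :=
  ⟨(qq_quot (Nat.succ_pos _)).lift g (descend_wd g hg), by
    rw [← qq_eq_bp.2 (⟨0, .inl rfl⟩ : (fun _ => 0) ∈ Cube.boundary (Fin (m + 2)))]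
    exact (DFunLike.congr_fun ((qq_quot (Nat.succ_pos _)).lift_comp g (descend_wd g hg)) _).trans
      (hg _ ⟨0, .inl rfl⟩)⟩

theorem descend_qq (g : C(Fin (m + 2) → I, X))
    (hg : ∀ y ∈ Cube.boundary (Fin (m + 2)), g y = x) (y) :
    (descend g hg).1 (qq (m + 2) y) = g y :=
  DFunLike.congr_fun ((qq_quot (Nat.succ_pos _)).lift_comp g (descend_wd g hg)) y

theorem cl_surj (a : Pi m X x) : ∃ φ : PM m X x, cl φ = a := by
  induction a using Quotient.inductionOn with | _ f
  refine ⟨descend f.1 f.2, congrArg (Quotient.mk _) (GenLoop.ext _ _ fun y => descend_qq _ f.2 y)⟩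

theorem cl_eq_of {φ ψ : PM m X x} (h : φ.1.HomotopicRel ψ.1 {bp (m + 2)}) : cl φ = cl ψ := by
  obtain ⟨H⟩ := h
  refine Quotient.sound ⟨?_⟩
  exact
    { toFun := fun p => H (p.1, qq (m + 2) p.2)
      continuous_toFun := by fun_prop
      map_zero_left := fun y => H.apply_zero _
      map_one_left := fun y => H.apply_one _
      prop' := fun t y hy => H.eq_fst t (qq_eq_bp.2 hy) }

/-- Homotopies given by a family of maps to a path space. -/
theorem homotopicRel_of_path {A : Type} [TopologicalSpace A] (φ : C(A, C(I, X))) {g h : C(A, X)}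
    (hg : ∀ a, φ a 0 = g a) (hh : ∀ a, φ a 1 = h a) {s : Set A} (hs : ∀ a ∈ s, ∀ t, φ a t = g a) :
    g.HomotopicRel h s :=
  ⟨{ toContinuousMap := φ.uncurry.comp ContinuousMap.prodSwap
     map_zero_left := hg
     map_one_left := hh
     prop' := fun t a ha => hs a ha t }⟩

theorem homotopicRel_of_cl {φ ψ : PM m X x} (h : cl φ = cl ψ) :
    φ.1.HomotopicRel ψ.1 {bp (m + 2)} := by
  obtain ⟨H⟩ : (loopOf φ).1.HomotopicRel (loopOf ψ).1 _ := Quotient.exact h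
  let K : PM m C(I, X) (.const I x) := descend (H.toContinuousMap.comp ContinuousMap.prodSwap).curry
    fun y hy => ContinuousMap.ext fun t => (H.eq_fst t hy).trans ((loopOf φ).2 y hy)
  have hK : ∀ y t, K.1 (qq (m + 2) y) t = H (t, y) := fun y t =>
    congrArg (fun w : C(I, X) => w t) (descend_qq _ _ y)
  refine homotopicRel_of_path K.1 (fun a => ?_) (fun a => ?_) ?_
  · obtain ⟨y, rfl⟩ := qq_surj (Nat.succ_pos _) a
    exact (hK y 0).trans (H.apply_zero y)
  · obtain ⟨y, rfl⟩ := qq_surj (Nat.succ_pos _) a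
    exact (hK y 1).trans (H.apply_one y)
  · rintro _ rfl t
    rw [K.2, φ.2]
    rfl

/-- Composition of pointed maps. -/
def PM.map (g : C(X, Y)) (h : g x = y) (φ : PM m X x) : PM m Y y :=
  ⟨g.comp φ.1, (congrArg g φ.2).trans h⟩

theorem piMap_cl (g : C(X, Y)) (h : g x = y) (φ : PM m X x) :
    piMap g h (cl φ) = cl (φ.map g h) := rfl

theorem cl_split_succ (i : Fin (m + 2)) {φ φ₁ φ₂ : PM m X x}
    (h₁ : ∀ s, s.1 i.succ ≤ 0 → φ.1 s = φ₁.1 s ∧ φ₂.1 s = x)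
    (h₂ : ∀ s, 0 ≤ s.1 i.succ → φ.1 s = φ₂.1 s ∧ φ₁.1 s = x) : cl φ = cl φ₂ * cl φ₁ :=
  genLoop_split i (fun y hy => h₁ _ ((qq_sign y i).1 hy)) (fun y hy => h₂ _ ((qq_sign y i).2 hy))

theorem cl_flip_succ (i : Fin (m + 2)) {φ φ' : PM m X x} (h : ∀ s s', s'.1 i.succ = -s.1 i.succ →
    (∀ j, j ≠ i.succ → s'.1 j = s.1 j) → φ'.1 s' = φ.1 s) : cl φ' = (cl φ)⁻¹ := by
  refine Eq.trans ?_ (HomotopyGroup.inv_spec (i := i) (p := loopOf φ)).symm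
  refine congrArg (Quotient.mk _) (GenLoop.ext _ _ fun y => ?_)
  change φ'.1 (qq _ y) = φ.1 (qq _ fun j => if j = i then σ (y i) else y j)
  have hy : (fun j => if j = i then σ (y i) else y j) = Function.update y i (σ (y i)) :=
    funext fun j => by rw [Function.update_apply]
  rw [hy]
  obtain ⟨h0, hs⟩ := qq_flip y i
  refine h _ _ (by rw [hs, if_pos rfl, neg_neg]) fun j hj => ?_
  cases j using Fin.cases with
  | zero => rw [h0]
  | succ j => rw [hs, if_neg fun e => hj (by rw [e])]

/-- Rotation in the plane of the first two coordinates. -/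
noncomputable def rot (m : ℕ) : C(I × CellBoundary (m + 3), CellBoundary (m + 3)) where
  toFun p := ⟨WithLp.toLp 2 (Fin.cons
    (Real.cos (Real.pi / 2 * p.1) * p.2.1 0 + Real.sin (Real.pi / 2 * p.1) * p.2.1 1)
    (Fin.cons (-(Real.sin (Real.pi / 2 * p.1) * p.2.1 0) + Real.cos (Real.pi / 2 * p.1) * p.2.1 1)
      fun i : Fin (m + 1) => p.2.1 i.succ.succ)), by
      have hs := sph_sum p.2
      rw [mem_sphere_zero_iff_norm, ← sq_eq_sq₀ (norm_nonneg _) zero_le_one, one_pow,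
        EuclideanSpace.real_norm_sq_eq, Fin.sum_univ_succ, Fin.sum_univ_succ]
      rw [Fin.sum_univ_succ] at hs
      simp only [Fin.succ_zero_eq_one] at hs
      simp only [Fin.cons_zero, Fin.cons_succ]
      have := Real.sin_sq_add_cos_sq (Real.pi / 2 * p.1)
      linear_combination hs + this * (p.2.1 0 ^ 2 + p.2.1 1 ^ 2)⟩
  continuous_toFun := by
    refine ((PiLp.continuous_toLp 2 _).comp (continuous_pi fun i => ?_)).subtype_mk _
    cases i using Fin.cases with
    | zero => simp only [Fin.cons_zero]; fun_prop
    | succ i =>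
      cases i using Fin.cases with
      | zero => simp only [Fin.cons_zero, Fin.cons_succ]; fun_prop
      | succ i => simp only [Fin.cons_succ]; fun_prop

theorem rot_two (p : I × CellBoundary (m + 3)) (i : Fin (m + 1)) :
    (rot m p).1 i.succ.succ = p.2.1 i.succ.succ := rfl

theorem rot_zero (s : CellBoundary (m + 3)) : rot m (0, s) = s := by
  refine sph_eq fun i => ?_
  cases i using Fin.cases with
  | zero => simp [rot]
  | succ i =>
    cases i using Fin.cases with
    | zero => simp [rot]
    | succ i => rfl

theorem rot_one_zero (s : CellBoundary (m + 3)) : (rot m (1, s)).1 0 = s.1 1 := by simp [rot]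

theorem rot_one_one (s : CellBoundary (m + 3)) : (rot m (1, s)).1 1 = -s.1 0 := by
  change (rot m (1, s)).1 (Fin.succ 0) = _
  simp [rot]

/-- Maps sending all coordinate hyperplanes to the base point. -/
def Kills (φ : PM m X x) : Prop := ∀ s i, s.1 i = 0 → φ.1 s = x

theorem bp_two : (bp (m + 2)).1 (Fin.succ (Fin.succ 0)) = 0 := bp_succ _

/-- Composition with the rotation by a right angle. -/
noncomputable def turn {φ : PM m X x} (h : Kills φ) : PM m X x :=
  ⟨φ.1.comp ((rot m).comp (.prodMk (.const _ 1) (.id _))), h (rot m (1, bp (m + 2))) (Fin.succ (Fin.succ 0))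
    ((rot_two _ 0).trans bp_two)⟩

theorem cl_turn {φ : PM m X x} (h : Kills φ) : cl (turn h) = cl φ := by
  refine (cl_eq_of ⟨?_⟩).symm
  exact
    { toFun := fun p => φ.1 (rot m p)
      continuous_toFun := by fun_prop
      map_zero_left := fun s => congrArg φ.1 (rot_zero s)
      map_one_left := fun s => rfl
      prop' := fun t s hs => by
        rw [Set.mem_singleton_iff.1 hs]
        exact (h (rot m (t, bp (m + 2))) (Fin.succ (Fin.succ 0)) ((rot_two _ 0).trans bp_two)).trans
          φ.2.symm }

theorem cl_split (i : Fin (m + 3)) {φ φ₁ φ₂ : PM m X x} (k : Kills φ) (k₁ : Kills φ₁)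
    (k₂ : Kills φ₂) (h₁ : ∀ s, s.1 i ≤ 0 → φ.1 s = φ₁.1 s ∧ φ₂.1 s = x)
    (h₂ : ∀ s, 0 ≤ s.1 i → φ.1 s = φ₂.1 s ∧ φ₁.1 s = x) : cl φ = cl φ₂ * cl φ₁ := by
  cases i using Fin.cases with
  | zero =>
    rw [← cl_turn k, ← cl_turn k₁, ← cl_turn k₂]
    exact cl_split_succ 0 (fun s hs => h₁ _ (le_of_eq_of_le (rot_one_zero s) hs))
      fun s hs => h₂ _ (le_of_le_of_eq hs (rot_one_zero s).symm)
  | succ i => exact cl_split_succ i h₁ h₂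

theorem cl_flip (i : Fin (m + 3)) {φ φ' : PM m X x} (k : Kills φ) (k' : Kills φ')
    (h : ∀ s s', s'.1 i = -s.1 i → (∀ j, j ≠ i → s'.1 j = s.1 j) → φ'.1 s' = φ.1 s) :
    cl φ' = (cl φ)⁻¹ := by
  cases i using Fin.cases with
  | zero =>
    rw [← cl_turn k, ← cl_turn k']
    refine cl_flip_succ 0 fun s s' h0 hj => h _ _ ?_ fun j hj0 => ?_
    · exact (rot_one_zero s').trans (h0.trans (congrArg _ (rot_one_zero s).symm))
    · cases j using Fin.cases with
      | zero => exact (hj0 rfl).elim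
      | succ j =>
        cases j using Fin.cases with
        | zero => exact (rot_one_one s').trans ((congrArg _ (hj 0 (Fin.succ_ne_zero 0).symm)).trans
            (rot_one_one s).symm)
        | succ j => exact hj _ fun e => Fin.succ_ne_zero _ (Fin.succ_injective _ e)
  | succ i => exact cl_flip_succ i h

end classes
end Swan

namespace Swan
open unitInterval Topology

section normalise
variable {m : ℕ}

/-- The ambient Euclidean space. -/
abbrev Ev (m : ℕ) : Type := EuclideanSpace ℝ (Fin (m + 3))

/-- The sphere. -/
abbrev Sp (m : ℕ) : Type := CellBoundary (m + 3)

open Classical in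
/-- Radial projection to the sphere. -/
noncomputable def nrm (v : Ev m) : Sp m :=
  if h : v = 0 then bp (m + 2) else ⟨‖v‖⁻¹ • v, by
    rw [mem_sphere_zero_iff_norm, norm_smul, norm_inv, norm_norm, inv_mul_cancel₀]
    exact norm_ne_zero_iff.2 h⟩

theorem nrm_val {v : Ev m} (h : v ≠ 0) : (nrm v).1 = ‖v‖⁻¹ • v := by
  unfold nrm
  rw [dif_neg h]

theorem nrm_apply {v : Ev m} (h : v ≠ 0) (i) : (nrm v).1 i = ‖v‖⁻¹ * v i := by
  rw [nrm_val h]; rfl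

theorem continuous_nrm {Z : Type} [TopologicalSpace Z] {f : Z → Ev m} (hf : Continuous f)
    (h0 : ∀ z, f z ≠ 0) : Continuous fun z => nrm (f z) := by
  refine Continuous.subtype_mk (f := fun z => ‖f z‖⁻¹ • f z) ?_ (fun z => ?_) |>.congr fun z =>
    Subtype.ext (nrm_val (h0 z)).symm
  · exact (hf.norm.inv₀ fun z => norm_ne_zero_iff.2 (h0 z)).smul hf
  · rw [← nrm_val (h0 z)]; exact (nrm (f z)).2

theorem sp_norm (x : Sp m) : ‖x.1‖ = 1 := norm_eq_of_mem_sphere x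

theorem sp_ne (x : Sp m) : x.1 ≠ 0 := fun h => by
  have := sp_norm x
  rw [h, norm_zero] at this
  exact zero_ne_one this

theorem nrm_smul {c : ℝ} (hc : 0 < c) (x : Sp m) : nrm (c • x.1) = x := by
  refine Subtype.ext ?_
  rw [nrm_val (smul_ne_zero hc.ne' (sp_ne x)), norm_smul, sp_norm, mul_one, smul_smul,
    Real.norm_eq_abs, abs_of_pos hc, inv_mul_cancel₀ hc.ne', one_smul]

theorem nrm_self (x : Sp m) : nrm x.1 = x := by simpa using nrm_smul one_pos x

theorem nrm_nonpos {v : Ev m} (hv : v ≠ 0) {i} (h : v i ≤ 0) : (nrm v).1 i ≤ 0 := by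
  rw [nrm_apply hv]
  exact mul_nonpos_of_nonneg_of_nonpos (inv_nonneg.2 (norm_nonneg _)) h

theorem norm_sub_bp {x : Sp m} (h : x.1 0 < -(1 / 2)) : ‖x.1 - (bp (m + 2)).1‖ < 1 := by
  rw [← sq_lt_one_iff₀ (norm_nonneg _), EuclideanSpace.real_norm_sq_eq, Fin.sum_univ_succ]
  have hs := sph_sum x
  simp only [PiLp.sub_apply, bp_zero, bp_succ, sub_zero]
  linarith [sq_nonneg (x.1 0)]

/-- A unit vector near the base point with negative coordinates. -/
noncomputable def s0 (m : ℕ) : Sp m :=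
  ⟨WithLp.toLp 2 (Fin.cons (-√(1 - (m + 2) * ((m + 3 : ℝ)⁻¹) ^ 2)) fun _ => -(m + 3 : ℝ)⁻¹), by
    rw [mem_sphere_zero_iff_norm, ← sq_eq_sq₀ (norm_nonneg _) zero_le_one, one_pow,
      EuclideanSpace.real_norm_sq_eq, Fin.sum_univ_succ]
    simp only [Fin.cons_zero, Fin.cons_succ, neg_sq, Finset.sum_const, Finset.card_univ,
      Fintype.card_fin, nsmul_eq_mul]
    rw [Real.sq_sqrt]
    · push_cast; ring
    · have : (m + 2 : ℝ) * ((m + 3 : ℝ)⁻¹) ^ 2 = (m + 2) / (m + 3) ^ 2 := by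
        rw [inv_pow, div_eq_mul_inv]
      rw [this, sub_nonneg, div_le_one (by positivity)]
      nlinarith⟩

theorem s0_zero : (s0 m).1 0 < -(1 / 2) := by
  change -√(1 - (m + 2) * ((m + 3 : ℝ)⁻¹) ^ 2) < _
  rw [neg_lt_neg_iff]
  refine Real.lt_sqrt_of_sq_lt ?_
  have : (m + 2 : ℝ) * ((m + 3 : ℝ)⁻¹) ^ 2 = (m + 2) / (m + 3) ^ 2 := by
      rw [inv_pow, div_eq_mul_inv]
  rw [this, lt_sub_comm, div_lt_iff₀ (by positivity)]
  nlinarith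

theorem s0_neg (i) : (s0 m).1 i < 0 := by
  cases i using Fin.cases with
  | zero => linarith [s0_zero (m := m)]
  | succ i =>
    change -(m + 3 : ℝ)⁻¹ < 0
    rw [neg_lt_zero]; positivity

/-- The product of the positive parts of the coordinates. -/
noncomputable def mn (x : Ev m) : ℝ := ∏ i, max (x i) 0

theorem continuous_mn : Continuous (mn (m := m)) := by unfold mn; fun_prop

theorem mn_nonneg (x : Ev m) : 0 ≤ mn x := Finset.prod_nonneg fun _ _ => le_max_right _ _

theorem mn_eq_zero {x : Ev m} {i} (h : x i ≤ 0) : mn x = 0 :=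
  Finset.prod_eq_zero (Finset.mem_univ i) (max_eq_right h)

theorem pos_of_mn {x : Ev m} (h : mn x ≠ 0) (i) : 0 < x i :=
  not_le.1 fun hi => h (mn_eq_zero hi)

/-- Unnormalised homotopy pushing the complement of the positive orthant to a point. -/
noncomputable def vv (s : I) (x : Ev m) : Ev m :=
  (1 - (s : ℝ) + s * mn x) • x + ((s : ℝ) * ‖x + (s0 m).1‖ ^ 2) • (s0 m).1

theorem continuous_vv : Continuous fun p : I × Ev m => vv p.1 p.2 := by
  have := continuous_mn (m := m)
  unfold vv
  fun_prop

theorem vv_zero (x : Ev m) : vv 0 x = x := by simp [vv]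

theorem vv_nonpos (s : I) {x : Ev m} {i} (h : x i ≤ 0) : vv s x i ≤ 0 := by
  change (1 - (s : ℝ) + s * mn x) * x i + ((s : ℝ) * ‖x + (s0 m).1‖ ^ 2) * (s0 m).1 i ≤ 0
  have h1 := s.2.1
  have h2 := s.2.2
  have := mul_nonneg h1 (mn_nonneg x)
  have := mul_nonneg h1 (sq_nonneg ‖x + (s0 m).1‖)
  nlinarith [s0_neg (m := m) i]

theorem neg_s0_pos {x : Ev m} (h : x + (s0 m).1 = 0) : 0 < mn x :=
  Finset.prod_pos fun i _ => lt_max_of_lt_left (by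
    rw [eq_neg_of_add_eq_zero_left h]
    exact neg_pos.2 (s0_neg i))

theorem norm_pos_of_mn {x : Ev m} (h : mn x = 0) : 0 < ‖x + (s0 m).1‖ ^ 2 :=
  pow_pos (norm_pos_iff.2 fun e => (neg_s0_pos e).ne' h) 2

theorem vv_ne (s : I) (x : Sp m) : vv s x.1 ≠ 0 := fun h => by
  have h1 := s.2.1
  have h2 := s.2.2
  have h3 := mul_nonneg h1 (mn_nonneg x.1)
  have hn := congrArg norm (eq_neg_of_add_eq_zero_left h)
  rw [norm_neg, norm_smul, norm_smul, sp_norm, sp_norm, mul_one, mul_one, Real.norm_eq_abs,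
    Real.norm_eq_abs, abs_of_nonneg (by linarith), abs_of_nonneg (by positivity)] at hn
  unfold vv at h
  rw [← hn, ← smul_add, smul_eq_zero] at h
  rcases h with h | h
  · rw [h] at hn
    have hs : (s : ℝ) ≠ 0 := fun hs => by rw [hs] at h; norm_num at h
    have hx : x.1 + (s0 m).1 = 0 := by
      rcases mul_eq_zero.1 hn.symm with h' | h'
      · exact (hs h').elim
      · exact norm_eq_zero.1 (pow_eq_zero_iff two_ne_zero |>.1 h')
    have := mul_pos (lt_of_le_of_ne h1 hs.symm) (neg_s0_pos hx)
    linarith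
  · rw [h] at hn
    have := neg_s0_pos h
    rw [norm_zero] at hn
    rcases h1.eq_or_lt with hs | hs
    · rw [← hs] at hn; norm_num at hn
    · have := mul_pos hs this
      nlinarith

theorem vv_one {x : Ev m} (h : mn x = 0) : vv 1 x = (‖x + (s0 m).1‖ ^ 2) • (s0 m).1 := by
  simp [vv, h]

/-- Vectors that are unit vectors as soon as all coordinates are positive. -/
def Adm (x : Ev m) : Prop := mn x ≠ 0 → ‖x‖ = 1

theorem vv_one_ne {x : Ev m} (h : Adm x) : vv 1 x ≠ 0 := by
  by_cases hx : mn x = 0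
  · rw [vv_one hx]
    exact smul_ne_zero (norm_pos_of_mn hx).ne' (sp_ne _)
  · exact vv_ne 1 ⟨x, mem_sphere_zero_iff_norm.2 (h hx)⟩

theorem nrm_vv_one {x : Ev m} (h : mn x = 0) : nrm (vv 1 x) = s0 m := by
  rw [vv_one h, nrm_smul (norm_pos_of_mn h)]

theorem mn_bp : mn (bp (m + 2)).1 = 0 := mn_eq_zero (i := 0) (by rw [bp_zero]; norm_num)

theorem shift_ne (u : Sp m) {v : Sp m} (hv : v.1 0 < -(1 / 2)) {s : ℝ} (h0 : 0 ≤ s) (h1 : s ≤ 1) :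
    u.1 + s • ((bp (m + 2)).1 - v.1) ≠ 0 := fun h => by
  have h2 := congrArg norm (eq_neg_of_add_eq_zero_left h)
  have h3 := norm_sub_bp hv
  rw [sp_norm, norm_neg, norm_smul, Real.norm_eq_abs, abs_of_nonneg h0, norm_sub_rev] at h2
  nlinarith [norm_nonneg (v.1 - (bp (m + 2)).1)]

/-- The homotopy moving the collapse point to the base point. -/
noncomputable def shf (s : I) (x : Ev m) : Sp m :=
  nrm ((nrm (vv 1 x)).1 + (s : ℝ) • ((bp (m + 2)).1 - (s0 m).1))

/-- The collapse of the complement of the positive orthant. -/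
noncomputable def that (x : Ev m) : Sp m := shf 1 x

theorem continuous_shf {Z : Type} [TopologicalSpace Z] {f : Z → Ev m} {s : Z → I}
    (hf : Continuous f) (hs : Continuous s) (h : ∀ z, Adm (f z)) :
    Continuous fun z => shf (s z) (f z) := by
  refine continuous_nrm ?_ fun z => shift_ne _ s0_zero (s z).2.1 (s z).2.2
  have := continuous_nrm (continuous_vv.comp ((continuous_const (y := (1 : I))).prodMk hf))
    fun z => vv_one_ne (h z)
  have h2 : Continuous fun z => (s z : ℝ) := by fun_prop
  exact (continuous_subtype_val.comp this).add (h2.smul continuous_const)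

theorem continuous_that {Z : Type} [TopologicalSpace Z] {f : Z → Ev m}
    (hf : Continuous f) (h : ∀ z, Adm (f z)) : Continuous fun z => that (f z) :=
  continuous_shf hf continuous_const h

theorem that_eq_bp {x : Ev m} (h : mn x = 0) : that x = bp (m + 2) := by
  unfold that shf
  rw [nrm_vv_one h, Set.Icc.coe_one, one_smul, add_sub_cancel, nrm_self]

theorem shf_nonpos (s : I) {x : Ev m} {i} (h : x i ≤ 0) : (shf s x).1 i ≤ 0 := by
  refine nrm_nonpos (shift_ne _ s0_zero s.2.1 s.2.2) ?_
  rw [nrm_vv_one (mn_eq_zero h)]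
  change (s0 m).1 i + s * ((bp (m + 2)).1 i - (s0 m).1 i) ≤ 0
  have hb : (bp (m + 2)).1 i ≤ 0 := by
    cases i using Fin.cases with
    | zero => rw [bp_zero]; norm_num
    | succ i => rw [bp_succ]
  nlinarith [s0_neg (m := m) i, s.2.1, s.2.2]

theorem vv_bp (s : I) : (nrm (vv s (bp (m + 2)).1)).1 0 < -(1 / 2) := by
  have h0 := vv_ne s (bp (m + 2))
  have hp := norm_pos_iff.2 h0
  rw [nrm_apply h0]
  have hd := norm_pos_of_mn (m := m) mn_bp
  have h1 := s.2.1
  have h2 := s.2.2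
  set d := ‖(bp (m + 2)).1 + (s0 m).1‖ ^ 2 with hd'
  have hv : vv s (bp (m + 2)).1 = (1 - (s : ℝ)) • (bp (m + 2)).1 + ((s : ℝ) * d) • (s0 m).1 := by
    unfold vv
    rw [mn_bp, mul_zero, add_zero]
  have hn : ‖vv s (bp (m + 2)).1‖ ≤ (1 - s) + s * d := by
    rw [hv]
    refine (norm_add_le _ _).trans ?_
    rw [norm_smul, norm_smul, sp_norm, sp_norm, mul_one, mul_one, Real.norm_eq_abs,
      Real.norm_eq_abs, abs_of_nonneg (by linarith), abs_of_nonneg (by positivity)]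
  have hc : vv s (bp (m + 2)).1 0 = -(1 - s) + s * d * (s0 m).1 0 := by
    rw [hv]
    change (1 - (s : ℝ)) * (bp (m + 2)).1 0 + _ = _
    rw [bp_zero]
    change _ + ((s : ℝ) * d) * (s0 m).1 0 = _
    ring
  rw [inv_mul_lt_iff₀ hp, hc]
  have hz := s0_zero (m := m)
  have hsd : 0 ≤ (s : ℝ) * d := by positivity
  rcases h2.lt_or_eq with hs | hs
  · nlinarith
  · have : 0 < (s : ℝ) * d := by rw [hs]; linarith
    nlinarith

/-- The collapse as a pointed map. -/
noncomputable def thatPM (m : ℕ) : PM m (Sp m) (bp (m + 2)) :=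
  ⟨⟨fun x => that x.1, continuous_that continuous_subtype_val fun x _ => sp_norm x⟩, that_eq_bp mn_bp⟩

/-- The identity as a pointed map. -/
def idPM (m : ℕ) : PM m (Sp m) (bp (m + 2)) := ⟨.id _, rfl⟩

theorem cl_that : cl (thatPM m) = cl (idPM m) := by
  refine (cl_eq_of ⟨?_⟩).symm
  have hT : Continuous fun p : I × Sp m => nrm (vv p.1 p.2.1) :=
    continuous_nrm (continuous_vv.comp (by fun_prop : Continuous fun p : I × Sp m => (p.1, p.2.1)))
      fun p => vv_ne p.1 p.2
  have hb : Continuous fun p : I × Sp m => nrm (vv p.1 (bp (m + 2)).1) :=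
    hT.comp (by fun_prop : Continuous fun p : I × Sp m => (p.1, bp (m + 2)))
  exact
    { toFun := fun p => nrm ((nrm (vv p.1 p.2.1)).1 +
        (1 : ℝ) • ((bp (m + 2)).1 - (nrm (vv p.1 (bp (m + 2)).1)).1))
      continuous_toFun := by
        refine continuous_nrm (by fun_prop) fun p => ?_
        exact shift_ne _ (vv_bp p.1) zero_le_one le_rfl
      map_zero_left := fun x => by
        change nrm ((nrm (vv 0 x.1)).1 + _) = x
        rw [vv_zero, vv_zero, nrm_self, nrm_self, sub_self, smul_zero, add_zero, nrm_self]
      map_one_left := fun x => by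
        change nrm ((nrm (vv 1 x.1)).1 + _) = nrm _
        rw [nrm_vv_one mn_bp, Set.Icc.coe_one]
      prop' := fun t x hx => by
        rw [Set.mem_singleton_iff.1 hx]
        change nrm _ = bp (m + 2)
        rw [one_smul, add_sub_cancel, nrm_self] }

end normalise
end Swan

namespace Swan
open unitInterval Topology

section wedge
variable {m : ℕ} {J : Type} {X : Type} [TopologicalSpace X] {x : X}

/-- The wedge of spheres indexed by `J`. -/
abbrev WW (m : ℕ) (J : Type) : Type :=
  {w : J → Sp m // ∀ j j', w j ≠ bp (m + 2) → w j' ≠ bp (m + 2) → j = j'}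

/-- The base point of the wedge. -/
noncomputable def wb (m : ℕ) (J : Type) : WW m J := ⟨fun _ => bp (m + 2), fun _ _ h => (h rfl).elim⟩

open Classical in
/-- The inclusion of a sphere in the wedge. -/
noncomputable def iot (m : ℕ) {J : Type} (j : J) : PM m (WW m J) (wb m J) :=
  ⟨⟨fun s => ⟨Function.update (fun _ => bp (m + 2)) j s, fun i i' h h' => by
      have : ∀ i, Function.update (fun _ => bp (m + 2)) j s i ≠ bp (m + 2) → i = j := fun i h =>
        by_contra fun e => h (Function.update_of_ne e _ _)
      rw [this i h, this i' h']⟩,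
    by exact (Continuous.update (f := fun _ : Sp m => fun _ : J => bp (m + 2)) continuous_const j
      continuous_id).subtype_mk _⟩,
    Subtype.ext (Function.update_eq_self j fun _ => bp (m + 2))⟩

open Classical in
theorem iot_apply (j : J) (s : Sp m) :
    ((iot m j).1 s).1 = Function.update (fun _ => bp (m + 2)) j s := rfl

theorem iot_self (j : J) (s : Sp m) : ((iot m j).1 s).1 j = s := by
  classical rw [iot_apply, Function.update_self]

theorem iot_ne {j j' : J} (h : j' ≠ j) (s : Sp m) : ((iot m j).1 s).1 j' = bp (m + 2) := by
  classical rw [iot_apply, Function.update_of_ne h]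

theorem iot_eq {w : WW m J} {j : J} (h : ∀ j', j' ≠ j → w.1 j' = bp (m + 2)) :
    (iot m j).1 (w.1 j) = w := Subtype.ext (funext fun j' => by
  rcases eq_or_ne j' j with rfl | hj
  · rw [iot_self]
  · rw [iot_ne hj, h j' hj])

theorem ww_cases (w : WW m J) : w = wb m J ∨ ∃ j s, w = (iot m j).1 s := by
  by_cases h : ∃ j, w.1 j ≠ bp (m + 2)
  · obtain ⟨j, hj⟩ := h
    exact .inr ⟨j, w.1 j, (iot_eq fun j' hj' => by_contra fun h => hj' (w.2 _ _ h hj)).symm⟩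
  · push Not at h
    exact .inl (Subtype.ext (funext h))

open Classical in
/-- The underlying function of a map out of a wedge. -/
noncomputable def wfun (φ : J → PM m X x) (w : WW m J) : X :=
  if h : ∃ j, w.1 j ≠ bp (m + 2) then (φ h.choose).1 (w.1 h.choose) else x

theorem wfun_base (φ : J → PM m X x) : wfun φ (wb m J) = x :=
  dif_neg fun ⟨_, h⟩ => h rfl

theorem wfun_eq (φ : J → PM m X x) {w : WW m J} {j : J} (h : ∀ j', j' ≠ j → w.1 j' = bp (m + 2)) :
    wfun φ w = (φ j).1 (w.1 j) := by
  unfold wfun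
  split_ifs with hw
  · have : hw.choose = j := by_contra fun e => hw.choose_spec (h _ e)
    rw [this]
  · push Not at hw
    rw [hw j, (φ j).2]

theorem continuous_wfun [Finite J] (φ : J → PM m X x) : Continuous (wfun φ) := by
  have hc : ∀ j, IsClosed {w : WW m J | w.1 j = bp (m + 2)} := fun j =>
    isClosed_eq ((continuous_apply j).comp continuous_subtype_val) continuous_const
  let A : Option J → Set (WW m J) := fun o => o.elim {wb m J} fun j =>
    {w | ∀ j', j' ≠ j → w.1 j' = bp (m + 2)}
  refine LocallyFinite.continuous (f := A) (locallyFinite_of_finite A) ?_ ?_ ?_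
  · refine Set.eq_univ_of_forall fun w => Set.mem_iUnion.2 ?_
    rcases ww_cases w with rfl | ⟨j, s, rfl⟩
    · exact ⟨none, rfl⟩
    · exact ⟨some j, fun j' hj => iot_ne hj s⟩
  · rintro (_ | j)
    · exact isClosed_singleton
    · have : A (some j) = ⋂ j', ⋂ _ : j' ≠ j, {w : WW m J | w.1 j' = bp (m + 2)} := by
        ext w; simp [A]
      rw [this]
      exact isClosed_iInter fun j' => isClosed_iInter fun _ => hc j'
  · rintro (_ | j)
    · exact continuousOn_singleton _ _
    · refine ContinuousOn.congr (f := fun w => (φ j).1 (w.1 j)) ?_ fun w hw => wfun_eq φ hw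
      exact ((φ j).1.continuous.comp
        ((continuous_apply j).comp continuous_subtype_val)).continuousOn

/-- The map out of a wedge given by pointed maps on the spheres. -/
noncomputable def wmap [Finite J] (φ : J → PM m X x) : C(WW m J, X) := ⟨wfun φ, continuous_wfun φ⟩

theorem wmap_base [Finite J] (φ : J → PM m X x) : wmap φ (wb m J) = x := wfun_base φ

theorem wmap_iot [Finite J] (φ : J → PM m X x) (j : J) (s : Sp m) :
    wmap φ ((iot m j).1 s) = (φ j).1 s :=
  (wfun_eq φ fun _ h => iot_ne h s).trans (congrArg (φ j).1 (iot_self j s))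

theorem wmap_comp_iot [Finite J] (φ : J → PM m X x) (j : J) :
    (iot m j).map (wmap φ) (wmap_base φ) = φ j :=
  Subtype.ext (ContinuousMap.ext fun s => wmap_iot φ j s)

theorem piMap_wmap [Finite J] (φ : J → PM m X x) (j : J) :
    piMap (wmap φ) (wmap_base φ) (cl (iot m j)) = cl (φ j) := by
  rw [piMap_cl, wmap_comp_iot]

theorem wedge_homotopicRel [Finite J] {g h : C(WW m J, X)} (hg : g (wb m J) = x)
    (hh : h (wb m J) = x)
    (H : ∀ j, piMap g hg (cl (iot m j)) = piMap h hh (cl (iot m j))) :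
    g.HomotopicRel h {wb m J} := by
  have H' : ∀ j, (g.comp (iot m j).1).HomotopicRel (h.comp (iot m j).1) {bp (m + 2)} := fun j =>
    homotopicRel_of_cl (φ := (iot m j).map g hg) (ψ := (iot m j).map h hh) (H j)
  let φ : J → PM m C(I, X) (.const I x) := fun j =>
    ⟨((H' j).some.toContinuousMap.comp ContinuousMap.prodSwap).curry, ContinuousMap.ext fun t =>
      ((H' j).some.eq_fst t rfl).trans (((congrArg g (iot m j).2).trans hg))⟩
  refine homotopicRel_of_path (wmap φ) (fun w => ?_) (fun w => ?_) ?_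
  · rcases ww_cases w with rfl | ⟨j, s, rfl⟩
    · rw [wmap_base, hg]; rfl
    · rw [wmap_iot]; exact (H' j).some.apply_zero s
  · rcases ww_cases w with rfl | ⟨j, s, rfl⟩
    · rw [wmap_base, hh]; rfl
    · rw [wmap_iot]; exact (H' j).some.apply_one s
  · rintro _ rfl t
    rw [wmap_base, hg]; rfl

/-- A matrix of integers realised by maps of wedges. -/
theorem exists_matrix_map [Finite J] {J' : Type} [Fintype J'] (A : J → J' → ℤ) :
    ∃ (g : C(WW m J, WW m J')) (hg : g (wb m J) = wb m J'),
      ∀ j, piMap g hg (cl (iot m j)) = ∏ j', cl (iot m j') ^ A j j' := by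
  choose φ hφ using fun j => cl_surj (∏ j', cl (iot m j') ^ A j j' : Pi m (WW m J') (wb m J'))
  exact ⟨wmap φ, wmap_base φ, fun j => (piMap_wmap φ j).trans (hφ j)⟩

theorem piMap_prod {Y : Type} [TopologicalSpace Y] {y : Y} [Fintype J] (g : C(X, Y)) (h : g x = y)
    (a : J → Pi m X x) (k : J → ℤ) :
    piMap g h (∏ j, a j ^ k j) = ∏ j, (piMap g h (a j)) ^ k j := by
  rw [map_prod]
  exact Finset.prod_congr rfl fun j _ => map_zpow _ _ _

theorem prod_zpow_sum {C : Type} [CommGroup C] (c : C) (s : Finset J) (k : J → ℤ) :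
    ∏ j ∈ s, c ^ k j = c ^ ∑ j ∈ s, k j := by
  classical
  induction s using Finset.induction_on with
  | empty => simp
  | insert j s hj ih => rw [Finset.prod_insert hj, Finset.sum_insert hj, zpow_add, ih]

theorem piMap_matrix {Y : Type} [TopologicalSpace Y] {y : Y} [Fintype J] {J' : Type} [Fintype J']
    (g : C(X, Y)) (h : g x = y) (a : J → Pi m X x) (c : J' → Pi m Y y) (A : J → J' → ℤ)
    (hA : ∀ j, piMap g h (a j) = ∏ j', c j' ^ A j j') (k : J → ℤ) :
    piMap g h (∏ j, a j ^ k j) = ∏ j', c j' ^ ∑ j, k j * A j j' := by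
  rw [piMap_prod]
  simp only [hA, ← Finset.prod_zpow, ← zpow_mul]
  rw [Finset.prod_comm]
  exact Finset.prod_congr rfl fun j _ => by simp only [mul_comm, prod_zpow_sum]

end wedge
end Swan

namespace Swan
open unitInterval Topology

section wedgecone
variable {m k : ℕ} {J : Type}

/-- The contraction of the cell to the base point. -/
noncomputable def ctr (m : ℕ) : C(I × Cell (m + 3), Cell (m + 3)) where
  toFun q := ⟨(1 - (q.1 : ℝ)) • q.2.1 + (q.1 : ℝ) • (bp (m + 2)).1, by
    have h := mem_closedBall_zero_iff.1 q.2.2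
    have h1 := q.1.2.1
    have h2 := q.1.2.2
    rw [mem_closedBall_zero_iff]
    refine (norm_add_le _ _).trans ?_
    rw [norm_smul, norm_smul, sp_norm, Real.norm_eq_abs, Real.norm_eq_abs, abs_of_nonneg h1,
      abs_of_nonneg (by linarith)]
    nlinarith⟩
  continuous_toFun := by fun_prop

theorem ctr_zero (p : Cell (m + 3)) : ctr m (0, p) = p := Subtype.ext (by simp [ctr])

theorem ctr_one (p : Cell (m + 3)) : ctr m (1, p) = pol (m + 2) (0, bp (m + 2)) :=
  Subtype.ext (by simp [ctr, pol_val])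

theorem ctr_bp (t : I) : ctr m (t, pol (m + 2) (0, bp (m + 2))) = pol (m + 2) (0, bp (m + 2)) :=
  Subtype.ext (by simp [ctr, pol_val, ← add_smul])

/-- The attaching maps of all spheres of a wedge but one. -/
noncomputable def att (e : Fin k ≃ J) : Fin k → C(CellBoundary (m + 3), WW m (Option J)) :=
  fun i => (iot m (some (e i))).1

theorem wedge_cone [Finite J] (e : Fin k ≃ J) :
    Nonempty (ContinuousMap.HomotopyEquiv
      (AttachCells (m + 3) k (WW m (Option J)) (att (m := m) e)) (Sp m)) := by
  let A := AttachCells (m + 3) k (WW m (Option J)) (att (m := m) e)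
  let f := att (m := m) e
  let p : C(WW m (Option J), Sp m) := ⟨fun w => w.1 none,
    (continuous_apply none).comp continuous_subtype_val⟩
  have hp : ∀ i, p.comp (f i) = .const _ (bp (m + 2)) := fun i =>
    ContinuousMap.ext fun s => iot_ne (by simp) s
  let r : C(A, Sp m) := desc p (fun _ => bp (m + 2)) fun i => (Path.refl _).cast (hp i) rfl
  let q : C(Sp m, A) := (inn f).comp (iot m none).1
  have hrq : r.comp q = .id _ := ContinuousMap.ext fun s => iot_self _ _
  refine ⟨⟨r, q, ?_, hrq ▸ .refl _⟩⟩
  have hq : ∀ i, ((inn f).comp ((iot m none).1.comp p)).comp (f i) =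
      .const _ (inn f (wb m (Option J))) := fun i => ContinuousMap.ext fun s =>
    congrArg (inn f) ((congrArg (iot m none).1 (DFunLike.congr_fun (hp i) s)).trans (iot m none).2)
  have hb : ∀ i, chr f i (pol (m + 2) (0, bp (m + 2))) = inn f (wb m (Option J)) := fun i =>
    (chr_pol_zero i _).trans (congrArg (inn f) (iot m (some (e i))).2)
  have h1 : q.comp r = desc ((inn f).comp ((iot m none).1.comp p))
      (fun _ => inn f (wb m (Option J))) fun i => (Path.refl _).cast (hq i) rfl := by
    refine att_ext (fun x => rfl) fun j t s => ?_
    rw [desc_chr]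
    refine (congrArg q (desc_chr _ _ _ _ _ _)).trans ?_
    exact congrArg (inn f) (iot m none).2
  have h2 : desc (inn f) (fun j => chr f j ⟨0, by simp⟩) (tau f) = .id A :=
    att_ext (fun x => rfl) fun j t s => desc_chr _ _ _ _ _ _
  let φ : Option J → PM m C(I, A) (.const I (inn f (wb m (Option J)))) := fun o => o.elim
    ⟨⟨fun s => .const I (q s), by fun_prop⟩,
      congrArg (fun w => ContinuousMap.const I (inn f w)) (iot m none).2⟩
    fun j => ⟨((chr f (e.symm j)).comp ((ctr m).comp
        ⟨fun x : Sp m × I => (x.2, pol (m + 2) (0, x.1)), by fun_prop⟩)).curry,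
      ContinuousMap.ext fun t => (congrArg (chr f (e.symm j)) (ctr_bp t)).trans (hb _)⟩
  have hφ : ∀ i s t, wmap φ (f i s) t = chr f i (ctr m (t, pol (m + 2) (0, s))) := fun i s t => by
    refine (congrArg (fun w : C(I, A) => w t) (wmap_iot φ (some (e i)) s)).trans ?_
    change chr f (e.symm (e i)) _ = _
    rw [e.symm_apply_apply]
    rfl
  rw [h1, ← h2]
  refine (desc_homotopic (wmap φ) (fun x => ?_) (fun x => ?_)
    (fun i => ⟨fun a => ((chr f i).comp ((ctr m).comp
      ⟨fun s => (a.1, pol (m + 2) (a.2, s)), by fun_prop⟩)), ?_⟩)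
    (fun i => ⟨fun a => chr f i (ctr m (a, ⟨0, by simp⟩)), by fun_prop⟩)
    (fun i a s => (hφ i s a).symm) (fun i a s => ?_) (fun i t => ?_) fun i t => ?_).symm
  · rcases ww_cases x with rfl | ⟨_ | j, s, rfl⟩
    · rw [wmap_base]; rfl
    · rw [wmap_iot]; rfl
    · obtain ⟨i, rfl⟩ := e.surjective j
      refine (hφ i s 0).trans ?_
      rw [ctr_zero, chr_pol_zero]
      rfl
  · rcases ww_cases x with rfl | ⟨_ | j, s, rfl⟩
    · rw [wmap_base]; exact congrArg (inn f) (iot m none).2.symm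
    · rw [wmap_iot]; exact congrArg (fun w => inn f ((iot m none).1 w)) (iot_self none s).symm
    · obtain ⟨i, rfl⟩ := e.surjective j
      refine (hφ i s 1).trans ?_
      rw [ctr_one, hb]
      exact (DFunLike.congr_fun (hq i) s).symm
  · exact ContinuousMap.continuous_of_continuous_uncurry _ (by
      change Continuous fun q : (I × I) × Sp m => chr f i (ctr m (q.1.1, pol (m + 2) (q.1.2, q.2)))
      fun_prop)
  · exact congrArg (fun w => chr f i (ctr m (a, w))) (Subtype.ext (by simp [pol_val]))
  · exact ContinuousMap.ext fun s => congrArg (chr f i) (ctr_zero _)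
  · exact ContinuousMap.ext fun s => (congrArg (chr f i) (ctr_one _)).trans (hb i)

end wedgecone
end Swan

namespace Swan
open unitInterval Topology

section labels
variable {m : ℕ} {Y : Type}

/-- The vector of values along a sequence of labels. -/
def col (ξ : Fin (m + 3) → Y → ℝ) (c : Fin (m + 3) → Y) : Ev m := WithLp.toLp 2 fun i => ξ i (c i)

theorem col_apply (ξ : Fin (m + 3) → Y → ℝ) (c : Fin (m + 3) → Y) (i) : col ξ c i = ξ i (c i) := rfl

section sum
variable [Fintype Y] {y₀ : Y}

/-- Label functions with at most one label in each slot, of norm one if every slot is occupied. -/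
def Good (ξ : Fin (m + 3) → Y → ℝ) : Prop :=
  (∀ i y, 0 ≤ ξ i y) ∧ (∀ i y y', ξ i y ≠ 0 → ξ i y' ≠ 0 → y = y') ∧
    ((∀ i, ∃ y, ξ i y ≠ 0) → ∑ i, ∑ y, ξ i y ^ 2 = 1)

theorem sum_sq_single {f : Y → ℝ} (h : ∀ y y', f y ≠ 0 → f y' ≠ 0 → y = y') {y : Y} (hy : f y ≠ 0) :
    ∑ y, f y ^ 2 = f y ^ 2 :=
  Finset.sum_eq_single y (fun y' _ hne => by
    rw [by_contra fun h' => hne (h _ _ h' hy), zero_pow two_ne_zero])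
    fun h => (h (Finset.mem_univ _)).elim

theorem Good.adm {ξ : Fin (m + 3) → Y → ℝ} (h : Good ξ) (c : Fin (m + 3) → Y) : Adm (col ξ c) := by
  intro hm
  have hp : ∀ i, ξ i (c i) ≠ 0 := fun i => (pos_of_mn hm i).ne'
  have := h.2.2 fun i => ⟨c i, hp i⟩
  rw [← sq_eq_sq₀ (norm_nonneg _) zero_le_one, one_pow, EuclideanSpace.real_norm_sq_eq, ← this]
  exact Finset.sum_congr rfl fun i _ => (sum_sq_single (h.2.1 i) (hp i)).symm

/-- Sequences of labels avoiding the base label. -/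
abbrev BB (m : ℕ) (y₀ : Y) : Type := {c : Fin (m + 3) → Y // ∀ i, c i ≠ y₀}

/-- The collapse of a label function to a wedge of spheres. -/
noncomputable def kap (y₀ : Y) {ξ : Fin (m + 3) → Y → ℝ} (h : Good ξ) : WW m (BB m y₀) :=
  ⟨fun c => that (col ξ c.1), fun c c' hc hc' => by
    have h1 := pos_of_mn fun e => hc (that_eq_bp e)
    have h2 := pos_of_mn fun e => hc' (that_eq_bp e)
    exact Subtype.ext (funext fun i => h.2.1 i _ _ (h1 i).ne' (h2 i).ne')⟩

theorem continuous_kap {Z : Type} [TopologicalSpace Z] {f : Z → Fin (m + 3) → Y → ℝ}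
    (hf : Continuous f) (h : ∀ z, Good (f z)) : Continuous fun z => kap y₀ (h z) := by
  refine Continuous.subtype_mk (continuous_pi fun c => ?_) _
  refine continuous_that (f := fun z => col (f z) c.1) ?_ fun z => (h z).adm _
  exact (PiLp.continuous_toLp 2 _).comp (continuous_pi fun i =>
    (continuous_apply (c.1 i)).comp ((continuous_apply i).comp hf))

theorem kap_congr {ξ ξ' : Fin (m + 3) → Y → ℝ} (e : ξ = ξ') (h : Good ξ) (h' : Good ξ') :
    kap y₀ h = kap y₀ h' := by subst e; rfl

theorem kap_base {ξ : Fin (m + 3) → Y → ℝ} (h : Good ξ)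
    (hξ : ∀ c : BB m y₀, ∃ i, ξ i (c.1 i) = 0) : kap y₀ h = wb m (BB m y₀) :=
  Subtype.ext (funext fun c => that_eq_bp (by
    obtain ⟨i, hi⟩ := hξ c
    exact mn_eq_zero (i := i) hi.le))

end sum

variable [DecidableEq Y]

/-- The label function with prescribed labels for positive and negative coordinates. -/
noncomputable def sig (a b : Fin (m + 3) → Option Y) (x : Ev m) : Fin (m + 3) → Y → ℝ := fun i y =>
  (if a i = some y then max (x i) 0 else 0) + (if b i = some y then max (-x i) 0 else 0)

theorem continuous_sig (a b : Fin (m + 3) → Option Y) : Continuous fun x : Ev m => sig a b x := by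
  refine continuous_pi fun i => continuous_pi fun y => ?_
  unfold sig
  split_ifs <;> fun_prop

theorem sig_of_nonneg {a b : Fin (m + 3) → Option Y} {x : Ev m} {i} (h : 0 ≤ x i) (y : Y) :
    sig a b x i y = if a i = some y then x i else 0 := by
  unfold sig
  rw [max_eq_left h, max_eq_right (neg_nonpos.2 h), ite_self, add_zero]

theorem sig_of_nonpos {a b : Fin (m + 3) → Option Y} {x : Ev m} {i} (h : x i ≤ 0) (y : Y) :
    sig a b x i y = if b i = some y then -x i else 0 := by
  unfold sig
  rw [max_eq_right h, max_eq_left (neg_nonneg.2 h), ite_self, zero_add]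

theorem sig_nonneg (a b : Fin (m + 3) → Option Y) (x : Ev m) (i) (y : Y) : 0 ≤ sig a b x i y := by
  unfold sig
  split_ifs <;> positivity

theorem sig_uniq (a b : Fin (m + 3) → Option Y) (x : Ev m) (i) (y y' : Y)
    (h : sig a b x i y ≠ 0) (h' : sig a b x i y' ≠ 0) : y = y' := by
  rcases le_total 0 (x i) with hx | hx
  · rw [sig_of_nonneg hx, ite_ne_right_iff] at h h'
    exact Option.some_injective _ (h.1.symm.trans h'.1)
  · rw [sig_of_nonpos hx, ite_ne_right_iff] at h h'
    exact Option.some_injective _ (h.1.symm.trans h'.1)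

theorem sig_sq {a b : Fin (m + 3) → Option Y} {x : Ev m} {i} {y : Y} (h : sig a b x i y ≠ 0) :
    sig a b x i y ^ 2 = x i ^ 2 := by
  rcases le_total 0 (x i) with hx | hx
  · rw [sig_of_nonneg hx] at h ⊢
    rw [if_pos (ite_ne_right_iff.1 h).1]
  · rw [sig_of_nonpos hx] at h ⊢
    rw [if_pos (ite_ne_right_iff.1 h).1, neg_sq]

theorem sig_zero {a b : Fin (m + 3) → Option Y} {x : Ev m} {i} (h : x i = 0) (y : Y) :
    sig a b x i y = 0 := by
  rw [sig_of_nonneg h.ge, h, ite_self]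

variable [Fintype Y] {y₀ : Y}

theorem sig_good (a b : Fin (m + 3) → Option Y) (x : Sp m) : Good (sig a b x.1) := by
  refine ⟨sig_nonneg _ _ _, sig_uniq _ _ _, fun h => ?_⟩
  choose y hy using h
  rw [Finset.sum_congr rfl fun i _ => (sum_sq_single (sig_uniq a b x.1 i) (hy i)).trans
    (sig_sq (hy i)), ← EuclideanSpace.real_norm_sq_eq, sp_norm, one_pow]

/-- The collapse of the sphere with given labels. -/
noncomputable def FF (y₀ : Y) (a b : Fin (m + 3) → Option Y) :
    PM m (WW m (BB m y₀)) (wb m (BB m y₀)) :=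
  ⟨⟨fun x => kap y₀ (sig_good a b x),
    continuous_kap ((continuous_sig a b).comp continuous_subtype_val) _⟩,
    kap_base (sig_good a b (bp (m + 2))) fun _ => ⟨Fin.succ 0, sig_zero (bp_succ _) _⟩⟩

theorem FF_kills (a b : Fin (m + 3) → Option Y) : Kills (FF y₀ a b) := fun s i h =>
  kap_base (sig_good a b s) fun _ => ⟨i, sig_zero h _⟩

/-- The degrees of a labelled collapse. -/
noncomputable def deg (a b : Fin (m + 3) → Option Y) (c : Fin (m + 3) → Y) : ℤ :=
  ∏ i, ((if a i = some (c i) then 1 else 0) - (if b i = some (c i) then 1 else 0))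

theorem cl_const {X : Type} [TopologicalSpace X] {x : X} {φ : PM m X x} (h : ∀ s, φ.1 s = x) :
    cl φ = 1 :=
  (congrArg (Quotient.mk _) (GenLoop.ext (loopOf φ) GenLoop.const fun y => h (qq _ y))).trans
    HomotopyGroup.one_def.symm

theorem cl_FF_none (a : Fin (m + 3) → Option Y) :
    cl (FF y₀ a fun _ => none) = ∏ c : BB m y₀, cl (iot m c) ^ deg a (fun _ => none) c.1 := by
  classical
  have hd : ∀ c : BB m y₀, deg a (fun _ => none) c.1 = if ∀ i, a i = some (c.1 i) then 1 else 0 :=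
    fun c => by simp [deg, Finset.prod_ite_zero]
  by_cases h : ∃ c : BB m y₀, ∀ i, a i = some (c.1 i)
  · obtain ⟨c, hc⟩ := h
    have hu : ∀ c' : BB m y₀, (∀ i, a i = some (c'.1 i)) → c' = c := fun c' h' =>
      Subtype.ext (funext fun i => Option.some_injective _ ((h' i).symm.trans (hc i)))
    rw [Finset.prod_eq_single c (fun c' _ hne => by rw [hd, if_neg fun h => hne (hu c' h), zpow_zero])
      fun h => (h (Finset.mem_univ _)).elim, hd, if_pos hc, zpow_one]
    have hF : FF y₀ a (fun _ => none) = (thatPM m).map (iot m c).1 (iot m c).2 := by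
      refine Subtype.ext (ContinuousMap.ext fun x => Subtype.ext (funext fun c' => ?_))
      change that (col (sig a (fun _ => none) x.1) c'.1) = ((iot m c).1 (that x.1)).1 c'
      rcases eq_or_ne c' c with rfl | hne
      · rw [iot_self]
        by_cases hx : ∀ i, 0 ≤ x.1 i
        · congr 1
          refine PiLp.ext fun i => ?_
          rw [col_apply, sig_of_nonneg (hx i), if_pos (hc i)]
        · push Not at hx
          obtain ⟨i, hi⟩ := hx
          rw [that_eq_bp (mn_eq_zero hi.le), that_eq_bp (mn_eq_zero (i := i) _)]
          rw [col_apply, sig_of_nonpos hi.le, if_neg (by simp)]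
      · rw [iot_ne hne]
        obtain ⟨i, hi⟩ := not_forall.1 fun h => hne (hu c' h)
        refine that_eq_bp (mn_eq_zero (i := i) ?_)
        rw [col_apply, sig, if_neg hi, if_neg (by simp), add_zero]
    rw [hF, ← piMap_cl, cl_that, piMap_cl]
    rfl
  · rw [Finset.prod_eq_one fun c _ => by rw [hd, if_neg fun h' => h ⟨c, h'⟩, zpow_zero]]
    refine cl_const fun x => kap_base (sig_good a (fun _ => none) x) fun c => ?_
    obtain ⟨i, hi⟩ := not_forall.1 fun h' => h ⟨c, h'⟩
    exact ⟨i, by rw [sig, if_neg hi, if_neg (by simp), add_zero]⟩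

theorem cl_FF (a b : Fin (m + 3) → Option Y) :
    cl (FF y₀ a b) = ∏ c : BB m y₀, cl (iot m c) ^ deg a b c.1 := by
  classical
  suffices ∀ (s : Finset (Fin (m + 3))) (a b : Fin (m + 3) → Option Y), (∀ i ∉ s, b i = none) →
      cl (FF y₀ a b) = ∏ c : BB m y₀, cl (iot m c) ^ deg a b c.1 from
    this Finset.univ a b fun i h => (h (Finset.mem_univ _)).elim
  intro s
  induction s using Finset.induction_on with
  | empty =>
    intro a b hb
    obtain rfl : b = fun _ => none := funext fun i => hb i (Finset.notMem_empty _)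
    exact cl_FF_none a
  | insert i s hi ih =>
    intro a b hb
    have hb' : ∀ j ∉ s, Function.update b i none j = none := fun j hj => by
      rcases eq_or_ne j i with rfl | hne
      · exact Function.update_self _ _ _
      · rw [Function.update_of_ne hne]
        exact hb j fun h => (Finset.mem_insert.1 h).elim hne hj
    have h1 : cl (FF y₀ a b) = cl (FF y₀ a (Function.update b i none)) *
        cl (FF y₀ (Function.update a i none) b) := by
      refine cl_split i (FF_kills _ _) (FF_kills _ _) (FF_kills _ _) (fun x hx => ⟨?_, ?_⟩)
        fun x hx => ⟨?_, ?_⟩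
      · refine kap_congr (funext fun j => funext fun y => ?_)
          (sig_good a b x) (sig_good (Function.update a i none) b x)
        rcases eq_or_ne j i with rfl | hne
        · rw [sig_of_nonpos hx, sig_of_nonpos hx]
        · unfold sig
          rw [Function.update_of_ne hne]
      · exact kap_base (sig_good a (Function.update b i none) x) fun c =>
          ⟨i, by rw [sig_of_nonpos hx, Function.update_self, if_neg (by simp)]⟩
      · refine kap_congr (funext fun j => funext fun y => ?_)
          (sig_good a b x) (sig_good a (Function.update b i none) x)
        rcases eq_or_ne j i with rfl | hne
        · rw [sig_of_nonneg hx, sig_of_nonneg hx]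
        · unfold sig
          rw [Function.update_of_ne hne]
      · exact kap_base (sig_good (Function.update a i none) b x) fun c =>
          ⟨i, by rw [sig_of_nonneg hx, Function.update_self, if_neg (by simp)]⟩
    have h2 : cl (FF y₀ (Function.update a i none) b) =
        (cl (FF y₀ (Function.update a i (b i)) (Function.update b i none)))⁻¹ := by
      refine cl_flip i (FF_kills _ _) (FF_kills _ _) fun x x' hx hj => ?_
      refine kap_congr (funext fun j => funext fun y => ?_) (sig_good _ _ x') (sig_good _ _ x)
      unfold sig
      rcases eq_or_ne j i with rfl | hne
      · rw [Function.update_self, Function.update_self, Function.update_self, hx, neg_neg]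
        simp
      · rw [Function.update_of_ne hne, Function.update_of_ne hne, Function.update_of_ne hne, hj j hne]
    rw [h1, h2, ih _ _ hb', ih _ _ hb', ← div_eq_mul_inv, ← Finset.prod_div_distrib]
    refine Finset.prod_congr rfl fun c _ => ?_
    rw [div_eq_mul_inv, ← zpow_neg, ← zpow_add, ← sub_eq_add_neg]
    congr 1
    rw [sub_eq_iff_eq_add]
    refine (Finset.prod_add_prod_eq (Finset.mem_univ i) ?_ ?_ ?_).symm
    · simp only [Function.update_self]
      simp
    · intro j _ hne
      simp only [Function.update_of_ne hne]
    · intro j _ hne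
      simp only [Function.update_of_ne hne]

end labels
end Swan

namespace Swan
open unitInterval Topology

section join
variable {m : ℕ} {Y : Type}

theorem sig_single [DecidableEq Y] (c c' : Fin (m + 3) → Y) (x : Ev m) (i) :
    sig (fun i => some (c i)) (fun i => some (c' i)) x i =
      Pi.single (if 0 ≤ x i then c i else c' i) |x i| := by
  funext y
  rw [Pi.single_apply]
  split_ifs with h h1 h2
  · rw [sig_of_nonneg h, if_pos (by rw [h1]), abs_of_nonneg h]
  · rw [sig_of_nonneg h, if_neg fun e => h1 (Option.some_injective _ e).symm]
  · rw [sig_of_nonpos (not_le.1 h).le, if_pos (by rw [h2]), abs_of_neg (not_le.1 h)]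
  · rw [sig_of_nonpos (not_le.1 h).le, if_neg fun e => h2 (Option.some_injective _ e).symm]

theorem deg_BB [DecidableEq Y] {y₀ : Y} (c c' : BB m y₀) :
    deg (fun i => some (c.1 i)) (fun _ => some y₀) c'.1 = if c' = c then 1 else 0 := by
  have h : ∀ i, ((if some (c.1 i) = some (c'.1 i) then 1 else 0) -
      (if some y₀ = some (c'.1 i) then 1 else 0) : ℤ) = if c.1 i = c'.1 i then 1 else 0 := fun i => by
    rw [if_neg fun e => c'.2 i (Option.some_injective _ e).symm, sub_zero]
    exact if_congr Option.some_inj rfl rfl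
  rw [deg, Finset.prod_congr rfl fun i _ => h i, Finset.prod_ite_zero, Finset.prod_const_one]
  by_cases hc : c' = c
  · rw [if_pos hc, if_pos fun i _ => by rw [hc]]
  · rw [if_neg hc, if_neg fun h => hc (Subtype.ext (funext fun i => (h i (Finset.mem_univ i)).symm))]

variable [Fintype Y]

/-- The join of `m + 3` copies of a discrete set. -/
abbrev XX (m : ℕ) (Y : Type) [Fintype Y] : Type :=
  {ξ : Fin (m + 3) → Y → ℝ // (∀ i y, 0 ≤ ξ i y) ∧
    (∀ i y y', ξ i y ≠ 0 → ξ i y' ≠ 0 → y = y') ∧ ∑ i, ∑ y, ξ i y ^ 2 = 1}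

theorem XX.good (ξ : XX m Y) : Good ξ.1 := ⟨ξ.2.1, ξ.2.2.1, fun _ => ξ.2.2.2⟩

theorem XX.exists_ne (ξ : XX m Y) : ∃ i y, ξ.1 i y ≠ 0 := by
  by_contra! h
  have := ξ.2.2.2
  simp [h] at this

theorem continuous_coord (i : Fin (m + 3)) (y : Y) : Continuous fun ξ : XX m Y => ξ.1 i y :=
  (continuous_apply y).comp ((continuous_apply i).comp continuous_subtype_val)

section action
variable {G : Type} [Group G] [MulAction G Y]

/-- The action of a group on the join. -/
def act (g : G) : C(XX m Y, XX m Y) where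
  toFun ξ := ⟨fun i y => ξ.1 i (g⁻¹ • y), fun i y => ξ.2.1 i _,
    fun i y y' h h' => smul_left_cancel g⁻¹ (ξ.2.2.1 i _ _ h h'), by
      refine Eq.trans ?_ ξ.2.2.2
      exact Finset.sum_congr rfl fun i _ =>
        Equiv.sum_comp (MulAction.toPerm g⁻¹) fun y => ξ.1 i y ^ 2⟩
  continuous_toFun := Continuous.subtype_mk (continuous_pi fun i => continuous_pi fun y =>
    continuous_coord i _) _

theorem act_one (ξ : XX m Y) : act (1 : G) ξ = ξ :=
  Subtype.ext (funext fun i => funext fun y => by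
    change ξ.1 i ((1 : G)⁻¹ • y) = ξ.1 i y
    rw [inv_one, one_smul])

theorem act_mul (g h : G) (ξ : XX m Y) : act (g * h) ξ = act g (act h ξ) :=
  Subtype.ext (funext fun i => funext fun y => by
    change ξ.1 i ((g * h)⁻¹ • y) = ξ.1 i (h⁻¹ • g⁻¹ • y)
    rw [mul_inv_rev, mul_smul])

theorem act_free (hY : ∀ (y : Y) (g : G), g • y = y → g = 1) {g : G} {ξ : XX m Y}
    (h : act g ξ = ξ) : g = 1 := by
  obtain ⟨i, y, hy⟩ := ξ.exists_ne
  have h1 : ξ.1 i (g⁻¹ • y) = ξ.1 i y := congrFun (congrFun (congrArg Subtype.val h) i) y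
  exact inv_eq_one.1 (hY y _ (ξ.2.2.1 i _ _ (h1 ▸ hy) hy))

end action

variable [DecidableEq Y]

theorem xx_mk {ξ : Fin (m + 3) → Y → ℝ} (u : Sp m) (h : ∀ i, ∃ y, ξ i = Pi.single y |u.1 i|) :
    (∀ i y, 0 ≤ ξ i y) ∧ (∀ i y y', ξ i y ≠ 0 → ξ i y' ≠ 0 → y = y') ∧
      ∑ i, ∑ y, ξ i y ^ 2 = 1 := by
  choose y hy using h
  have hne : ∀ {i y'}, ξ i y' ≠ 0 → y' = y i := fun {i y'} h => by
    by_contra hne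
    rw [hy, Pi.single_eq_of_ne hne] at h
    exact h rfl
  refine ⟨fun i y' => ?_, fun i y₁ y₂ h₁ h₂ => (hne h₁).trans (hne h₂).symm, ?_⟩
  · rw [hy, Pi.single_apply]
    split_ifs <;> positivity
  · rw [← one_pow 2, ← sp_norm u, EuclideanSpace.real_norm_sq_eq]
    refine Finset.sum_congr rfl fun i _ => ?_
    rw [Finset.sum_eq_single (y i) (fun y' _ h => by rw [hy, Pi.single_eq_of_ne h, zero_pow two_ne_zero])
      fun h => (h (Finset.mem_univ _)).elim, hy, Pi.single_eq_same, sq_abs]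

theorem XX.slot (y₀ : Y) (ξ : XX m Y) (i) : ∃ y r, 0 ≤ r ∧ ξ.1 i = Pi.single y r := by
  by_cases h : ∃ y, ξ.1 i y ≠ 0
  · obtain ⟨y, hy⟩ := h
    refine ⟨y, ξ.1 i y, ξ.2.1 i y, funext fun y' => ?_⟩
    rcases eq_or_ne y' y with rfl | hne
    · rw [Pi.single_eq_same]
    · rw [Pi.single_eq_of_ne hne]
      exact by_contra fun h => hne (ξ.2.2.1 i _ _ h hy)
  · push Not at h
    exact ⟨y₀, 0, le_rfl, by rw [Pi.single_zero]; exact funext h⟩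

/-- The sphere in the join spanned by two sequences of labels. -/
noncomputable def rho0 (c c' : Fin (m + 3) → Y) : C(Sp m, XX m Y) :=
  ⟨fun x => ⟨sig (fun i => some (c i)) (fun i => some (c' i)) x.1,
    xx_mk x fun i => ⟨_, sig_single c c' x.1 i⟩⟩,
    ((continuous_sig _ _).comp continuous_subtype_val).subtype_mk _⟩

theorem act_rho0 {G : Type} [Group G] [MulAction G Y] (g : G) (c c' : Fin (m + 3) → Y) (x : Sp m) :
    act g (rho0 c c' x) = rho0 (fun i => g • c i) (fun i => g • c' i) x := by
  refine Subtype.ext (funext fun i => funext fun y => ?_)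
  change sig (fun i => some (c i)) (fun i => some (c' i)) x.1 i (g⁻¹ • y) =
    sig (fun i => some (g • c i)) (fun i => some (g • c' i)) x.1 i y
  simp only [sig, Option.some_inj, eq_inv_smul_iff]

variable (y₀ : Y)

/-- The base vertex of the join. -/
noncomputable def vx (m : ℕ) : XX m Y := rho0 (fun _ => y₀) (fun _ => y₀) (bp (m + 2))

/-- The sphere in the join with given positive labels and constant negative label. -/
noncomputable def rho (c : Fin (m + 3) → Y) : PM m (XX m Y) (vx y₀ m) :=
  ⟨rho0 c fun _ => y₀, Subtype.ext (funext fun i => by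
    refine (sig_single c (fun _ => y₀) _ i).trans
      (Eq.trans ?_ (sig_single (fun _ => y₀) (fun _ => y₀) _ i).symm)
    cases i using Fin.cases with
    | zero => rw [bp_zero, if_neg (by norm_num), if_neg (by norm_num)]
    | succ i => rw [bp_succ, abs_zero, Pi.single_zero, Pi.single_zero])⟩

/-- The map from the wedge of spheres to the join. -/
noncomputable def rr : C(WW m (BB m y₀), XX m Y) := wmap fun c => rho y₀ c.1

/-- The collapse of the join. -/
noncomputable def kB : C(XX m Y, WW m (BB m y₀)) :=
  ⟨fun ξ => kap y₀ ξ.good, continuous_kap continuous_subtype_val _⟩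

theorem kB_rho0 (c c' : Fin (m + 3) → Y) :
    (kB y₀).comp (rho0 c c') = (FF y₀ (fun i => some (c i)) fun i => some (c' i)).1 := rfl

theorem kB_vx : kB y₀ (vx y₀ m) = wb m (BB m y₀) :=
  (FF y₀ (fun _ => some y₀) fun _ => some y₀).2

theorem kB_rr_base : ((kB y₀).comp (rr y₀)) (wb m (BB m y₀)) = wb m (BB m y₀) :=
  (congrArg (kB y₀) (wmap_base _)).trans (kB_vx y₀)

theorem map_kB_rr (c : BB m y₀) : (iot m c).map ((kB y₀).comp (rr y₀)) (kB_rr_base y₀) =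
    FF y₀ (fun i => some (c.1 i)) fun _ => some y₀ :=
  Subtype.ext (ContinuousMap.ext fun s => (congrArg (kB y₀)
    (wmap_iot (fun c : BB m y₀ => rho y₀ c.1) c s)).trans
      (congrArg (fun f : C(Sp m, WW m (BB m y₀)) => f s) (kB_rho0 y₀ c.1 fun _ => y₀)))

theorem rr_kB : ((kB y₀).comp (rr y₀)).HomotopicRel (.id (WW m (BB m y₀))) {wb m (BB m y₀)} := by
  refine wedge_homotopicRel (kB_rr_base y₀) rfl fun c => ?_
  have h : cl (FF y₀ (fun i => some (c.1 i)) fun _ => some y₀) = cl (iot m c) := by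
    rw [cl_FF, Finset.prod_eq_single c (fun c' _ h => by rw [deg_BB, if_neg h, zpow_zero])
      fun h => (h (Finset.mem_univ _)).elim, deg_BB, if_pos rfl, zpow_one]
  exact (congrArg cl (map_kB_rr y₀ c)).trans h

theorem sg_single {f : Y → ℝ} {y : Y} {r : ℝ} (h : f = Pi.single y r) :
    ∑ y', (if y' = y₀ then -1 else 1) * f y' = if y = y₀ then -r else r := by
  rw [h, Finset.sum_eq_single y (fun y' _ h => by rw [Pi.single_eq_of_ne h, mul_zero])
    fun h => (h (Finset.mem_univ _)).elim, Pi.single_eq_same]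
  split_ifs <;> ring

/-- The signed coordinates of a point of the join. -/
noncomputable def sg (ξ : XX m Y) : Sp m :=
  ⟨WithLp.toLp 2 fun i => ∑ y, (if y = y₀ then -1 else 1) * ξ.1 i y, by
    rw [mem_sphere_zero_iff_norm, ← sq_eq_sq₀ (norm_nonneg _) zero_le_one, one_pow,
      EuclideanSpace.real_norm_sq_eq]
    refine Eq.trans ?_ ξ.2.2.2
    refine Finset.sum_congr rfl fun i _ => ?_
    obtain ⟨y, r, -, h⟩ := ξ.slot y₀ i
    refine (congrArg (· ^ 2) (sg_single y₀ h)).trans ?_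
    rw [Finset.sum_eq_single y (fun y' _ h' => by rw [h, Pi.single_eq_of_ne h', zero_pow two_ne_zero])
      fun h => (h (Finset.mem_univ _)).elim, h, Pi.single_eq_same]
    split_ifs <;> ring⟩

theorem sg_apply {ξ : XX m Y} {i y r} (h : ξ.1 i = Pi.single y r) :
    (sg y₀ ξ).1 i = if y = y₀ then -r else r := sg_single y₀ h

theorem continuous_sg : Continuous (sg (m := m) y₀) :=
  Continuous.subtype_mk ((PiLp.continuous_toLp 2 _).comp (continuous_pi fun i =>
    continuous_finsetSum _ fun y _ => continuous_const.mul (continuous_coord i y))) _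

/-- The difference between a coordinate and the sum of the other coordinates in its slot. -/
noncomputable def dif (ξ : XX m Y) (i : Fin (m + 3)) (y : Y) : ℝ := 2 * ξ.1 i y - ∑ y', ξ.1 i y'

theorem dif_apply {ξ : XX m Y} {i y r} (h : ξ.1 i = Pi.single y r) (y') :
    dif ξ i y' = if y' = y then r else -r := by
  have : ∑ y', ξ.1 i y' = r := by rw [h, Finset.sum_pi_single', if_pos (Finset.mem_univ _)]
  rw [dif, this, h, Pi.single_apply]
  split_ifs <;> ring

/-- Renaming the coordinates of a sphere by the labels of a point of the join. -/
noncomputable def lab (ξ : XX m Y) (u : Ev m) : Fin (m + 3) → Y → ℝ := fun i y =>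
  if y = y₀ then max (-u i) 0 else if 0 ≤ dif ξ i y then max (u i) 0 else 0

/-- The sign compatibility needed for renaming. -/
def Compat (ξ : XX m Y) (u : Sp m) : Prop := ∀ i, (sg y₀ ξ).1 i ≤ 0 → u.1 i ≤ 0

variable {y₀}

theorem lab_nonpos {ξ : XX m Y} {u : Ev m} {i} (h : u i ≤ 0) : lab y₀ ξ u i = Pi.single y₀ (-u i) := by
  funext y
  rw [lab, Pi.single_apply, max_eq_left (neg_nonneg.2 h), max_eq_right h, ite_self]

theorem lab_pos {ξ : XX m Y} {u : Ev m} {i y r} (h : 0 < u i) (hr : 0 < r) (hy : y ≠ y₀)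
    (hξ : ξ.1 i = Pi.single y r) : lab y₀ ξ u i = Pi.single y (u i) := by
  funext y'
  rw [lab, Pi.single_apply, max_eq_right (neg_nonpos.2 h.le), max_eq_left h.le, dif_apply hξ]
  rcases eq_or_ne y' y with rfl | hne
  · rw [if_neg hy, if_pos rfl, if_pos rfl, if_pos hr.le]
  · rw [if_neg hne, if_neg hne, if_neg (by linarith : ¬0 ≤ -r), ite_self]

theorem pos_slot {ξ : XX m Y} {i} (h : 0 < (sg y₀ ξ).1 i) :
    ∃ y r, 0 < r ∧ y ≠ y₀ ∧ ξ.1 i = Pi.single y r ∧ (sg y₀ ξ).1 i = r := by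
  obtain ⟨y, r, hr, hξ⟩ := ξ.slot y₀ i
  have hs := sg_apply y₀ hξ
  split_ifs at hs with hy
  · linarith
  · exact ⟨y, r, hs ▸ h, hy, hξ, hs⟩

theorem lab_mem {ξ : XX m Y} {u : Sp m} (h : Compat y₀ ξ u) (i) :
    ∃ y, lab y₀ ξ u.1 i = Pi.single y |u.1 i| := by
  rcases le_or_gt (u.1 i) 0 with hu | hu
  · exact ⟨y₀, by rw [lab_nonpos hu, abs_of_nonpos hu]⟩
  · obtain ⟨y, r, hr, hy, hξ, -⟩ := pos_slot (not_le.1 fun hs => (h i hs).not_gt hu)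
    exact ⟨y, by rw [lab_pos hu hr hy hξ, abs_of_pos hu]⟩

/-- Renaming as a point of the join. -/
noncomputable def labX {ξ : XX m Y} {u : Sp m} (h : Compat y₀ ξ u) : XX m Y :=
  ⟨lab y₀ ξ u.1, xx_mk u (lab_mem h)⟩

theorem continuous_labX {Z : Type} [TopologicalSpace Z] {f : Z → XX m Y} {u : Z → Sp m}
    (hf : Continuous f) (hu : Continuous u) (h : ∀ z, Compat y₀ (f z) (u z)) :
    Continuous fun z => labX (h z) := by
  refine Continuous.subtype_mk (continuous_pi fun i => continuous_pi fun y => ?_) _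
  have hi : Continuous fun z => (u z).1 i := by fun_prop
  unfold lab
  by_cases hy : y = y₀
  · simp only [if_pos hy]
    fun_prop
  simp only [if_neg hy]
  refine Continuous.if_le (hi.max continuous_const) continuous_const continuous_const ?_ fun z hz => ?_
  · exact (continuous_const.mul ((continuous_coord i y).comp hf)).sub
      (continuous_finsetSum _ fun y' _ => (continuous_coord i y').comp hf)
  · refine max_eq_right (h z i ?_)
    obtain ⟨y', r, -, hξ⟩ := (f z).slot y₀ i
    rw [dif_apply hξ] at hz
    have hr : r = 0 := by split_ifs at hz <;> linarith
    rw [sg_apply y₀ hξ, hr, neg_zero, ite_self]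

theorem labX_congr {ξ : XX m Y} {u u' : Sp m} (e : u = u') (h : Compat y₀ ξ u)
    (h' : Compat y₀ ξ u') : labX h = labX h' := by subst e; rfl

theorem labX_sg (ξ : XX m Y) (h : Compat y₀ ξ (sg y₀ ξ)) : labX h = ξ := by
  refine Subtype.ext (funext fun i => ?_)
  change lab y₀ ξ (sg y₀ ξ).1 i = _
  rcases le_or_gt ((sg y₀ ξ).1 i) 0 with hu | hu
  · rw [lab_nonpos hu]
    obtain ⟨y, r, hr, hξ⟩ := ξ.slot y₀ i
    rw [hξ]
    rw [sg_apply y₀ hξ] at hu ⊢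
    split_ifs at hu ⊢ with hy
    · rw [neg_neg, hy]
    · rw [le_antisymm hu hr, neg_zero, Pi.single_zero, Pi.single_zero]
  · obtain ⟨y, r, hr, hy, hξ, hs⟩ := pos_slot hu
    rw [lab_pos hu hr hy hξ, hs, hξ]

theorem compat_nrm (s : I) (ξ : XX m Y) : Compat y₀ ξ (nrm (vv s (sg y₀ ξ).1)) := fun _ h =>
  nrm_nonpos (vv_ne s _) (vv_nonpos s h)

theorem compat_shf (s : I) (ξ : XX m Y) : Compat y₀ ξ (shf s (sg y₀ ξ).1) := fun _ h =>
  shf_nonpos s h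

theorem rr_kB_apply (ξ : XX m Y) : rr y₀ (kB y₀ ξ) = labX (compat_shf (y₀ := y₀) 1 ξ) := by
  by_cases h : ∃ i, (sg y₀ ξ).1 i ≤ 0
  · obtain ⟨i, hi⟩ := h
    have h1 : kB y₀ ξ = wb m (BB m y₀) := kap_base ξ.good fun c => ⟨i, by
      obtain ⟨y, r, hr, hξ⟩ := ξ.slot y₀ i
      rw [sg_apply y₀ hξ] at hi
      rw [hξ, Pi.single_apply]
      split_ifs at hi ⊢ with h1 h2 h2
      · exact (c.2 i (h1.trans h2)).elim
      · exact le_antisymm hi hr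
      · rfl
      · rfl⟩
    refine (congrArg (rr y₀) h1).trans ((wmap_base _).trans (Subtype.ext (funext fun j => ?_)))
    have h2 : shf 1 (sg y₀ ξ).1 = bp (m + 2) := that_eq_bp (mn_eq_zero hi)
    have h3 : (bp (m + 2)).1 j ≤ 0 := by
      cases j using Fin.cases with
      | zero => rw [bp_zero]; norm_num
      | succ j => rw [bp_succ]
    refine (sig_single (fun _ => y₀) (fun _ => y₀) _ j).trans (Eq.trans ?_
      (congrArg (fun u : Sp m => lab y₀ ξ u.1 j) h2).symm)
    rw [lab_nonpos h3, ite_self, abs_of_nonpos h3]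
  · push Not at h
    choose y r hr hy hξ hs using fun i => pos_slot (h i)
    have h1 : col ξ.1 y = (sg y₀ ξ).1 := PiLp.ext fun i => by
      rw [col_apply, hs, hξ, Pi.single_eq_same]
    have h2 : kB y₀ ξ = (iot m (⟨y, hy⟩ : BB m y₀)).1 (that (sg y₀ ξ).1) := by
      rw [← h1]
      refine (iot_eq (w := kB y₀ ξ) fun c' hc => that_eq_bp ?_).symm
      obtain ⟨i, hi⟩ := Function.ne_iff.1 fun e => hc (Subtype.ext e)
      refine mn_eq_zero (i := i) ?_
      rw [col_apply, hξ, Pi.single_eq_of_ne hi]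
    refine (congrArg (rr y₀) h2).trans ((wmap_iot _ _ _).trans (Subtype.ext (funext fun i => ?_)))
    refine (sig_single y (fun _ => y₀) _ i).trans ?_
    change _ = lab y₀ ξ (that (sg y₀ ξ).1).1 i
    rcases le_or_gt ((that (sg y₀ ξ).1).1 i) 0 with hu | hu
    · rw [lab_nonpos hu, abs_of_nonpos hu]
      rcases hu.lt_or_eq with hu | hu
      · rw [if_neg hu.not_ge]
      · rw [hu, neg_zero, Pi.single_zero, Pi.single_zero]
    · rw [lab_pos hu (hr i) (hy i) (hξ i), if_pos hu.le, abs_of_pos hu]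

theorem kB_rr : ((rr y₀).comp (kB y₀)).Homotopic (.id (XX m Y)) := by
  have hs := continuous_sg (m := m) y₀
  let f : C(XX m Y, XX m Y) := ⟨fun ξ => labX (compat_nrm (y₀ := y₀) 1 ξ),
    continuous_labX continuous_id (continuous_nrm (continuous_vv.comp (continuous_const.prodMk
      (continuous_subtype_val.comp hs))) fun ξ => vv_ne 1 _) _⟩
  refine ContinuousMap.Homotopic.trans (g := f) (.symm ⟨⟨⟨fun p => labX (compat_shf (y₀ := y₀) p.1 p.2), ?_⟩,
    fun ξ => ?_, fun ξ => ?_⟩⟩) (.symm ⟨⟨⟨fun p => labX (compat_nrm (y₀ := y₀) p.1 p.2), ?_⟩,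
      fun ξ => ?_, fun ξ => ?_⟩⟩)
  · exact continuous_labX continuous_snd (continuous_shf (continuous_subtype_val.comp
      (hs.comp continuous_snd)) continuous_fst fun p _ => sp_norm _) _
  · refine labX_congr ?_ (compat_shf 0 ξ) (compat_nrm 1 ξ)
    rw [shf, Set.Icc.coe_zero, zero_smul, add_zero, nrm_self]
  · exact (rr_kB_apply ξ).symm
  · exact continuous_labX continuous_snd (continuous_nrm (continuous_vv.comp
      (continuous_fst.prodMk (continuous_subtype_val.comp (hs.comp continuous_snd))))
      fun p => vv_ne p.1 _) _
  · have h : nrm (vv 0 (sg y₀ ξ).1) = sg y₀ ξ := by rw [vv_zero, nrm_self]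
    exact (labX_congr h (compat_nrm 0 ξ) fun _ => id).trans (labX_sg ξ _)
  · rfl

end join
end Swan

namespace Swan
open unitInterval Topology

variable {m : ℕ}

theorem prod_zpow_single {C J : Type} [CommGroup C] [Fintype J] (c : J → C) (k : J → ℤ) (j : J)
    (h : ∀ j', j' ≠ j → k j' = 0) (h1 : k j = 1) : ∏ j', c j' ^ k j' = c j := by
  rw [Finset.prod_eq_single j (fun j' _ hj => by rw [h j' hj, zpow_zero])
    fun h => (h (Finset.mem_univ _)).elim, h1, zpow_one]

theorem wedge_inverse {J J' : Type} [Fintype J] [Fintype J'] {A : J → J' → ℤ} {B : J' → J → ℤ}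
    (hd : ∀ j k, j ≠ k → ∑ j', A j j' * B j' k = 0) (h1 : ∀ j, ∑ j', A j j' * B j' j = 1)
    {f : C(WW m J, WW m J')} (hf : f (wb m J) = wb m J')
    (hA : ∀ j, piMap f hf (cl (iot m j)) = ∏ j', cl (iot m j') ^ A j j')
    {g : C(WW m J', WW m J)} (hg : g (wb m J') = wb m J)
    (hB : ∀ j, piMap g hg (cl (iot m j)) = ∏ j', cl (iot m j') ^ B j j') :
    (g.comp f).Homotopic (.id _) := by
  have hb : (g.comp f) (wb m J) = wb m J := (congrArg g hf).trans hg
  refine (wedge_homotopicRel hb rfl fun j => ?_).homotopic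
  have h2 : piMap (g.comp f) hb (cl (iot m j)) = piMap g hg (piMap f hf (cl (iot m j))) := rfl
  rw [h2, hA, piMap_matrix g hg _ _ B hB]
  exact prod_zpow_single _ _ j (fun j' h => hd j j' h.symm) (h1 j)

theorem exists_wedge_equiv {J J' : Type} [Fintype J] [Fintype J'] {A : J → J' → ℤ}
    {B : J' → J → ℤ} (hd : ∀ j k, j ≠ k → ∑ j', A j j' * B j' k = 0)
    (h1 : ∀ j, ∑ j', A j j' * B j' j = 1) (hd' : ∀ j k, j ≠ k → ∑ j', B j j' * A j' k = 0)
    (h1' : ∀ j, ∑ j', B j j' * A j' j = 1) :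
    ∃ (e : ContinuousMap.HomotopyEquiv (WW m J) (WW m J')) (h : e.toFun (wb m J) = wb m J'),
      ∀ j, piMap e.toFun h (cl (iot m j)) = ∏ j', cl (iot m j') ^ A j j' := by
  obtain ⟨f, hf, hA⟩ := exists_matrix_map (m := m) A
  obtain ⟨g, hg, hB⟩ := exists_matrix_map (m := m) B
  exact ⟨⟨f, g, wedge_inverse hd h1 hf hA hg hB, wedge_inverse hd' h1' hg hB hf hA⟩, hf, hA⟩

variable {Y : Type} [DecidableEq Y] {y₀ : Y}

theorem deg_some (a b c : Fin (m + 3) → Y) :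
    deg (fun i => some (a i)) (fun i => some (b i)) c = GMod.dd a b c :=
  Finset.prod_congr rfl fun _ _ => congrArg₂ (· - ·)
    (if_congr (Option.some_inj.trans eq_comm) rfl rfl) (if_congr (Option.some_inj.trans eq_comm) rfl rfl)

theorem dd_base {a : Fin (m + 3) → Y} (h : ¬∀ i, a i ≠ y₀) (c) : GMod.dd a (fun _ => y₀) c = 0 := by
  push Not at h
  obtain ⟨i, hi⟩ := h
  exact Finset.prod_eq_zero (Finset.mem_univ i) (by rw [hi, sub_self])

theorem dd_smul {G : Type} [Group G] [MulAction G Y] (g : G) (a b c : Fin (m + 3) → Y) :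
    GMod.dd (fun i => g • a i) (fun i => g • b i) c = GMod.dd a b fun i => g⁻¹ • c i := by
  simp only [GMod.dd, inv_smul_eq_iff]

variable [Fintype Y]

theorem sum_BB {f : (Fin (m + 3) → Y) → ℤ} (h : ∀ a, (¬∀ i, a i ≠ y₀) → f a = 0) :
    ∑ a : BB m y₀, f a.1 = ∑ a, f a := by
  rw [← Fintype.sum_subtype_add_sum_subtype (fun a : Fin (m + 3) → Y => ∀ i, a i ≠ y₀) f,
    Finset.sum_eq_zero (s := Finset.univ (α := {a : Fin (m + 3) → Y // ¬∀ i, a i ≠ y₀}))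
      fun a _ => h a.1 a.2, add_zero]

section
variable {G : Type} [Group G] [MulAction G Y] (g : G)

/-- The self-map of the wedge of spheres induced by a group element. -/
noncomputable def actW (y₀ : Y) : C(WW m (BB m y₀), WW m (BB m y₀)) :=
  (kB y₀).comp ((act g).comp (rr y₀))

theorem actW_base : actW g y₀ (wb m (BB m y₀)) = wb m (BB m y₀) :=
  (congrArg (fun ξ => kB y₀ (act g ξ)) (wmap_base _)).trans
    ((congrArg (kB y₀) (act_rho0 g _ _ _)).trans (FF y₀ (fun _ => some (g • y₀)) fun _ => some (g • y₀)).2)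

theorem actW_map (c : BB m y₀) : (iot m c).map (actW g y₀) (actW_base g) =
    FF y₀ (fun i => some (g • c.1 i)) fun _ => some (g • y₀) :=
  Subtype.ext (ContinuousMap.ext fun s =>
    (congrArg (fun ξ => kB y₀ (act g ξ)) (wmap_iot (fun c : BB m y₀ => rho y₀ c.1) c s)).trans
      ((congrArg (kB y₀) (act_rho0 g c.1 (fun _ => y₀) s)).trans
        (congrArg (fun f : C(Sp m, WW m (BB m y₀)) => f s)
          (kB_rho0 y₀ (fun i => g • c.1 i) fun _ => g • y₀))))

theorem actW_cl (f : (Fin (m + 3) → Y) → ℤ) (hf : GMod.Marg f) :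
    piMap (actW g y₀) (actW_base g) (∏ c : BB m y₀, cl (iot m c) ^ f c.1) =
      ∏ c : BB m y₀, cl (iot m c) ^ f fun i => g⁻¹ • c.1 i := by
  rw [piMap_matrix (actW g y₀) (actW_base g) _ _
    (fun a c : BB m y₀ => GMod.dd a.1 (fun _ => y₀) fun i => g⁻¹ • c.1 i) fun a =>
      (congrArg cl (actW_map g a)).trans ((cl_FF _ _).trans
        (Finset.prod_congr rfl fun c _ => by rw [deg_some, dd_smul]))]
  refine Finset.prod_congr rfl fun c _ => congrArg _ ?_
  exact (sum_BB (f := fun a => f a * GMod.dd a (fun _ => y₀) fun i => g⁻¹ • c.1 i)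
    fun a h => by rw [dd_base h, mul_zero]).trans (hf.expand _ _)

end

theorem exists_attaching {G : Type} [Group G] [Fintype G] [MulAction G Y]
    {b : ℕ} {z : Option (Fin b × G) → (Fin (m + 3) → Y) → ℤ}
    {Q : (Fin (m + 3) → Y) → Option (Fin b × G) → ℤ} (hz : ∀ j, GMod.Marg (z j))
    (hg : ∀ i g a, z (some (i, g)) a = z (some (i, 1)) fun k => g⁻¹ • a k)
    (hQ : ∀ a c, ∑ j, Q a j * z j c = GMod.dd a (fun _ => y₀) c)
    (h1 : ∀ i, ∑ a, z i a * Q a i = 1) (hd : ∀ i j, i ≠ j → ∑ a, z i a * Q a j = 0) :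
    ∃ α : Fin b → C(Sp m, XX m Y), ∀ (k : ℕ) (e : Fin k ≃ Fin b × G),
      Nonempty (ContinuousMap.HomotopyEquiv (AttachCells (m + 3) k (XX m Y)
        fun p => (act (e p).2).comp (α (e p).1)) (Sp m)) := by
  have hQ0 : ∀ a, (¬∀ i, a i ≠ y₀) → ∀ j, Q a j = 0 := fun a ha j => by
    have h : ∑ c, (∑ j', Q a j' * z j' c) * Q c j = 0 :=
      Finset.sum_eq_zero fun c _ => by rw [hQ, dd_base ha, zero_mul]
    simp only [Finset.sum_mul, mul_assoc] at h
    rw [Finset.sum_comm] at h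
    simp only [← Finset.mul_sum] at h
    rwa [Finset.sum_eq_single j (fun j' _ h' => by rw [hd _ _ h', mul_zero])
      fun h => (h (Finset.mem_univ _)).elim, h1, mul_one] at h
  have hs : ∀ i j, ∑ a : BB m y₀, z i a.1 * Q a.1 j = ∑ a, z i a * Q a j := fun i j =>
    sum_BB (f := fun a => z i a * Q a j) fun a ha => by rw [hQ0 a ha, mul_zero]
  have hB : ∀ a c : BB m y₀, ∑ j, Q a.1 j * z j c.1 = if c = a then 1 else 0 := fun a c => by
    rw [hQ, ← deg_some, deg_BB]
  obtain ⟨Θ, hΘ, hcl⟩ := exists_wedge_equiv (m := m) (A := fun (a : BB m y₀) j => Q a.1 j)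
    (B := fun j a => z j a.1) (fun a c h => (hB a c).trans (if_neg h.symm))
    (fun a => (hB a a).trans (if_pos rfl)) (fun i j h => (hs i j).trans (hd i j h))
    fun i => (hs i i).trans (h1 i)
  choose w hw using fun i : Fin b => cl_surj
    (∏ c : BB m y₀, cl (iot m c) ^ z (some (i, 1)) c.1 : Pi m (WW m (BB m y₀)) (wb m (BB m y₀)))
  let e1 : ContinuousMap.HomotopyEquiv (XX m Y) (WW m (BB m y₀)) :=
    ⟨kB y₀, rr y₀, kB_rr, (rr_kB y₀).homotopic⟩
  refine ⟨fun i => (rr y₀).comp (w i).1, fun k e => ?_⟩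
  obtain ⟨E⟩ := wedge_cone (m := m) e
  obtain ⟨F⟩ := attach_homotopyEquiv (m := m + 2) (e1.trans Θ)
    (f := fun p => (act (e p).2).comp ((rr y₀).comp (w (e p).1).1)) (f' := att (m := m) e) fun p => by
      have h : cl (((w (e p).1).map (actW (e p).2 y₀) (actW_base _)).map Θ.toFun hΘ) =
          cl (iot m (some (e p))) := by
        rw [← piMap_cl, ← piMap_cl, hw, actW_cl _ _ (hz _)]
        simp only [← hg]
        rw [piMap_matrix Θ.toFun hΘ _ _ (fun (a : BB m y₀) j => Q a.1 j) hcl]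
        exact prod_zpow_single _ _ (some (e p)) (fun j h => (hs _ _).trans (hd _ _ h.symm))
          ((hs _ _).trans (h1 _))
      exact (homotopicRel_of_cl h).homotopic
  exact ⟨F.trans E⟩

end Swan

namespace Swan
open Topology

theorem compactSpace_of_isFiniteCWAtMost {n : ℕ} {X : Type} [TopologicalSpace X]
    (h : IsFiniteCWAtMost n X) : CompactSpace X := by
  induction h with
  | base k f => infer_instance
  | up _ ih => exact ih
  | attach _ k f ih => infer_instance
  | homeo _ e ih => exact e.compactSpace

section chart
variable {d : ℕ}

/-- The size of the negative part of a vector. -/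
noncomputable def mu (x : EuclideanSpace ℝ (Fin d)) : ℝ := ‖fun i => max (-x i) 0‖

theorem neg_le_mu (x : EuclideanSpace ℝ (Fin d)) (i) : -x i ≤ mu x :=
  (le_max_left _ _).trans ((le_abs_self _).trans (norm_le_pi_norm (fun i => max (-x i) 0) i))

theorem mu_nonneg (x : EuclideanSpace ℝ (Fin d)) : 0 ≤ mu x := norm_nonneg _

theorem mu_smul {t : ℝ} (ht : 0 ≤ t) (x : EuclideanSpace ℝ (Fin d)) : mu (t • x) = t * mu x := by
  have : (fun i => max (-(t • x) i) 0) = t • fun i => max (-x i) 0 := funext fun i => by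
    change max (-(t * x i)) 0 = t * max (-x i) 0
    rw [mul_max_of_nonneg _ _ ht, mul_zero, mul_neg]
  rw [mu, this, norm_smul, Real.norm_of_nonneg ht, mu]

/-- Homogeneous coordinates on a simplex of a point of a ball. -/
noncomputable def yc (x : EuclideanSpace ℝ (Fin d)) : Fin (d + 1) → ℝ :=
  Fin.cons (mu x + 1 - ‖x‖) fun i => x i + (mu x + 1 - ‖x‖)

theorem yc_zero (x : EuclideanSpace ℝ (Fin d)) : yc x 0 = mu x + 1 - ‖x‖ := rfl

theorem yc_succ (x : EuclideanSpace ℝ (Fin d)) (i : Fin d) :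
    yc x i.succ = x i + (mu x + 1 - ‖x‖) := rfl

theorem continuous_yc (i : Fin (d + 1)) :
    Continuous fun x : EuclideanSpace ℝ (Fin d) => yc x i := by
  have : Continuous (mu (d := d)) := by unfold mu; fun_prop
  cases i using Fin.cases with
  | zero => simp only [yc_zero]; fun_prop
  | succ i => simp only [yc_succ]; fun_prop

theorem le_yc (x : EuclideanSpace ℝ (Fin d)) (i) : 1 - ‖x‖ ≤ yc x i := by
  cases i using Fin.cases with
  | zero => linarith [yc_zero x, mu_nonneg x]
  | succ i => linarith [yc_succ x i, neg_le_mu x i]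

theorem exists_yc_le {x : EuclideanSpace ℝ (Fin d)} (hx : ‖x‖ = 1) : ∃ i, yc x i ≤ 0 := by
  by_contra! h
  have h0 := h 0
  rw [yc_zero, hx, add_sub_cancel_right] at h0
  refine lt_irrefl (mu x) ((pi_norm_lt_iff h0).2 fun i => ?_)
  have hi := h i.succ
  rw [yc_succ, hx, add_sub_cancel_right] at hi
  rw [Real.norm_of_nonneg (le_max_right _ _)]
  exact max_lt (by linarith) h0

theorem yc_inj {x x' : EuclideanSpace ℝ (Fin d)} {t : ℝ} (ht : 0 ≤ t)
    (h : ∀ i, yc x' i = t * yc x i) : x' = x := by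
  have h0 := h 0
  rw [yc_zero, yc_zero] at h0
  obtain rfl : x' = t • x := PiLp.ext fun i => by
    have hi := h i.succ
    rw [yc_succ, yc_succ, mul_add, ← h0] at hi
    exact add_right_cancel hi
  rw [mu_smul ht, norm_smul, Real.norm_of_nonneg ht] at h0
  obtain rfl : t = 1 := by linarith
  exact one_smul _ _

theorem yc_ne (x : EuclideanSpace ℝ (Fin d)) : ∃ i, yc x i ≠ 0 := by
  by_contra! h
  have hx : x = 0 := (yc_inj (x := 0) le_rfl fun i => by rw [h, zero_mul])
  have h0 := h 0
  rw [yc_zero, hx, norm_zero] at h0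
  linarith [mu_nonneg (0 : EuclideanSpace ℝ (Fin d))]

theorem yc_surj {p : Fin (d + 1) → ℝ} (h : ∀ i, 0 ≤ p i) (hp : ∃ i, p i ≠ 0) :
    ∃ x : EuclideanSpace ℝ (Fin d), ‖x‖ ≤ 1 ∧ ∃ t, 0 < t ∧ ∀ i, yc x i = t * p i := by
  let q : EuclideanSpace ℝ (Fin d) := WithLp.toLp 2 fun i => p i.succ - p 0
  have hq : ∀ i, q i = p i.succ - p 0 := fun _ => rfl
  have h1 : mu q ≤ p 0 := (pi_norm_le_iff_of_nonneg (h 0)).2 fun i => by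
    rw [Real.norm_of_nonneg (le_max_right _ _), hq]
    exact max_le (by linarith [h i.succ]) (h 0)
  have h2 : 0 < p 0 - mu q + ‖q‖ := by
    refine (add_nonneg (sub_nonneg.2 h1) (norm_nonneg q)).lt_of_ne fun e => ?_
    have h3 : q = 0 := norm_eq_zero.1 (by linarith [norm_nonneg q])
    have h4 : mu q = 0 := by
      have := mu_smul le_rfl q
      rwa [h3, smul_zero, zero_mul, ← h3] at this
    rw [h4, h3, norm_zero] at e
    obtain ⟨i, hi⟩ := hp
    refine hi ?_
    cases i using Fin.cases with
    | zero => linarith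
    | succ i =>
      have : q i = 0 := by rw [h3]; rfl
      linarith [hq i]
  set t := (p 0 - mu q + ‖q‖)⁻¹ with ht
  have ht0 : 0 < t := inv_pos.2 h2
  have h5 : t * (p 0 - mu q + ‖q‖) = 1 := inv_mul_cancel₀ h2.ne'
  have h6 : ‖t • q‖ = t * ‖q‖ := by rw [norm_smul, Real.norm_of_nonneg ht0.le]
  refine ⟨t • q, ?_, t, ht0, fun i => ?_⟩
  · rw [h6, ← h5]
    exact mul_le_mul_of_nonneg_left (by linarith) ht0.le
  · cases i using Fin.cases with
    | zero =>
      rw [yc_zero, h6, mu_smul ht0.le]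
      linarith
    | succ i =>
      rw [yc_succ, h6, mu_smul ht0.le, PiLp.smul_apply, smul_eq_mul, hq]
      linarith

end chart

section attach
variable {n k : ℕ} {X : Type} [TopologicalSpace X] {f : Fin k → C(CellBoundary n, X)}

theorem attach_cases (q : AttachCells n k X f) : (∃ a, q = Quot.mk _ (Sum.inl a)) ∨
    ∃ (i : Fin k) (x : Cell n), ‖x.1‖ < 1 ∧ q = Quot.mk _ (Sum.inr ⟨i, x⟩) := by
  induction q using Quot.ind with | _ q
  rcases q with a | ⟨i, x⟩
  · exact .inl ⟨a, rfl⟩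
  · rcases (mem_closedBall_zero_iff.1 x.2).lt_or_eq with h | h
    · exact .inr ⟨i, x, h, rfl⟩
    · exact .inl ⟨f i ⟨x.1, mem_sphere_zero_iff_norm.2 h⟩, (Quot.sound ⟨i, _, rfl, rfl⟩).symm⟩

open Classical in
/-- The reduced representative of a point of a space with cells attached. -/
noncomputable def attachNf : AttachCells n k X f → X ⊕ (Σ _ : Fin k, Cell n) :=
  Quot.lift (Sum.elim Sum.inl fun p => if h : ‖p.2.1‖ = 1 then
    Sum.inl (f p.1 ⟨p.2.1, mem_sphere_zero_iff_norm.2 h⟩) else Sum.inr p) fun _ _ ⟨i, s, h, h'⟩ => by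
    subst h h'
    simp only [Sum.elim_inl, Sum.elim_inr]
    rw [dif_pos (norm_eq_of_mem_sphere s)]

theorem attachNf_inr {p : Σ _ : Fin k, Cell n} (h : ‖p.2.1‖ < 1) :
    attachNf (f := f) (Quot.mk _ (Sum.inr p)) = Sum.inr p := dif_neg h.ne

end attach

section realization
variable {V : Type} {K : Finset V → Prop} {d : ℕ}

/-- The faces with `d` elements. -/
abbrev Face (K : Finset V → Prop) (d : ℕ) : Type := {σ : Finset V // K σ ∧ σ.card = d}

open Classical in
/-- The characteristic map of a face. -/
noncomputable def chart (σ : Face K (d + 1)) (x : EuclideanSpace ℝ (Fin d)) (v : V) : ℝ :=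
  if h : v ∈ σ.1 then (√(∑ j, yc x j ^ 2))⁻¹ * yc x (σ.1.equivFinOfCardEq σ.2.2 ⟨v, h⟩) else 0

variable {σ : Face K (d + 1)} {x : EuclideanSpace ℝ (Fin d)}

theorem sqrt_pos (x : EuclideanSpace ℝ (Fin d)) : 0 < √(∑ j, yc x j ^ 2) := by
  obtain ⟨i, hi⟩ := yc_ne x
  exact Real.sqrt_pos.2 ((pow_pos (abs_pos.2 hi) 2).trans_le (sq_abs (yc x i) ▸
    Finset.single_le_sum (f := fun j => yc x j ^ 2) (fun j _ => sq_nonneg _) (Finset.mem_univ i)))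

theorem chart_symm (j : Fin (d + 1)) : chart σ x ((σ.1.equivFinOfCardEq σ.2.2).symm j).1 =
    (√(∑ j, yc x j ^ 2))⁻¹ * yc x j := by
  rw [chart, dif_pos ((σ.1.equivFinOfCardEq σ.2.2).symm j).2, Subtype.coe_eta, Equiv.apply_symm_apply]

theorem chart_notMem {v : V} (h : v ∉ σ.1) : chart σ x v = 0 := dif_neg h

theorem chart_nonneg (hx : ‖x‖ ≤ 1) (v : V) : 0 ≤ chart σ x v := by
  unfold chart
  split_ifs
  · exact mul_nonneg (inv_nonneg.2 (Real.sqrt_nonneg _)) ((sub_nonneg.2 hx).trans (le_yc _ _))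
  · rfl

theorem chart_inj {x' : EuclideanSpace ℝ (Fin d)} (h : chart σ x' = chart σ x) : x' = x := by
  have h1 := sqrt_pos x
  have h2 := sqrt_pos x'
  refine yc_inj (t := √(∑ j, yc x' j ^ 2) * (√(∑ j, yc x j ^ 2))⁻¹) (by positivity) fun i => ?_
  have := congrFun h ((σ.1.equivFinOfCardEq σ.2.2).symm i).1
  rw [chart_symm, chart_symm] at this
  rw [mul_assoc, ← this, mul_inv_cancel_left₀ h2.ne']

theorem continuous_chart (σ : Face K (d + 1)) : Continuous (chart σ) := by
  have := continuous_yc (d := d)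
  refine continuous_pi fun v => ?_
  unfold chart
  split_ifs with h
  · refine Continuous.mul (Continuous.inv₀ ?_ fun x => (sqrt_pos x).ne') (this _)
    exact Real.continuous_sqrt.comp (continuous_finsetSum _ fun j _ => (this j).pow 2)
  · exact continuous_const

variable [Fintype V]

open Classical in
/-- The support of a function on a finite type. -/
noncomputable def supp (ξ : V → ℝ) : Finset V := Finset.univ.filter fun v => ξ v ≠ 0

theorem mem_supp {ξ : V → ℝ} {v} : v ∈ supp ξ ↔ ξ v ≠ 0 := by simp [supp]

/-- The spherical realization of the `d`-element faces and their subfaces. -/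
abbrev RR (K : Finset V → Prop) (d : ℕ) : Type :=
  {ξ : V → ℝ // (∀ v, 0 ≤ ξ v) ∧ ∑ v, ξ v ^ 2 = 1 ∧ K (supp ξ) ∧ (supp ξ).card ≤ d}

theorem sum_face (f : V → ℝ) (hf : ∀ v ∉ σ.1, f v = 0) :
    ∑ v, f v = ∑ j, f ((σ.1.equivFinOfCardEq σ.2.2).symm j).1 := by
  rw [Equiv.sum_comp (σ.1.equivFinOfCardEq σ.2.2).symm fun v => f v.1, Finset.sum_coe_sort]
  exact (Finset.sum_subset (Finset.subset_univ _) fun v _ h => hf v h).symm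

theorem chart_sum : ∑ v, chart σ x v ^ 2 = 1 := by
  rw [sum_face (σ := σ) _ fun v h => by rw [chart_notMem h, zero_pow two_ne_zero]]
  simp only [chart_symm, mul_pow]
  rw [← Finset.mul_sum, inv_pow, Real.sq_sqrt (Finset.sum_nonneg fun _ _ => sq_nonneg _)]
  exact inv_mul_cancel₀ (Real.sqrt_pos.1 (sqrt_pos x)).ne'

theorem supp_chart_subset : supp (chart σ x) ⊆ σ.1 := fun _ h =>
  by_contra fun h' => mem_supp.1 h (chart_notMem h')

theorem supp_chart (hx : ‖x‖ < 1) : supp (chart σ x) = σ.1 :=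
  supp_chart_subset.antisymm fun v h => mem_supp.2 (by
    rw [chart, dif_pos h]
    exact (mul_pos (inv_pos.2 (sqrt_pos x)) ((sub_pos.2 hx).trans_le (le_yc _ _))).ne')

theorem card_chart (hx : ‖x‖ = 1) : (supp (chart σ x)).card ≤ d := by
  obtain ⟨i, hi⟩ := exists_yc_le hx
  have h0 : yc x i = 0 := le_antisymm hi ((sub_nonneg.2 hx.le).trans (le_yc _ _))
  refine Nat.lt_succ_iff.1 ((Finset.card_lt_card ?_).trans_eq σ.2.2)
  refine supp_chart_subset.ssubset_of_ne fun h => ?_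
  have hm : ((σ.1.equivFinOfCardEq σ.2.2).symm i).1 ∈ supp (chart σ x) := by
    rw [h]
    exact ((σ.1.equivFinOfCardEq σ.2.2).symm i).2
  rw [mem_supp, chart_symm, h0, mul_zero] at hm
  exact hm rfl

theorem chart_surj {ξ : V → ℝ} (h0 : ∀ v, 0 ≤ ξ v) (h1 : ∑ v, ξ v ^ 2 = 1) (hσ : supp ξ = σ.1) :
    ∃ x : EuclideanSpace ℝ (Fin d), ‖x‖ ≤ 1 ∧ chart σ x = ξ := by
  have hn : ∀ v ∉ σ.1, ξ v = 0 := fun v hv => by_contra fun h => hv (hσ ▸ mem_supp.2 h)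
  let p : Fin (d + 1) → ℝ := fun j => ξ ((σ.1.equivFinOfCardEq σ.2.2).symm j).1
  have hp : ∑ j, p j ^ 2 = 1 := by
    rw [← h1, sum_face (σ := σ) _ fun v h => by rw [hn v h, zero_pow two_ne_zero]]
  obtain ⟨x, hx, t, ht, hy⟩ := yc_surj (p := p) (fun j => h0 _) (by
    by_contra! h
    simp [h] at hp)
  refine ⟨x, hx, funext fun v => ?_⟩
  by_cases hv : v ∈ σ.1
  · rw [chart, dif_pos hv, hy]
    simp only [hy, mul_pow]
    rw [← Finset.mul_sum, hp, mul_one, Real.sqrt_sq ht.le, inv_mul_cancel_left₀ ht.ne']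
    exact congrArg (fun v : σ.1 => ξ v.1) (Equiv.symm_apply_apply _ _)
  · rw [chart_notMem hv, hn v hv]

/-- The characteristic map of a face, into the realization. -/
noncomputable def chartMap (hK : ∀ σ τ : Finset V, σ ⊆ τ → K τ → K σ) (σ : Face K (d + 1)) :
    C(Cell d, RR K (d + 1)) :=
  ⟨fun x => ⟨chart σ x.1, chart_nonneg (mem_closedBall_zero_iff.1 x.2), chart_sum,
    hK _ _ supp_chart_subset σ.2.1, (Finset.card_le_card supp_chart_subset).trans_eq σ.2.2⟩,
    ((continuous_chart σ).comp continuous_subtype_val).subtype_mk _⟩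

theorem RR.skeleton (hK : ∀ σ τ : Finset V, σ ⊆ τ → K τ → K σ) {X : Type} [TopologicalSpace X]
    [CompactSpace X] (j : C(X, RR K (d + 1))) (hj : Function.Injective j)
    (hjr : ∀ ξ, (∃ a, j a = ξ) ↔ (supp ξ.1).card ≤ d)
    (hl : ∀ σ : Face K (d + 1), ∃ f : C(CellBoundary d, X),
      ∀ s, (j (f s)).1 = chart σ s.1) :
    ∃ k f, Nonempty (AttachCells d k X f ≃ₜ RR K (d + 1)) := by
  classical
  choose f hf using hl
  let e := (Fintype.equivFin (Face K (d + 1))).symm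
  let Φ : AttachCells d _ X (fun i => f (e i)) → RR K (d + 1) :=
    Quot.lift (Sum.elim j fun p => chartMap hK (e p.1) p.2) fun _ _ ⟨i, s, h, h'⟩ => by
      subst h h'
      exact Subtype.ext (hf (e i) s)
  have hΦ : Continuous Φ := continuous_quot_lift _ (j.continuous.sumElim
    (continuous_sigma fun i => (chartMap hK (e i)).continuous))
  have hc : ∀ (i) (x : Cell d), ‖x.1‖ < 1 → supp (chartMap hK (e i) x).1 = (e i).1 :=
    fun i x h => supp_chart h
  have hne : ∀ a i (x : Cell d), ‖x.1‖ < 1 → j a ≠ chartMap hK (e i) x := fun a i x h h' => by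
    have h2 := (hjr _).1 ⟨a, h'⟩
    rw [hc i x h, (e i).2.2] at h2
    exact absurd h2 (Nat.not_succ_le_self d)
  have hinj : Function.Injective Φ := fun p q h => by
    rcases attach_cases p with ⟨a, rfl⟩ | ⟨i, x, hx, rfl⟩ <;>
      rcases attach_cases q with ⟨a', rfl⟩ | ⟨i', x', hx', rfl⟩
    · rw [hj h]
    · exact (hne a i' x' hx' h).elim
    · exact (hne a' i x hx h.symm).elim
    · have h1 : chartMap hK (e i) x = chartMap hK (e i') x' := h
      obtain rfl : i = i' := e.injective (Subtype.ext (by rw [← hc i x hx, ← hc i' x' hx', h1]))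
      rw [Subtype.ext (chart_inj (congrArg Subtype.val h1))]
  have hsurj : Function.Surjective Φ := fun ξ => by
    by_cases h : (supp ξ.1).card ≤ d
    · obtain ⟨a, ha⟩ := (hjr ξ).2 h
      exact ⟨Quot.mk _ (Sum.inl a), ha⟩
    · obtain ⟨i, hi⟩ := e.surjective ⟨supp ξ.1, ξ.2.2.2.1, le_antisymm ξ.2.2.2.2 (not_le.1 h)⟩
      obtain ⟨x, hx, hξ⟩ := chart_surj (σ := e i) ξ.2.1 ξ.2.2.1 (by rw [hi])
      exact ⟨Quot.mk _ (Sum.inr ⟨i, x, mem_closedBall_zero_iff.2 hx⟩), Subtype.ext hξ⟩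
  exact ⟨_, _, ⟨Continuous.homeoOfEquivCompactToT2 (f := Equiv.ofBijective Φ ⟨hinj, hsurj⟩) hΦ⟩⟩

theorem RR.isFiniteCWAtMost (hK : ∀ σ τ : Finset V, σ ⊆ τ → K τ → K σ) :
    ∀ d, IsFiniteCWAtMost d (RR K (d + 1))
  | 0 => by
    obtain ⟨k, f, ⟨e⟩⟩ := RR.skeleton (d := 0) hK (X := Empty) ⟨Empty.elim, by fun_prop⟩
      (fun a => a.elim) (fun ξ => ⟨fun ⟨a, _⟩ => a.elim, fun h => by
        have h1 : ∀ v, ξ.1 v = 0 := fun v => by_contra fun hv => by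
          have := Finset.card_pos.2 ⟨v, mem_supp.2 hv⟩
          lia
        have h2 := ξ.2.2.1
        simp [h1] at h2⟩) fun σ => by
        have : IsEmpty (CellBoundary 0) := ⟨fun s => by
          have := norm_eq_of_mem_sphere s
          rw [Subsingleton.elim s.1 0, norm_zero] at this
          exact zero_ne_one this⟩
        exact ⟨⟨fun s => isEmptyElim s, continuous_of_const fun s => isEmptyElim s⟩,
          fun s => isEmptyElim s⟩
    exact .homeo (.base k f) e
  | d + 1 => by
    have ih := RR.isFiniteCWAtMost hK d
    have := compactSpace_of_isFiniteCWAtMost ih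
    obtain ⟨k, f, ⟨e⟩⟩ := RR.skeleton (d := d + 1) hK (X := RR K (d + 1))
      ⟨fun ξ => ⟨ξ.1, ξ.2.1, ξ.2.2.1, ξ.2.2.2.1, ξ.2.2.2.2.trans (Nat.le_succ _)⟩,
        continuous_subtype_val.subtype_mk _⟩
      (fun a b h => Subtype.ext (congrArg (fun ξ : RR K (d + 2) => ξ.1) h))
      (fun ξ => ⟨fun ⟨a, ha⟩ => ha ▸ a.2.2.2.2,
        fun h => ⟨⟨ξ.1, ξ.2.1, ξ.2.2.1, ξ.2.2.2.1, h⟩, rfl⟩⟩)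
      fun σ => ⟨⟨fun s => ⟨chart σ s.1, chart_nonneg (norm_eq_of_mem_sphere s).le, chart_sum,
        hK _ _ supp_chart_subset σ.2.1, card_chart (norm_eq_of_mem_sphere s)⟩,
        ((continuous_chart σ).comp continuous_subtype_val).subtype_mk _⟩, fun s => rfl⟩
    exact .homeo (.attach ih k f) e

end realization

theorem XX.isFiniteCWAtMost (m : ℕ) (Y : Type) [Fintype Y] : IsFiniteCWAtMost (m + 2) (XX m Y) := by
  let K : Finset (Fin (m + 3) × Y) → Prop := fun σ => ∀ p ∈ σ, ∀ q ∈ σ, p.1 = q.1 → p = q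
  have hK : ∀ σ τ, σ ⊆ τ → K τ → K σ := fun σ τ h hτ p hp q hq => hτ p (h hp) q (h hq)
  have hcard : ∀ σ, K σ → σ.card ≤ m + 3 := fun σ hσ =>
    (Finset.card_le_card_of_injOn Prod.fst (t := Finset.univ) (fun _ _ => Finset.mem_coe.2 (Finset.mem_univ _))
      fun p hp q hq => hσ p hp q hq).trans_eq (Finset.card_fin _)
  refine .homeo (RR.isFiniteCWAtMost hK (m + 2)) ⟨⟨fun ξ => ⟨fun i y => ξ.1 (i, y), fun i y =>
    ξ.2.1 _, fun i y y' h h' => congrArg Prod.snd (ξ.2.2.2.1 _ (mem_supp.2 h) _ (mem_supp.2 h') rfl),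
    (Fintype.sum_prod_type' fun i y => ξ.1 (i, y) ^ 2).symm.trans ξ.2.2.1⟩, fun ξ =>
    ⟨fun p => ξ.1 p.1 p.2, fun p => ξ.2.1 _ _, (Fintype.sum_prod_type' fun i y => ξ.1 i y ^ 2).trans
      ξ.2.2.2, ?_⟩, fun _ => rfl, fun _ => rfl⟩, ?_, ?_⟩
  · have : K (supp fun p => ξ.1 p.1 p.2) := fun p hp q hq h => by
      obtain ⟨i, y⟩ := p
      obtain ⟨i', y'⟩ := q
      obtain rfl : i = i' := h
      exact congrArg (Prod.mk i) (ξ.2.2.1 i y y' (mem_supp.1 hp :) (mem_supp.1 hq :))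
    exact ⟨this, hcard _ this⟩
  · exact (continuous_pi fun i => continuous_pi fun y =>
      (continuous_apply (A := fun _ => ℝ) (i, y)).comp continuous_subtype_val).subtype_mk _
  · exact (continuous_pi fun p : Fin (m + 3) × Y => continuous_coord p.1 p.2).subtype_mk _

end Swan

namespace Swan
open Topology

section action
variable {G X : Type} [Group G] [TopologicalSpace X] {n b k : ℕ}

/-- The induced map on a space with a free family of equivariant cells attached. -/
def actAttach (ρ : G → C(X, X)) (hmul : ∀ g h x, ρ (g * h) x = ρ g (ρ h x))
    (α : Fin b → C(CellBoundary n, X)) (e : Fin k ≃ Fin b × G) (g : G) :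
    C(AttachCells n k X fun p => (ρ (e p).2).comp (α (e p).1),
      AttachCells n k X fun p => (ρ (e p).2).comp (α (e p).1)) where
  toFun := Quot.map (Sum.map (ρ g) fun p => ⟨e.symm ((e p.1).1, g * (e p.1).2), p.2⟩)
    fun _ _ ⟨i, s, h, h'⟩ => by
      subst h h'
      refine ⟨e.symm ((e i).1, g * (e i).2), s, congrArg Sum.inl ?_, rfl⟩
      change ρ g (ρ (e i).2 (α (e i).1 s)) = ρ (e (e.symm _)).2 (α (e (e.symm _)).1 s)
      rw [Equiv.apply_symm_apply]
      exact (hmul g (e i).2 (α (e i).1 s)).symm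
  continuous_toFun := continuous_quot_lift _ (continuous_quot_mk.comp ((ρ g).continuous.sumMap
    (continuous_sigma fun i => continuous_sigmaMk (σ := fun _ : Fin k => Cell n) (i := e.symm ((e i).1, g * (e i).2)))))

variable {ρ : G → C(X, X)} (hmul : ∀ g h x, ρ (g * h) x = ρ g (ρ h x))
  (α : Fin b → C(CellBoundary n, X)) (e : Fin k ≃ Fin b × G)

theorem actAttach_mul (g h : G) (q) :
    actAttach ρ hmul α e (g * h) q = actAttach ρ hmul α e g (actAttach ρ hmul α e h q) := by
  induction q using Quot.ind with | _ q
  refine congrArg (Quot.mk _) ?_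
  rcases q with x | ⟨i, x⟩
  · exact congrArg Sum.inl (hmul g h x)
  · refine congrArg (fun j => Sum.inr (⟨j, x⟩ : Σ _ : Fin k, Cell n)) ?_
    change e.symm _ = e.symm ((e (e.symm _)).1, g * (e (e.symm _)).2)
    rw [Equiv.apply_symm_apply, mul_assoc]

theorem actAttach_free (hfree : ∀ g x, ρ g x = x → g = 1) {g : G} {q}
    (h : actAttach ρ hmul α e g q = q) : g = 1 := by
  have h1 := congrArg attachNf h
  rcases attach_cases q with ⟨x, rfl⟩ | ⟨i, x, hx, rfl⟩
  · exact hfree g x (Sum.inl_injective h1)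
  · have h2 := (attachNf_inr (p := ⟨e.symm ((e i).1, g * (e i).2), x⟩) hx).symm.trans
      (h1.trans (attachNf_inr (p := ⟨i, x⟩) hx))
    have h3 := congrArg Sigma.fst (Sum.inr_injective h2)
    exact mul_eq_right.1 (congrArg Prod.snd (e.symm_apply_eq.1 h3))

theorem actAttach_one (hone : ∀ x, ρ 1 x = x) (q) : actAttach ρ hmul α e 1 q = q := by
  induction q using Quot.ind with | _ q
  refine congrArg (Quot.mk _) ?_
  rcases q with x | ⟨i, x⟩
  · exact congrArg Sum.inl (hone x)
  · refine congrArg (fun j => Sum.inr (⟨j, x⟩ : Σ _ : Fin k, Cell n)) ?_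
    change e.symm ((e i).1, 1 * (e i).2) = i
    rw [one_mul, e.symm_apply_apply]

end action

/-- The group of homeomorphisms given by an action through continuous maps. -/
def homeoHom {G X : Type} [Group G] [TopologicalSpace X] (ρ : G → C(X, X))
    (hone : ∀ x, ρ 1 x = x) (hmul : ∀ g h x, ρ (g * h) x = ρ g (ρ h x)) : G →* (X ≃ₜ X) where
  toFun g := ⟨⟨ρ g, ρ g⁻¹, fun x => by rw [← hmul, inv_mul_cancel, hone],
    fun x => by rw [← hmul, mul_inv_cancel, hone]⟩, (ρ g).continuous, (ρ g⁻¹).continuous⟩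
  map_one' := Homeomorph.ext hone
  map_mul' g h := Homeomorph.ext (hmul g h)

end Swan

/-- **Swan's theorem (1960).** If `G` is a finite group in which every abelian subgroup is
cyclic, then there exist `n > 0`, a finite CW complex `X` homotopy equivalent to the sphere
`S^n`, and a free continuous action of `G` on `X`. -/
theorem swan_free_action_on_homotopy_sphere
    (G : Type) [Group G] [Finite G]
    (h : ∀ A : Subgroup G, (∀ a b : A, a * b = b * a) → IsCyclic A) :
    ∃ (n : ℕ) (X : TopCat), 0 < n ∧ IsFiniteCW X ∧
      Nonempty (ContinuousMap.HomotopyEquiv X (Sph n)) ∧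
      ∃ φ : G →* (X ≃ₜ X), ∀ (g : G) (x : X), φ g x = x → g = 1 := by
  classical
  have := Fintype.ofFinite G
  obtain ⟨Y, _, _, _, y₀, n, b, z, Q, hn, hfree, hz, hg, hQ, hQz⟩ := GMod.exists_marg_basis G h
  obtain ⟨m, rfl⟩ := Nat.exists_eq_add_of_le' hn
  obtain ⟨α, hα⟩ := Swan.exists_attaching (y₀ := y₀) hz hg hQ
    (fun i => (hQz i i).trans (Pi.single_eq_same (M := fun _ => ℤ) i 1))
    fun i j hij => (hQz i j).trans (Pi.single_eq_of_ne (M := fun _ => ℤ) hij.symm 1)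
  let e := (Fintype.equivFin (Fin b × G)).symm
  refine ⟨m + 2, TopCat.of _, Nat.succ_pos _, ⟨m + 3, .attach (Swan.XX.isFiniteCWAtMost m Y) _ _⟩,
    hα _ e, Swan.homeoHom (Swan.actAttach Swan.act Swan.act_mul α e)
      (Swan.actAttach_one Swan.act_mul α e Swan.act_one) (Swan.actAttach_mul Swan.act_mul α e),
    fun g x hx => Swan.actAttach_free Swan.act_mul α e (fun g ξ => Swan.act_free hfree) hx⟩
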